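/- Let k be an algebraically closed field of characteristic p > 0. Let G be a finite quasi-p group and let H be a solvable normal subgroup of G. If G/H occurs as the Galois group of an unramified cover of Spec k[X], then G occurs as the Galois group of an unramified cover of Spec k[X]. (Serre's theorem on solvable embedding problems over the affine line.) -/

import Mathlib

open scoped Polynomial

/-- A finite group `G` occurs as the Galois group of an unramified cover of
`Spec A`, where `A` is a ring equipped with an embedding into the rational
function field `k(X)` (with fraction field `k(X)`): there is a finite Galois
field extension `L/k(X)` with Galois group isomorphic to `G` such that the
integral closure of `A` in `L` is an étale `A`-algebra. -/
def OccursAsGaloisGroupOfUnramifiedCover (k : Type) [Field k]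
    (A : Type) [CommRing A] [Algebra A (RatFunc k)]
    (G : Type) [Group G] : Prop :=
  ∃ (L : Type) (_ : Field L) (_ : Algebra (RatFunc k) L) (_ : Algebra A L)
    (_ : IsScalarTower A (RatFunc k) L),
      FiniteDimensional (RatFunc k) L ∧ IsGalois (RatFunc k) L ∧
      Nonempty (G ≃* (L ≃ₐ[RatFunc k] L)) ∧
      Algebra.Etale A (integralClosure A L)

/-- The subgroup of a finite group `G` generated by all of its `p`-subgroups. -/
def pPart (p : ℕ) (G : Type) [Group G] : Subgroup G :=
  ⨆ (P : Subgroup G) (_ : IsPGroup p P), P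

open scoped IntermediateField

namespace AffineLineCover

/-- The `k`-algebra of elements of `L` that are integral over `k[z]`. -/
def intClosure (k : Type*) {L : Type*} [Field k] [Field L] [Algebra k L] (z : L) :
    Subalgebra k L :=
  (integralClosure (Algebra.adjoin k {z}) L).restrictScalars k

/-- `z` is transcendental over `k` and `L` is finite separable over `k(z)`. -/
structure IsSepGen (k : Type*) {L : Type*} [Field k] [Field L] [Algebra k L] (z : L) : Prop where
  transcendental : Transcendental k z
  finite : FiniteDimensional k⟮z⟯ L
  separable : Algebra.IsSeparable k⟮z⟯ L

section Basic

open scoped IntermediateField.algebraAdjoinAdjoin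

variable {k L : Type*} [Field k] [Field L] [Algebra k L] {z : L}

theorem mem_intClosure {x : L} :
    x ∈ intClosure k z ↔ IsIntegral (Algebra.adjoin k {z}) x := Iff.rfl

theorem aeval_mem_adjoin (z : L) (p : k[X]) : Polynomial.aeval z p ∈ Algebra.adjoin k {z} := by
  rw [Algebra.adjoin_singleton_eq_range_aeval]; exact ⟨p, rfl⟩

theorem aeval_mem_intClosure (z : L) (p : k[X]) : Polynomial.aeval z p ∈ intClosure k z := by
  rw [mem_intClosure]
  exact isIntegral_algebraMap (R := Algebra.adjoin k {z}) (x := ⟨_, aeval_mem_adjoin z p⟩)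

theorem self_mem_intClosure (z : L) : z ∈ intClosure k z := by
  simpa using aeval_mem_intClosure (k := k) z Polynomial.X

/-- The polynomial ring is isomorphic to `k[z]` for `z` transcendental. -/
noncomputable def polyEquivAdjoin (hz : Transcendental k z) : k[X] ≃ₐ[k] Algebra.adjoin k {z} :=
  (AlgEquiv.ofInjective _ (transcendental_iff_injective.mp hz)).trans
    (Subalgebra.equivOfEq _ _ (Algebra.adjoin_singleton_eq_range_aeval k z).symm)

@[simp]
theorem coe_polyEquivAdjoin (hz : Transcendental k z) (p : k[X]) :
    (polyEquivAdjoin hz p : L) = Polynomial.aeval z p := rfl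

theorem isPrincipalIdealRing_adjoin (hz : Transcendental k z) :
    IsPrincipalIdealRing (Algebra.adjoin k {z}) :=
  IsPrincipalIdealRing.of_surjective (polyEquivAdjoin hz).toRingEquiv.toRingHom
    (polyEquivAdjoin hz).surjective

theorem IsSepGen.isDedekindDomain (h : IsSepGen k z) : IsDedekindDomain (intClosure k z) := by
  have := isPrincipalIdealRing_adjoin h.transcendental
  have := h.finite
  have := h.separable
  exact integralClosure.isDedekindDomain (Algebra.adjoin k {z}) k⟮z⟯ L

theorem IsSepGen.isFractionRing (h : IsSepGen k z) : IsFractionRing (intClosure k z) L := by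
  have := h.finite
  exact integralClosure.isFractionRing_of_finite_extension k⟮z⟯ L

theorem IsSepGen.exists_basis (h : IsSepGen k z) :
    ∃ e : Fin (Module.finrank k⟮z⟯ L) → L, (∀ i, e i ∈ intClosure k z) ∧
      (∀ x ∈ intClosure k z, ∃ p : Fin (Module.finrank k⟮z⟯ L) → k[X],
        x = ∑ i, Polynomial.aeval z (p i) * e i) ∧
      (∀ p : Fin (Module.finrank k⟮z⟯ L) → k[X],
        ∑ i, Polynomial.aeval z (p i) * e i = 0 → p = 0) := by
  have := isPrincipalIdealRing_adjoin h.transcendental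
  have := h.finite
  have := h.separable
  let C := integralClosure (Algebra.adjoin k {z}) L
  have hf : Module.Free (Algebra.adjoin k {z}) C :=
    IsIntegralClosure.module_free (Algebra.adjoin k {z}) k⟮z⟯ L C
  have hfin : Module.Finite (Algebra.adjoin k {z}) C :=
    IsIntegralClosure.finite (Algebra.adjoin k {z}) k⟮z⟯ L C
  have hr : Module.finrank (Algebra.adjoin k {z}) C = Module.finrank k⟮z⟯ L :=
    IsIntegralClosure.rank (Algebra.adjoin k {z}) k⟮z⟯ L C
  let b : Module.Basis (Fin (Module.finrank k⟮z⟯ L)) (Algebra.adjoin k {z}) C :=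
    (Module.finBasis (Algebra.adjoin k {z}) C).reindex (finCongr hr)
  refine ⟨fun i => (b i : L), fun i => (b i).2, fun x hx => ?_, fun p hp => ?_⟩
  · refine ⟨fun i => (polyEquivAdjoin h.transcendental).symm (b.repr ⟨x, hx⟩ i), ?_⟩
    have := congrArg (Subtype.val : C → L) (b.sum_repr ⟨x, hx⟩)
    rw [AddSubmonoidClass.coe_finsetSum] at this
    refine this.symm.trans (Finset.sum_congr rfl fun i _ => ?_)
    rw [← coe_polyEquivAdjoin h.transcendental, AlgEquiv.apply_symm_apply]
    rfl
  · have hli := Fintype.linearIndependent_iff.mp b.linearIndependent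
      (fun i => polyEquivAdjoin h.transcendental (p i)) (by
        apply Subtype.ext
        rw [AddSubmonoidClass.coe_finsetSum]
        exact hp)
    funext i
    simpa using hli i

theorem IsSepGen.finiteType (h : IsSepGen k z) : Algebra.FiniteType k (intClosure k z) := by
  have := isPrincipalIdealRing_adjoin h.transcendental
  have := h.finite
  have := h.separable
  let C := integralClosure (Algebra.adjoin k {z}) L
  have hfin : Module.Finite (Algebra.adjoin k {z}) C :=
    IsIntegralClosure.finite (Algebra.adjoin k {z}) k⟮z⟯ L C
  have h1 : Algebra.FiniteType k (Algebra.adjoin k {z}) :=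
    Algebra.FiniteType.equiv inferInstance (polyEquivAdjoin h.transcendental)
  have h2 : Algebra.FiniteType k C := Algebra.FiniteType.trans h1 inferInstance
  exact h2

theorem IsSepGen.ne_zero (h : IsSepGen k z) : z ≠ 0 := by
  rintro rfl
  exact h.transcendental (isAlgebraic_zero)

theorem adjoin_inv_eq (z : L) : k⟮z⁻¹⟯ = k⟮z⟯ := by
  apply le_antisymm
  · rw [IntermediateField.adjoin_simple_le_iff]
    exact inv_mem (IntermediateField.mem_adjoin_simple_self k z)
  · rw [IntermediateField.adjoin_simple_le_iff]
    have := inv_mem (IntermediateField.mem_adjoin_simple_self k z⁻¹)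
    rwa [inv_inv] at this

theorem IsSepGen.inv (h : IsSepGen k z) : IsSepGen k z⁻¹ := by
  refine ⟨fun h' => h.transcendental (by simpa using h'.inv), ?_, ?_⟩
  · rw [adjoin_inv_eq]; exact h.finite
  · rw [adjoin_inv_eq]; exact h.separable

theorem exists_pow_mul_mem_adjoin_inv (hz : z ≠ 0) {c : L} (hc : c ∈ Algebra.adjoin k {z}) :
    ∃ M : ℕ, ∀ m ≥ M, z⁻¹ ^ m * c ∈ Algebra.adjoin k {z⁻¹} := by
  rw [Algebra.adjoin_singleton_eq_range_aeval] at hc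
  obtain ⟨p, rfl⟩ := hc
  refine ⟨p.natDegree, fun m hm => ?_⟩
  change z⁻¹ ^ m * Polynomial.aeval z p ∈ _
  rw [Polynomial.aeval_eq_sum_range, Finset.mul_sum]
  refine Subalgebra.sum_mem _ fun i hi => ?_
  have hi' : i ≤ m := by
    have := Finset.mem_range.mp hi
    omega
  rw [mul_smul_comm]
  refine Subalgebra.smul_mem _ ?_ _
  have : z⁻¹ ^ m * z ^ i = z⁻¹ ^ (m - i) := by
    obtain ⟨j, rfl⟩ := Nat.exists_eq_add_of_le hi'
    rw [Nat.add_sub_cancel_left, pow_add, mul_right_comm, ← mul_pow, inv_mul_cancel₀ hz, one_pow,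
      one_mul]
  rw [this]
  exact Subalgebra.pow_mem _ (Algebra.self_mem_adjoin_singleton k _) _

theorem exists_pow_mul_mem_intClosure_inv (hz : z ≠ 0) {x : L} (hx : x ∈ intClosure k z) :
    ∃ M : ℕ, ∀ m ≥ M, z⁻¹ ^ m * x ∈ intClosure k z⁻¹ := by
  obtain ⟨P, hP, hPx⟩ := hx
  have hc : ∀ i, ∃ M : ℕ, ∀ m ≥ M, z⁻¹ ^ m * (P.coeff i : L) ∈ Algebra.adjoin k {z⁻¹} :=
    fun i => exists_pow_mul_mem_adjoin_inv hz (P.coeff i).2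
  choose M hM using hc
  refine ⟨∑ i ∈ Finset.range P.natDegree, M i, fun m hm => ?_⟩
  set s : L := z⁻¹ ^ m with hs
  set Q : L[X] := P.map (algebraMap (Algebra.adjoin k {z}) L) with hQ
  have hQm : Q.Monic := hP.map _
  have hlift : Q.scaleRoots s ∈ Polynomial.lifts (algebraMap (Algebra.adjoin k {z⁻¹}) L) := by
    rw [Polynomial.lifts_iff_coeff_lifts]
    intro i
    rw [Polynomial.coeff_scaleRoots]
    have hdeg : Q.natDegree = P.natDegree := hP.natDegree_map _
    have key : Q.coeff i * s ^ (Q.natDegree - i) ∈ Algebra.adjoin k {z⁻¹} := by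
      rcases lt_trichotomy i P.natDegree with hi | hi | hi
      · obtain ⟨j, hj⟩ := Nat.exists_eq_add_of_lt hi
        have h1 : Q.natDegree - i = j + 1 := by omega
        have h2 : M i ≤ m := le_trans
          (Finset.single_le_sum (f := M) (fun _ _ => Nat.zero_le _) (Finset.mem_range.mpr hi)) hm
        rw [h1, hQ, Polynomial.coeff_map, pow_succ, mul_comm, mul_assoc]
        exact Subalgebra.mul_mem _
          (Subalgebra.pow_mem _ (Subalgebra.pow_mem _ (Algebra.self_mem_adjoin_singleton k _) _) _)
          (hM i m h2)
      · rw [hdeg, hi, Nat.sub_self, pow_zero, mul_one, ← hdeg]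
        rw [hQm.coeff_natDegree]
        exact Subalgebra.one_mem _
      · rw [Polynomial.coeff_eq_zero_of_natDegree_lt (by omega), zero_mul]
        exact Subalgebra.zero_mem _
    exact ⟨⟨_, key⟩, rfl⟩
  obtain ⟨R, hR, -, hRm⟩ := Polynomial.lifts_and_natDegree_eq_and_monic hlift
    ((Polynomial.monic_scaleRoots_iff s).mpr hQm)
  refine ⟨R, hRm, ?_⟩
  rw [← Polynomial.eval_map, hR]
  have h0 : Polynomial.aeval x Q = 0 := by
    rw [hQ, Polynomial.aeval_map_algebraMap]; exact hPx
  have := Polynomial.scaleRoots_aeval_eq_zero (r := s) h0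
  rw [Polynomial.aeval_def, Algebra.algebraMap_self, Polynomial.eval₂_id] at this
  exact this

theorem exists_pow_mul_mem_intClosure (hz : z ≠ 0) {x : L} (hx : x ∈ intClosure k z⁻¹) :
    ∃ M : ℕ, ∀ m ≥ M, z ^ m * x ∈ intClosure k z := by
  have := exists_pow_mul_mem_intClosure_inv (k := k) (inv_ne_zero hz) hx
  simpa using this

theorem exists_algebraMap_of_mem_both [IsAlgClosed k] {x : L} (hx : x ∈ intClosure k z)
    (hx' : x ∈ intClosure k z⁻¹) : ∃ c : k, algebraMap k L c = x := by
  suffices h : IsIntegral k x by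
    exact IsAlgClosed.algebraMap_bijective_of_isIntegral (k := k)
      (K := integralClosure k L) |>.2 ⟨x, h⟩ |>.imp fun c hc => congrArg Subtype.val hc
  have key : x ∈ (integralClosure
      (Subring.closure (Set.range (algebraMap k L))) L).toSubring := by
    rw [← iInf_valuationSubring_superset]
    simp only [Subring.mem_iInf]
    rintro ⟨V, hV⟩
    change x ∈ V
    have hkV : ∀ c : k, algebraMap k L c ∈ V := fun c =>
      hV (Set.mem_range_self c)
    have gen : ∀ t : L, t ∈ V → ∀ y ∈ intClosure k t, y ∈ V := by
      rintro t ht y ⟨P, hP, hPy⟩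
      have hsub : ∀ c ∈ Algebra.adjoin k {t}, c ∈ V := by
        intro c hc
        induction hc using Algebra.adjoin_induction with
        | mem x hx => rw [Set.mem_singleton_iff.mp hx]; exact ht
        | algebraMap r => exact hkV r
        | add x y _ _ hx hy => exact add_mem hx hy
        | mul x y _ _ hx hy => exact mul_mem hx hy
      let f : Algebra.adjoin k {t} →+* V :=
        { toFun := fun c => ⟨c, hsub c c.2⟩, map_one' := rfl, map_mul' := fun _ _ => rfl,
          map_zero' := rfl, map_add' := fun _ _ => rfl }
      have hInt : IsIntegral V y := by
        refine ⟨P.map f, hP.map f, ?_⟩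
        rw [Polynomial.eval₂_map]
        exact hPy
      obtain ⟨v, hv⟩ := IsIntegrallyClosed.isIntegral_iff.mp hInt
      rw [← hv]; exact v.2
    rcases V.mem_or_inv_mem z with h | h
    · exact gen z h x hx
    · exact gen _ h x hx'
  have hInt : IsIntegral (Subring.closure (Set.range (algebraMap k L))) x := key
  have hcl : Subring.closure (Set.range (algebraMap k L)) = (algebraMap k L).range := by
    rw [← RingHom.coe_range, Subring.closure_eq]
  rw [hcl] at hInt
  obtain ⟨P, hP, hPx⟩ := hInt
  have hlift : P.map (algebraMap (algebraMap k L).range L) ∈ Polynomial.lifts (algebraMap k L) := by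
    rw [Polynomial.lifts_iff_coeff_lifts]
    intro i
    rw [Polynomial.coeff_map]
    exact (P.coeff i).2
  obtain ⟨R, hR, -, hRm⟩ := Polynomial.lifts_and_natDegree_eq_and_monic hlift (hP.map _)
  refine ⟨R, hRm, ?_⟩
  rw [← Polynomial.eval_map, hR, Polynomial.eval_map]
  exact hPx

end Basic

theorem finrank_le_add_of_ker_le {k E W : Type*} [Field k] [AddCommGroup E] [Module k E]
    [AddCommGroup W] [Module k W] [Module.Finite k W] {U V : Submodule k E} [Module.Finite k U]
    (f : V →ₗ[k] W) (hf : ∀ x : V, f x = 0 → (x : E) ∈ U) :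
    Module.Finite k V ∧ Module.finrank k V ≤ Module.finrank k U + Module.finrank k W := by
  let g : LinearMap.ker f →ₗ[k] U :=
    (V.subtype.comp (LinearMap.ker f).subtype).codRestrict U fun x => hf x x.2
  have hinj : Function.Injective g := by
    intro x y hxy
    exact Subtype.ext (Subtype.ext (congrArg (fun u : U => (u : E)) hxy))
  have hker : Module.Finite k (LinearMap.ker f) := Module.Finite.of_injective _ hinj
  have hV : Module.Finite k V := by
    have := Module.Finite.equiv f.quotKerEquivRange.symm
    exact Module.Finite.of_submodule_quotient (LinearMap.ker f)
  refine ⟨hV, ?_⟩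
  rw [← f.finrank_range_add_finrank_ker, add_comm]
  gcongr
  · exact LinearMap.finrank_le_finrank_of_injective hinj
  · exact Submodule.finrank_le _

section Filtration

variable {k L : Type*} [Field k] [Field L] [Algebra k L] {z : L}

theorem IsSepGen.exists_reduction (h : IsSepGen k z) :
    ∃ r : intClosure k z →ₗ[k] (Fin (Module.finrank k⟮z⟯ L) → k),
      ∀ x, r x = 0 → ∃ y ∈ intClosure k z, (x : L) = z * y := by
  obtain ⟨e, he, hspan, hind⟩ := h.exists_basis
  choose p hp using fun x : intClosure k z => hspan x x.2
  have huniq : ∀ (x : intClosure k z) q, (x : L) = ∑ i, Polynomial.aeval z (q i) * e i →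
      p x = q := by
    intro x q hq
    refine sub_eq_zero.mp (hind _ ?_)
    simp only [Pi.sub_apply, map_sub, sub_mul, Finset.sum_sub_distrib]
    rw [← hp x, ← hq, sub_self]
  refine ⟨{ toFun := fun x i => (p x i).coeff 0, map_add' := fun x y => ?_,
            map_smul' := fun c x => ?_ }, fun x hx => ?_⟩
  · have := huniq (x + y) (p x + p y) (by
      simp only [Pi.add_apply, map_add, add_mul, Finset.sum_add_distrib]
      rw [← hp x, ← hp y]; rfl)
    funext i
    simp [this]
  · have := huniq (c • x) (c • p x) (by
      simp only [Pi.smul_apply, map_smul, smul_mul_assoc, ← Finset.smul_sum]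
      rw [← hp x]; rfl)
    funext i
    simp [this]
  · have h0 : ∀ i, (p x i).coeff 0 = 0 := fun i => congrFun hx i
    refine ⟨∑ i, Polynomial.aeval z (p x i).divX * e i,
      Subalgebra.sum_mem _ fun i _ => Subalgebra.mul_mem _ (aeval_mem_intClosure z _) (he i), ?_⟩
    rw [hp x, Finset.mul_sum]
    refine Finset.sum_congr rfl fun i _ => ?_
    conv_lhs => rw [← Polynomial.X_mul_divX_add (p x i), h0 i]
    simp [mul_assoc]

variable (k) in
/-- Functions integral over `k[z]` with poles at infinity bounded by those of `z ^ M`. -/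
def poleFilt (z : L) (M : ℕ) : Submodule k L where
  carrier := {x | x ∈ intClosure k z ∧ z⁻¹ ^ M * x ∈ intClosure k z⁻¹}
  add_mem' := fun ha hb => ⟨add_mem ha.1 hb.1, by rw [mul_add]; exact add_mem ha.2 hb.2⟩
  zero_mem' := ⟨zero_mem _, by rw [mul_zero]; exact zero_mem _⟩
  smul_mem' := fun c x hx => ⟨Subalgebra.smul_mem _ hx.1 c, by
    rw [mul_smul_comm]; exact Subalgebra.smul_mem _ hx.2 c⟩

theorem mem_poleFilt {M : ℕ} {x : L} :
    x ∈ poleFilt k z M ↔ x ∈ intClosure k z ∧ z⁻¹ ^ M * x ∈ intClosure k z⁻¹ := Iff.rfl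

theorem poleFilt_mono {M N : ℕ} (h : M ≤ N) : poleFilt k z M ≤ poleFilt k z N := by
  rintro x ⟨h1, h2⟩
  obtain ⟨j, rfl⟩ := Nat.exists_eq_add_of_le h
  refine ⟨h1, ?_⟩
  rw [add_comm, pow_add, mul_assoc]
  exact mul_mem (pow_mem (self_mem_intClosure _) _) h2

theorem mul_mem_poleFilt {M N : ℕ} {x y : L} (hx : x ∈ poleFilt k z M) (hy : y ∈ poleFilt k z N) :
    x * y ∈ poleFilt k z (M + N) := by
  refine ⟨mul_mem hx.1 hy.1, ?_⟩
  rw [pow_add, mul_mul_mul_comm]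
  exact mul_mem hx.2 hy.2

theorem exists_mem_poleFilt (hz : z ≠ 0) {x : L} (hx : x ∈ intClosure k z) :
    ∃ M, ∀ m ≥ M, x ∈ poleFilt k z m := by
  obtain ⟨M, hM⟩ := exists_pow_mul_mem_intClosure_inv hz hx
  exact ⟨M, fun m hm => ⟨hx, hM m hm⟩⟩

theorem aeval_mem_poleFilt (hz : z ≠ 0) {p : k[X]} {M : ℕ} (hp : p.natDegree ≤ M) :
    Polynomial.aeval z p ∈ poleFilt k z M := by
  rw [Polynomial.aeval_eq_sum_range]
  refine sum_mem fun i hi => Submodule.smul_mem _ _ ?_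
  have hi' : i ≤ M := by
    have := Finset.mem_range.mp hi
    omega
  refine poleFilt_mono hi' ⟨pow_mem (self_mem_intClosure z) _, ?_⟩
  rw [← mul_pow, inv_mul_cancel₀ hz, one_pow]
  exact one_mem _

theorem mem_poleFilt_zero [IsAlgClosed k] {x : L} (hx : x ∈ poleFilt k z 0) :
    ∃ c : k, algebraMap k L c = x :=
  exists_algebraMap_of_mem_both hx.1 (by simpa using hx.2)

theorem finrank_poleFilt_zero [IsAlgClosed k] :
    Module.Finite k (poleFilt k z 0) ∧ Module.finrank k (poleFilt k z 0) ≤ 1 := by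
  have hle : poleFilt k z 0 ≤ Submodule.span k {1} := by
    intro x hx
    obtain ⟨c, rfl⟩ := mem_poleFilt_zero hx
    exact Submodule.mem_span_singleton.mpr ⟨c, by rw [Algebra.algebraMap_eq_smul_one]⟩
  refine ⟨Submodule.finiteDimensional_of_le hle, ?_⟩
  exact (Submodule.finrank_mono hle).trans (finrank_span_singleton one_ne_zero).le

theorem IsSepGen.finrank_poleFilt_succ [IsAlgClosed k] (h : IsSepGen k z) (M : ℕ)
    [Module.Finite k (poleFilt k z M)] :
    Module.Finite k (poleFilt k z (M + 1)) ∧ Module.finrank k (poleFilt k z (M + 1)) ≤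
      Module.finrank k (poleFilt k z M) + Module.finrank k⟮z⟯ L := by
  obtain ⟨r, hr⟩ := h.inv.exists_reduction
  have hfr : Module.finrank k⟮z⁻¹⟯ L = Module.finrank k⟮z⟯ L := by rw [adjoin_inv_eq]
  let g : poleFilt k z (M + 1) →ₗ[k] intClosure k z⁻¹ :=
    { toFun := fun x => ⟨z⁻¹ ^ (M + 1) * x, x.2.2⟩
      map_add' := fun x y => Subtype.ext (mul_add _ _ _)
      map_smul' := fun c x => Subtype.ext (mul_smul_comm _ _ _) }
  have := finrank_le_add_of_ker_le (U := poleFilt k z M) (r.comp g) (by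
    intro x hx
    obtain ⟨y, hy, hxy⟩ := hr _ hx
    refine ⟨x.2.1, ?_⟩
    have : z⁻¹ ^ M * (x : L) = y := by
      apply mul_left_cancel₀ (inv_ne_zero h.ne_zero)
      rw [← hxy, ← mul_assoc, ← pow_succ']
      rfl
    rw [this]; exact hy)
  simpa [hfr] using this

theorem IsSepGen.finite_poleFilt [IsAlgClosed k] (h : IsSepGen k z) (M : ℕ) :
    Module.Finite k (poleFilt k z M) := by
  induction M with
  | zero => exact finrank_poleFilt_zero.1
  | succ M ih => exact (h.finrank_poleFilt_succ M).1

theorem IsSepGen.finrank_poleFilt_add_le [IsAlgClosed k] (h : IsSepGen k z) (M j : ℕ) :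
    Module.finrank k (poleFilt k z (M + j)) ≤
      Module.finrank k (poleFilt k z M) + j * Module.finrank k⟮z⟯ L := by
  induction j with
  | zero => simp
  | succ j ih =>
    have := h.finite_poleFilt (M + j)
    have := (h.finrank_poleFilt_succ (M + j)).2
    rw [← add_assoc, Nat.succ_mul]
    omega

theorem IsSepGen.finrank_poleFilt_le [IsAlgClosed k] (h : IsSepGen k z) (M : ℕ) :
    Module.finrank k (poleFilt k z M) ≤ M * Module.finrank k⟮z⟯ L + 1 := by
  have := h.finrank_poleFilt_add_le 0 M
  have h0 := (finrank_poleFilt_zero (k := k) (z := z)).2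
  rw [zero_add] at this
  omega

theorem IsSepGen.exists_le_finrank_poleFilt [IsAlgClosed k] (h : IsSepGen k z) :
    ∃ n₀, ∀ M, (M + 1) * Module.finrank k⟮z⟯ L ≤ Module.finrank k (poleFilt k z (M + n₀)) := by
  obtain ⟨e, he, hspan, hind⟩ := h.exists_basis
  choose n hn using fun i => exists_mem_poleFilt h.ne_zero (he i)
  refine ⟨∑ i, n i, fun M => ?_⟩
  have := h.finite_poleFilt (M + ∑ i, n i)
  let f : (Fin (Module.finrank k⟮z⟯ L) → Polynomial.degreeLT k (M + 1)) →ₗ[k]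
      poleFilt k z (M + ∑ i, n i) :=
    { toFun := fun p => ⟨∑ i, Polynomial.aeval z (p i : k[X]) * e i, sum_mem fun i _ =>
        mul_mem_poleFilt (aeval_mem_poleFilt h.ne_zero (by
            have := Polynomial.mem_degreeLT.mp (p i).2
            by_cases h0 : (p i : k[X]) = 0
            · simp [h0]
            · have := (Polynomial.natDegree_lt_iff_degree_lt h0).mpr this
              omega))
          (hn i _ (Finset.single_le_sum (f := n) (fun _ _ => Nat.zero_le _) (Finset.mem_univ i)))⟩
      map_add' := fun p q => Subtype.ext (by simp [add_mul, Finset.sum_add_distrib])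
      map_smul' := fun c p => Subtype.ext (by simp [Finset.smul_sum]) }
  have hf : Function.Injective f := by
    rw [← LinearMap.ker_eq_bot, LinearMap.ker_eq_bot']
    intro p hp
    have := hind (fun i => (p i : k[X])) (congrArg Subtype.val hp)
    funext i
    exact Subtype.ext (congrFun this i)
  have hfr := LinearMap.finrank_le_finrank_of_injective hf
  have : Module.finrank k (Polynomial.degreeLT k (M + 1)) = M + 1 := by
    rw [(Polynomial.degreeLTEquiv k (M + 1)).finrank_eq]; simp
  have hfd : Module.Finite k (Polynomial.degreeLT k (M + 1)) :=
    Module.Finite.equiv (Polynomial.degreeLTEquiv k (M + 1)).symm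
  rw [Module.finrank_pi_fintype] at hfr
  simp only [this, Finset.sum_const, Finset.card_univ, Fintype.card_fin, smul_eq_mul] at hfr
  rwa [mul_comm]

end Filtration

theorem exists_seq_of_step {E : Type*} [Nonempty E] (P : ℕ → (ℕ → E) → Prop)
    (hloc : ∀ n x y, (∀ m ≤ n, x m = y m) → P n x → P n y)
    (hstep : ∀ n x, ∃ e, P n (Function.update x n e)) : ∃ x, ∀ n, P n x := by
  choose e he using hstep
  let F : ∀ n, (∀ m, m < n → E) → E := fun n x =>
    e n fun m => if h : m < n then x m h else Classical.arbitrary E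
  let x : ℕ → E := fun n => Nat.strongRec (motive := fun _ => E) F n
  have hx : ∀ n, x n = e n fun m => if m < n then x m else Classical.arbitrary E := fun n => by
    change Nat.strongRec (motive := fun _ => E) F n = _
    rw [Nat.strongRec_eq]
    rfl
  refine ⟨x, fun n => hloc n _ _ (fun m hm => ?_)
    (he n fun m => if m < n then x m else Classical.arbitrary E)⟩
  rcases hm.eq_or_lt with rfl | h
  · rw [Function.update_self, ← hx]
  · rw [Function.update_of_ne h.ne, if_pos h]

section Division

variable {k B ι : Type*} [Field k] [CommRing B] [Algebra k B] [Fintype ι]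

/-- The map `(c, q) ↦ ∑ cᵢ bᵢ + v q`. -/
noncomputable def divMap (b : ι → B) (v : PowerSeries B) :
    (ι → PowerSeries k) × PowerSeries B →ₗ[PowerSeries k] PowerSeries B where
  toFun x := ∑ i, x.1 i • PowerSeries.C (b i) + v * x.2
  map_add' x y := by
    simp only [Prod.fst_add, Prod.snd_add, Pi.add_apply, add_smul, Finset.sum_add_distrib]
    ring
  map_smul' c x := by
    simp only [Prod.smul_fst, Prod.smul_snd, Pi.smul_apply, smul_eq_mul, mul_smul,
      RingHom.id_apply, smul_add, Finset.smul_sum, mul_smul_comm]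

theorem coeff_smul_C (f : PowerSeries k) (b : B) (n : ℕ) :
    PowerSeries.coeff n (f • PowerSeries.C b) = PowerSeries.coeff n f • b := by
  rw [Algebra.smul_def, PowerSeries.algebraMap_apply'', PowerSeries.coeff_mul_C,
    PowerSeries.coeff_map, Algebra.smul_def]

theorem divMap_bijective (b : ι → B) (v : PowerSeries B)
    (h : Function.Bijective fun x : (ι → k) × B =>
      ∑ i, x.1 i • b i + PowerSeries.constantCoeff v * x.2) :
    Function.Bijective (divMap (k := k) b v) := by
  obtain ⟨w, hw⟩ : ∃ w, v = PowerSeries.C (PowerSeries.constantCoeff v) + PowerSeries.X * w := by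
    have : PowerSeries.X ∣ v - PowerSeries.C (PowerSeries.constantCoeff v) := by
      rw [PowerSeries.X_dvd_iff]; simp
    obtain ⟨w, hw⟩ := this
    exact ⟨w, by rw [← hw]; ring⟩
  set u := PowerSeries.constantCoeff v
  have hc : ∀ x n, PowerSeries.coeff n (divMap (k := k) b v x) =
      (∑ i, PowerSeries.coeff n (x.1 i) • b i + u * PowerSeries.coeff n x.2) +
        PowerSeries.coeff n (PowerSeries.X * (w * x.2)) := by
    intro x n
    rw [divMap]
    simp only [LinearMap.coe_mk, AddHom.coe_mk, map_add, map_sum, coeff_smul_C]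
    rw [hw, add_mul, map_add, PowerSeries.coeff_C_mul, mul_assoc, add_assoc]
  constructor
  · rw [injective_iff_map_eq_zero]
    intro x hx
    have key : ∀ n, (∀ i, PowerSeries.coeff n (x.1 i) = 0) ∧ PowerSeries.coeff n x.2 = 0 := by
      intro n
      induction n using Nat.strong_induction_on with
      | _ n ih =>
      have hn := hc x n
      rw [hx, map_zero] at hn
      have h0 : PowerSeries.coeff n (PowerSeries.X * (w * x.2)) = 0 := by
        cases n with
        | zero => simp
        | succ n =>
          rw [PowerSeries.coeff_succ_X_mul, PowerSeries.coeff_mul]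
          refine Finset.sum_eq_zero fun q hq => ?_
          rw [(ih q.2 (by have := Finset.HasAntidiagonal.mem_antidiagonal.mp hq; omega)).2,
              mul_zero]
      rw [h0, add_zero] at hn
      have := @h.1 (fun i => PowerSeries.coeff n (x.1 i), PowerSeries.coeff n x.2) 0
        (by simpa using hn.symm)
      exact ⟨fun i => congrFun (congrArg Prod.fst this) i, congrArg Prod.snd this⟩
    refine Prod.ext (funext fun i => PowerSeries.ext fun n => ?_) (PowerSeries.ext fun n => ?_)
    · simpa using (key n).1 i
    · simpa using (key n).2
  · intro f
    let mkx : (ℕ → (ι → k) × B) → (ι → PowerSeries k) × PowerSeries B := fun x =>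
      (fun i => PowerSeries.mk fun n => (x n).1 i, PowerSeries.mk fun n => (x n).2)
    have hX : ∀ n (x y : ℕ → (ι → k) × B), (∀ m < n, x m = y m) →
        PowerSeries.coeff n (PowerSeries.X * (w * (mkx x).2)) =
          PowerSeries.coeff n (PowerSeries.X * (w * (mkx y).2)) := by
      intro n x y hxy
      cases n with
      | zero => simp
      | succ n =>
        rw [PowerSeries.coeff_succ_X_mul, PowerSeries.coeff_succ_X_mul, PowerSeries.coeff_mul,
          PowerSeries.coeff_mul]
        refine Finset.sum_congr rfl fun q hq => ?_
        simp only [mkx, PowerSeries.coeff_mk]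
        rw [hxy q.2 (by have := Finset.HasAntidiagonal.mem_antidiagonal.mp hq; omega)]
    obtain ⟨x, hx⟩ := exists_seq_of_step (E := (ι → k) × B)
      (fun n x => PowerSeries.coeff n (divMap (k := k) b v (mkx x)) = PowerSeries.coeff n f)
      (by
        intro n x y hxy h
        rw [← h, hc, hc, hX n x y fun m hm => hxy m hm.le]
        simp [mkx, hxy n le_rfl])
      (by
        intro n x
        obtain ⟨e, he⟩ := h.2 (PowerSeries.coeff n f -
          PowerSeries.coeff n (PowerSeries.X * (w * (mkx x).2)))
        refine ⟨e, ?_⟩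
        rw [hc, hX n (Function.update x n e) x fun m hm => Function.update_of_ne hm.ne _ _]
        simp only [mkx, PowerSeries.coeff_mk, Function.update_self]
        simp only at he
        rw [he]
        simp [mkx])
    exact ⟨mkx x, PowerSeries.ext hx⟩

/-- Coordinates modulo `v` of a power series with respect to a family `b`. -/
theorem exists_coordinates (b : ι → B) (v : PowerSeries B)
    (h : Function.Bijective fun x : (ι → k) × B =>
      ∑ i, x.1 i • b i + PowerSeries.constantCoeff v * x.2) :
    ∃ c : PowerSeries B →ₗ[PowerSeries k] (ι → PowerSeries k),
      (∀ f, c f = 0 ↔ v ∣ f) ∧ (∀ f, v ∣ f - ∑ i, c f i • PowerSeries.C (b i)) ∧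
      ∀ a : ι → PowerSeries k, c (∑ i, a i • PowerSeries.C (b i)) = a := by
  let e := LinearEquiv.ofBijective _ (divMap_bijective b v h)
  have he : ∀ f, f = ∑ i, (e.symm f).1 i • PowerSeries.C (b i) + v * (e.symm f).2 := fun f =>
    (e.apply_symm_apply f).symm
  have hs : ∀ a q, e.symm (∑ i, a i • PowerSeries.C (b i) + v * q) = (a, q) := fun a q =>
    e.symm_apply_apply (a, q)
  refine ⟨(LinearMap.fst _ _ _).comp e.symm.toLinearMap, fun f => ⟨fun hf => ?_, ?_⟩, fun f => ?_,
    fun a => ?_⟩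
  · replace hf : (e.symm f).1 = 0 := hf
    rw [he f, hf]; simp
  · rintro ⟨q, rfl⟩
    change (e.symm (v * q)).1 = 0
    have := hs 0 q
    simp only [Pi.zero_apply, zero_smul, Finset.sum_const_zero, zero_add] at this
    rw [this]
  · exact ⟨(e.symm f).2, by
      change f - ∑ i, (e.symm f).1 i • PowerSeries.C (b i) = _
      conv_lhs => rw [he f]
      rw [hs]; ring⟩
  · change (e.symm _).1 = a
    have := hs a 0
    rw [mul_zero, add_zero] at this
    rw [this]

end Division

section Points

variable {k : Type*} [Field k]

theorem exists_algHom_of_nontrivial [IsAlgClosed k] (S : Type*) [CommRing S] [Algebra k S]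
    [Nontrivial S]
    [Algebra.FiniteType k S] : Nonempty (S →ₐ[k] k) := by
  obtain ⟨M, hM⟩ := Ideal.exists_maximal S
  let := Ideal.Quotient.field M
  have : Module.Finite k (S ⧸ M) := finite_of_finite_type_of_isJacobsonRing k (S ⧸ M)
  have hb := IsAlgClosed.algebraMap_bijective_of_isIntegral (k := k) (K := S ⧸ M)
  exact ⟨((AlgEquiv.ofBijective (Algebra.ofId k (S ⧸ M)) hb).symm : (S ⧸ M) →ₐ[k] k).comp
    (Ideal.Quotient.mkₐ k M)⟩

theorem exists_algHom_of_isPrime [IsAlgClosed k] {S : Type*} [CommRing S] [Algebra k S]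
    [Algebra.FiniteType k S] (Q : Ideal S) [Q.IsPrime] {h : S} (hh : h ∉ Q) :
    ∃ ε : S →ₐ[k] k, Q ≤ RingHom.ker ε ∧ ε h ≠ 0 := by
  have h0 : Ideal.Quotient.mk Q h ≠ 0 := by rwa [Ne, Ideal.Quotient.eq_zero_iff_mem]
  let T := Localization.Away (Ideal.Quotient.mk Q h)
  have hT : Nontrivial T := (IsLocalization.injective T
    (powers_le_nonZeroDivisors_of_noZeroDivisors h0)).nontrivial
  have : Algebra.FiniteType (S ⧸ Q) T :=
    IsLocalization.finiteType_of_monoid_fg (Submonoid.powers (Ideal.Quotient.mk Q h)) T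
  have hk : Algebra.FiniteType k T := Algebra.FiniteType.trans (S := S ⧸ Q) inferInstance this
  obtain ⟨ε⟩ := exists_algHom_of_nontrivial (k := k) T
  refine ⟨ε.comp ((IsScalarTower.toAlgHom k (S ⧸ Q) T).comp (Ideal.Quotient.mkₐ k Q)),
    fun x hx => ?_, ?_⟩
  · have : Ideal.Quotient.mk Q x = 0 := Ideal.Quotient.eq_zero_iff_mem.mpr hx
    simp [RingHom.mem_ker, this]
  · have := (IsLocalization.Away.algebraMap_isUnit (S := T) (Ideal.Quotient.mk Q h)).map ε
    exact this.ne_zero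

theorem algHom_eq_of_ker_le {S : Type*} [CommRing S] [Algebra k S] {f g : S →ₐ[k] k}
    (h : RingHom.ker f ≤ RingHom.ker g) : f = g := by
  ext x
  have : x - algebraMap k S (f x) ∈ RingHom.ker f := by simp [RingHom.mem_ker]
  have := h this
  rw [RingHom.mem_ker, map_sub, AlgHom.commutes, sub_eq_zero] at this
  exact this.symm

theorem ker_isMaximal {S : Type*} [CommRing S] [Algebra k S] (f : S →ₐ[k] k) :
    (RingHom.ker f).IsMaximal :=
  RingHom.ker_isMaximal_of_surjective f fun c => ⟨algebraMap k S c, by simp⟩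

theorem exists_algHom_ker_eq [IsAlgClosed k] {S : Type*} [CommRing S] [Algebra k S]
    [Algebra.FiniteType k S]
    (M : Ideal S) [hM : M.IsMaximal] : ∃ f : S →ₐ[k] k, RingHom.ker f = M := by
  obtain ⟨ε, hε, -⟩ := exists_algHom_of_isPrime (k := k) M (h := 1)
    (fun h => hM.ne_top ((Ideal.eq_top_iff_one _).mpr h))
  exact ⟨ε, (hM.eq_of_le (ker_isMaximal ε).ne_top hε).symm⟩

/-- Points outside a proper closed subset lift along a dominant morphism. -/
theorem exists_extension_of_injective [IsAlgClosed k] {B R : Type*} [CommRing B] [IsDomain B]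
    [Algebra k B]
    [Algebra.FiniteType k B] [CommRing R] [IsDomain R] [Algebra k R] [Algebra.FiniteType k R]
    (φ : B →ₐ[k] R) (hφ : Function.Injective φ) {h : R} (hh : h ≠ 0) :
    ∃ h' : B, h' ≠ 0 ∧ ∀ y : B →ₐ[k] k, y h' ≠ 0 → ∃ ε : R →ₐ[k] k, ε.comp φ = y ∧ ε h ≠ 0 := by
  have : IsNoetherianRing B := Algebra.FiniteType.isNoetherianRing k B
  have hft : (φ : B →+* R).FiniteType := by
    apply RingHom.FiniteType.of_comp_finiteType (f := algebraMap k B)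
    have : (φ : B →+* R).comp (algebraMap k B) = algebraMap k R := φ.comp_algebraMap
    rw [this]
    exact RingHom.finiteType_algebraMap.mpr inferInstance
  have hfp := RingHom.FinitePresentation.of_finiteType.mp hft
  have hcon := PrimeSpectrum.isConstructible_comap_image hfp
    (PrimeSpectrum.isConstructible_basicOpen (f := h))
  obtain ⟨S, hS⟩ := PrimeSpectrum.exists_constructibleSetData_iff.mpr hcon
  have hbot : (⊥ : PrimeSpectrum B) ∈ S.toSet := by
    rw [hS]
    refine ⟨⊥, by simpa using hh, ?_⟩
    ext x
    simp [PrimeSpectrum.comap_asIdeal, map_eq_zero_iff _ hφ]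
  rw [PrimeSpectrum.ConstructibleSetData.toSet] at hbot
  simp only [Set.mem_iUnion] at hbot
  obtain ⟨C, hC, hbC⟩ := hbot
  refine ⟨C.f, fun h0 => hbC.2 ?_, fun y hy => ?_⟩
  · simp [h0]
  · have hyp : (RingHom.ker y).IsPrime := (ker_isMaximal y).isPrime
    have hmem : (⟨RingHom.ker y, hyp⟩ : PrimeSpectrum B) ∈ S.toSet := by
      rw [PrimeSpectrum.ConstructibleSetData.toSet]
      simp only [Set.mem_iUnion]
      refine ⟨C, hC, fun g hg => ?_, fun hf => hy ?_⟩
      · have := hbC.1 hg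
        have hg0 : g = 0 := by simpa using this
        simp [hg0]
      · simpa [PrimeSpectrum.mem_zeroLocus, RingHom.mem_ker] using hf
    rw [hS] at hmem
    obtain ⟨Q, hQ, hQy⟩ := hmem
    obtain ⟨ε, hε, hεh⟩ := exists_algHom_of_isPrime (k := k) Q.asIdeal (h := h) hQ
    refine ⟨ε, (algHom_eq_of_ker_le fun x hx => ?_).symm, hεh⟩
    have : x ∈ (PrimeSpectrum.comap (φ : B →+* R) Q).asIdeal := by rw [hQy]; exact hx
    exact hε this

end Points

section QuotientDimension

variable {k B : Type*} [Field k] [CommRing B] [Algebra k B]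

theorem ideal_eq_of_le_of_finrank_le {I J : Ideal B} (h : I ≤ J) [Module.Finite k (B ⧸ I)]
    (hf : Module.finrank k (B ⧸ I) ≤ Module.finrank k (B ⧸ J)) : I = J := by
  let f := (Ideal.Quotient.factorₐ k h).toLinearMap
  have hs : Function.Surjective f := Ideal.Quotient.factor_surjective h
  have : Module.Finite k (B ⧸ J) := Module.Finite.of_surjective f hs
  have heq : Module.finrank k (B ⧸ I) = Module.finrank k (B ⧸ J) :=
    le_antisymm hf (LinearMap.finrank_le_finrank_of_surjective hs)
  have hi := (LinearMap.injective_iff_surjective_of_finrank_eq_finrank heq).mpr hs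
  refine le_antisymm h fun x hx => ?_
  have : f (Ideal.Quotient.mk I x) = f 0 := by
    rw [map_zero]
    exact Ideal.Quotient.eq_zero_iff_mem.mpr hx
  exact Ideal.Quotient.eq_zero_iff_mem.mp (hi this)

theorem finrank_quotient_mul [IsDedekindDomain B] {I J : Ideal B} (hI : I ≠ ⊥) (hJ : J ≠ ⊥)
    [Module.Finite k (B ⧸ I)] [Module.Finite k (B ⧸ J)] :
    Module.Finite k (B ⧸ I * J) ∧
      Module.finrank k (B ⧸ I * J) = Module.finrank k (B ⧸ I) + Module.finrank k (B ⧸ J) := by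
  obtain ⟨a, ha⟩ := IsDedekindDomain.exists_sup_span_eq (I := I * J) (J := I) Ideal.mul_le_left
    (mul_ne_zero hI hJ)
  have haI : a ∈ I := by
    rw [← ha]; exact Ideal.mem_sup_right (Ideal.mem_span_singleton_self a)
  let f₀ : B →ₗ[k] B ⧸ I * J := (Ideal.Quotient.mkₐ k (I * J)).toLinearMap.comp
    (LinearMap.mulLeft k a)
  have hker : ∀ x, f₀ x = 0 ↔ x ∈ J := by
    intro x
    change Ideal.Quotient.mk (I * J) (a * x) = 0 ↔ _
    rw [Ideal.Quotient.eq_zero_iff_mem]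
    refine ⟨fun hx => ?_, fun hx => Ideal.mul_mem_mul haI hx⟩
    have h1 : I * Ideal.span {x} ≤ I * J := by
      conv_lhs => rw [← ha]
      rw [Ideal.sup_mul, sup_le_iff]
      refine ⟨Ideal.mul_le_left, ?_⟩
      rw [Ideal.span_singleton_mul_span_singleton, Ideal.span_singleton_le_iff_mem]
      exact hx
    have h2 := (mul_le_mul_iff_right₀ (a := I) (bot_lt_iff_ne_bot.mpr hI)).mp h1
    exact (Ideal.span_singleton_le_iff_mem _).mp h2
  let f : (B ⧸ J) →ₗ[k] B ⧸ I * J := ((J.restrictScalars k).liftQ f₀ fun x hx => (hker x).mpr hx)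
  have hf : Function.Injective f := by
    rw [← LinearMap.ker_eq_bot, LinearMap.ker_eq_bot']
    intro x hx
    obtain ⟨x, rfl⟩ := Ideal.Quotient.mk_surjective x
    exact Ideal.Quotient.eq_zero_iff_mem.mpr ((hker x).mp hx)
  let g := (Ideal.Quotient.factorₐ k (Ideal.mul_le_left (I := I) (J := J))).toLinearMap
  have hg : Function.Surjective g := Ideal.Quotient.factor_surjective
    (Ideal.mul_le_left (I := I) (J := J))
  have hfg : LinearMap.ker g = LinearMap.range f := by
    ext x
    obtain ⟨x, rfl⟩ := Ideal.Quotient.mk_surjective x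
    constructor
    · intro hx
      have hx' : x ∈ I := Ideal.Quotient.eq_zero_iff_mem.mp hx
      rw [← ha] at hx'
      obtain ⟨y, hy, w, hw, rfl⟩ := Submodule.mem_sup.mp hx'
      obtain ⟨b, rfl⟩ := Ideal.mem_span_singleton'.mp hw
      refine ⟨Ideal.Quotient.mk J b, ?_⟩
      change Ideal.Quotient.mk (I * J) (a * b) = Ideal.Quotient.mk (I * J) (y + b * a)
      rw [Ideal.Quotient.eq]
      have : a * b - (y + b * a) = - y := by ring
      rw [this]
      exact neg_mem hy
    · rintro ⟨b, hb⟩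
      obtain ⟨b, rfl⟩ := Ideal.Quotient.mk_surjective b
      rw [← hb]
      exact Ideal.Quotient.eq_zero_iff_mem.mpr (Ideal.mul_mem_right _ _ haI)
  have hkf : Module.Finite k (LinearMap.ker g) := by rw [hfg]; infer_instance
  have hqf : Module.Finite k ((B ⧸ I * J) ⧸ LinearMap.ker g) :=
    Module.Finite.equiv (g.quotKerEquivOfSurjective hg).symm
  have hfin : Module.Finite k (B ⧸ I * J) := Module.Finite.of_submodule_quotient (LinearMap.ker g)
  refine ⟨hfin, ?_⟩
  rw [← g.finrank_range_add_finrank_ker, hfg, LinearMap.finrank_range_of_inj hf,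
    LinearMap.range_eq_top.mpr hg, finrank_top]

theorem finrank_quotient_pow [IsDedekindDomain B] {I : Ideal B} (hI : I ≠ ⊥)
    [Module.Finite k (B ⧸ I)] (n : ℕ) :
    Module.Finite k (B ⧸ I ^ n) ∧
      Module.finrank k (B ⧸ I ^ n) = n * Module.finrank k (B ⧸ I) := by
  induction n with
  | zero =>
    rw [pow_zero, Ideal.one_eq_top]
    have : Subsingleton (B ⧸ (⊤ : Ideal B)) := Ideal.Quotient.subsingleton_iff.mpr rfl
    exact ⟨inferInstance, by rw [Module.finrank_zero_of_subsingleton, zero_mul]⟩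
  | succ n ih =>
    have := ih.1
    rw [pow_succ]
    have h := finrank_quotient_mul (k := k) (pow_ne_zero n hI) hI
    exact ⟨h.1, by rw [h.2, ih.2, Nat.succ_mul]⟩

theorem finrank_quotient_ker (y : B →ₐ[k] k) :
    Module.Finite k (B ⧸ RingHom.ker y) ∧ Module.finrank k (B ⧸ RingHom.ker y) = 1 := by
  have e : (B ⧸ RingHom.ker y) ≃ₐ[k] k := Ideal.quotientKerAlgEquivOfSurjective
    (f := y) fun c => ⟨algebraMap k B c, by simp⟩
  exact ⟨Module.Finite.equiv e.symm.toLinearEquiv, by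
    rw [e.toLinearEquiv.finrank_eq, Module.finrank_self]⟩

theorem exists_lift_basis [IsDomain B] {u : B} (hu : u ≠ 0)
    [Module.Finite k (B ⧸ Ideal.span {u})] {r : ℕ}
    (hr : Module.finrank k (B ⧸ Ideal.span {u}) = r) :
    ∃ b : Fin r → B, Function.Bijective fun x : (Fin r → k) × B =>
      ∑ i, x.1 i • b i + u * x.2 := by
  let e : Module.Basis (Fin r) k (B ⧸ Ideal.span {u}) := Module.finBasisOfFinrankEq k _ hr
  choose b hb using fun i => Ideal.Quotient.mk_surjective (e i)
  have hsum : ∀ a : Fin r → k, Ideal.Quotient.mk (Ideal.span {u}) (∑ i, a i • b i) =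
      ∑ i, a i • e i := by
    intro a
    rw [map_sum]
    refine Finset.sum_congr rfl fun i _ => ?_
    rw [← hb]
    exact map_smul (Ideal.Quotient.mkₐ k (Ideal.span {u})) _ _
  have hu0 : ∀ q, Ideal.Quotient.mk (Ideal.span {u}) (u * q) = 0 := fun q =>
    Ideal.Quotient.eq_zero_iff_mem.mpr (Ideal.mul_mem_right _ _ (Ideal.mem_span_singleton_self u))
  refine ⟨b, fun x x' h => ?_, fun f => ?_⟩
  · have h1 : ∑ i, x.1 i • e i = ∑ i, x'.1 i • e i := by
      rw [← hsum, ← hsum]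
      have := congrArg (Ideal.Quotient.mk (Ideal.span {u})) h
      simpa only [map_add, hu0, add_zero] using this
    have h2 : x.1 = x'.1 := by
      funext i
      have := congrArg (fun w => e.repr w i) h1
      simpa only [e.repr_sum_self] using this
    refine Prod.ext h2 ?_
    simp only [h2, add_right_inj] at h
    exact mul_left_cancel₀ hu h
  · have h1 := e.sum_repr (Ideal.Quotient.mk (Ideal.span {u}) f)
    rw [← hsum, Ideal.Quotient.eq, Ideal.mem_span_singleton] at h1
    obtain ⟨q, hq⟩ := h1
    exact ⟨(fun i => e.repr (Ideal.Quotient.mk (Ideal.span {u}) f) i, -q), by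
      simp only [mul_neg, ← hq]; ring⟩

end QuotientDimension

section Specialization

open scoped TensorProduct

variable {k B : Type*} [Field k] [CommRing B] [Algebra k B]

variable (k B) in
/-- Constant power series, as a morphism of `k`-algebras. -/
noncomputable def constHom : B →ₐ[k] PowerSeries B :=
  { (PowerSeries.C : B →+* PowerSeries B) with
    commutes' := fun _ => (PowerSeries.algebraMap_apply).symm }

/-- The natural map `R ⊗ B → B⟦X⟧` for a subalgebra `R` of `k⟦X⟧`. -/
noncomputable def tensorToSeries (R : Subalgebra k (PowerSeries k)) :
    R ⊗[k] B →ₐ[k] PowerSeries B :=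
  Algebra.TensorProduct.productMap
    ((PowerSeries.mapAlgHom (Algebra.ofId k B)).comp R.val) (constHom k B)

theorem tensorToSeries_tmul {R : Subalgebra k (PowerSeries k)} (r : R) (x : B) :
    tensorToSeries R (r ⊗ₜ[k] x) = (r : PowerSeries k) • PowerSeries.C x := by
  rw [tensorToSeries, Algebra.TensorProduct.productMap_apply_tmul, Algebra.smul_def,
    PowerSeries.algebraMap_apply'', AlgHom.comp_apply, PowerSeries.mapAlgHom_apply]
  rfl

/-- Specialization `R ⊗ B → B` at a `k`-point of `R`. -/
noncomputable def tensorEval {R : Subalgebra k (PowerSeries k)} (ε : R →ₐ[k] k) :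
    R ⊗[k] B →ₐ[k] B :=
  Algebra.TensorProduct.productMap ((Algebra.ofId k B).comp ε) (AlgHom.id k B)

theorem tensorEval_tmul {R : Subalgebra k (PowerSeries k)} (ε : R →ₐ[k] k) (r : R) (x : B) :
    tensorEval ε (r ⊗ₜ[k] x) = ε r • x := by
  rw [tensorEval, Algebra.TensorProduct.productMap_apply_tmul, Algebra.smul_def]
  rfl

theorem tensorEval_surjective {R : Subalgebra k (PowerSeries k)} (ε : R →ₐ[k] k) :
    Function.Surjective (tensorEval (B := B) ε) := fun x =>
  ⟨1 ⊗ₜ x, by rw [tensorEval_tmul, map_one, one_smul]⟩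

/-- The specialization of the ideal generated by a power series. -/
noncomputable def specIdeal {R : Subalgebra k (PowerSeries k)} (ε : R →ₐ[k] k)
    (w : PowerSeries B) : Ideal B :=
  ((Ideal.span {w}).comap (tensorToSeries (B := B) R)).map (tensorEval ε)

theorem mem_specIdeal {R : Subalgebra k (PowerSeries k)} {ε : R →ₐ[k] k} {w : PowerSeries B}
    {x : B} : x ∈ specIdeal ε w ↔ ∃ t, tensorEval ε t = x ∧ w ∣ tensorToSeries R t := by
  rw [specIdeal, Ideal.mem_map_iff_of_surjective _ (tensorEval_surjective ε)]
  simp only [Ideal.mem_comap, Ideal.mem_span_singleton]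
  exact ⟨fun ⟨t, h1, h2⟩ => ⟨t, h2, h1⟩, fun ⟨t, h1, h2⟩ => ⟨t, h2, h1⟩⟩

theorem specIdeal_pow_le {R : Subalgebra k (PowerSeries k)} (ε : R →ₐ[k] k)
    (w : PowerSeries B) (n : ℕ) : specIdeal ε w ^ n ≤ specIdeal ε (w ^ n) := by
  rw [specIdeal, specIdeal, ← Ideal.map_pow]
  refine Ideal.map_mono ((Ideal.le_comap_pow _ n).trans ?_)
  rw [Ideal.span_singleton_pow]

theorem specIdeal_le_of_dvd {R : Subalgebra k (PowerSeries k)} (ε : R →ₐ[k] k)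
    {w w' : PowerSeries B} (h : w ∣ w') : specIdeal ε w' ≤ specIdeal ε w := by
  intro x hx
  obtain ⟨t, h1, h2⟩ := mem_specIdeal.mp hx
  exact mem_specIdeal.mpr ⟨t, h1, h.trans h2⟩

theorem coordinates_mem {r : ℕ} {b : Fin r → B} {w : PowerSeries B}
    {c : PowerSeries B →ₗ[PowerSeries k] (Fin r → PowerSeries k)}
    (hc0 : ∀ f, c f = 0 ↔ w ∣ f) (hc1 : ∀ f, w ∣ f - ∑ i, c f i • PowerSeries.C (b i))
    {R : Subalgebra k (PowerSeries k)} {G : Set B} (hG : Algebra.adjoin k G = ⊤)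
    (h1 : ∀ i, c 1 i ∈ R) (hb : ∀ x ∈ G, ∀ j i, c (PowerSeries.C (x * b j)) i ∈ R)
    (x : B) (i : Fin r) : c (PowerSeries.C x) i ∈ R := by
  suffices h : ∀ y, (∀ i, c (PowerSeries.C y) i ∈ R) → ∀ i, c (PowerSeries.C (x * y)) i ∈ R by
    simpa using h 1 (by simpa using h1) i
  have hx : x ∈ Algebra.adjoin k G := by rw [hG]; trivial
  induction hx using Algebra.adjoin_induction with
  | mem x hx =>
    intro y hy i
    have hd : c (PowerSeries.C x * (PowerSeries.C y -
        ∑ i, c (PowerSeries.C y) i • PowerSeries.C (b i))) = 0 :=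
      (hc0 _).mpr (Dvd.dvd.mul_left (hc1 _) _)
    rw [mul_sub, map_sub, sub_eq_zero, Finset.mul_sum] at hd
    rw [map_mul, hd]
    simp only [mul_smul_comm, map_sum, map_smul, ← map_mul, Finset.sum_apply, Pi.smul_apply,
      smul_eq_mul]
    exact sum_mem fun j _ => mul_mem (hy j) (hb x hx j i)
  | algebraMap a =>
    intro y hy i
    have : PowerSeries.C (algebraMap k B a * y) = (PowerSeries.C a : PowerSeries k) •
        PowerSeries.C y := by
      rw [Algebra.smul_def, PowerSeries.algebraMap_apply'', PowerSeries.map_C, map_mul]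
    rw [this, map_smul]
    exact mul_mem (R.algebraMap_mem a) (hy i)
  | add x x' _ _ h h' =>
    intro y hy i
    rw [add_mul, map_add, map_add]
    exact add_mem (h y hy i) (h' y hy i)
  | mul x x' _ _ h h' =>
    intro y hy i
    rw [mul_assoc]
    exact h _ (h' y hy) i

theorem finrank_quotient_specIdeal {r : ℕ} {b : Fin r → B} {w : PowerSeries B}
    {c : PowerSeries B →ₗ[PowerSeries k] (Fin r → PowerSeries k)}
    (hc0 : ∀ f, c f = 0 ↔ w ∣ f) (hc1 : ∀ f, w ∣ f - ∑ i, c f i • PowerSeries.C (b i))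
    (hc2 : ∀ a : Fin r → PowerSeries k, c (∑ i, a i • PowerSeries.C (b i)) = a)
    {R : Subalgebra k (PowerSeries k)} (hR : ∀ x i, c (PowerSeries.C x) i ∈ R)
    (ε : R →ₐ[k] k) :
    Module.Finite k (B ⧸ specIdeal ε w) ∧ Module.finrank k (B ⧸ specIdeal ε w) = r := by
  let cε : B →ₗ[k] (Fin r → k) :=
    { toFun := fun x i => ε ⟨c (PowerSeries.C x) i, hR x i⟩
      map_add' := fun x y => by
        funext i
        rw [Pi.add_apply, ← map_add]
        congr 1
        ext1
        simp
      map_smul' := fun a x => by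
        funext i
        rw [Pi.smul_apply, RingHom.id_apply, ← map_smul]
        congr 1
        ext1
        have : PowerSeries.C (a • x) = (PowerSeries.C a : PowerSeries k) • PowerSeries.C x := by
          rw [Algebra.smul_def, Algebra.smul_def, PowerSeries.algebraMap_apply'',
            PowerSeries.map_C, map_mul]
        change c (PowerSeries.C (a • x)) i = a • c (PowerSeries.C x) i
        rw [this, map_smul, Pi.smul_apply, smul_eq_mul, PowerSeries.smul_eq_C_mul] }
  have hcε : ∀ x i, cε x i = ε ⟨c (PowerSeries.C x) i, hR x i⟩ := fun _ _ => rfl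
  have hsurj : Function.Surjective cε := by
    intro a
    refine ⟨∑ i, a i • b i, ?_⟩
    funext i
    have h := hc2 fun i => PowerSeries.C (a i)
    have h' : ∑ i, (PowerSeries.C (a i) : PowerSeries k) • PowerSeries.C (b i) =
        PowerSeries.C (∑ i, a i • b i) := by
      rw [map_sum]
      refine Finset.sum_congr rfl fun i _ => ?_
      rw [Algebra.smul_def, Algebra.smul_def, PowerSeries.algebraMap_apply'',
            PowerSeries.map_C, map_mul]
    rw [h'] at h
    rw [hcε]
    have : (⟨c (PowerSeries.C (∑ i, a i • b i)) i, hR _ i⟩ : R) = algebraMap k R (a i) := by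
      exact Subtype.ext (congrFun h i)
    rw [this, AlgHom.commutes]; rfl
  have hten : ∀ t : R ⊗[k] B, ∃ ρ : Fin r → R, (c (tensorToSeries R t) = fun i => (ρ i :
      PowerSeries k)) ∧ cε (tensorEval ε t) = fun i => ε (ρ i) := by
    intro t
    induction t using TensorProduct.induction_on with
    | zero => exact ⟨0, by simp; rfl, by simp; rfl⟩
    | tmul a x =>
      refine ⟨fun i => a * ⟨c (PowerSeries.C x) i, hR x i⟩, ?_, ?_⟩
      · rw [tensorToSeries_tmul, map_smul]; rfl
      · rw [tensorEval_tmul, map_smul]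
        funext i
        rw [map_mul]
        rfl
    | add t t' h h' =>
      obtain ⟨ρ, h1, h2⟩ := h
      obtain ⟨ρ', h1', h2'⟩ := h'
      refine ⟨ρ + ρ', ?_, ?_⟩
      · rw [map_add, map_add, h1, h1']; rfl
      · rw [map_add, map_add, h2, h2']
        funext i
        simp
  have hker : ∀ x, x ∈ LinearMap.ker cε ↔ x ∈ (specIdeal ε w).restrictScalars k := by
    intro x
    rw [Submodule.restrictScalars_mem, mem_specIdeal, LinearMap.mem_ker]
    constructor
    · intro hx
      refine ⟨1 ⊗ₜ x - ∑ i, (⟨c (PowerSeries.C x) i, hR x i⟩ : R) ⊗ₜ[k] b i, ?_, ?_⟩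
      · rw [map_sub, tensorEval_tmul, map_one, one_smul, map_sum, sub_eq_self]
        refine Finset.sum_eq_zero fun i _ => ?_
        rw [tensorEval_tmul, ← hcε, hx, Pi.zero_apply, zero_smul]
      · rw [map_sub, map_sum, tensorToSeries_tmul]
        simp only [tensorToSeries_tmul, OneMemClass.coe_one, one_smul]
        exact hc1 _
    · rintro ⟨t, rfl, ht⟩
      obtain ⟨ρ, h1, h2⟩ := hten t
      rw [(hc0 _).mpr ht] at h1
      rw [h2]
      funext i
      have : ρ i = 0 := Subtype.ext (congrFun h1 i).symm
      simp [this]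
  have e : (B ⧸ specIdeal ε w) ≃ₗ[k] (Fin r → k) :=
    (Submodule.quotEquivOfEq _ _ (Submodule.ext hker)).symm.trans
      (cε.quotKerEquivOfSurjective hsurj)
  exact ⟨Module.Finite.equiv e.symm, by rw [e.finrank_eq]; simp⟩

end Specialization

section Deformation

open scoped TensorProduct

theorem exists_monic_dvd_aeval {k B : Type*} [Field k] [CommRing B] [Algebra k B]
    {r : ℕ} {b : Fin r → B} {w : PowerSeries B}
    {c : PowerSeries B →ₗ[PowerSeries k] (Fin r → PowerSeries k)}
    (hc1 : ∀ f, w ∣ f - ∑ i, c f i • PowerSeries.C (b i)) (z : PowerSeries B) :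
    ∃ χ : (PowerSeries k)[X], χ.Monic ∧ w ∣ Polynomial.aeval z χ := by
  classical
  let Q := PowerSeries B ⧸ Ideal.span {w}
  have hfin : Module.Finite (PowerSeries k) Q := by
    refine ⟨⟨Finset.univ.image fun i => Ideal.Quotient.mk _ (PowerSeries.C (b i)), ?_⟩⟩
    rw [eq_top_iff]
    rintro x -
    obtain ⟨f, rfl⟩ := Ideal.Quotient.mk_surjective x
    have : Ideal.Quotient.mk (Ideal.span {w}) f =
        ∑ i, c f i • Ideal.Quotient.mk (Ideal.span {w}) (PowerSeries.C (b i)) := by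
      have h := Ideal.Quotient.eq.mpr (Ideal.mem_span_singleton.mpr (hc1 f))
      rw [h, map_sum]
      exact Finset.sum_congr rfl fun i _ =>
        map_smul (Ideal.Quotient.mkₐ (PowerSeries k) (Ideal.span {w})) _ _
    rw [this]
    exact sum_mem fun i _ => Submodule.smul_mem _ _ (Submodule.subset_span (by simp))
  obtain ⟨χ, hχ, hχz⟩ := Algebra.IsIntegral.isIntegral (R := PowerSeries k)
    (Ideal.Quotient.mk (Ideal.span {w}) z)
  refine ⟨χ, hχ, ?_⟩
  rw [← Ideal.mem_span_singleton, ← Ideal.Quotient.eq_zero_iff_mem]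
  have := Polynomial.aeval_algHom_apply (Ideal.Quotient.mkₐ (PowerSeries k) (Ideal.span {w})) z χ
  exact this.symm.trans hχz

theorem exists_eq_mul_pow_of_deformation {k B Λ : Type*} [Field k] [IsAlgClosed k] [CommRing B]
    [IsDedekindDomain B] [Algebra k B] [Algebra.FiniteType k B] [Field Λ] [Algebra k Λ]
    [Algebra (PowerSeries k) Λ] [IsScalarTower k (PowerSeries k) Λ]
    [IsFractionRing (PowerSeries k) Λ] {ℓ D : ℕ} (hℓ : ℓ ≠ 0) (v : PowerSeries B)
    (hv : PowerSeries.constantCoeff v ≠ 0)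
    (hfin : Module.Finite k (B ⧸ Ideal.span {PowerSeries.constantCoeff v}))
    (hD : Module.finrank k (B ⧸ Ideal.span {PowerSeries.constantCoeff v}) = D)
    (V : Submodule k B) [Module.Finite k V] (hV : ∀ n, PowerSeries.coeff n (v ^ ℓ) ∈ V)
    (hdim : ∀ g ∈ V, g ≠ 0 → Module.Finite k (B ⧸ Ideal.span {g}) ∧
      Module.finrank k (B ⧸ Ideal.span {g}) ≤ ℓ * D + 1)
    (τ : B →ₐ[k] Λ) (hτ : Function.Injective τ) (z : B)
    (hz : τ z ∉ Set.range (algebraMap (PowerSeries k) Λ)) (κ : Λ) (hκ : κ ≠ 0)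
    (ρ : V →ₗ[k] PowerSeries k) (hρ : ∀ x : V, algebraMap _ Λ (ρ x) = κ * τ x)
    (hrel : ∀ m, ∑ q ∈ Finset.HasAntidiagonal.antidiagonal m,
      PowerSeries.coeff q.2 (ρ ⟨PowerSeries.coeff q.1 (v ^ ℓ), hV q.1⟩) = 0) :
    ∃ h : B, h ≠ 0 ∧ ∀ y : B →ₐ[k] k, y h ≠ 0 →
      ∃ g : B, g ≠ 0 ∧ ∃ J : Ideal B, Ideal.span {g} = RingHom.ker y * J ^ ℓ := by
  classical
  set u := PowerSeries.constantCoeff v with hu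
  have huℓ : PowerSeries.constantCoeff (v ^ ℓ) = u ^ ℓ := map_pow _ _ _
  have hspanu : Ideal.span {u} ≠ (⊥ : Ideal B) := by simpa using hv
  have hpow := finrank_quotient_pow (k := k) hspanu ℓ
  rw [Ideal.span_singleton_pow, hD] at hpow
  have hfinℓ := hpow.1
  obtain ⟨b, hb⟩ := exists_lift_basis (k := k) hv hD
  obtain ⟨c, hc0, hc1, hc2⟩ := exists_coordinates b v hb
  obtain ⟨b', hb'⟩ := exists_lift_basis (k := k) (pow_ne_zero ℓ hv) hpow.2
  obtain ⟨c', hc0', hc1', hc2'⟩ := exists_coordinates b' (v ^ ℓ) (by rw [huℓ]; exact hb')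
  obtain ⟨χ, hχ, hχz⟩ := exists_monic_dvd_aeval hc1' (PowerSeries.C z)
  let a := Module.finBasis k V
  let f : Fin (Module.finrank k V) → PowerSeries k := fun j =>
    PowerSeries.mk fun n => a.repr ⟨PowerSeries.coeff n (v ^ ℓ), hV n⟩ j
  have hf : ∑ j, f j • PowerSeries.C (a j : B) = v ^ ℓ := by
    ext n
    rw [map_sum]
    simp only [coeff_smul_C, f, PowerSeries.coeff_mk]
    have := congrArg (Subtype.val : V → B) (a.sum_repr ⟨PowerSeries.coeff n (v ^ ℓ), hV n⟩)
    rw [AddSubmonoidClass.coe_finsetSum] at this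
    exact this
  have hfρ : ∑ j, f j * ρ (a j) = 0 := by
    ext m
    rw [map_sum, map_zero, ← hrel m]
    simp only [PowerSeries.coeff_mul]
    rw [Finset.sum_comm]
    refine Finset.sum_congr rfl fun q _ => ?_
    conv_rhs => rw [← a.sum_repr ⟨PowerSeries.coeff q.1 (v ^ ℓ), hV q.1⟩, map_sum, map_sum]
    refine Finset.sum_congr rfl fun j _ => ?_
    rw [map_smul, PowerSeries.coeff_smul, smul_eq_mul]
    simp [f]
  obtain ⟨j₀, hj₀⟩ : ∃ j, f j ≠ 0 := by
    by_contra! h0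
    have : v ^ ℓ = 0 := by rw [← hf]; simp [h0]
    have hvv : v = 0 := pow_eq_zero_iff hℓ |>.mp this
    exact hv (by rw [hu, hvv, map_zero])
  obtain ⟨G, hG⟩ := (inferInstance : Algebra.FiniteType k B).out
  let S : Set (PowerSeries k) := Set.range (c 1) ∪ Set.range (c' 1) ∪
    (⋃ x ∈ G, ⋃ j, Set.range (c (PowerSeries.C (x * b j)))) ∪
    (⋃ x ∈ G, ⋃ j, Set.range (c' (PowerSeries.C (x * b' j)))) ∪ Set.range f ∪
    (χ.coeffs : Set (PowerSeries k))
  have hS : S.Finite := by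
    refine Set.Finite.union (Set.Finite.union (Set.Finite.union (Set.Finite.union
      (Set.Finite.union ?_ ?_) ?_) ?_) ?_) ?_
    · exact Set.finite_range _
    · exact Set.finite_range _
    · exact G.finite_toSet.biUnion fun x _ => Set.finite_iUnion fun j => Set.finite_range _
    · exact G.finite_toSet.biUnion fun x _ => Set.finite_iUnion fun j => Set.finite_range _
    · exact Set.finite_range _
    · exact χ.coeffs.finite_toSet
  let R := Algebra.adjoin k S
  have hSR : ∀ x ∈ S, x ∈ R := fun x hx => Algebra.subset_adjoin hx
  have hRc : ∀ x i, c (PowerSeries.C x) i ∈ R := coordinates_mem hc0 hc1 hG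
    (fun i => hSR _ (by simp [S])) (fun x hx j i => hSR _ (by
      refine Or.inl (Or.inl (Or.inl (Or.inr ?_)))
      exact Set.mem_biUnion hx (Set.mem_iUnion.mpr ⟨j, i, rfl⟩)))
  have hRc' : ∀ x i, c' (PowerSeries.C x) i ∈ R := coordinates_mem hc0' hc1' hG
    (fun i => hSR _ (by simp [S])) (fun x hx j i => hSR _ (by
      refine Or.inl (Or.inl (Or.inr ?_))
      exact Set.mem_biUnion hx (Set.mem_iUnion.mpr ⟨j, i, rfl⟩)))
  have hRf : ∀ j, f j ∈ R := fun j => hSR _ (Or.inl (Or.inr ⟨j, rfl⟩))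
  have hRχ : ∀ i, χ.coeff i ∈ R := fun i => by
    by_cases h0 : χ.coeff i = 0
    · rw [h0]; exact zero_mem _
    · exact hSR _ (Or.inr (Polynomial.coeff_mem_coeffs h0))
  let ι : PowerSeries k →ₐ[k] Λ := IsScalarTower.toAlgHom k (PowerSeries k) Λ
  have hι : Function.Injective ι := IsFractionRing.injective (PowerSeries k) Λ
  let R₀ := Algebra.adjoin k (ι '' S ∪ τ '' G)
  have hR₀ft : Algebra.FiniteType k R₀ := (Subalgebra.fg_iff_finiteType _).mp
    (Subalgebra.fg_def.mpr ⟨_, (hS.image _).union (G.finite_toSet.image _), rfl⟩)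
  have hRR₀ : ∀ x ∈ R, ι x ∈ R₀ := by
    have : R.map ι ≤ R₀ := by
      rw [AlgHom.map_adjoin]; exact Algebra.adjoin_mono Set.subset_union_left
    exact fun x hx => this ⟨x, hx, rfl⟩
  have hBR₀ : ∀ x, τ x ∈ R₀ := by
    have : (⊤ : Subalgebra k B).map τ ≤ R₀ := by
      rw [← hG, AlgHom.map_adjoin]; exact Algebra.adjoin_mono Set.subset_union_right
    exact fun x => this ⟨x, trivial, rfl⟩
  let φ : B →ₐ[k] R₀ := τ.codRestrict R₀ hBR₀
  let ψ : R →ₐ[k] R₀ := (ι.comp R.val).codRestrict R₀ fun x => hRR₀ _ x.2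
  let χz : R₀ := ∑ i ∈ Finset.range (χ.natDegree + 1), ψ ⟨χ.coeff i, hRχ i⟩ * φ z ^ i
  have hχz0 : χz ≠ 0 := by
    intro h0
    have h1 : Polynomial.aeval (τ z) χ = 0 := by
      have := congrArg R₀.val h0
      rw [map_zero, map_sum] at this
      rw [Polynomial.aeval_eq_sum_range, ← this]
      refine Finset.sum_congr rfl fun i _ => ?_
      rw [Algebra.smul_def, map_mul, map_pow]
      rfl
    have hInt : IsIntegral (PowerSeries k) (τ z) := ⟨χ, hχ, h1⟩
    exact hz (IsIntegrallyClosed.isIntegral_iff.mp hInt)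
  have hh0 : ψ ⟨f j₀, hRf j₀⟩ * χz ≠ 0 := by
    refine mul_ne_zero (fun h0 => hj₀ ?_) hχz0
    have := congrArg R₀.val h0
    exact hι (this.trans (map_zero ι).symm)
  obtain ⟨h', hh', hext⟩ := exists_extension_of_injective φ
    (fun x y hxy => hτ (congrArg R₀.val hxy)) hh0
  refine ⟨h', hh', fun y hy => ?_⟩
  obtain ⟨ε₀, hε₀, hε₀h⟩ := hext y hy
  rw [map_mul] at hε₀h
  let ε : R →ₐ[k] k := ε₀.comp ψ
  let g : V := ∑ j, ε ⟨f j, hRf j⟩ • a j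
  have hg0 : g ≠ 0 := by
    intro h0
    have := congrArg (fun x => a.repr x j₀) h0
    simp only [g, a.repr_sum_self] at this
    rw [map_zero, Finsupp.zero_apply] at this
    exact left_ne_zero_of_mul hε₀h this
  have hgB : (g : B) = ∑ j, ε ⟨f j, hRf j⟩ • (a j : B) := by simp [g]
  have hgI : (g : B) ∈ specIdeal ε (v ^ ℓ) := by
    refine mem_specIdeal.mpr ⟨∑ j, (⟨f j, hRf j⟩ : R) ⊗ₜ[k] (a j : B), ?_, ?_⟩
    · rw [map_sum, hgB]
      exact Finset.sum_congr rfl fun j _ => tensorEval_tmul _ _ _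
    · rw [map_sum]
      simp only [tensorToSeries_tmul]
      rw [hf]
  have hgy : (g : B) ∈ RingHom.ker y := by
    have h1 : ∑ j, ψ ⟨f j, hRf j⟩ * φ (a j) = 0 := by
      apply Subtype.val_injective
      have h2 : ∑ j, ι (f j) * τ (a j) = 0 := by
        apply mul_left_cancel₀ hκ
        rw [mul_zero, Finset.mul_sum, ← map_zero ι, ← hfρ, map_sum]
        refine Finset.sum_congr rfl fun j _ => ?_
        rw [map_mul]
        have : ι (ρ (a j)) = κ * τ (a j) := hρ _
        rw [this]; ring
      rw [AddSubmonoidClass.coe_finsetSum]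
      exact h2
    have h3 := congrArg ε₀ h1
    rw [map_zero, map_sum] at h3
    rw [RingHom.mem_ker, hgB, map_sum, ← h3]
    refine Finset.sum_congr rfl fun j _ => ?_
    rw [map_smul, map_mul, ← hε₀]
    rfl
  have hχI : ∑ i ∈ Finset.range (χ.natDegree + 1), ε ⟨χ.coeff i, hRχ i⟩ • z ^ i ∈
      specIdeal ε (v ^ ℓ) := by
    refine mem_specIdeal.mpr ⟨∑ i ∈ Finset.range (χ.natDegree + 1),
      (⟨χ.coeff i, hRχ i⟩ : R) ⊗ₜ[k] (z ^ i), ?_, ?_⟩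
    · rw [map_sum]
      exact Finset.sum_congr rfl fun j _ => tensorEval_tmul _ _ _
    · rw [map_sum]
      simp only [tensorToSeries_tmul]
      rw [Polynomial.aeval_eq_sum_range] at hχz
      simpa only [map_pow] using hχz
  have hχy : y (∑ i ∈ Finset.range (χ.natDegree + 1), ε ⟨χ.coeff i, hRχ i⟩ • z ^ i) ≠ 0 := by
    have : y (∑ i ∈ Finset.range (χ.natDegree + 1), ε ⟨χ.coeff i, hRχ i⟩ • z ^ i) = ε₀ χz := by
      rw [map_sum, map_sum]
      refine Finset.sum_congr rfl fun j _ => ?_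
      rw [map_smul, map_mul, map_pow, map_pow, ← hε₀]
      rfl
    rw [this]
    exact right_ne_zero_of_mul hε₀h
  obtain ⟨hf1, hr1⟩ := finrank_quotient_specIdeal hc0 hc1 hc2 hRc ε
  obtain ⟨hf2, hr2⟩ := finrank_quotient_specIdeal hc0' hc1' hc2' hRc' ε
  have hI2 : specIdeal ε (v ^ ℓ) ≠ ⊥ := fun h0 => by
    rw [h0, Ideal.mem_bot] at hχI
    rw [hχI, map_zero] at hχy
    exact hχy rfl
  have hI1 : specIdeal ε v ≠ ⊥ := fun h0 => hI2 (le_bot_iff.mp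
    ((specIdeal_le_of_dvd ε (dvd_pow_self v hℓ)).trans h0.le))
  obtain ⟨hf3, hr3⟩ := finrank_quotient_pow (k := k) hI1 ℓ
  have hIeq : specIdeal ε v ^ ℓ = specIdeal ε (v ^ ℓ) :=
    ideal_eq_of_le_of_finrank_le (k := k) (specIdeal_pow_le ε v ℓ) (by rw [hr3, hr1, hr2])
  have hym := ker_isMaximal y
  have hsup : RingHom.ker y ⊔ specIdeal ε (v ^ ℓ) = ⊤ := by
    refine hym.1.2 _ (lt_of_le_of_ne le_sup_left fun h0 => hχy ?_)
    have : specIdeal ε (v ^ ℓ) ≤ RingHom.ker y := by rw [h0]; exact le_sup_right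
    exact this hχI
  have hgmul : (g : B) ∈ RingHom.ker y * specIdeal ε (v ^ ℓ) := by
    rw [Ideal.mul_eq_inf_of_coprime hsup]
    exact ⟨hgy, hgI⟩
  have hgB0 : (g : B) ≠ 0 := fun h0 => hg0 (Subtype.ext h0)
  obtain ⟨hfg, hrg⟩ := hdim g g.2 hgB0
  obtain ⟨hfy, hry⟩ := finrank_quotient_ker y
  have hker0 : RingHom.ker y ≠ ⊥ := fun h0 => hgB0 (by rw [h0] at hgy; exact hgy)
  have hr4 := (finrank_quotient_mul (k := k) hker0 hI2).2
  refine ⟨g, hgB0, specIdeal ε v, ?_⟩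
  rw [hIeq]
  refine ideal_eq_of_le_of_finrank_le (k := k)
    ((Ideal.span_singleton_le_iff_mem _).mpr hgmul) ?_
  rw [hr4, hr2, hry]
  omega

end Deformation

section Expansion

variable {k L : Type*} [Field k] [Field L] [Algebra k L] {Y : L}

theorem IsSepGen.ker_ne_bot (h : IsSepGen k Y) (c₀ : intClosure k Y →ₐ[k] k) :
    RingHom.ker c₀ ≠ ⊥ := by
  intro h0
  let y : intClosure k Y := ⟨Y, self_mem_intClosure Y⟩
  have h1 : y - algebraMap k _ (c₀ y) ∈ RingHom.ker c₀ := by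
    rw [RingHom.mem_ker, map_sub, AlgHom.commutes]
    exact sub_self _
  rw [h0, Ideal.mem_bot, sub_eq_zero] at h1
  have h2 : Y = algebraMap k L (c₀ y) := congrArg Subtype.val h1
  exact h.transcendental (h2 ▸ isAlgebraic_algebraMap _)

theorem IsSepGen.exists_pole (h : IsSepGen k Y) (c₀ : intClosure k Y →ₐ[k] k) :
    ∃ w : L, (∀ x : intClosure k Y, c₀ x = 0 → (x : L) * w ∈ intClosure k Y) ∧
      ∃ x y : intClosure k Y, c₀ x = 0 ∧ (y : L) = x * w ∧ c₀ y ≠ 0 := by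
  have := h.isDedekindDomain
  have := h.isFractionRing
  have hbot := h.ker_ne_bot c₀
  obtain ⟨w, hw, hw1⟩ := FractionalIdeal.exists_notMem_one_of_ne_bot (K := L) hbot
    (ker_isMaximal c₀).ne_top
  rw [FractionalIdeal.mem_inv_iff (by simpa using hbot)] at hw
  have hmem : ∀ x : intClosure k Y, c₀ x = 0 → (x : L) * w ∈ intClosure k Y := by
    intro x hx
    have := hw x ((FractionalIdeal.mem_coeIdeal _).mpr ⟨x, hx, rfl⟩)
    obtain ⟨y, hy⟩ := (FractionalIdeal.mem_one_iff _).mp this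
    rw [mul_comm, ← hy]
    exact y.2
  refine ⟨w, hmem, ?_⟩
  by_contra! hcon
  refine hw1 ((FractionalIdeal.mem_one_iff _).mpr ?_)
  let N : Submodule (intClosure k Y) L :=
    Submodule.map (Algebra.linearMap (intClosure k Y) L) (RingHom.ker c₀)
  have hN : IsIntegral (intClosure k Y) w := by
    refine isIntegral_of_smul_mem_submodule N ?_ ?_ w ?_
    · intro h0
      refine hbot (le_bot_iff.mp fun x hx => ?_)
      have h1 : algebraMap (intClosure k Y) L x ∈ N := ⟨x, hx, rfl⟩
      rw [h0, Submodule.mem_bot] at h1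
      exact Subtype.ext h1
    · exact Submodule.FG.map _ (IsNoetherian.noetherian _)
    · rintro _ ⟨x, hx, rfl⟩
      refine ⟨⟨x * w, hmem x hx⟩, ?_, ?_⟩
      · exact hcon x _ hx rfl
      · exact mul_comm _ _
  obtain ⟨y, hy⟩ := (IsIntegrallyClosed.isIntegral_iff (R := intClosure k Y)).mp hN
  exact ⟨y, hy⟩

/-- A power series expansion at a place of `intClosure k Y`, together with an element having a
simple pole there, equal to the inverse of the parameter. -/
theorem IsSepGen.exists_expansion (h : IsSepGen k Y) (c₀ : intClosure k Y →ₐ[k] k) :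
    ∃ (w : L) (τ : intClosure k Y →ₐ[k] PowerSeries k),
      (∀ x : intClosure k Y, c₀ x = 0 → (x : L) * w ∈ intClosure k Y) ∧
      Function.Injective τ ∧ (∀ x, PowerSeries.constantCoeff (τ x) = c₀ x) ∧
      ∃ x y : intClosure k Y, x ≠ 0 ∧ (y : L) = x * w ∧ τ x = PowerSeries.X * τ y := by
  obtain ⟨w, hw, π, π', hπ, hπ', hπ0⟩ := h.exists_pole c₀
  have hsub : ∀ x : intClosure k Y, c₀ (x - algebraMap k _ (c₀ x)) = 0 := fun x => by
    rw [map_sub, AlgHom.commutes]; exact sub_self _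
  let T : intClosure k Y →ₗ[k] intClosure k Y :=
    { toFun := fun x => ⟨_, hw _ (hsub x)⟩
      map_add' := fun x y => Subtype.ext (by
        simp only [map_add, Subalgebra.coe_add, Subalgebra.coe_sub]; ring)
      map_smul' := fun a x => Subtype.ext (by
        simp [Algebra.smul_def]; ring) }
  have hT : ∀ x, (T x : L) = (x - algebraMap k L (c₀ x)) * w := fun x => rfl
  have hTmul : ∀ x y, T (x * y) = T x * y + algebraMap k _ (c₀ x) * T y := fun x y => by
    apply Subtype.ext
    simp only [hT, map_mul, Subalgebra.coe_add, Subalgebra.coe_mul, Subalgebra.coe_algebraMap]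
    ring
  let τ₀ : intClosure k Y →ₗ[k] PowerSeries k :=
    { toFun := fun x => PowerSeries.mk fun n => c₀ ((T ^ n) x)
      map_add' := fun x y => by ext n; simp
      map_smul' := fun a x => by ext n; simp }
  have hτ0 : ∀ x, PowerSeries.constantCoeff (τ₀ x) = c₀ x := fun x => by
    rw [← PowerSeries.coeff_zero_eq_constantCoeff_apply]
    simp [τ₀]
  have hτT : ∀ x, τ₀ x = PowerSeries.C (c₀ x) + PowerSeries.X * τ₀ (T x) := fun x => by
    ext n
    cases n with
    | zero => simp [hτ0]
    | succ n =>
      rw [map_add, PowerSeries.coeff_succ_X_mul, PowerSeries.coeff_C, if_neg n.succ_ne_zero,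
          zero_add]
      simp [τ₀, pow_succ]
  have hC : ∀ (a : k) x, τ₀ (algebraMap k _ a * x) = PowerSeries.C a * τ₀ x := fun a x => by
    rw [← Algebra.smul_def, map_smul, PowerSeries.smul_eq_C_mul]
  have hmul : ∀ x y, τ₀ (x * y) = τ₀ x * τ₀ y := by
    have key : ∀ n x y, PowerSeries.coeff n (τ₀ (x * y) - τ₀ x * τ₀ y) = 0 := by
      intro n
      induction n with
      | zero =>
        intro x y
        rw [PowerSeries.coeff_zero_eq_constantCoeff_apply]
        simp [hτ0]
      | succ n ih =>
        intro x y
        have : τ₀ (x * y) - τ₀ x * τ₀ y = PowerSeries.X * (τ₀ (T x * y) - τ₀ (T x) * τ₀ y) := by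
          rw [hτT (x * y), hTmul, map_add, hC]
          conv_lhs => rw [hτT x]
          have h2 := hτT y
          rw [map_mul, map_mul]
          linear_combination (-PowerSeries.C (c₀ x)) * h2
        rw [this, PowerSeries.coeff_succ_X_mul]
        exact ih _ _
    intro x y
    rw [← sub_eq_zero]
    ext n
    rw [key, map_zero]
  have hone : τ₀ 1 = 1 := by
    rw [hτT, map_one, map_one]
    have : T 1 = 0 := Subtype.ext (by simp [hT])
    rw [this, map_zero, mul_zero, add_zero]
  let τ : intClosure k Y →ₐ[k] PowerSeries k := AlgHom.ofLinearMap τ₀ hone hmul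
  have hTπ : T π = π' := Subtype.ext (by rw [hT, hπ, map_zero, sub_zero, hπ'])
  have hππ : τ π = PowerSeries.X * τ π' := by
    have := hτT π
    rw [hπ, hTπ, map_zero, zero_add] at this
    exact this
  have hπne : τ π ≠ 0 := by
    rw [hππ]
    refine mul_ne_zero PowerSeries.X_ne_zero fun h0 => hπ0 ?_
    rw [← hτ0]
    have : τ₀ π' = 0 := h0
    rw [this, map_zero]
  have := h.isDedekindDomain
  refine ⟨w, τ, hw, ?_, hτ0, π, π', fun h0 => hπne (by rw [h0, map_zero]), hπ', hππ⟩
  change Function.Injective (τ : intClosure k Y →+* PowerSeries k)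
  rw [RingHom.injective_iff_ker_eq_bot]
  by_contra hne
  have hprime : (RingHom.ker (τ : intClosure k Y →+* PowerSeries k)).IsPrime :=
    RingHom.ker_isPrime _
  have hmax := hprime.isMaximal hne
  have hle : RingHom.ker (τ : intClosure k Y →+* PowerSeries k) ≤ RingHom.ker c₀ := fun x hx => by
    rw [RingHom.mem_ker] at hx ⊢
    rw [← hτ0]
    have : τ₀ x = 0 := hx
    rw [this, map_zero]
  have heq := hmax.eq_of_le (ker_isMaximal c₀).ne_top hle
  have : π ∈ RingHom.ker c₀ := hπ
  rw [← heq] at this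
  exact hπne this

end Expansion

section Infinity

variable {k L : Type*} [Field k] [Field L] [Algebra k L] {z : L}

theorem IsSepGen.exists_algHom_inv [IsAlgClosed k] (h : IsSepGen k z) :
    ∃ c₀ : intClosure k z⁻¹ →ₐ[k] k, c₀ ⟨z⁻¹, self_mem_intClosure _⟩ = 0 := by
  have := h.inv.finiteType
  let y : intClosure k z⁻¹ := ⟨z⁻¹, self_mem_intClosure _⟩
  have hy : ¬ IsUnit y := by
    intro hu
    obtain ⟨y', hy'⟩ := hu.exists_right_inv
    have h1 : z⁻¹ * (y' : L) = 1 := congrArg Subtype.val hy'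
    have h2 : (y' : L) = z := by
      rw [inv_mul_eq_one₀ h.ne_zero] at h1; exact h1.symm
    have h3 := y'.2
    rw [h2] at h3
    obtain ⟨c, hc⟩ := exists_algebraMap_of_mem_both (self_mem_intClosure (k := k) z) h3
    exact h.transcendental (hc ▸ isAlgebraic_algebraMap _)
  obtain ⟨M, hM, hyM⟩ := exists_max_ideal_of_mem_nonunits hy
  obtain ⟨f, hf⟩ := exists_algHom_ker_eq (k := k) M
  refine ⟨f, ?_⟩
  rw [← hf] at hyM
  exact hyM

variable (k) in
/-- Functions with pole order at most `N` along `z = ∞`, with an additional polar part allowed,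
given by multiples of `w`. -/
def polarFilt (z w : L) (N : ℕ) : Submodule k (intClosure k z) where
  carrier := {x | ∃ c : k, z⁻¹ ^ N * (x : L) - algebraMap k L c * w ∈ intClosure k z⁻¹}
  add_mem' := by
    rintro x y ⟨c, hc⟩ ⟨d, hd⟩
    refine ⟨c + d, ?_⟩
    have := add_mem hc hd
    rw [map_add, Subalgebra.coe_add]
    convert this using 1
    ring
  zero_mem' := ⟨0, by simp⟩
  smul_mem' := by
    rintro a x ⟨c, hc⟩
    refine ⟨a * c, ?_⟩
    have := Subalgebra.smul_mem _ hc a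
    convert this using 1
    rw [map_mul, Subalgebra.coe_smul, Algebra.smul_def, Algebra.smul_def]
    ring

theorem mem_polarFilt_of_mem_poleFilt {w : L} {N : ℕ} {x : intClosure k z}
    (hx : (x : L) ∈ poleFilt k z N) : x ∈ polarFilt k z w N :=
  ⟨0, by simpa using hx.2⟩

theorem mul_mem_polarFilt {w : L} {c₀ : intClosure k z⁻¹ →ₐ[k] k}
    (hw : ∀ x : intClosure k z⁻¹, c₀ x = 0 → (x : L) * w ∈ intClosure k z⁻¹) {M N : ℕ}
    {x y : intClosure k z} (hx : (x : L) ∈ poleFilt k z M) (hy : y ∈ polarFilt k z w N) :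
    x * y ∈ polarFilt k z w (M + N) := by
  obtain ⟨c, hc⟩ := hy
  let x' : intClosure k z⁻¹ := ⟨_, hx.2⟩
  have h1 : c₀ (x' - algebraMap k _ (c₀ x')) = 0 := by
    rw [map_sub, AlgHom.commutes]; exact sub_self _
  have h2 := hw _ h1
  refine ⟨c * c₀ x', ?_⟩
  have := add_mem (mul_mem x'.2 hc) (Subalgebra.smul_mem _ h2 c)
  convert this using 1
  simp only [x', Subalgebra.coe_mul, Subalgebra.coe_sub, Subalgebra.coe_algebraMap,
    Algebra.smul_def, map_mul]
  ring

theorem IsSepGen.finrank_polarFilt_le [IsAlgClosed k] (h : IsSepGen k z) {w : L} (N : ℕ) :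
    Module.Finite k (polarFilt k z w N) ∧
      Module.finrank k (polarFilt k z w N) ≤ Module.finrank k (poleFilt k z N) + 1 := by
  have := h.finite_poleFilt N
  let P : Submodule k (intClosure k z) := (poleFilt k z N).comap (intClosure k z).val.toLinearMap
  let i : P →ₗ[k] poleFilt k z N :=
    ((intClosure k z).val.toLinearMap.comp P.subtype).codRestrict _ fun x => x.2
  have hi : Function.Injective i := fun x y hxy =>
    Subtype.ext (Subtype.ext (congrArg (fun t : poleFilt k z N => (t : L)) hxy))
  have hP : Module.Finite k P := Module.Finite.of_injective i hi
  have hP' := LinearMap.finrank_le_finrank_of_injective hi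
  let C : Submodule k L := Subalgebra.toSubmodule (intClosure k z⁻¹)
  let f : polarFilt k z w N →ₗ[k] L ⧸ C := C.mkQ ∘ₗ LinearMap.mulLeft k (z⁻¹ ^ N) ∘ₗ
    (intClosure k z).val.toLinearMap ∘ₗ (polarFilt k z w N).subtype
  have hrange : ∀ x, f x ∈ Submodule.span k {C.mkQ w} := by
    rintro ⟨x, c, hc⟩
    refine Submodule.mem_span_singleton.mpr ⟨c, ?_⟩
    rw [← map_smul, Algebra.smul_def]
    exact ((Submodule.Quotient.eq C).mpr hc).symm
  let f' := f.codRestrict _ hrange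
  obtain ⟨h1, h2⟩ := finrank_le_add_of_ker_le (U := P) f' fun x hx => by
    have : f x = 0 := congrArg Subtype.val hx
    exact ⟨x.1.2, (Submodule.Quotient.mk_eq_zero C).mp this⟩
  refine ⟨h1, h2.trans (add_le_add hP' ?_)⟩
  refine (finrank_span_le_card _).trans ?_
  rw [Set.toFinset_singleton, Finset.card_singleton]

/-- An increasing union of subspaces of bounded dimension has bounded dimension. -/
theorem finrank_le_of_iSup {E : Type*} [AddCommGroup E] [Module k E] (U : ℕ → Submodule k E)
    (hU : Monotone U) (htop : ∀ x, ∃ n, x ∈ U n) {c : ℕ}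
    (hc : ∀ n, Module.Finite k (U n) ∧ Module.finrank k (U n) ≤ c) :
    Module.Finite k E ∧ Module.finrank k E ≤ c := by
  have hr : Module.rank k E ≤ c := by
    refine rank_le fun s hs => ?_
    choose n hn using htop
    let M := s.sup n
    have hmem : ∀ x : s, (x : E) ∈ U M := fun x => hU (Finset.le_sup x.2) (hn x)
    have := (hc M).1
    have hli : LinearIndependent k fun x : s => (⟨x, hmem x⟩ : U M) :=
      LinearIndependent.of_comp (U M).subtype hs
    have := hli.fintype_card_le_finrank
    rw [Fintype.card_coe] at this
    exact this.trans (hc M).2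
  have hfin : Module.Finite k E := Module.rank_lt_aleph0_iff.mp
    (hr.trans_lt (Cardinal.natCast_lt_aleph0))
  exact ⟨hfin, Module.finrank_le_of_rank_le hr⟩

theorem IsSepGen.finrank_quotient_le [IsAlgClosed k] (h : IsSepGen k z) {w : L}
    {c₀ : intClosure k z⁻¹ →ₐ[k] k}
    (hw : ∀ x : intClosure k z⁻¹, c₀ x = 0 → (x : L) * w ∈ intClosure k z⁻¹) {N : ℕ}
    {g : intClosure k z} (hg : g ∈ polarFilt k z w N) (hg0 : g ≠ 0) :
    Module.Finite k (intClosure k z ⧸ Ideal.span {g}) ∧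
      Module.finrank k (intClosure k z ⧸ Ideal.span {g}) ≤ N * Module.finrank k⟮z⟯ L + 1 := by
  let q : intClosure k z →ₗ[k] intClosure k z ⧸ Ideal.span {g} :=
    (Ideal.Quotient.mkₐ k (Ideal.span {g})).toLinearMap
  let U : ℕ → Submodule k (intClosure k z ⧸ Ideal.span {g}) := fun M =>
    (polarFilt k z w (M + N)).map q
  refine finrank_le_of_iSup U ?_ ?_ fun M => ?_
  · intro M M' hM
    refine Submodule.map_mono ?_
    rintro x ⟨c, hc⟩
    have hpow : z⁻¹ ^ (M' - M) * z ^ 0 = z⁻¹ ^ (M' - M) := by simp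
    obtain rfl | hlt := hM.eq_or_lt
    · exact ⟨c, hc⟩
    have h1 : (1 : L) ∈ poleFilt k z (M' - M) :=
      poleFilt_mono (Nat.zero_le _) ⟨one_mem _, by simp⟩
    have := mul_mem_polarFilt hw (x := 1) h1 (y := x) ⟨c, hc⟩
    rw [one_mul] at this
    rwa [show M' - M + (M + N) = M' + N by omega] at this
  · intro x
    obtain ⟨x, rfl⟩ := Ideal.Quotient.mk_surjective x
    obtain ⟨M, hM⟩ := exists_mem_poleFilt h.ne_zero x.2
    exact ⟨M, x, mem_polarFilt_of_mem_poleFilt (hM _ (Nat.le_add_right _ _)), rfl⟩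
  · obtain ⟨h1, h2⟩ := h.finrank_polarFilt_le (w := w) (M + N)
    have h3 := h.finite_poleFilt M
    refine ⟨inferInstance, ?_⟩
    let q' := q.domRestrict (polarFilt k z w (M + N))
    have hU : U M = LinearMap.range q' := by
      rw [LinearMap.range_domRestrict]
    let m : poleFilt k z M →ₗ[k] LinearMap.ker q' :=
      { toFun := fun x => ⟨⟨⟨x, x.2.1⟩ * g, mul_mem_polarFilt hw x.2 hg⟩, by
          rw [LinearMap.mem_ker]
          exact Ideal.Quotient.eq_zero_iff_mem.mpr
            (Ideal.mul_mem_left _ _ (Ideal.mem_span_singleton_self g))⟩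
        map_add' := fun x y => Subtype.ext (Subtype.ext (Subtype.ext (add_mul (x : L) y g)))
        map_smul' := fun a x => Subtype.ext
            (Subtype.ext (Subtype.ext (smul_mul_assoc a (x : L) g))) }
    have hm : Function.Injective m := by
      intro x y hxy
      have h4 : (x : L) * g = y * g :=
        congrArg (fun t : LinearMap.ker q' => ((t : polarFilt k z w (M + N)) : intClosure k z).1)
            hxy
      exact Subtype.ext (mul_right_cancel₀ (fun h0 => hg0 (Subtype.ext h0)) h4)
    have h5 := LinearMap.finrank_le_finrank_of_injective hm
    have h6 := q'.finrank_range_add_finrank_ker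
    have h7 := h.finrank_poleFilt_add_le M N
    rw [hU]
    omega

theorem IsSepGen.finrank_quotient_pow_self [IsAlgClosed k] (h : IsSepGen k z) (n : ℕ) :
    Module.Finite k (intClosure k z ⧸ Ideal.span
        {(⟨z, self_mem_intClosure z⟩ ^ n : intClosure k z)}) ∧
    n * Module.finrank k⟮z⟯ L ≤ Module.finrank k
      (intClosure k z ⧸ Ideal.span {(⟨z, self_mem_intClosure z⟩ ^ n : intClosure k z)}) := by
  have := h.isDedekindDomain
  let Z : intClosure k z := ⟨z, self_mem_intClosure z⟩
  have hZ0 : Z ≠ 0 := fun h0 => h.ne_zero (congrArg Subtype.val h0)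
  have hfin : Module.Finite k (intClosure k z ⧸ Ideal.span {Z}) := by
    obtain ⟨c₀, hc₀⟩ := h.exists_algHom_inv
    refine (h.finrank_quotient_le (w := 0) (c₀ := c₀) (N := 1) (by simp) ⟨0, ?_⟩ hZ0).1
    simp [Z, inv_mul_cancel₀ h.ne_zero]
  rw [← Ideal.span_singleton_pow]
  obtain ⟨h1, h2⟩ := finrank_quotient_pow (k := k) (I := Ideal.span {Z}) (by simpa using hZ0) n
  refine ⟨h1, h2 ▸ Nat.mul_le_mul_left n ?_⟩
  obtain ⟨e, he, hspan, hind⟩ := h.exists_basis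
  have hli : LinearIndependent k fun i => Ideal.Quotient.mk (Ideal.span {Z}) ⟨e i, he i⟩ := by
    rw [Fintype.linearIndependent_iff]
    intro c hc
    have h3 : Ideal.Quotient.mk (Ideal.span {Z}) (∑ i, c i • ⟨e i, he i⟩) = 0 := by
      rw [← hc, map_sum]
      exact Finset.sum_congr rfl fun i _ =>
        map_smul (Ideal.Quotient.mkₐ k (Ideal.span {Z})) _ _
    rw [Ideal.Quotient.eq_zero_iff_mem, Ideal.mem_span_singleton] at h3
    obtain ⟨b, hb⟩ := h3
    obtain ⟨p, hp⟩ := hspan b b.2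
    have h4 := hind (fun i => Polynomial.C (c i) - Polynomial.X * p i) (by
      have h5 := congrArg Subtype.val hb
      rw [AddSubmonoidClass.coe_finsetSum, Subalgebra.coe_mul, hp, Finset.mul_sum] at h5
      rw [← sub_eq_zero, ← Finset.sum_sub_distrib] at h5
      rw [← h5]
      refine Finset.sum_congr rfl fun i _ => ?_
      rw [map_sub, map_mul, Polynomial.aeval_C, Polynomial.aeval_X, Subalgebra.coe_smul,
        Algebra.smul_def, sub_mul, mul_assoc])
    intro i
    have h5 := congrArg (Polynomial.coeff · 0) (congrFun h4 i)
    simpa using h5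
  have := hli.fintype_card_le_finrank
  rwa [Fintype.card_fin] at this

end Infinity

section Recursion

variable {k L : Type*} [Field k] [Field L] [Algebra k L] {z : L}

theorem IsSepGen.exists_division (h : IsSepGen k z) :
    ∃ M₀, ∀ m, ∀ b ∈ intClosure k z, ∃ q ∈ intClosure k z, ∃ r ∈ poleFilt k z (m + M₀),
      b = z ^ m * q + r := by
  obtain ⟨e, he, hspan, -⟩ := h.exists_basis
  choose M hM using fun i => exists_mem_poleFilt h.ne_zero (he i)
  refine ⟨Finset.univ.sup M, fun m b hb => ?_⟩
  obtain ⟨p, hp⟩ := hspan b hb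
  have hX : (Polynomial.X ^ m : k[X]).Monic := Polynomial.monic_X_pow m
  refine ⟨∑ i, Polynomial.aeval z (p i /ₘ Polynomial.X ^ m) * e i,
    sum_mem fun i _ => mul_mem (aeval_mem_intClosure _ _) (he i),
    ∑ i, Polynomial.aeval z (p i %ₘ Polynomial.X ^ m) * e i,
    sum_mem fun i _ => mul_mem_poleFilt (aeval_mem_poleFilt h.ne_zero ?_)
      (hM i _ (Finset.le_sup (Finset.mem_univ i))), ?_⟩
  · have := Polynomial.natDegree_modByMonic_le (p i) hX
    rwa [Polynomial.natDegree_X_pow] at this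
  · rw [hp, Finset.mul_sum, ← Finset.sum_add_distrib]
    refine Finset.sum_congr rfl fun i _ => ?_
    conv_lhs => rw [← Polynomial.modByMonic_add_div (p i) (Polynomial.X ^ m)]
    rw [map_add, map_mul, map_pow, Polynomial.aeval_X]
    ring

theorem IsSepGen.exists_correction (h : IsSepGen k z) {w : L} {c₀ : intClosure k z⁻¹ →ₐ[k] k}
    (hw : ∀ x : intClosure k z⁻¹, c₀ x = 0 → (x : L) * w ∈ intClosure k z⁻¹)
    (hc₀ : c₀ ⟨z⁻¹, self_mem_intClosure _⟩ = 0) {ℓ : ℕ} (hℓ : (ℓ : k) ≠ 0) :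
    ∃ n₀, ∀ n ≥ n₀, ∀ b : intClosure k z, ∀ c : k, ∃ x : intClosure k z,
      z⁻¹ ^ (ℓ * n) * ((b + (ℓ : intClosure k z) * (⟨z, self_mem_intClosure z⟩ ^ n) ^ (ℓ - 1) * x :
        intClosure k z) : L) - algebraMap k L c * w ∈ intClosure k z⁻¹ := by
  have hz := h.ne_zero
  obtain ⟨M₀, hM₀⟩ := h.exists_division
  obtain ⟨M₁, hM₁⟩ := exists_pow_mul_mem_intClosure hz (hw _ hc₀)
  refine ⟨M₀ + (M₁ + 1), fun n hn b c => ?_⟩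
  obtain ⟨q, hq, r, hr, hb⟩ := hM₀ (n * (ℓ - 1)) b b.2
  have hℓ1 : 1 ≤ ℓ := Nat.one_le_iff_ne_zero.mpr fun h0 => hℓ (by rw [h0, Nat.cast_zero])
  have hzw : z ^ n * w ∈ intClosure k z := by
    have h3 := hM₁ (n + 1) (by omega)
    convert h3 using 1
    rw [pow_succ]
    field_simp
  refine ⟨⟨algebraMap k L (ℓ : k)⁻¹ * (algebraMap k L c * (z ^ n * w) - q),
    mul_mem (Subalgebra.algebraMap_mem _ _)
      (sub_mem (mul_mem (Subalgebra.algebraMap_mem _ _) hzw) hq)⟩, ?_⟩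
  have hrN : z⁻¹ ^ (ℓ * n) * r ∈ intClosure k z⁻¹ := by
    refine (poleFilt_mono (k := k) (z := z) ?_ hr).2
    obtain ⟨j, rfl⟩ := Nat.exists_eq_add_of_le hℓ1
    rw [Nat.add_sub_cancel_left, add_mul, one_mul, mul_comm]
    omega
  convert hrN using 1
  have hℓL : algebraMap k L (ℓ : k) ≠ 0 := by
    rwa [Ne, map_eq_zero]
  have hzN : z⁻¹ ^ (ℓ * n) * z ^ (ℓ * n) = 1 := by rw [← mul_pow, inv_mul_cancel₀ hz, one_pow]
  have hzN' : z ^ (n * (ℓ - 1)) * z ^ n = z ^ (ℓ * n) := by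
    rw [← pow_add]; congr 1
    obtain ⟨j, rfl⟩ := Nat.exists_eq_add_of_le hℓ1
    rw [Nat.add_sub_cancel_left]; ring
  have hcast : ((ℓ : intClosure k z) : L) = algebraMap k L (ℓ : k) := by simp
  rw [Subalgebra.coe_add, Subalgebra.coe_mul, Subalgebra.coe_mul, hcast, Subalgebra.coe_pow,
    Subalgebra.coe_pow, ← pow_mul, hb]
  dsimp only
  rw [map_inv₀]
  have h5 : algebraMap k L (ℓ : k) * z ^ (n * (ℓ - 1)) *
      ((algebraMap k L (ℓ : k))⁻¹ * (algebraMap k L c * (z ^ n * w) - q)) =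
      algebraMap k L c * w * (z ^ (n * (ℓ - 1)) * z ^ n) - z ^ (n * (ℓ - 1)) * q := by
    field_simp
  rw [h5, hzN']
  linear_combination (algebraMap k L c * w) * hzN

theorem coeff_add_mul_X_pow {B : Type*} [CommRing B] (f : PowerSeries B) (x : B) (n ℓ : ℕ) :
    PowerSeries.coeff (n + 1) ((f + PowerSeries.X ^ (n + 1) * PowerSeries.C x) ^ ℓ) =
      PowerSeries.coeff (n + 1) (f ^ ℓ) + ℓ * PowerSeries.constantCoeff f ^ (ℓ - 1) * x ∧
    ∀ m ≤ n, PowerSeries.coeff m ((f + PowerSeries.X ^ (n + 1) * PowerSeries.C x) ^ ℓ) =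
      PowerSeries.coeff m (f ^ ℓ) := by
  obtain ⟨c, hc⟩ := Polynomial.powAddExpansion f (PowerSeries.X ^ (n + 1) * PowerSeries.C x) ℓ
  have h1 : (f + PowerSeries.X ^ (n + 1) * PowerSeries.C x) ^ ℓ = f ^ ℓ + PowerSeries.X ^ (n + 1) *
      ((ℓ : PowerSeries B) * f ^ (ℓ - 1) * PowerSeries.C x +
        PowerSeries.X * (c * PowerSeries.X ^ n * PowerSeries.C x ^ 2)) := by
    rw [hc]; ring
  rw [h1]
  refine ⟨?_, fun m hm => ?_⟩
  · rw [map_add]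
    have := PowerSeries.coeff_X_pow_mul ((ℓ : PowerSeries B) * f ^ (ℓ - 1) * PowerSeries.C x +
        PowerSeries.X * (c * PowerSeries.X ^ n * PowerSeries.C x ^ 2)) (n + 1) 0
    rw [zero_add] at this
    rw [this, PowerSeries.coeff_zero_eq_constantCoeff_apply]
    simp
  · rw [map_add, PowerSeries.coeff_X_pow_mul', if_neg (by omega), add_zero]

/-- The residue part of `polarFilt`, expanded at the pole of `w`. -/
theorem exists_expansion_linearMap {Λ : Type*} [Field Λ] [Algebra k Λ] [Algebra (PowerSeries k) Λ]
    [IsScalarTower k (PowerSeries k) Λ] [IsFractionRing (PowerSeries k) Λ] {w : L}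
    (τ : intClosure k z⁻¹ →ₐ[k] PowerSeries k) (τL : L →ₐ[k] Λ)
    (hτ : ∀ x : intClosure k z⁻¹, τL x = algebraMap _ Λ (τ x))
    (hτw : algebraMap (PowerSeries k) Λ PowerSeries.X * τL w = 1) (N : ℕ) :
    ∃ ρ : polarFilt k z w N →ₗ[k] PowerSeries k,
      (∀ x, algebraMap _ Λ (ρ x) = (algebraMap (PowerSeries k) Λ PowerSeries.X * τL z⁻¹ ^ N) *
        τL (x : intClosure k z)) ∧
      ∀ (x : polarFilt k z w N) (c : k), z⁻¹ ^ N * ((x : intClosure k z) : L) -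
        algebraMap k L c * w ∈ intClosure k z⁻¹ → PowerSeries.constantCoeff (ρ x) = c := by
  let ι : PowerSeries k →ₗ[k] Λ := (IsScalarTower.toAlgHom k (PowerSeries k) Λ).toLinearMap
  have hι : Function.Injective ι := IsFractionRing.injective (PowerSeries k) Λ
  let f : polarFilt k z w N →ₗ[k] Λ :=
    LinearMap.mulLeft k (algebraMap (PowerSeries k) Λ PowerSeries.X * τL z⁻¹ ^ N) ∘ₗ
      τL.toLinearMap ∘ₗ (intClosure k z).val.toLinearMap ∘ₗ (polarFilt k z w N).subtype
  have hf : ∀ (x : polarFilt k z w N) (c : k) (o : intClosure k z⁻¹),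
      z⁻¹ ^ N * ((x : intClosure k z) : L) - algebraMap k L c * w = o →
      f x = ι (PowerSeries.X * τ o + PowerSeries.C c) := by
    intro x c o ho
    have h1 : f x = algebraMap (PowerSeries k) Λ PowerSeries.X *
        τL (z⁻¹ ^ N * ((x : intClosure k z) : L)) := by
      rw [map_mul, map_pow, ← mul_assoc]; rfl
    have h2 : τL (algebraMap k L c) = algebraMap (PowerSeries k) Λ (PowerSeries.C c) := by
      rw [AlgHom.commutes, IsScalarTower.algebraMap_apply k (PowerSeries k) Λ]
      rfl
    have h3 : ι (PowerSeries.X * τ o + PowerSeries.C c) = algebraMap (PowerSeries k) Λ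
        PowerSeries.X * algebraMap (PowerSeries k) Λ (τ o) +
        algebraMap (PowerSeries k) Λ (PowerSeries.C c) := by
      rw [← map_mul, ← map_add]; rfl
    rw [h1, sub_eq_iff_eq_add.mp ho, h3, map_add, map_mul, hτ, h2]
    linear_combination algebraMap (PowerSeries k) Λ (PowerSeries.C c) * hτw
  have hrange : ∀ x, f x ∈ LinearMap.range ι := fun x => by
    obtain ⟨c, hc⟩ := x.2
    exact ⟨_, (hf x c ⟨_, hc⟩ rfl).symm⟩
  let e := LinearEquiv.ofInjective ι hι
  let ρ : polarFilt k z w N →ₗ[k] PowerSeries k :=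
    e.symm.toLinearMap ∘ₗ f.codRestrict (LinearMap.range ι) hrange
  have hρ : ∀ x, ι (ρ x) = f x := fun x =>
    congrArg Subtype.val (e.apply_symm_apply (f.codRestrict (LinearMap.range ι) hrange x))
  refine ⟨ρ, hρ, fun x c hc => ?_⟩
  have := hι ((hρ x).trans (hf x c ⟨_, hc⟩ rfl))
  rw [this]
  simp

open Finset.HasAntidiagonal in
theorem exists_series_of_correction {B : Type*} [CommRing B] [Algebra k B] {ℓ : ℕ} (u : B)
    (V : Submodule k B) (hu : u ^ ℓ ∈ V) (ρ : V →ₗ[k] PowerSeries k)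
    (hu0 : PowerSeries.constantCoeff (ρ ⟨_, hu⟩) = 0)
    (hcor : ∀ (b : B) (c : k), ∃ x : B, ∃ h : b + ℓ * u ^ (ℓ - 1) * x ∈ V,
      PowerSeries.constantCoeff (ρ ⟨_, h⟩) = c) :
    ∃ v : PowerSeries B, PowerSeries.constantCoeff v = u ∧
      ∃ hV : ∀ n, PowerSeries.coeff n (v ^ ℓ) ∈ V,
      ∀ m, ∑ q ∈ antidiagonal m,
        PowerSeries.coeff q.2 (ρ ⟨PowerSeries.coeff q.1 (v ^ ℓ), hV q.1⟩) = 0 := by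
  obtain ⟨ρ', hρ'⟩ := LinearMap.exists_extend ρ
  have hρρ : ∀ x : V, ρ' x = ρ x := fun x => LinearMap.congr_fun hρ' x
  let v : (ℕ → B) → PowerSeries B := fun x => PowerSeries.C u + PowerSeries.X * PowerSeries.mk x
  have hv0 : ∀ x, PowerSeries.constantCoeff (v x) = u := fun x => by simp [v]
  have hv0ℓ : ∀ x, PowerSeries.coeff 0 (v x ^ ℓ) = u ^ ℓ := fun x => by
    rw [PowerSeries.coeff_zero_eq_constantCoeff_apply, map_pow, hv0]
  have hvtrunc : ∀ n x y, (∀ m ≤ n, x m = y m) → ∀ m ≤ n + 1,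
      PowerSeries.coeff m (v x ^ ℓ) = PowerSeries.coeff m (v y ^ ℓ) := by
    intro n x y hxy
    have h1 : PowerSeries.X ^ (n + 2) ∣ v x - v y := by
      rw [PowerSeries.X_pow_dvd_iff]
      intro m hm
      cases m with
      | zero => simp [v]
      | succ m => simp [v, hxy m (by omega)]
    have h2 := h1.trans (sub_dvd_pow_sub_pow (v x) (v y) ℓ)
    rw [PowerSeries.X_pow_dvd_iff] at h2
    intro m hm
    have := h2 m (by omega)
    rwa [map_sub, sub_eq_zero] at this
  let P : ℕ → (ℕ → B) → Prop := fun n x => PowerSeries.coeff (n + 1) (v x ^ ℓ) ∈ V ∧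
    ∑ q ∈ antidiagonal (n + 1),
      PowerSeries.coeff q.2 (ρ' (PowerSeries.coeff q.1 (v x ^ ℓ))) = 0
  obtain ⟨x, hx⟩ := exists_seq_of_step P (by
    intro n x y hxy hP
    have h := hvtrunc n x y hxy
    refine ⟨h _ le_rfl ▸ hP.1, ?_⟩
    rw [← hP.2]
    refine Finset.sum_congr rfl fun q hq => ?_
    rw [h q.1 (by have := mem_antidiagonal.mp hq; omega)]) (by
    intro n x
    let x₀ := Function.update x n 0
    have hup : ∀ e, v (Function.update x n e) =
        v x₀ + PowerSeries.X ^ (n + 1) * PowerSeries.C e := by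
      intro e
      ext m
      cases m with
      | zero => simp [v]
      | succ m =>
        simp only [v, x₀, map_add, PowerSeries.coeff_succ_X_mul, PowerSeries.coeff_mk,
          PowerSeries.coeff_X_pow_mul', PowerSeries.coeff_C, m.succ_ne_zero, if_false, zero_add]
        by_cases hmn : m = n
        · subst hmn; simp
        · rw [Function.update_of_ne hmn, Function.update_of_ne hmn]
          split_ifs with h1 h2
          · omega
          · simp
          · simp
    let S := ∑ q ∈ (antidiagonal (n + 1)).erase (n + 1, 0),
      PowerSeries.coeff q.2 (ρ' (PowerSeries.coeff q.1 (v x₀ ^ ℓ)))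
    obtain ⟨e, he, hec⟩ := hcor (PowerSeries.coeff (n + 1) (v x₀ ^ ℓ)) (-S)
    obtain ⟨h1, h2⟩ := coeff_add_mul_X_pow (v x₀) e n ℓ
    rw [← hup, hv0] at h1
    simp only [← hup] at h2
    refine ⟨e, h1 ▸ he, ?_⟩
    rw [← Finset.add_sum_erase _ _ (show (n + 1, 0) ∈ antidiagonal (n + 1) by simp)]
    have h3 : ρ' (PowerSeries.coeff (n + 1) (v (Function.update x n e) ^ ℓ)) = ρ ⟨_, he⟩ := by
      rw [h1, ← hρρ]
    rw [h3, PowerSeries.coeff_zero_eq_constantCoeff_apply, hec]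
    rw [neg_add_eq_zero]
    refine Finset.sum_congr rfl fun q hq => ?_
    rw [Finset.mem_erase, mem_antidiagonal] at hq
    rw [h2 q.1]
    by_contra hlt
    exact hq.1 (Prod.ext (by simp; omega) (by simp; omega)))
  have hV : ∀ n, PowerSeries.coeff n (v x ^ ℓ) ∈ V := fun n => by
    cases n with
    | zero => rw [hv0ℓ]; exact hu
    | succ n => exact (hx n).1
  refine ⟨v x, hv0 x, hV, fun m => ?_⟩
  simp only [← hρρ]
  cases m with
  | zero =>
    have h1 : antidiagonal (0 : ℕ) = {(0, 0)} := rfl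
    rw [h1, Finset.sum_singleton, hv0ℓ]
    have := hρρ ⟨_, hu⟩
    rw [this, PowerSeries.coeff_zero_eq_constantCoeff_apply, hu0]
  | succ n => exact (hx n).2

theorem IsSepGen.exists_eq_ker_mul_pow_of_generic [IsAlgClosed k] (h : IsSepGen k z) {ℓ : ℕ}
    (hℓ : (ℓ : k) ≠ 0) : ∃ a : intClosure k z, a ≠ 0 ∧ ∀ y : intClosure k z →ₐ[k] k, y a ≠ 0 →
      ∃ g : intClosure k z, g ≠ 0 ∧ ∃ J : Ideal (intClosure k z),
        Ideal.span {g} = RingHom.ker y * J ^ ℓ := by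
  have := h.isDedekindDomain
  have := h.finiteType
  have := h.inv.isFractionRing
  obtain ⟨c₀, hc₀⟩ := h.exists_algHom_inv
  obtain ⟨w, τ, hw, hτinj, hτ0, π, π', hπ0, hπ', hππ⟩ := h.inv.exists_expansion c₀
  let Λ := FractionRing (PowerSeries k)
  let ι : PowerSeries k →ₐ[k] Λ := IsScalarTower.toAlgHom k (PowerSeries k) Λ
  have hι : Function.Injective ι := IsFractionRing.injective (PowerSeries k) Λ
  have hinj : Function.Injective (ι.comp τ) := hι.comp hτinj
  let τL : L →ₐ[k] Λ := IsFractionRing.liftAlgHom hinj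
  have hτL : ∀ x : intClosure k z⁻¹, τL x = algebraMap _ Λ (τ x) := fun x =>
    IsFractionRing.lift_algebraMap (g := (ι.comp τ : intClosure k z⁻¹ →+* Λ)) hinj x
  have hτw : algebraMap (PowerSeries k) Λ PowerSeries.X * τL w = 1 := by
    have h1 : τL π ≠ 0 := by
      rw [Ne, map_eq_zero]
      exact fun h0 => hπ0 (Subtype.ext h0)
    have h2 : algebraMap _ Λ (τ π) = algebraMap (PowerSeries k) Λ PowerSeries.X *
        algebraMap _ Λ (τ π') := by
      rw [hππ, map_mul]
    rw [← hτL, ← hτL, hπ', map_mul] at h2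
    apply mul_left_cancel₀ h1
    linear_combination -h2
  obtain ⟨n₀, hn₀⟩ := h.exists_correction hw hc₀ hℓ
  have hz := h.ne_zero
  let n := n₀
  let Z : intClosure k z := ⟨z, self_mem_intClosure z⟩
  have hZ0 : Z ≠ 0 := fun h0 => hz (congrArg Subtype.val h0)
  have hℓ0 : ℓ ≠ 0 := fun h0 => hℓ (by rw [h0, Nat.cast_zero])
  let V := polarFilt k z w (ℓ * n)
  have hu : (Z ^ n) ^ ℓ ∈ V := ⟨0, by
    rw [map_zero, zero_mul, sub_zero]
    simp only [Z, Subalgebra.coe_pow]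
    rw [← pow_mul, mul_comm n ℓ, ← mul_pow, inv_mul_cancel₀ hz, one_pow]
    exact one_mem _⟩
  obtain ⟨ρ, hρ, hρ0⟩ := exists_expansion_linearMap τ τL hτL hτw (ℓ * n)
  obtain ⟨v, hv, hV, hrel⟩ := exists_series_of_correction (ℓ := ℓ) (Z ^ n) V hu ρ
    (hρ0 ⟨_, hu⟩ 0 (by
      rw [map_zero, zero_mul, sub_zero]
      simp only [Z, Subalgebra.coe_pow]
      rw [← pow_mul, mul_comm n ℓ, ← mul_pow, inv_mul_cancel₀ hz, one_pow]
      exact one_mem _))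
    (fun b c => by
      obtain ⟨x, hx⟩ := hn₀ n le_rfl b c
      exact ⟨x, ⟨c, hx⟩, hρ0 _ c hx⟩)
  obtain ⟨hfin, hD⟩ := h.finrank_quotient_pow_self n
  have hVfin := (h.finrank_polarFilt_le (w := w) (ℓ * n)).1
  refine exists_eq_mul_pow_of_deformation (k := k) (Λ := Λ) (z := Z) hℓ0 v ?_ ?_ rfl V hV ?_
    (τL.comp (intClosure k z).val) ?_ ?_
    (algebraMap (PowerSeries k) Λ PowerSeries.X * τL z⁻¹ ^ (ℓ * n)) ?_ ρ hρ hrel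
  · rw [hv]; exact pow_ne_zero _ hZ0
  · rw [hv]; exact hfin
  · intro g hg hg0
    obtain ⟨h1, h2⟩ := h.finrank_quotient_le hw hg hg0
    refine ⟨h1, h2.trans ?_⟩
    rw [hv, mul_assoc]
    exact Nat.add_le_add_right (Nat.mul_le_mul_left ℓ hD) 1
  · exact τL.toRingHom.injective.comp Subtype.val_injective
  · rintro ⟨a, ha⟩
    have h1 := hτL ⟨z⁻¹, self_mem_intClosure _⟩
    have h2 : algebraMap (PowerSeries k) Λ (a * τ ⟨z⁻¹, self_mem_intClosure _⟩) =
        algebraMap (PowerSeries k) Λ 1 := by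
      rw [map_mul, ← h1, ha, map_one]
      change τL z * τL z⁻¹ = 1
      rw [← map_mul, mul_inv_cancel₀ hz, map_one]
    have h3 := congrArg (PowerSeries.constantCoeff (R := k)) (hι h2)
    rw [map_mul, hτ0, hc₀, mul_zero, map_one] at h3
    exact zero_ne_one h3
  · refine mul_ne_zero (left_ne_zero_of_mul_eq_one hτw) (pow_ne_zero _ ?_)
    rw [Ne, map_eq_zero]
    exact inv_ne_zero hz

end Recursion

section Moving

variable {k L : Type*} [Field k] [Field L] [Algebra k L] {z : L}

/-- Every point of an affine curve is `ℓ`-divisible in the divisor class group. -/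
theorem IsSepGen.exists_eq_ker_mul_pow [IsAlgClosed k] (h : IsSepGen k z) {ℓ : ℕ}
    (hℓ : (ℓ : k) ≠ 0) (y : intClosure k z →ₐ[k] k) :
    ∃ g : intClosure k z, g ≠ 0 ∧ ∃ J : Ideal (intClosure k z),
      Ideal.span {g} = RingHom.ker y * J ^ ℓ := by
  have := h.isDedekindDomain
  have := h.finiteType
  obtain ⟨a, ha, hgen⟩ := h.exists_eq_ker_mul_pow_of_generic hℓ
  have key : ∀ I : Ideal (intClosure k z), I ≠ ⊥ → I ⊔ Ideal.span {a} = ⊤ →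
      ∃ g : intClosure k z, g ≠ 0 ∧ ∃ J : Ideal (intClosure k z), Ideal.span {g} = I * J ^ ℓ := by
    intro I
    induction I using UniqueFactorizationMonoid.induction_on_prime with
    | h₁ => exact fun h0 => absurd rfl h0
    | h₂ I hI =>
      intro _ _
      rw [Ideal.isUnit_iff] at hI
      refine ⟨1, one_ne_zero, ⊤, ?_⟩
      rw [hI, ← Ideal.one_eq_top, one_pow, one_mul, Ideal.span_singleton_one, Ideal.one_eq_top]
    | h₃ I P hI hP ih =>
      intro h0 hsup
      have hPI : P * I ≤ I := Ideal.mul_le_right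
      have hPP : P * I ≤ P := Ideal.mul_le_left
      obtain ⟨g, hg, J, hJ⟩ := ih (fun h1 => h0 (le_bot_iff.mp (h1 ▸ hPI)))
        (top_le_iff.mp (hsup.symm.le.trans (sup_le_sup_right hPI _)))
      have hPprime : P.IsPrime := Ideal.isPrime_of_prime hP
      have hPmax := hPprime.isMaximal hP.ne_zero
      obtain ⟨f, hf⟩ := exists_algHom_ker_eq (k := k) P
      have hfa : f a ≠ 0 := by
        intro hfa
        refine hPprime.ne_top (top_le_iff.mp (hsup.symm.le.trans (sup_le hPP ?_)))
        rw [Ideal.span_singleton_le_iff_mem, ← hf]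
        exact hfa
      obtain ⟨g', hg', J', hJ'⟩ := hgen f hfa
      refine ⟨g' * g, mul_ne_zero hg' hg, J' * J, ?_⟩
      rw [← Ideal.span_singleton_mul_span_singleton, hJ, hJ', hf, mul_pow]
      ring
  have hm := ker_isMaximal y
  have hm0 := h.ker_ne_bot y
  have hI0 : RingHom.ker y * (RingHom.ker y * Ideal.span {a}) ≠ 0 :=
    mul_ne_zero hm0 (mul_ne_zero hm0 (by simpa using ha))
  obtain ⟨x, hx⟩ := IsDedekindDomain.exists_sup_span_eq
    (I := RingHom.ker y * (RingHom.ker y * Ideal.span {a})) (J := RingHom.ker y)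
    Ideal.mul_le_left hI0
  have hxm : Ideal.span {x} ≤ RingHom.ker y := le_sup_right.trans hx.le
  obtain ⟨I, hI⟩ := Ideal.dvd_iff_le.mpr hxm
  have hcop : (RingHom.ker y * Ideal.span {a}) ⊔ I = ⊤ := by
    rw [hI, ← Ideal.mul_sup] at hx
    have := mul_left_cancel₀ hm0 (hx.trans (mul_one _).symm)
    rwa [Ideal.one_eq_top] at this
  have hI0 : I ≠ ⊥ := by
    rintro rfl
    rw [sup_bot_eq] at hcop
    exact hm.ne_top (top_le_iff.mp (hcop.symm.le.trans Ideal.mul_le_left))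
  obtain ⟨g, hg, J, hJ⟩ := key I hI0 (by
    rw [sup_comm]
    exact top_le_iff.mp (hcop.symm.le.trans (sup_le_sup_right Ideal.mul_le_right _)))
  obtain ⟨j, rfl⟩ : ∃ j, ℓ = j + 1 := Nat.exists_eq_succ_of_ne_zero fun h0 => hℓ (by
    rw [h0, Nat.cast_zero])
  have hx0 : x ≠ 0 := by
    rintro rfl
    rw [Ideal.span_singleton_eq_bot.mpr rfl] at hI
    exact mul_ne_zero hm0 hI0 hI.symm
  refine ⟨x * g ^ j, mul_ne_zero hx0 (pow_ne_zero _ hg), I * J ^ j, ?_⟩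
  rw [← Ideal.span_singleton_mul_span_singleton, ← Ideal.span_singleton_pow, hJ, hI]
  ring

end Moving

section CommonZero

variable {k : Type*} [Field k] [IsAlgClosed k]

theorem ker_constantCoeff_height {n : ℕ} :
    (n : ℕ∞) ≤ (RingHom.ker (MvPolynomial.constantCoeff (σ := Fin n) (R := k))).height := by
  set m₀ := RingHom.ker (MvPolynomial.constantCoeff (σ := Fin n) (R := k)) with hm₀
  by_contra hlt
  push Not at hlt
  obtain ⟨r, hr⟩ := ENat.ne_top_iff_exists.mp hlt.ne_top
  have hdim : ringKrullDim (MvPolynomial (Fin n) k) ≤ (r : WithBot ℕ∞) := by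
    refine (ringKrullDim_le_iff_isMaximal_height_le (r : WithBot ℕ∞)).mpr fun M hM ↦ ?_
    obtain ⟨f, hf⟩ := exists_algHom_ker_eq (k := k) M
    let a : Fin n → k := fun i ↦ f (MvPolynomial.X i)
    let T (b : Fin n → k) : MvPolynomial (Fin n) k →ₐ[k] MvPolynomial (Fin n) k :=
      MvPolynomial.aeval fun i ↦ MvPolynomial.X i + MvPolynomial.C (b i)
    have hT (b : Fin n → k) : (T b).comp (T (-b)) = AlgHom.id k _ := by
      ext i : 1
      simp [T]
    let e : MvPolynomial (Fin n) k ≃ₐ[k] MvPolynomial (Fin n) k :=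
      AlgEquiv.ofAlgHom (T a) (T (-a)) (hT a) (by simpa using hT (-a))
    have hev : ∀ q, f q = MvPolynomial.constantCoeff (e q) := by
      intro q
      have : (MvPolynomial.aeval (R := k) (S₁ := k) (fun _ : Fin n ↦ (0 : k))).comp
          e.toAlgHom = f := by
        ext i
        simp [e, T, a]
      rw [← this]
      simp
    have hME : M = m₀.comap e.toRingEquiv := by
      rw [← hf]
      ext q
      simp only [RingHom.mem_ker, hm₀, Ideal.mem_comap]
      rw [hev]; rfl
    have : M.height = m₀.height := by
      rw [hME]; exact RingEquiv.height_comap e.toRingEquiv m₀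
    rw [this, ← hr]
    rfl
  rw [MvPolynomial.ringKrullDim_of_isNoetherianRing, ringKrullDim_eq_zero_of_field] at hdim
  rw [← hr] at hlt
  simp only [Nat.card_eq_fintype_card, Fintype.card_fin, zero_add] at hdim
  have h1 : n ≤ r := by exact_mod_cast hdim
  have h2 : r < n := by exact_mod_cast hlt
  omega

/-- Fewer than `n` polynomials in `n` variables without constant term have a common nontrivial
zero over an algebraically closed field. -/
theorem exists_common_zero {n : ℕ} {ι : Type*} [Finite ι] (hι : Nat.card ι < n)
    (P : ι → MvPolynomial (Fin n) k) (hP : ∀ i, MvPolynomial.constantCoeff (P i) = 0) :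
    ∃ x : Fin n → k, x ≠ 0 ∧ ∀ i, MvPolynomial.eval x (P i) = 0 := by
  set m₀ := RingHom.ker (MvPolynomial.constantCoeff (σ := Fin n) (R := k)) with hm₀
  have : m₀.IsPrime := RingHom.ker_isPrime _
  have hle : Ideal.span (Set.range P) ≤ m₀ := by
    rw [Ideal.span_le]; rintro _ ⟨i, rfl⟩; exact hP i
  obtain ⟨Q, hQ, hQm⟩ := Ideal.exists_minimalPrimes_le hle
  have hQp : Q.IsPrime := hQ.1.1
  have hh := Ideal.height_le_card_of_mem_minimalPrimes_span (Set.finite_range P) hQ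
  have hne : ¬ m₀ ≤ Q := by
    intro h
    have : m₀ = Q := le_antisymm h hQm
    rw [← this] at hh
    have h1 := ker_constantCoeff_height (k := k) (n := n)
    have h2 : (Set.range P).ncard ≤ Nat.card ι := by
      rw [← Set.ncard_univ, ← Set.image_univ]; exact Set.ncard_image_le
    have h3 : n ≤ (Set.range P).ncard := by exact_mod_cast h1.trans hh
    omega
  obtain ⟨f, hf, hfQ⟩ := SetLike.not_le_iff_exists.mp hne
  obtain ⟨ε, hε, hεf⟩ := exists_algHom_of_isPrime (k := k) Q hfQ
  have hεe : ∀ q, ε q = MvPolynomial.eval (fun i ↦ ε (MvPolynomial.X i)) q := by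
    intro q
    have : ε = MvPolynomial.aeval (fun i ↦ ε (MvPolynomial.X i)) := by ext i; simp
    conv_lhs => rw [this]
    simp [MvPolynomial.aeval_eq_eval]
  refine ⟨fun i ↦ ε (MvPolynomial.X i), ?_, fun i ↦ ?_⟩
  · intro h0
    apply hεf
    rw [hεe, h0, MvPolynomial.eval_zero]
    exact hf
  · rw [← hεe]
    exact hε (hQ.1.2 (Ideal.subset_span ⟨i, rfl⟩))

/-- A polynomial without constant term whose coefficients lie in a `k`-subspace of dimension less
than the number of variables has a nontrivial zero over `k`. -/
theorem exists_zero_of_mem_coeffsIn {F : Type*} [Field F] [Algebra k F] {n : ℕ}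
    (U : Submodule k F) [FiniteDimensional k U] (hU : Module.finrank k U < n)
    (P : MvPolynomial (Fin n) F) (hP : P ∈ MvPolynomial.coeffsIn (Fin n) U)
    (h0 : MvPolynomial.constantCoeff P = 0) :
    ∃ x : Fin n → k, x ≠ 0 ∧ MvPolynomial.eval (fun i ↦ algebraMap k F (x i)) P = 0 := by
  let b := Module.finBasis k U
  let c (m : Fin n →₀ ℕ) : U := ⟨MvPolynomial.coeff m P, hP m⟩
  let Q (i : Fin (Module.finrank k U)) : MvPolynomial (Fin n) k :=
    ∑ m ∈ P.support, MvPolynomial.monomial m (b.repr (c m) i)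
  have hc0 : c 0 = 0 := Subtype.ext h0
  obtain ⟨x, hx, hxQ⟩ := exists_common_zero (n := n) (by simpa using hU) Q (by
    intro i
    simp only [Q, map_sum]
    refine Finset.sum_eq_zero fun m hm ↦ ?_
    rw [MvPolynomial.constantCoeff_monomial]
    split_ifs with h
    · subst h; simp [hc0]
    · rfl)
  refine ⟨x, hx, ?_⟩
  rw [MvPolynomial.eval_eq']
  have key : ∀ m, MvPolynomial.coeff m P
      = ∑ i, algebraMap k F (b.repr (c m) i) * (b i : F) := by
    intro m
    have := congrArg (Subtype.val) (b.sum_repr (c m))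
    rw [AddSubmonoidClass.coe_finsetSum] at this
    simpa [Algebra.smul_def, c] using this.symm
  have hQ' : ∀ i, ∑ m ∈ P.support, b.repr (c m) i * ∏ j, x j ^ m j = 0 := by
    intro i
    have := hxQ i
    simp only [Q, map_sum, MvPolynomial.eval_monomial] at this
    rw [← this]
    refine Finset.sum_congr rfl fun m _ ↦ ?_
    rw [Finsupp.prod_fintype]
    simp
  calc _ = ∑ m ∈ P.support, ∑ i, (b i : F) *
        algebraMap k F (b.repr (c m) i * ∏ j, x j ^ m j) := by
        refine Finset.sum_congr rfl fun m _ ↦ ?_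
        rw [key, Finset.sum_mul]
        refine Finset.sum_congr rfl fun i _ ↦ ?_
        simp only [map_mul, map_prod, map_pow]
        ring
    _ = ∑ i, (b i : F) * algebraMap k F (∑ m ∈ P.support, b.repr (c m) i * ∏ j, x j ^ m j) := by
        rw [Finset.sum_comm]
        refine Finset.sum_congr rfl fun i _ ↦ ?_
        rw [map_sum, Finset.mul_sum]
    _ = 0 := by simp [hQ']

end CommonZero

section Functorial

variable {k L F : Type*} [Field k] [Field L] [Algebra k L] [Field F] [Algebra k F] {z : L}

theorem mem_intClosure_iff_exists {x : L} :
    x ∈ intClosure k z ↔ ∃ P : k[X][X], P.Monic ∧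
      P.eval₂ (Polynomial.aeval (R := k) z).toRingHom x = 0 := by
  rw [mem_intClosure]
  constructor
  · rintro ⟨p, hp, hpx⟩
    let f : k[X] →+* Algebra.adjoin k {z} :=
      (Polynomial.aeval z : k[X] →ₐ[k] L).toRingHom.codRestrict (Algebra.adjoin k {z})
        (aeval_mem_adjoin z)
    have hf : Function.Surjective f := by
      rintro ⟨c, hc⟩
      rw [Algebra.adjoin_singleton_eq_range_aeval] at hc
      obtain ⟨q, rfl⟩ := hc
      exact ⟨q, rfl⟩
    obtain ⟨q, rfl, -, hq⟩ := Polynomial.lifts_and_natDegree_eq_and_monic (f := f)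
      ((Polynomial.mem_lifts _).mpr (Polynomial.map_surjective f hf p)) hp
    refine ⟨q, hq, ?_⟩
    rw [Polynomial.eval₂_map] at hpx
    exact hpx
  · rintro ⟨P, hP, hPx⟩
    let f : k[X] →+* Algebra.adjoin k {z} :=
      (Polynomial.aeval z : k[X] →ₐ[k] L).toRingHom.codRestrict (Algebra.adjoin k {z})
        (aeval_mem_adjoin z)
    refine ⟨P.map f, hP.map f, ?_⟩
    rw [Polynomial.eval₂_map]
    exact hPx

theorem map_mem_intClosure_iff (f : L →ₐ[k] F) {x : L} :
    f x ∈ intClosure k (f z) ↔ x ∈ intClosure k z := by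
  simp only [mem_intClosure_iff_exists]
  have key : ∀ P : k[X][X], P.eval₂ (Polynomial.aeval (R := k) (f z)).toRingHom (f x)
      = f (P.eval₂ (Polynomial.aeval (R := k) z).toRingHom x) := by
    intro P
    have h := Polynomial.hom_eval₂ P (Polynomial.aeval (R := k) z).toRingHom f.toRingHom x
    have h' : f.toRingHom.comp (Polynomial.aeval (R := k) z).toRingHom
        = (Polynomial.aeval (R := k) (f z)).toRingHom := by
      ext <;> simp
    rw [h'] at h
    exact h.symm
  simp only [key, map_eq_zero]

theorem map_mem_poleFilt_iff (f : L →ₐ[k] F) {M : ℕ} {x : L} :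
    f x ∈ poleFilt k (f z) M ↔ x ∈ poleFilt k z M := by
  rw [mem_poleFilt, mem_poleFilt, map_mem_intClosure_iff f, ← map_inv₀, ← map_pow, ← map_mul,
    map_mem_intClosure_iff f]

end Functorial

section Norm

variable {k K' F : Type*} [Field k] [Field K'] [Algebra k K'] [Field F]
  [Algebra k F] {z' : K'}

theorem mul_mem_coeffsIn {σ : Type*} {U V W : Submodule k F} (h : ∀ u ∈ U, ∀ v ∈ V, u * v ∈ W)
    {P Q : MvPolynomial σ F} (hP : P ∈ MvPolynomial.coeffsIn σ U)
    (hQ : Q ∈ MvPolynomial.coeffsIn σ V) : P * Q ∈ MvPolynomial.coeffsIn σ W := by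
  have h1 : P * Q ∈ MvPolynomial.coeffsIn σ (U * V) := by
    rw [MvPolynomial.coeffsIn_mul]; exact Submodule.mul_mem_mul hP hQ
  exact fun m ↦ (Submodule.mul_le.mpr h) (h1 m)

theorem prod_mem_coeffsIn {σ : Type*} {z : F} {M : ℕ} (A : ℕ → MvPolynomial σ F)
    (hA : ∀ i, A i ∈ MvPolynomial.coeffsIn σ (poleFilt k z M)) (n : ℕ) :
    ∏ i ∈ Finset.range n, A i ∈ MvPolynomial.coeffsIn σ (poleFilt k z (n * M)) := by
  induction n with
  | zero =>
    rw [Finset.prod_range_zero, MvPolynomial.one_coeffsIn]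
    exact ⟨one_mem _, by simp⟩
  | succ n ih =>
    rw [Finset.prod_range_succ, Nat.succ_mul]
    exact mul_mem_coeffsIn (fun u hu v hv ↦ mul_mem_poleFilt hu hv) ih (hA n)

theorem linear_mem_coeffsIn {σ ι : Type*} [Fintype ι] (U : Submodule k F) (c : ι → F)
    (hc : ∀ i, c i ∈ U) (s : ι → σ) :
    ∑ j, MvPolynomial.C (c j) * MvPolynomial.X (s j) ∈ MvPolynomial.coeffsIn σ U :=
  sum_mem fun j _ ↦ (MvPolynomial.mul_X_mem_coeffsIn).mpr (MvPolynomial.C_mem_coeffsIn.mpr (hc j))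

set_option maxHeartbeats 1000000 in
theorem IsSepGen.exists_norm_eq_of_mem [IsAlgClosed k] (f : K' →ₐ[k] F) (h' : IsSepGen k z')
    (h : IsSepGen k (f z')) (τ : F ≃ₐ[k] F) (hτ : ∀ y, τ y = y ↔ y ∈ f.range) {ℓ : ℕ} (hℓ : 0 < ℓ)
    (hτℓ : ∀ y, (τ ^ ℓ) y = y)
    (hd : ℓ * Module.finrank k⟮z'⟯ K' ≤ Module.finrank k⟮f z'⟯ F)
    {x : K'} (hx0 : x ≠ 0) (hx : x ∈ intClosure k z') :
    ∃ g : F, g ≠ 0 ∧ ∏ i ∈ Finset.range ℓ, (τ ^ i) g = f x := by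
  have hτf (y : K') : τ (f y) = f y := (hτ _).mpr ⟨y, rfl⟩
  have hτif (i : ℕ) (y : K') : (τ ^ i) (f y) = f y := by
    induction i with
    | zero => rfl
    | succ i ih => rw [pow_succ, AlgEquiv.mul_apply, hτf, ih]
  obtain ⟨c, hc⟩ := exists_mem_poleFilt h'.ne_zero hx
  replace hc := hc c le_rfl
  obtain ⟨n₁, hn₁⟩ := h'.exists_le_finrank_poleFilt
  obtain ⟨n₂, hn₂⟩ := h.exists_le_finrank_poleFilt
  set d' := Module.finrank k⟮z'⟯ K'
  set d := Module.finrank k⟮f z'⟯ F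
  have hd' : 0 < d' := by
    have := h'.finite
    exact Module.finrank_pos
  set m := ℓ * (n₁ + n₂) + c + 1 with hm
  set M := m + (n₁ + n₂) with hM
  have := h'.finite_poleFilt M
  have := h.finite_poleFilt M
  let e := Module.finBasis k (poleFilt k (f z') M)
  let b := Module.finBasis k (poleFilt k z' M)
  set r := Module.finrank k (poleFilt k (f z') M) with hr
  set s := Module.finrank k (poleFilt k z' M) with hs
  let A (i : ℕ) : MvPolynomial (Fin (r + s)) F :=
    ∑ j, MvPolynomial.C ((τ ^ i) (e j : F)) * MvPolynomial.X (Fin.castAdd s j)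
  let B : MvPolynomial (Fin (r + s)) F :=
    ∑ j, MvPolynomial.C (f (b j : K')) * MvPolynomial.X (Fin.natAdd r j)
  let P := ∏ i ∈ Finset.range ℓ, A i - MvPolynomial.C (f x) * ∏ _i ∈ Finset.range ℓ, B
  have hτV (i : ℕ) (y : F) (hy : y ∈ poleFilt k (f z') M) : (τ ^ i) y ∈ poleFilt k (f z') M := by
    have := (map_mem_poleFilt_iff (z := f z') (M := M) (x := y) (τ ^ i).toAlgHom).mpr hy
    simpa [hτif] using this
  have hfV {N : ℕ} {y : K'} (hy : y ∈ poleFilt k z' N) : f y ∈ poleFilt k (f z') N :=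
    (map_mem_poleFilt_iff f).mpr hy
  have hPV : P ∈ MvPolynomial.coeffsIn _ (poleFilt k (f z') (c + ℓ * M)) := by
    refine sub_mem ?_ ?_
    · have := prod_mem_coeffsIn (k := k) (z := f z') (M := M) A (fun i ↦
        linear_mem_coeffsIn _ _ (fun j ↦ hτV i _ (e j).2) _) ℓ
      exact fun m ↦ poleFilt_mono (by omega) (this m)
    · have := prod_mem_coeffsIn (k := k) (z := f z') (M := M) (fun _ ↦ B) (fun i ↦
        linear_mem_coeffsIn _ _ (fun j ↦ hfV (b j).2) _) ℓ
      exact mul_mem_coeffsIn (fun u hu v hv ↦ mul_mem_poleFilt hu hv)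
        (MvPolynomial.C_mem_coeffsIn.mpr (hfV hc)) this
  have hAτ (i : ℕ) : MvPolynomial.map τ.toRingEquiv.toRingHom (A i) = A (i + 1) := by
    simp only [A, map_sum, map_mul, MvPolynomial.map_C, MvPolynomial.map_X, pow_succ']
    rfl
  have hBτ : MvPolynomial.map τ.toRingEquiv.toRingHom B = B := by
    simp only [B, map_sum, map_mul, MvPolynomial.map_C, MvPolynomial.map_X]
    refine Finset.sum_congr rfl fun j _ ↦ ?_
    congr 2
    exact hτf _
  have hAℓ : A ℓ = A 0 := by
    simp only [A, hτℓ]; rfl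
  have hPτ : MvPolynomial.map τ.toRingEquiv.toRingHom P = P := by
    simp only [P, map_sub, map_prod, map_mul, hAτ, hBτ, MvPolynomial.map_C]
    congr 1
    · rw [← Nat.sub_add_cancel hℓ, Finset.prod_range_succ, Finset.prod_range_succ',
        Nat.sub_add_cancel hℓ, hAℓ]
    · congr 2
      exact hτf _
  let U : Submodule k F := (poleFilt k z' (c + ℓ * M)).map f.toLinearMap
  have hPU : P ∈ MvPolynomial.coeffsIn _ U := by
    intro m
    have h1 : τ (MvPolynomial.coeff m P) = MvPolynomial.coeff m P := by
      have := MvPolynomial.coeff_map (τ.toRingEquiv.toRingHom) P m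
      rw [hPτ] at this
      exact this.symm
    obtain ⟨y, hy⟩ := (hτ _).mp h1
    refine ⟨y, ?_, hy⟩
    rw [SetLike.mem_coe, ← map_mem_poleFilt_iff f]
    have := hPV m
    rw [← hy] at this
    exact this
  have := h'.finite_poleFilt (c + ℓ * M)
  have hUdim : Module.finrank k U < r + s := by
    have h1 : Module.finrank k U ≤ (c + ℓ * M) * d' + 1 :=
      (Submodule.finrank_map_le _ _).trans (h'.finrank_poleFilt_le _)
    have h2 : (m + n₁ + 1) * d ≤ r := by
      have := hn₂ (m + n₁)
      rwa [add_assoc m n₁ n₂] at this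
    have h3 : (m + n₂ + 1) * d' ≤ s := by
      have := hn₁ (m + n₂)
      rwa [add_assoc m n₂ n₁, add_comm n₂ n₁] at this
    have h4 : (m + n₁ + 1) * (ℓ * d') ≤ r := (Nat.mul_le_mul_left _ hd).trans h2
    have h5 : (c + ℓ * M) + 1 < (m + n₁ + 1) * ℓ + (m + n₂ + 1) := by
      rw [hM]
      nlinarith
    calc Module.finrank k U ≤ (c + ℓ * M) * d' + 1 := h1
      _ ≤ ((c + ℓ * M) + 1) * d' := by nlinarith
      _ < ((m + n₁ + 1) * ℓ + (m + n₂ + 1)) * d' := Nat.mul_lt_mul_of_pos_right h5 hd'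
      _ ≤ r + s := by nlinarith
  have hA0 (i : ℕ) : MvPolynomial.constantCoeff (A i) = 0 := by simp [A]
  have hB0 : MvPolynomial.constantCoeff B = 0 := by simp [B]
  obtain ⟨t, ht0, ht⟩ := exists_zero_of_mem_coeffsIn U hUdim P hPU (by
    simp [P, hA0, hB0, hℓ.ne'])
  set g : F := ∑ j, algebraMap k F (t (Fin.castAdd s j)) * (e j : F) with hg
  set w : K' := ∑ j, algebraMap k K' (t (Fin.natAdd r j)) * (b j : K') with hw
  have hev : ∏ i ∈ Finset.range ℓ, (τ ^ i) g = f x * (f w) ^ ℓ := by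
    have hAe (i : ℕ) : MvPolynomial.eval (fun i ↦ algebraMap k F (t i)) (A i) = (τ ^ i) g := by
      simp only [A, hg, map_sum, map_mul, MvPolynomial.eval_C, MvPolynomial.eval_X,
        AlgEquiv.commutes]
      exact Finset.sum_congr rfl fun j _ ↦ mul_comm _ _
    have hBe : MvPolynomial.eval (fun i ↦ algebraMap k F (t i)) B = f w := by
      simp only [B, hw, map_sum, map_mul, MvPolynomial.eval_C, MvPolynomial.eval_X,
        AlgHom.commutes]
      exact Finset.sum_congr rfl fun j _ ↦ mul_comm _ _
    have := ht
    simp only [P, map_sub, map_prod, map_mul, map_pow, hAe, hBe, MvPolynomial.eval_C,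
      Finset.prod_const, Finset.card_range, sub_eq_zero] at this
    exact this
  have hgw : g ≠ 0 ∨ w ≠ 0 := by
    by_contra! hcon
    apply ht0
    have h1 : ∀ j, t (Fin.castAdd s j) = 0 := by
      refine Fintype.linearIndependent_iff.mp e.linearIndependent _ (Subtype.ext ?_)
      rw [AddSubmonoidClass.coe_finsetSum]
      simpa [hg, Algebra.smul_def] using hcon.1
    have h2 : ∀ j, t (Fin.natAdd r j) = 0 := by
      refine Fintype.linearIndependent_iff.mp b.linearIndependent _ (Subtype.ext ?_)
      rw [AddSubmonoidClass.coe_finsetSum]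
      simpa [hw, Algebra.smul_def] using hcon.2
    funext j
    exact Fin.addCases h1 h2 j
  have hfx : f x ≠ 0 := by simpa using hx0
  have hg0 : g ≠ 0 := by
    rintro hg0
    have hw0 : w ≠ 0 := hgw.resolve_left (fun h ↦ h hg0)
    rw [hg0, Finset.prod_eq_zero (i := 0) (by simpa using hℓ) (by simp)] at hev
    exact mul_ne_zero hfx (pow_ne_zero _ (by simpa using hw0)) hev.symm
  have hw0 : w ≠ 0 := by
    rintro hw0
    rw [hw0, map_zero, zero_pow hℓ.ne', mul_zero, Finset.prod_eq_zero_iff] at hev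
    obtain ⟨i, -, hi⟩ := hev
    exact hg0 ((map_eq_zero_iff _ (τ ^ i).injective).mp hi)
  have hfw : f w ≠ 0 := by simpa using hw0
  refine ⟨g / f w, div_ne_zero hg0 hfw, ?_⟩
  simp only [map_div₀, hτif, Finset.prod_div_distrib, hev, Finset.prod_const, Finset.card_range]
  field_simp

/-- **Tsen's theorem**, for cyclic extensions: every nonzero element is a norm. -/
theorem IsSepGen.exists_norm_eq [IsAlgClosed k] (f : K' →ₐ[k] F) (h' : IsSepGen k z')
    (h : IsSepGen k (f z')) (τ : F ≃ₐ[k] F) (hτ : ∀ y, τ y = y ↔ y ∈ f.range) {ℓ : ℕ} (hℓ : 0 < ℓ)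
    (hτℓ : ∀ y, (τ ^ ℓ) y = y)
    (hd : ℓ * Module.finrank k⟮z'⟯ K' ≤ Module.finrank k⟮f z'⟯ F)
    {x : K'} (hx0 : x ≠ 0) :
    ∃ g : F, g ≠ 0 ∧ ∏ i ∈ Finset.range ℓ, (τ ^ i) g = f x := by
  have hτif (i : ℕ) (y : K') : (τ ^ i) (f y) = f y := by
    induction i with
    | zero => rfl
    | succ i ih => rw [pow_succ, AlgEquiv.mul_apply, (hτ (f y)).mpr ⟨y, rfl⟩, ih]
  have := h'.isFractionRing
  obtain ⟨a, b, hb, hab⟩ := IsFractionRing.div_surjective (A := intClosure k z') x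
  have hb0 : (b : K') ≠ 0 := by
    simpa using nonZeroDivisors.ne_zero hb
  have hab' : (a : K') / (b : K') = x := hab
  have ha0 : (a : K') ≠ 0 := by
    rintro h0
    rw [h0, zero_div] at hab'
    exact hx0 hab'.symm
  obtain ⟨g, hg0, hg⟩ := h'.exists_norm_eq_of_mem f h τ hτ hℓ hτℓ hd
    (x := (a * b ^ (ℓ - 1) : K')) (mul_ne_zero ha0 (pow_ne_zero _ hb0))
    (mul_mem a.2 (pow_mem b.2 _))
  have hfb : f (b : K') ≠ 0 := by simpa using hb0
  refine ⟨g / f b, div_ne_zero hg0 hfb, ?_⟩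
  simp only [map_div₀, hτif, Finset.prod_div_distrib, hg, Finset.prod_const, Finset.card_range,
    ← hab', map_mul, map_pow]
  obtain ⟨n, rfl⟩ := Nat.exists_eq_add_of_lt hℓ
  simp only [zero_add, Nat.add_sub_cancel]
  field_simp
  ring

end Norm

section Tower

variable {k K' F : Type*} [Field k] [Field K'] [Algebra k K'] [Field F]
  [Algebra k F] [Algebra K' F] [IsScalarTower k K' F] {z' : K'}

theorem map_adjoin_simple_algebraMap (z' : K') :
    k⟮z'⟯.map (IsScalarTower.toAlgHom k K' F) = k⟮algebraMap K' F z'⟯ := by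
  rw [IntermediateField.adjoin_map, Set.image_singleton]
  rfl

/-- The isomorphism `k(z') ≃ k(z)` where `z` is the image of `z'`. -/
noncomputable def adjoinSimpleEquiv (z' : K') : k⟮z'⟯ ≃ₐ[k] k⟮algebraMap K' F z'⟯ :=
  (k⟮z'⟯.equivMap (IsScalarTower.toAlgHom k K' F)).trans
    (IntermediateField.equivOfEq (map_adjoin_simple_algebraMap z'))

theorem IsSepGen.of_tower (h : IsSepGen k (algebraMap K' F z')) : IsSepGen k z' := by
  have := h.finite
  have := h.separable
  have h1 : Module.Finite k⟮z'⟯ F :=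
    Module.Finite.of_equiv_equiv (adjoinSimpleEquiv (F := F) z').toRingEquiv.symm
      (RingEquiv.refl F) (by
        ext x
        obtain ⟨y, rfl⟩ := (adjoinSimpleEquiv (F := F) z').surjective x
        simp only [RingHom.comp_apply]
        change algebraMap K' F _ = _
        erw [AlgEquiv.symm_apply_apply]
        rfl)
  have h2 : Algebra.IsSeparable k⟮z'⟯ F :=
    Algebra.IsSeparable.of_equiv_equiv (adjoinSimpleEquiv (F := F) z').toRingEquiv.symm
      (RingEquiv.refl F) (by
        ext x
        obtain ⟨y, rfl⟩ := (adjoinSimpleEquiv (F := F) z').surjective x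
        simp only [RingHom.comp_apply]
        change algebraMap K' F _ = _
        erw [AlgEquiv.symm_apply_apply]
        rfl)
  refine ⟨fun halg ↦ h.transcendental (halg.algebraMap), ?_, ?_⟩
  · exact FiniteDimensional.left k⟮z'⟯ K' F
  · exact Algebra.isSeparable_tower_bot_of_isSeparable k⟮z'⟯ K' F

theorem finrank_adjoin_mul_finrank (z' : K') :
    Module.finrank k⟮z'⟯ K' * Module.finrank K' F = Module.finrank k⟮algebraMap K' F z'⟯ F := by
  rw [Module.finrank_mul_finrank]
  refine Algebra.finrank_eq_of_equiv_equiv (adjoinSimpleEquiv (F := F) z').toRingEquiv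
      (RingEquiv.refl F) ?_
  ext x; rfl

end Tower

section Splitting

variable {A P E : Type*} [CommGroup A] [Group P] [Group E] (α : P →* MulAut A)

/-- Every crossed homomorphism from a subgroup of `P` to `A` is principal. -/
def Hilbert90 : Prop :=
  ∀ (P₂ : Subgroup P) (c : P → A), (∀ p ∈ P₂, ∀ q ∈ P₂, c (p * q) = c p * α p (c q)) →
    ∃ b : A, ∀ p ∈ P₂, c p = α p b / b

/-- Norms are surjective in the layers of `A` that are cyclic of degree `ℓ`. -/
def NormSurjective (ℓ : ℕ) : Prop :=
  ∀ (P₂ P₃ : Subgroup P) (τ : P), P₂ ≤ P₃ → Nat.card P₃ = ℓ * Nat.card P₂ → τ ∈ P₃ →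
    P₃ ≤ P₂ ⊔ Subgroup.zpowers τ → (∀ p ∈ P₂, τ * p * τ⁻¹ ∈ P₂) → τ ^ ℓ ∈ P₂ →
    ∀ x : A, (∀ p ∈ P₃, α p x = x) →
      ∃ g : A, (∀ p ∈ P₂, α p g = g) ∧ ∏ i ∈ Finset.range ℓ, α (τ ^ i) g = x

variable {α}

theorem mul_pow_eq_prod_mul_pow {ι : A →* E} {q : E →* P}
    (hconj : ∀ e x, e * ι x * e⁻¹ = ι (α (q e) x)) (g : A) (t : E) (n : ℕ) :
    (ι g * t) ^ n = ι (∏ i ∈ Finset.range n, α (q t ^ i) g) * t ^ n := by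
  induction n with
  | zero => simp
  | succ n ih =>
    have h1 := hconj (t ^ n) g
    rw [map_pow] at h1
    rw [pow_succ, ih, Finset.prod_range_succ, map_mul, ← h1]
    group

theorem exists_complement_step {ℓ : ℕ} [Fact ℓ.Prime] (h90 : Hilbert90 α)
    (hN : NormSurjective α ℓ) {ι : A →* E} {q : E →* P}
    (hι : Function.Injective ι) (hq : Function.Surjective q) (hker : q.ker = ι.range)
    (hconj : ∀ e x, e * ι x * e⁻¹ = ι (α (q e) x)) (P₂ P₃ : Subgroup P) (hle : P₂ ≤ P₃)
    (hcard : Nat.card P₃ = ℓ * Nat.card P₂) (τ : P) (hτ : τ ∈ P₃) (hτ2 : τ ∉ P₂)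
    (hsup : P₃ ≤ P₂ ⊔ Subgroup.zpowers τ)
    (hnorm : τ ∈ Subgroup.normalizer (P₂ : Set P)) (hτℓ : τ ^ ℓ ∈ P₂) (C : Subgroup E)
    (hC : C.map q = P₂) (hC1 : ∀ c ∈ C, q c = 1 → c = 1) :
    ∃ C' : Subgroup E, C'.map q = P₃ ∧ ∀ c ∈ C', q c = 1 → c = 1 := by
  have hex : ∀ p : P, ∃ c : E, p ∈ P₂ → c ∈ C ∧ q c = p := by
    intro p
    by_cases hp : p ∈ P₂
    · rw [← hC] at hp
      obtain ⟨c, hc, rfl⟩ := hp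
      exact ⟨c, fun _ ↦ ⟨hc, rfl⟩⟩
    · exact ⟨1, fun h ↦ (hp h).elim⟩
  choose s hs using hex
  have huniq : ∀ c ∈ C, ∀ d ∈ C, q c = q d → c = d := by
    intro c hc d hd h
    have := hC1 (c * d⁻¹) (mul_mem hc (inv_mem hd)) (by rw [map_mul, map_inv, h, mul_inv_cancel])
    exact mul_inv_eq_one.mp this
  have hqC : ∀ c ∈ C, q c ∈ P₂ := fun c hc ↦ hC ▸ Subgroup.mem_map_of_mem q hc
  have hs_q : ∀ c ∈ C, s (q c) = c := fun c hc ↦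
    huniq _ (hs _ (hqC c hc)).1 _ hc (hs _ (hqC c hc)).2
  have hsm : ∀ p ∈ P₂, ∀ p' ∈ P₂, s (p * p') = s p * s p' := by
    intro p hp p' hp'
    refine huniq _ (hs _ (mul_mem hp hp')).1 _ (mul_mem (hs p hp).1 (hs p' hp').1) ?_
    rw [(hs _ (mul_mem hp hp')).2, map_mul, (hs p hp).2, (hs p' hp').2]
  have hτconj : ∀ p ∈ P₂, τ⁻¹ * p * τ ∈ P₂ := by
    intro p hp
    have := (Subgroup.mem_normalizer_iff.mp (inv_mem hnorm) p).mp hp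
    simpa using this
  have hqι : ∀ x, q (ι x) = 1 := fun x ↦ by
    have : ι x ∈ q.ker := hker ▸ ⟨x, rfl⟩
    exact this
  obtain ⟨t₀, ht₀⟩ := hq τ
  have hc : ∀ p : P, ∃ x : A, p ∈ P₂ → t₀ * s (τ⁻¹ * p * τ) * t₀⁻¹ = ι x * s p := by
    intro p
    by_cases hp : p ∈ P₂
    · have : t₀ * s (τ⁻¹ * p * τ) * t₀⁻¹ * (s p)⁻¹ ∈ q.ker := by
        rw [MonoidHom.mem_ker]
        simp only [map_mul, map_inv, ht₀, (hs _ (hτconj p hp)).2, (hs p hp).2]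
        group
      rw [hker] at this
      obtain ⟨x, hx⟩ := this
      exact ⟨x, fun _ ↦ by rw [hx]; group⟩
    · exact ⟨1, fun h ↦ (hp h).elim⟩
  choose c hc using hc
  have hcomm : ∀ p ∈ P₂, ∀ x, s p * ι x = ι (α p x) * s p := by
    intro p hp x
    have := hconj (s p) x
    rw [(hs p hp).2] at this
    rw [← this]; group
  obtain ⟨b, hb⟩ := h90 P₂ c (by
    intro p hp p' hp'
    apply hι
    have h1 := hc _ (mul_mem hp hp')
    have h2 : τ⁻¹ * (p * p') * τ = (τ⁻¹ * p * τ) * (τ⁻¹ * p' * τ) := by group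
    rw [h2, hsm _ (hτconj p hp) _ (hτconj p' hp'), hsm p hp p' hp'] at h1
    have h3 : t₀ * (s (τ⁻¹ * p * τ) * s (τ⁻¹ * p' * τ)) * t₀⁻¹
        = (t₀ * s (τ⁻¹ * p * τ) * t₀⁻¹) * (t₀ * s (τ⁻¹ * p' * τ) * t₀⁻¹) := by group
    rw [h3, hc p hp, hc p' hp'] at h1
    have h4 : ι (c p) * s p * (ι (c p') * s p') = ι (c p) * ι (α p (c p')) * (s p * s p') := by
      rw [mul_assoc, ← mul_assoc (s p), hcomm p hp]; group
    rw [h4] at h1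
    rw [map_mul]
    exact (mul_right_cancel h1).symm)
  set t := ι b * t₀ with ht
  have hqt : q t = τ := by rw [ht, map_mul, hqι, one_mul, ht₀]
  have hts : ∀ p ∈ P₂, t * s (τ⁻¹ * p * τ) * t⁻¹ = s p := by
    intro p hp
    have h1 : t * s (τ⁻¹ * p * τ) * t⁻¹
        = ι b * (t₀ * s (τ⁻¹ * p * τ) * t₀⁻¹) * (ι b)⁻¹ := by rw [ht]; group
    rw [h1, hc p hp, ← map_inv, mul_assoc, mul_assoc, hcomm p hp, hb p hp, ← mul_assoc,
      ← mul_assoc, ← map_mul, ← map_mul]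
    simp
  -- `t` normalizes `C`
  have htC : ∀ c ∈ C, t * c * t⁻¹ ∈ C ∧ t⁻¹ * c * t ∈ C := by
    intro c hcC
    constructor
    · have hp : τ * q c * τ⁻¹ ∈ P₂ := (Subgroup.mem_normalizer_iff.mp hnorm _).mp (hqC c hcC)
      have := hts _ hp
      rw [show τ⁻¹ * (τ * q c * τ⁻¹) * τ = q c by group, hs_q c hcC] at this
      rw [this]; exact (hs _ hp).1
    · have h1 := hts _ (hqC c hcC)
      rw [hs_q c hcC] at h1
      rw [← h1, show t⁻¹ * (t * s (τ⁻¹ * q c * τ) * t⁻¹) * t = s (τ⁻¹ * q c * τ) by group]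
      exact (hs _ (hτconj _ (hqC c hcC))).1
  have htn : t ∈ Subgroup.normalizer (C : Set E) := by
    rw [Subgroup.mem_normalizer_iff]
    intro c
    refine ⟨fun h ↦ (htC c h).1, fun h ↦ ?_⟩
    have := (htC _ h).2
    rwa [show t⁻¹ * (t * c * t⁻¹) * t = c by group] at this
  obtain ⟨x, hx⟩ : ∃ x, ι x * s (τ ^ ℓ) = t ^ ℓ := by
    have : t ^ ℓ * (s (τ ^ ℓ))⁻¹ ∈ q.ker := by
      rw [MonoidHom.mem_ker, map_mul, map_inv, map_pow, hqt, (hs _ hτℓ).2, mul_inv_cancel]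
    rw [hker] at this
    obtain ⟨x, hx⟩ := this
    exact ⟨x, by rw [hx]; group⟩
  have hxτ : α τ x = x := by
    apply hι
    have h1 : t * (ι x * s (τ ^ ℓ)) * t⁻¹ = ι x * s (τ ^ ℓ) := by
      rw [hx]; group
    have h2 := hts _ hτℓ
    rw [show τ⁻¹ * τ ^ ℓ * τ = τ ^ ℓ by group] at h2
    have h3 : t * (ι x * s (τ ^ ℓ)) * t⁻¹ = (t * ι x * t⁻¹) * (t * s (τ ^ ℓ) * t⁻¹) := by group
    rw [h3, h2, hconj, hqt] at h1
    exact mul_right_cancel h1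
  have hxP : ∀ p ∈ P₂, α p x = x := by
    intro p hp
    apply hι
    have h1 : (t ^ ℓ)⁻¹ * s p * t ^ ℓ ∈ C := by
      have := (Subgroup.mem_normalizer_iff.mp (inv_mem (pow_mem htn ℓ)) (s p)).mp (hs p hp).1
      rwa [inv_inv] at this
    have h2 : (s (τ ^ ℓ))⁻¹ * s p * s (τ ^ ℓ) ∈ C :=
      mul_mem (mul_mem (inv_mem (hs _ hτℓ).1) (hs p hp).1) (hs _ hτℓ).1
    have h3 := huniq _ h1 _ h2 (by simp only [map_mul, map_inv, map_pow, hqt, (hs _ hτℓ).2])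
    rw [← hx] at h3
    have h4 : (ι x)⁻¹ * s p * ι x = s p := by
      calc (ι x)⁻¹ * s p * ι x = s (τ ^ ℓ) * ((ι x * s (τ ^ ℓ))⁻¹ * s p * (ι x * s (τ ^ ℓ)))
            * (s (τ ^ ℓ))⁻¹ := by group
        _ = s p := by rw [h3]; group
    have h5 : s p * ι x = ι x * s p := by
      conv_rhs => rw [← h4]
      group
    rw [hcomm p hp] at h5
    exact mul_right_cancel h5
  have hxP3 : ∀ p ∈ P₃, α p x⁻¹ = x⁻¹ := by
    intro p hp
    have hle3 : P₂ ⊔ Subgroup.zpowers τ ≤ (MulAction.stabilizer (MulAut A) x).comap α := by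
      rw [sup_le_iff, Subgroup.zpowers_le]
      exact ⟨fun p hp ↦ hxP p hp, hxτ⟩
    have : α p x = x := hle3 (hsup hp)
    rw [map_inv, this]
  obtain ⟨g, hgP, hg⟩ := hN P₂ P₃ τ hle hcard hτ hsup
    (fun p hp ↦ (Subgroup.mem_normalizer_iff.mp hnorm p).mp hp) hτℓ x⁻¹ hxP3
  set t' := ι g * t with ht'
  have hqt' : q t' = τ := by rw [ht', map_mul, hqι, one_mul, hqt]
  have hgC : ι g ∈ Subgroup.normalizer (C : Set E) := by
    rw [Subgroup.mem_normalizer_iff]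
    have : ∀ c ∈ C, ι g * c = c * ι g := by
      intro c hcC
      have := hcomm _ (hqC c hcC) g
      rw [hs_q c hcC, hgP _ (hqC c hcC)] at this
      exact this.symm
    intro c
    constructor
    · intro h; rw [this c h]; simpa using h
    · intro h
      have h2 : c = (ι g)⁻¹ * ((ι g * c * (ι g)⁻¹) * ι g) := by group
      rw [← this _ h, inv_mul_cancel_left] at h2
      rwa [h2]
  have ht'n : t' ∈ Subgroup.normalizer (C : Set E) := mul_mem hgC htn
  have ht'ℓ : t' ^ ℓ ∈ C := by
    rw [ht', mul_pow_eq_prod_mul_pow hconj, hqt, hg, ← hx, ← mul_assoc, ← map_mul, inv_mul_cancel,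
      map_one, one_mul]
    exact (hs _ hτℓ).1
  have hmem : ∀ {e : E}, e ∈ C ⊔ Subgroup.zpowers t' ↔ ∃ c ∈ C, ∃ i : ℤ, c * t' ^ i = e := by
    intro e
    rw [← SetLike.mem_coe, Subgroup.coe_mul_of_right_le_normalizer_left _ _
      (by rwa [Subgroup.zpowers_le]), Set.mem_mul]
    constructor
    · rintro ⟨c, hc, _, ⟨i, rfl⟩, rfl⟩
      exact ⟨c, hc, i, rfl⟩
    · rintro ⟨c, hc, i, rfl⟩
      exact ⟨c, hc, _, ⟨i, rfl⟩, rfl⟩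
  refine ⟨C ⊔ Subgroup.zpowers t', ?_, ?_⟩
  · rw [Subgroup.map_sup, hC, MonoidHom.map_zpowers, hqt']
    refine le_antisymm (sup_le hle ?_) hsup
    rwa [Subgroup.zpowers_le]
  · intro e he hqe
    obtain ⟨c, hcC, i, rfl⟩ := hmem.mp he
    rw [map_mul, map_zpow, hqt'] at hqe
    have hi : τ ^ i ∈ P₂ := by
      rw [← inv_eq_of_mul_eq_one_right hqe]
      exact inv_mem (hqC c hcC)
    have hdvd : (ℓ : ℤ) ∣ i := by
      by_contra hnd
      have hcop : IsCoprime (ℓ : ℤ) i :=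
        (Nat.prime_iff_prime_int.mp (Fact.out : ℓ.Prime)).coprime_iff_not_dvd.mpr hnd
      obtain ⟨u, v, huv⟩ := hcop
      apply hτ2
      have : τ = (τ ^ ℓ) ^ u * (τ ^ i) ^ v := by
        rw [← zpow_natCast τ ℓ, ← zpow_mul, ← zpow_mul, ← zpow_add, mul_comm (ℓ : ℤ), mul_comm i,
          huv, zpow_one]
      rw [this]
      exact mul_mem (zpow_mem hτℓ u) (zpow_mem hi v)
    obtain ⟨j, rfl⟩ := hdvd
    have : t' ^ ((ℓ : ℤ) * j) ∈ C := by
      rw [zpow_mul, zpow_natCast]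
      exact zpow_mem ht'ℓ j
    exact hC1 _ (mul_mem hcC this) (by rw [map_mul, map_zpow, hqt', hqe])

end Splitting

section Splitting

variable {A P E : Type*} [CommGroup A] [Group P] [Group E] {α : P →* MulAut A}

theorem exists_complement [Finite P] {ℓ : ℕ} [Fact ℓ.Prime] (h90 : Hilbert90 α)
    (hN : NormSurjective α ℓ) {ι : A →* E} {q : E →* P}
    (hι : Function.Injective ι) (hq : Function.Surjective q) (hker : q.ker = ι.range)
    (hconj : ∀ e x, e * ι x * e⁻¹ = ι (α (q e) x)) (n : ℕ) (P₃ : Subgroup P)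
    (hP₃ : Nat.card P₃ = ℓ ^ n) :
    ∃ C : Subgroup E, C.map q = P₃ ∧ ∀ c ∈ C, q c = 1 → c = 1 := by
  have hℓ : ℓ.Prime := Fact.out
  induction n generalizing P₃ with
  | zero =>
    refine ⟨⊥, ?_, fun c hc _ ↦ hc⟩
    rw [Subgroup.map_bot, eq_comm, ← Subgroup.card_eq_one, hP₃, pow_zero]
  | succ n ih =>
    obtain ⟨K, hK⟩ := Sylow.exists_subgroup_card_pow_prime (G := P₃) ℓ (n := n)
      (by rw [hP₃]; exact pow_dvd_pow _ n.le_succ)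
    have hidx : K.index = ℓ := by
      have := K.card_mul_index
      rw [hK, hP₃, pow_succ] at this
      exact Nat.eq_of_mul_eq_mul_left (pow_pos hℓ.pos n) this
    have hKn : K.Normal := by
      apply Subgroup.normal_of_index_eq_minFac_card
      rw [hidx, hP₃, hℓ.pow_minFac n.succ_ne_zero]
    set P₂ := K.map P₃.subtype with hP₂
    have hcard2 : Nat.card P₂ = ℓ ^ n := by
      rw [hP₂, Subgroup.card_subtype, hK]
    have hle : P₂ ≤ P₃ := Subgroup.map_subtype_le K
    have hcard : Nat.card P₃ = ℓ * Nat.card P₂ := by rw [hP₃, hcard2, pow_succ']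
    have hne : ¬ P₃ ≤ P₂ := by
      intro h
      rw [le_antisymm h hle, hcard2] at hP₃
      exact absurd (Nat.pow_right_injective hℓ.two_le hP₃) (by omega)
    obtain ⟨τ, hτ, hτ2⟩ := SetLike.not_le_iff_exists.mp hne
    have hmem (x : P) (hx : x ∈ P₃) : x ∈ P₂ ↔ (⟨x, hx⟩ : P₃) ∈ K := by
      rw [hP₂, Subgroup.mem_map]
      constructor
      · rintro ⟨y, hy, rfl⟩; exact hy
      · intro h; exact ⟨_, h, rfl⟩
    have hsup : P₃ ≤ P₂ ⊔ Subgroup.zpowers τ := by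
      have hM : P₂ ⊔ Subgroup.zpowers τ ≤ P₃ :=
        sup_le hle (by rwa [Subgroup.zpowers_le])
      have h1 := Subgroup.card_dvd_of_le hM
      have h2 := Subgroup.card_dvd_of_le (le_sup_left : P₂ ≤ P₂ ⊔ Subgroup.zpowers τ)
      refine (Subgroup.eq_of_le_of_card_ge hM ?_).ge
      rw [hP₃] at h1 ⊢
      obtain ⟨m, hm, hm'⟩ := (Nat.dvd_prime_pow hℓ).mp h1
      rw [hm'] at h2 ⊢
      rw [hcard2] at h2
      have h3 : n ≤ m := (Nat.pow_dvd_pow_iff_le_right hℓ.one_lt).mp h2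
      rcases h3.eq_or_lt with rfl | h3
      · have : P₂ = P₂ ⊔ Subgroup.zpowers τ :=
          Subgroup.eq_of_le_of_card_ge le_sup_left (by rw [hm', hcard2])
        exact absurd (this ▸ Subgroup.mem_sup_right (Subgroup.mem_zpowers τ)) hτ2
      · exact Nat.pow_le_pow_right hℓ.pos h3
    have hnorm : τ ∈ Subgroup.normalizer (P₂ : Set P) := by
      rw [Subgroup.mem_normalizer_iff]
      intro x
      constructor
      · intro hx
        have hx3 := hle hx
        rw [hmem _ (mul_mem (mul_mem hτ hx3) (inv_mem hτ))]
        exact hKn.conj_mem _ ((hmem x hx3).mp hx) ⟨τ, hτ⟩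
      · intro hx
        have hx3 := hle hx
        have h1 := hKn.conj_mem _ ((hmem _ hx3).mp hx) ⟨τ⁻¹, inv_mem hτ⟩
        have h2 : x ∈ P₃ := by
          have := mul_mem (mul_mem (inv_mem hτ) hx3) hτ
          rwa [show τ⁻¹ * (τ * x * τ⁻¹) * τ = x by group] at this
        rw [hmem x h2]
        convert h1
        simp [mul_assoc]
    have hτℓ : τ ^ ℓ ∈ P₂ := by
      rw [hmem _ (pow_mem hτ _)]
      have := K.pow_index_mem (⟨τ, hτ⟩ : P₃)
      rw [hidx] at this
      exact this
    obtain ⟨C, hC, hC1⟩ := ih P₂ hcard2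
    exact exists_complement_step h90 hN hι hq hker hconj P₂ P₃ hle hcard τ hτ hτ2 hsup hnorm hτℓ
      C hC hC1

/-- An extension of a finite `ℓ`-group `P` by a `P`-module satisfying Hilbert 90 and the
surjectivity of norms splits. -/
theorem exists_section [Finite P] {ℓ : ℕ} [Fact ℓ.Prime] (hP : IsPGroup ℓ P) (h90 : Hilbert90 α)
    (hN : NormSurjective α ℓ) {ι : A →* E} {q : E →* P}
    (hι : Function.Injective ι) (hq : Function.Surjective q) (hker : q.ker = ι.range)
    (hconj : ∀ e x, e * ι x * e⁻¹ = ι (α (q e) x)) :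
    ∃ s : P →* E, ∀ p, q (s p) = p := by
  obtain ⟨n, hn⟩ := IsPGroup.iff_card.mp hP
  obtain ⟨C, hC, hC1⟩ := exists_complement h90 hN hι hq hker hconj n ⊤
    (by rw [Subgroup.card_top, hn])
  have hbij : Function.Bijective (q.comp C.subtype) := by
    constructor
    · rw [injective_iff_map_eq_one]
      intro c hc
      exact Subtype.ext (hC1 c c.2 hc)
    · intro p
      have : p ∈ C.map q := hC ▸ Subgroup.mem_top p
      obtain ⟨c, hc, rfl⟩ := this
      exact ⟨⟨c, hc⟩, rfl⟩
  let φ := MulEquiv.ofBijective _ hbij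
  exact ⟨C.subtype.comp φ.symm.toMonoidHom, fun p ↦ φ.apply_symm_apply p⟩

/-- A character of the kernel of a central extension of `P` extends to a crossed homomorphism. -/
theorem exists_crossed [Finite P] {ℓ : ℕ} [Fact ℓ.Prime] (hP : IsPGroup ℓ P) (h90 : Hilbert90 α)
    (hN : NormSurjective α ℓ) {π : E →* P} (hπ : Function.Surjective π)
    (hcen : π.ker ≤ Subgroup.center E) (j : π.ker →* A) (hj : ∀ p z, α p (j z) = j z) :
    ∃ a : E → A, (∀ e e', a (e * e') = a e * α (π e) (a e')) ∧ ∀ z : π.ker, a z = j z := by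
  let S := A ⋊[α.comp π] E
  let ν : π.ker →* S :=
    { toFun := fun z ↦ ⟨(j z)⁻¹, z⟩
      map_one' := by ext <;> simp
      map_mul' := by
        rintro ⟨x, hx⟩ ⟨y, hy⟩
        ext
        · change (j (⟨x, hx⟩ * ⟨y, hy⟩))⁻¹ = (j ⟨x, hx⟩)⁻¹ * α (π x) (j ⟨y, hy⟩)⁻¹
          rw [map_inv, hj, map_mul, mul_inv]
        · rfl }
  have hmul (m : A) (z : π.ker) : (SemidirectProduct.inl m : S) * ν z = ⟨m * (j z)⁻¹, z⟩ := by
    ext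
    · change m * α (π 1) (j z)⁻¹ = m * (j z)⁻¹
      rw [map_one, map_one, MulAut.one_apply]
    · change 1 * (z : E) = z
      rw [one_mul]
  have hνn : ν.range.Normal := by
    constructor
    rintro _ ⟨z, rfl⟩ g
    have hz : ∀ e : E, e * z * e⁻¹ = z := fun e ↦ by
      rw [Subgroup.mem_center_iff.mp (hcen z.2) e, mul_inv_cancel_right]
    have hz1 : π z = 1 := z.2
    refine ⟨z, ?_⟩
    ext
    · have h1 : α (π g.right) (α (π (z : E)) (α (π g.right)⁻¹ g.left⁻¹)) = g.left⁻¹ := by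
        rw [hz1, map_one, ← MulAut.mul_apply, ← MulAut.mul_apply, mul_one, ← map_mul,
          mul_inv_cancel, map_one, MulAut.one_apply]
      change (j z)⁻¹ = (g.left * α (π g.right) (j z)⁻¹) *
        α (π (g.right * z)) (α (π g.right⁻¹) g.left⁻¹)
      rw [map_mul π, map_mul α, MulAut.mul_apply, map_inv π, h1, map_inv, hj,
        mul_right_comm, mul_inv_cancel, one_mul]
    · exact (hz g.right).symm
  let Q := S ⧸ ν.range
  let ι : A →* Q := (QuotientGroup.mk' ν.range).comp SemidirectProduct.inl
  let q : Q →* P := QuotientGroup.lift ν.range (π.comp SemidirectProduct.rightHom) (by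
    rintro _ ⟨z, rfl⟩
    exact z.2)
  have hqmk (g : S) : q (QuotientGroup.mk' ν.range g) = π g.right := rfl
  have hι : Function.Injective ι := by
    rw [injective_iff_map_eq_one]
    intro x hx
    have hx' : (SemidirectProduct.inl x : S) ∈ ν.range := (QuotientGroup.eq_one_iff _).mp hx
    obtain ⟨z, hz⟩ := hx'
    have hz1 : z = 1 := Subtype.ext (congrArg SemidirectProduct.right hz)
    have := congrArg SemidirectProduct.left hz
    rw [hz1] at this
    simpa [ν] using this.symm
  have hq : Function.Surjective q := by
    intro p
    obtain ⟨e, rfl⟩ := hπ p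
    exact ⟨QuotientGroup.mk' _ (SemidirectProduct.inr e), rfl⟩
  have hker : q.ker = ι.range := by
    apply le_antisymm
    · intro g hg
      obtain ⟨⟨x, e⟩, rfl⟩ := QuotientGroup.mk'_surjective _ g
      have he : e ∈ π.ker := hg
      refine ⟨x * j ⟨e, he⟩, ?_⟩
      refine (QuotientGroup.mk'_eq_mk' _).mpr ⟨ν ⟨e, he⟩, ⟨_, rfl⟩, ?_⟩
      rw [hmul, mul_inv_cancel_right]
    · rintro _ ⟨x, rfl⟩
      rw [MonoidHom.mem_ker]
      change π 1 = 1
      exact map_one π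
  have hconj : ∀ e x, e * ι x * e⁻¹ = ι (α (q e) x) := by
    intro e x
    obtain ⟨g, rfl⟩ := QuotientGroup.mk'_surjective _ e
    rw [hqmk]
    change QuotientGroup.mk' ν.range (g * SemidirectProduct.inl x * g⁻¹) = QuotientGroup.mk' _ _
    congr 1
    ext
    · change (g.left * α (π g.right) x) * α (π (g.right * 1)) (α (π g.right⁻¹) g.left⁻¹)
        = α (π g.right) x
      rw [mul_one, map_inv π, ← MulAut.mul_apply, ← map_mul, mul_inv_cancel, map_one,
        MulAut.one_apply, mul_right_comm, mul_inv_cancel, one_mul]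
    · change g.right * 1 * g.right⁻¹ = 1
      rw [mul_one, mul_inv_cancel]
  obtain ⟨s, hs⟩ := exists_section hP h90 hN hι hq hker hconj
  have ha : ∀ e : E, ∃ x : A, ι x * s (π e)
      = QuotientGroup.mk' ν.range (SemidirectProduct.inr e) := by
    intro e
    have : QuotientGroup.mk' ν.range (SemidirectProduct.inr e) * (s (π e))⁻¹ ∈ q.ker := by
      rw [MonoidHom.mem_ker, map_mul, map_inv, hs, hqmk, SemidirectProduct.right_inr,
        mul_inv_cancel]
    rw [hker] at this
    obtain ⟨x, hx⟩ := this
    exact ⟨x, by rw [hx]; group⟩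
  choose a ha using ha
  refine ⟨a, fun e e' ↦ ?_, fun z ↦ ?_⟩
  · apply hι
    have h1 := ha (e * e')
    rw [map_mul, map_mul SemidirectProduct.inr, map_mul (QuotientGroup.mk' _), ← ha e, ← ha e',
      map_mul] at h1
    have h2 := hconj (s (π e)) (a e')
    rw [hs] at h2
    rw [map_mul, ← h2]
    calc ι (a (e * e')) = ι (a (e * e')) * (s (π e) * s (π e')) * (s (π e) * s (π e'))⁻¹ := by
          group
      _ = _ := by rw [h1]; group
  · apply hι
    have h1 := ha z
    rw [show π z = 1 from z.2, map_one, mul_one] at h1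
    rw [h1]
    refine ((QuotientGroup.mk'_eq_mk' ν.range).mpr ⟨ν z, ⟨_, rfl⟩, ?_⟩).symm
    rw [hmul, mul_inv_cancel]
    rfl

end Splitting

section UnitsAction

variable {k L P : Type*} [Field k] [Field L] [Algebra k L] [Group P] (ρ : P →* (L ≃ₐ[k] L))

/-- The action on `Lˣ` of a group acting on the field `L`. -/
def unitsAction : P →* MulAut Lˣ where
  toFun p := Units.mapEquiv (ρ p : L ≃* L)
  map_one' := by ext; simp; rfl
  map_mul' p q := by ext; simp; rfl

@[simp]
theorem coe_unitsAction (p : P) (x : Lˣ) : ((unitsAction ρ p x : Lˣ) : L) = ρ p x := rfl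

variable {ρ}

theorem exists_sum_ne_zero (hρ : Function.Injective ρ) (s : Finset P) (hs : s.Nonempty)
    (c : P → Lˣ) : ∃ y : L, ∑ p ∈ s, (c p : L) * ρ p y ≠ 0 := by
  by_contra! h
  have hinj : Function.Injective fun p : P ↦ ((ρ p : L →ₐ[k] L) : L →* L) := by
    intro p q hpq
    apply hρ
    ext x
    exact DFunLike.congr_fun hpq x
  have hli := (linearIndependent_monoidHom L L).comp _ hinj
  obtain ⟨p, hp⟩ := hs
  refine (c p).ne_zero (linearIndependent_iff'.mp hli s (fun p ↦ (c p : L)) ?_ p hp)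
  ext y
  rw [Finset.sum_apply]
  exact h y

theorem hilbert90_unitsAction [Finite P] (hρ : Function.Injective ρ) :
    Hilbert90 (unitsAction ρ) := by
  classical
  intro P₂ c hc
  have := Fintype.ofFinite P
  obtain ⟨y, hy⟩ := exists_sum_ne_zero hρ (Finset.univ.filter (· ∈ P₂))
    ⟨1, by simp [P₂.one_mem]⟩ c
  refine ⟨(Units.mk0 _ hy)⁻¹, fun q hq ↦ ?_⟩
  have key : unitsAction ρ q (Units.mk0 _ hy) * c q = Units.mk0 _ hy := by
    ext
    rw [Units.val_mul, coe_unitsAction, Units.val_mk0, map_sum, Finset.sum_mul]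
    refine Finset.sum_bij (fun p _ ↦ q * p) ?_ ?_ ?_ ?_
    · intro p hp
      simp only [Finset.mem_filter, Finset.mem_univ, true_and] at hp ⊢
      exact mul_mem hq hp
    · intro p _ p' _ h
      exact mul_left_cancel h
    · intro p hp
      simp only [Finset.mem_filter, Finset.mem_univ, true_and] at hp
      exact ⟨q⁻¹ * p, by simpa using mul_mem (inv_mem hq) hp, by simp⟩
    · intro p hp
      simp only [Finset.mem_filter, Finset.mem_univ, true_and] at hp
      rw [hc q hq p hp, Units.val_mul, coe_unitsAction, map_mul, map_mul, AlgEquiv.mul_apply]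
      ring
  rw [map_inv, div_inv_eq_mul, eq_inv_mul_iff_mul_eq]
  exact key

theorem finrank_fixedField_map [Finite P] (hρ : Function.Injective ρ) (H : Subgroup P) :
    Module.finrank (IntermediateField.fixedField (H.map ρ)) L = Nat.card H := by
  classical
  have hfin : Finite (H.map ρ) := by
    have : Finite H := inferInstance
    exact ((Set.toFinite (H : Set P)).image ρ).to_subtype
  have := Fintype.ofFinite (H.map ρ)
  rw [show Nat.card H = Nat.card (H.map ρ) from
    (Nat.card_congr (H.equivMapOfInjective ρ hρ).toEquiv), Nat.card_eq_fintype_card]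
  exact FixedPoints.finrank_eq_card (H.map ρ) L

theorem mem_fixedField_map (H : Subgroup P) (x : L) :
    x ∈ IntermediateField.fixedField (H.map ρ) ↔ ∀ p ∈ H, ρ p x = x := by
  rw [IntermediateField.mem_fixedField_iff]
  simp

theorem normSurjective_unitsAction [IsAlgClosed k] [Finite P] {z : L} (h : IsSepGen k z)
    (hz : ∀ p, ρ p z = z) (hρ : Function.Injective ρ) {ℓ : ℕ} (hℓ : 0 < ℓ) :
    NormSurjective (unitsAction ρ) ℓ := by
  intro P₂ P₃ τ hle hcard hτ hsup hnorm hτℓ x hx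
  set F₂ := IntermediateField.fixedField (P₂.map ρ) with hF₂
  set F₃ := IntermediateField.fixedField (P₃.map ρ) with hF₃
  have m2 (x : L) : x ∈ F₂ ↔ ∀ p ∈ P₂, ρ p x = x := mem_fixedField_map P₂ x
  have m3 (x : L) : x ∈ F₃ ↔ ∀ p ∈ P₃, ρ p x = x := mem_fixedField_map P₃ x
  let f : F₃ →ₐ[k] F₂ := IntermediateField.inclusion
    (fun x hx ↦ (m2 x).mpr fun p hp ↦ (m3 x).mp hx p (hle hp))
  let z' : F₃ := ⟨z, (m3 z).mpr fun p _ ↦ hz p⟩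
  have h3 : IsSepGen k z' := IsSepGen.of_tower (F := L) h
  have h2 : IsSepGen k (f z') := IsSepGen.of_tower (F := L) h
  have hstab (y : F₂) : ρ τ y ∈ F₂ := by
    rw [m2]
    have hnorm' : P₂.map (MulAut.conj τ).toMonoidHom = P₂ := by
      apply Subgroup.eq_of_le_of_card_ge
      · rintro _ ⟨p, hp, rfl⟩
        exact hnorm p hp
      · rw [Subgroup.card_map_of_injective (MulAut.conj τ).injective]
    intro p hp
    rw [← hnorm'] at hp
    obtain ⟨q, hq, rfl⟩ := hp
    have := (m2 y).mp y.2 q hq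
    change ρ (τ * q * τ⁻¹) (ρ τ y) = _
    rw [← AlgEquiv.mul_apply, ← map_mul, inv_mul_cancel_right, map_mul, AlgEquiv.mul_apply, this]
  let φ : F₂ →ₐ[k] F₂ := ((ρ τ : L →ₐ[k] L).comp F₂.val).codRestrict F₂.toSubalgebra hstab
  have hφ1 (y : F₂) : (φ y : L) = ρ τ y := rfl
  have hφ (n : ℕ) (y : F₂) : ((φ ^ n) y : L) = ρ (τ ^ n) y := by
    induction n generalizing y with
    | zero => simp
    | succ n ih => rw [pow_succ, AlgHom.mul_apply, ih, hφ1, pow_succ, map_mul, AlgEquiv.mul_apply]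
  have hφℓ (y : F₂) : (φ ^ ℓ) y = y := by
    apply Subtype.ext
    rw [hφ]
    exact (m2 y).mp y.2 _ hτℓ
  have hbij : Function.Bijective φ := by
    refine ⟨φ.injective, fun y ↦ ⟨(φ ^ (ℓ - 1)) y, ?_⟩⟩
    rw [← AlgHom.mul_apply, ← pow_succ', Nat.sub_add_cancel hℓ, hφℓ]
  let τF : F₂ ≃ₐ[k] F₂ := AlgEquiv.ofBijective φ hbij
  have hτF (n : ℕ) (y : F₂) : ((τF ^ n) y : L) = ρ (τ ^ n) y := by
    induction n generalizing y with
    | zero => simp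
    | succ n ih =>
      rw [pow_succ, AlgEquiv.mul_apply, ih, pow_succ, map_mul, AlgEquiv.mul_apply]
      rfl
  have hfix (y : F₂) : τF y = y ↔ y ∈ f.range := by
    constructor
    · intro hy
      have hy3 : (y : L) ∈ F₃ := by
        rw [m3]
        intro p hp
        have hsub : P₂ ⊔ Subgroup.zpowers τ ≤
            (MulAction.stabilizer (L ≃ₐ[k] L) (y : L)).comap ρ := by
          refine sup_le (fun q hq ↦ (m2 y).mp y.2 q hq) ?_
          rw [Subgroup.zpowers_le]
          exact congrArg Subtype.val hy
        exact hsub (hsup hp)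
      exact ⟨⟨y, hy3⟩, rfl⟩
    · rintro ⟨y', rfl⟩
      exact Subtype.ext ((m3 y').mp y'.2 τ hτ)
  have hd : ℓ * Module.finrank k⟮z'⟯ F₃ ≤ Module.finrank k⟮f z'⟯ F₂ := by
    have e3 := finrank_adjoin_mul_finrank (k := k) (F := L) z'
    have e2 := finrank_adjoin_mul_finrank (k := k) (F := L) (f z')
    rw [finrank_fixedField_map hρ] at e3 e2
    have e : Module.finrank k⟮f z'⟯ F₂ * Nat.card P₂ = Module.finrank k⟮z'⟯ F₃ * Nat.card P₃ :=
      e2.trans e3.symm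
    rw [hcard, ← mul_assoc, mul_comm _ ℓ] at e
    exact (Nat.eq_of_mul_eq_mul_right Nat.card_pos e).ge
  obtain ⟨g, hg0, hg⟩ := IsSepGen.exists_norm_eq f h3 h2 τF hfix hℓ
    (fun y ↦ Subtype.ext (by rw [hτF]; exact (m2 y).mp y.2 _ hτℓ)) hd
    (x := ⟨x, (m3 x).mpr fun p hp ↦ congrArg Units.val (hx p hp)⟩)
    (fun h0 ↦ x.ne_zero (congrArg Subtype.val h0))
  refine ⟨Units.mk0 (g : L) (fun h0 ↦ hg0 (Subtype.ext h0)), fun p hp ↦ ?_, ?_⟩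
  · ext
    exact (m2 g).mp g.2 p hp
  · ext
    have := congrArg (Subtype.val : F₂ → L) hg
    rw [← F₂.coe_val, map_prod] at this
    rw [Units.coe_prod]
    refine Eq.trans (Finset.prod_congr rfl fun i _ ↦ ?_) this
    exact (hτF i g).symm

end UnitsAction

section Places

variable {k L : Type*} [Field k] [Field L] [Algebra k L] {z : L}

/-- The map induced on integral closures by an automorphism fixing `z`. -/
noncomputable def intClosureHom (σ : L ≃ₐ[k] L) (hσ : σ z = z) :
    intClosure k z →ₐ[k] intClosure k z :=
  ((σ : L →ₐ[k] L).comp (intClosure k z).val).codRestrict (intClosure k z) fun x ↦ by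
    have := (map_mem_intClosure_iff (z := z) (x := (x : L)) (σ : L →ₐ[k] L)).mpr x.2
    rwa [show (σ : L →ₐ[k] L) z = z from hσ] at this

@[simp]
theorem coe_intClosureHom (σ : L ≃ₐ[k] L) (hσ : σ z = z) (x : intClosure k z) :
    (intClosureHom σ hσ x : L) = σ x := rfl

/-- The automorphism `σ` lies in the inertia group of the place `y`. -/
def InertAt (y : intClosure k z →ₐ[k] k) (σ : L ≃ₐ[k] L) : Prop :=
  ∀ x x' : intClosure k z, σ x = x' → y x' = y x

theorem inertAt_iff (y : intClosure k z →ₐ[k] k) (σ : L ≃ₐ[k] L) (hσ : σ z = z) :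
    InertAt y σ ↔ y.comp (intClosureHom σ hσ) = y := by
  constructor
  · intro h
    ext x
    exact h x _ rfl
  · intro h x x' hx
    have : intClosureHom σ hσ x = x' := Subtype.ext hx
    rw [← this, ← AlgHom.comp_apply, h]

/-- The units of the local ring of the place `y`. -/
def localUnits (y : intClosure k z →ₐ[k] k) : Subgroup Lˣ where
  carrier := {u | ∃ s₁ s₂ : intClosure k z, y s₁ ≠ 0 ∧ y s₂ ≠ 0 ∧ (u : L) * s₂ = s₁}
  one_mem' := ⟨1, 1, by simp, by simp, by simp⟩
  mul_mem' := by
    rintro u v ⟨s₁, s₂, h1, h2, h⟩ ⟨t₁, t₂, h1', h2', h'⟩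
    refine ⟨s₁ * t₁, s₂ * t₂, by simp [h1, h1'], by simp [h2, h2'], ?_⟩
    push_cast
    rw [← h, ← h']
    ring
  inv_mem' := by
    rintro u ⟨s₁, s₂, h1, h2, h⟩
    refine ⟨s₂, s₁, h2, h1, ?_⟩
    rw [← h, ← mul_assoc, Units.inv_mul, one_mul]

theorem mem_localUnits {y : intClosure k z →ₐ[k] k} {u : Lˣ} :
    u ∈ localUnits y ↔ ∃ s₁ s₂ : intClosure k z, y s₁ ≠ 0 ∧ y s₂ ≠ 0 ∧ (u : L) * s₂ = s₁ := Iff.rfl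

/-- A uniformizer at `y` generates `Lˣ` modulo the local units. -/
theorem IsSepGen.exists_zpow_mul_mem_localUnits (h : IsSepGen k z) (y : intClosure k z →ₐ[k] k)
    {u : Lˣ} {u' : intClosure k z} (hu : (u' : L) = u) (hu1 : u' ∈ RingHom.ker y)
    (hu2 : u' ∉ RingHom.ker y ^ 2) (x : Lˣ) : ∃ n : ℤ, x * u ^ n ∈ localUnits y := by
  have := h.isDedekindDomain
  have := h.isFractionRing
  let v : IsDedekindDomain.HeightOneSpectrum (intClosure k z) :=
    ⟨RingHom.ker y, (ker_isMaximal y).isPrime, h.ker_ne_bot y⟩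
  have hvu0 : v.valuation L (u : L) ≠ 0 := by simp
  have hvu : v.valuation L (u : L) = WithZero.exp (-1 : ℤ) := by
    have h1 : v.valuation L (u : L) ≤ WithZero.exp (-((1 : ℕ) : ℤ)) := by
      rw [← hu]
      refine (v.valuation_of_algebraMap u').trans_le ?_
      rw [v.intValuation_le_pow_iff_mem, pow_one]
      exact hu1
    have h2 : ¬ v.valuation L (u : L) ≤ WithZero.exp (-((2 : ℕ) : ℤ)) := by
      rw [← hu]
      intro h2
      have := (v.valuation_of_algebraMap (K := L) u').symm.trans_le h2
      rw [v.intValuation_le_pow_iff_mem] at this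
      exact hu2 this
    rw [← WithZero.exp_log hvu0, WithZero.exp_le_exp] at h1 h2
    rw [← WithZero.exp_log hvu0]
    congr 1
    push_cast at h1 h2
    omega
  have hvx0 : v.valuation L (x : L) ≠ 0 := by simp
  refine ⟨WithZero.log (v.valuation L (x : L)), ?_⟩
  have hone : v.valuation L ((x * u ^ WithZero.log (v.valuation L (x : L)) : Lˣ) : L) = 1 := by
    rw [Units.val_mul, map_mul, Units.val_zpow_eq_zpow_val, map_zpow₀, hvu, ← WithZero.exp_zsmul]
    nth_rewrite 1 [← WithZero.exp_log hvx0]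
    rw [← WithZero.exp_add]
    simp
  obtain ⟨n, ⟨d, hd⟩, hnd⟩ := v.exists_primeCompl_mul_eq_of_integer _ hone.le
  refine ⟨n, d, ?_, hd, hnd⟩
  have h3 := congrArg (v.valuation L) hnd
  rw [map_mul, hone, one_mul, (v.valuation_eq_one_iff_notMem (K := L)).mpr hd] at h3
  exact (v.valuation_eq_one_iff_notMem (K := L)).mp h3.symm

theorem IsSepGen.finite_setOf_zero (h : IsSepGen k z) {b : intClosure k z} (hb : b ≠ 0) :
    {y : intClosure k z →ₐ[k] k | y b = 0}.Finite := by
  have := h.isDedekindDomain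
  have hfin := Ideal.finite_factors (I := Ideal.span {b}) (by simpa using hb)
  let F : (intClosure k z →ₐ[k] k) → IsDedekindDomain.HeightOneSpectrum (intClosure k z) :=
    fun y ↦ ⟨RingHom.ker y, (ker_isMaximal y).isPrime, h.ker_ne_bot y⟩
  have hF : Function.Injective F := fun y y' hyy ↦ algHom_eq_of_ker_le
    (congrArg IsDedekindDomain.HeightOneSpectrum.asIdeal hyy).le
  refine (hfin.preimage hF.injOn).subset fun y hy ↦ ?_
  change (F y).asIdeal ∣ Ideal.span {b}
  rw [Ideal.dvd_span_singleton]
  exact hy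

theorem IsSepGen.finite_setOf_notMem_localUnits (h : IsSepGen k z) (x : Lˣ) :
    {y : intClosure k z →ₐ[k] k | x ∉ localUnits y}.Finite := by
  have := h.isFractionRing
  obtain ⟨a, b, hb, hab⟩ := IsFractionRing.div_surjective (A := intClosure k z) (x : L)
  have hb0 := nonZeroDivisors.ne_zero hb
  have hbL : algebraMap (intClosure k z) L b ≠ 0 := by simpa using hb0
  have ha0 : a ≠ 0 := by
    rintro rfl
    simp at hab
    exact x.ne_zero hab.symm
  refine ((h.finite_setOf_zero ha0).union (h.finite_setOf_zero hb0)).subset fun y hy ↦ ?_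
  by_contra hn
  simp only [Set.mem_union, Set.mem_ofPred_eq, not_or] at hn
  refine hy ⟨a, b, hn.1, hn.2, ?_⟩
  rw [← hab]
  exact div_mul_cancel₀ _ hbL

end Places

section Kummer

variable {k L P : Type*} [Field k] [Field L] [Algebra k L] {z : L}

/-- The elements of `Lˣ` whose `ℓ`-th roots are unramified at `y`. -/
def regularUnits (ℓ : ℕ) (y : intClosure k z →ₐ[k] k) : Subgroup Lˣ :=
  localUnits y ⊔ (powMonoidHom ℓ).range

theorem mem_regularUnits {ℓ : ℕ} {y : intClosure k z →ₐ[k] k} {x : Lˣ} :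
    x ∈ regularUnits ℓ y ↔ ∃ c : Lˣ, x * c ^ ℓ ∈ localUnits y := by
  rw [regularUnits, Subgroup.mem_sup]
  constructor
  · rintro ⟨u, hu, _, ⟨c, rfl⟩, rfl⟩
    exact ⟨c⁻¹, by simpa using hu⟩
  · rintro ⟨c, hc⟩
    exact ⟨_, hc, (c⁻¹) ^ ℓ, ⟨c⁻¹, rfl⟩, by simp⟩

theorem localUnits_le_regularUnits (ℓ : ℕ) (y : intClosure k z →ₐ[k] k) :
    localUnits y ≤ regularUnits ℓ y := le_sup_left

theorem pow_mem_regularUnits (ℓ : ℕ) (y : intClosure k z →ₐ[k] k) (c : Lˣ) :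
    c ^ ℓ ∈ regularUnits ℓ y := Subgroup.mem_sup_right ⟨c, rfl⟩

/-- The local structure of a generator of `𝔪 J ^ ℓ`. -/
theorem IsSepGen.exists_local_factor (h : IsSepGen k z) {ℓ : ℕ}
    {𝔪 J : Ideal (intClosure k z)} {g : intClosure k z} (hg0 : g ≠ 0)
    (hg : Ideal.span {g} = 𝔪 * J ^ ℓ) (y : intClosure k z →ₐ[k] k) :
    ∃ c d u : intClosure k z, c ≠ 0 ∧ y d ≠ 0 ∧ d ^ ℓ * g = c ^ ℓ * u ∧
      ∃ K : Ideal (intClosure k z), ¬ K ≤ RingHom.ker y ∧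
        Ideal.span {u} * K ^ ℓ = Ideal.span {d ^ ℓ} * 𝔪 := by
  have := h.isDedekindDomain
  have hyp : (RingHom.ker y).IsPrime := (ker_isMaximal y).isPrime
  have hJ0 : J ^ ℓ ≠ 0 := by
    intro hJ
    rw [hJ, mul_zero] at hg
    exact hg0 (Ideal.span_singleton_eq_bot.mp hg)
  by_cases hℓ : ℓ = 0
  · subst hℓ
    refine ⟨1, 1, g, one_ne_zero, by simp, by simp, ⊤, ?_, by simpa using hg⟩
    exact fun h ↦ hyp.ne_top (top_le_iff.mp h)
  have hJ : J ≠ 0 := fun hJ ↦ hJ0 (by rw [hJ, zero_pow hℓ])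
  have hlt : J * RingHom.ker y < J := by
    refine lt_of_le_of_ne Ideal.mul_le_left fun h1 ↦ hyp.ne_top ?_
    have : J * RingHom.ker y = J * 1 := by rw [h1, mul_one]
    exact (mul_left_cancel₀ hJ this).trans Ideal.one_eq_top
  obtain ⟨c, hc, hc'⟩ := SetLike.exists_of_lt hlt
  obtain ⟨K, hK⟩ : J ∣ Ideal.span {c} := Ideal.dvd_span_singleton.mpr hc
  have hKy : ¬ K ≤ RingHom.ker y := by
    intro hle
    apply hc'
    have := Ideal.mul_mono_right (I := J) hle
    rw [← hK] at this
    exact this (Ideal.mem_span_singleton_self c)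
  obtain ⟨d, hd, hdy⟩ := SetLike.not_le_iff_exists.mp hKy
  have hc0 : c ≠ 0 := by
    rintro rfl
    exact hc' (Ideal.zero_mem _)
  have hdvd : c ^ ℓ ∣ d ^ ℓ * g := by
    rw [← Ideal.mem_span_singleton, ← Ideal.span_singleton_pow, hK, mul_pow, mul_comm (J ^ ℓ)]
    refine Ideal.mul_mem_mul (Ideal.pow_mem_pow hd ℓ) ?_
    have := Ideal.mem_span_singleton_self g
    rw [hg] at this
    exact Ideal.mul_le_right this
  obtain ⟨u, hu⟩ := hdvd
  refine ⟨c, d, u, hc0, hdy, hu, K, hKy, ?_⟩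
  apply mul_left_cancel₀ hJ0
  calc J ^ ℓ * (Ideal.span {u} * K ^ ℓ) = Ideal.span {c} ^ ℓ * Ideal.span {u} := by
        rw [hK]; ring
    _ = Ideal.span {d ^ ℓ * g} := by
        rw [Ideal.span_singleton_pow, Ideal.span_singleton_mul_span_singleton, hu]
    _ = _ := by
        rw [← Ideal.span_singleton_mul_span_singleton, hg]; ring

theorem IsSepGen.mem_regularUnits_of_ne (h : IsSepGen k z) {ℓ : ℕ}
    {y y' : intClosure k z →ₐ[k] k} (hyy : y ≠ y') {J : Ideal (intClosure k z)}
    {g : intClosure k z} (hg0 : g ≠ 0) (hg : Ideal.span {g} = RingHom.ker y * J ^ ℓ)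
    {x : Lˣ} (hx : (x : L) = g) : x ∈ regularUnits ℓ y' := by
  have hyp : (RingHom.ker y').IsPrime := (ker_isMaximal y').isPrime
  obtain ⟨c, d, u, hc0, hd, hdu, K, hK, hKu⟩ := h.exists_local_factor hg0 hg y'
  have hcL : (c : L) ≠ 0 := fun h0 ↦ hc0 (Subtype.ext h0)
  refine mem_regularUnits.mpr ⟨(Units.mk0 (c : L) hcL)⁻¹, u, d ^ ℓ, fun hu ↦ ?_, ?_, ?_⟩
  · have h1 : Ideal.span {d ^ ℓ} * RingHom.ker y ≤ RingHom.ker y' := by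
      rw [← hKu]
      exact Ideal.mul_le_left.trans ((Ideal.span_singleton_le_iff_mem _).mpr hu)
    rcases hyp.mul_le.mp h1 with h2 | h2
    · rw [Ideal.span_singleton_le_iff_mem, RingHom.mem_ker, map_pow] at h2
      exact pow_ne_zero ℓ hd h2
    · exact hyy (algHom_eq_of_ker_le h2)
  · rw [map_pow]
    exact pow_ne_zero ℓ hd
  · have := congrArg (Subtype.val : intClosure k z → L) hdu
    push_cast at this
    rw [Units.val_mul, Units.val_pow_eq_pow_val, Units.val_inv_eq_inv_val, Units.val_mk0, hx,
      inv_pow]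
    push_cast
    field_simp
    linear_combination this

theorem IsSepGen.exists_zpow_mul_mem_regularUnits (h : IsSepGen k z) {ℓ : ℕ}
    {y : intClosure k z →ₐ[k] k} {J : Ideal (intClosure k z)}
    {g : intClosure k z} (hg0 : g ≠ 0) (hg : Ideal.span {g} = RingHom.ker y * J ^ ℓ)
    {x : Lˣ} (hx : (x : L) = g) (β : Lˣ) : ∃ n : ℤ, β * x ^ n ∈ regularUnits ℓ y := by
  have := h.isDedekindDomain
  have hyp : (RingHom.ker y).IsPrime := (ker_isMaximal y).isPrime
  obtain ⟨c, d, u, hc0, hd, hdu, K, hK, hKu⟩ := h.exists_local_factor hg0 hg y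
  have hd0 : d ≠ 0 := fun h0 ↦ hd (by rw [h0, map_zero])
  have hu0 : u ≠ 0 := by
    rintro rfl
    rw [mul_zero] at hdu
    exact mul_ne_zero (pow_ne_zero ℓ hd0) hg0 hdu
  have hdℓ : d ^ ℓ ∉ RingHom.ker y := by
    rw [RingHom.mem_ker, map_pow]
    exact pow_ne_zero ℓ hd
  have hu1 : u ∈ RingHom.ker y := by
    have h1 : Ideal.span {u} * K ^ ℓ ≤ RingHom.ker y := by
      rw [hKu]
      exact Ideal.mul_le_right
    rcases hyp.mul_le.mp h1 with h2 | h2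
    · exact (Ideal.span_singleton_le_iff_mem _).mp h2
    · exact absurd (hyp.le_of_pow_le h2) hK
  have hu2 : u ∉ RingHom.ker y ^ 2 := by
    intro hu2
    have h1 : Ideal.span {d ^ ℓ} * RingHom.ker y ≤ RingHom.ker y ^ 2 := by
      rw [← hKu]
      exact Ideal.mul_le_left.trans ((Ideal.span_singleton_le_iff_mem _).mpr hu2)
    rw [← Ideal.dvd_iff_le, sq] at h1
    have h2 := (mul_dvd_mul_iff_right (h.ker_ne_bot y)).mp h1
    rw [Ideal.dvd_span_singleton] at h2
    exact hdℓ h2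
  have huL : (u : L) ≠ 0 := fun h0 ↦ hu0 (Subtype.ext h0)
  have hcL : (c : L) ≠ 0 := fun h0 ↦ hc0 (Subtype.ext h0)
  have hdL : (d : L) ≠ 0 := fun h0 ↦ hd0 (Subtype.ext h0)
  obtain ⟨n, hn⟩ := h.exists_zpow_mul_mem_localUnits y (u := Units.mk0 (u : L) huL) rfl hu1 hu2 β
  have hxu : x = Units.mk0 (u : L) huL * (Units.mk0 (c : L) hcL / Units.mk0 (d : L) hdL) ^ ℓ := by
    ext
    have := congrArg (Subtype.val : intClosure k z → L) hdu
    push_cast at this ⊢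
    simp only [Units.val_mk0]
    rw [hx, div_pow]
    field_simp
    linear_combination this
  refine ⟨n, ?_⟩
  rw [hxu, mul_zpow, ← mul_assoc]
  exact mul_mem (localUnits_le_regularUnits _ _ hn) (zpow_mem (pow_mem_regularUnits _ _ _) _)

variable [Group P] {ρ : P →* (L ≃ₐ[k] L)}

theorem unitsAction_mem_regularUnits {ℓ : ℕ} (hz : ∀ p, ρ p z = z)
    {y : intClosure k z →ₐ[k] k} (p : P) {x : Lˣ}
    (hx : x ∈ regularUnits ℓ (y.comp (intClosureHom (ρ p) (hz p)))) :
    unitsAction ρ p x ∈ regularUnits ℓ y := by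
  obtain ⟨c, s₁, s₂, h1, h2, h⟩ := mem_regularUnits.mp hx
  refine mem_regularUnits.mpr ⟨unitsAction ρ p c, intClosureHom (ρ p) (hz p) s₁,
    intClosureHom (ρ p) (hz p) s₂, h1, h2, ?_⟩
  rw [← map_pow, ← map_mul, coe_unitsAction, coe_intClosureHom, coe_intClosureHom, ← map_mul, h]

/-- A class in `Lˣ / (Lˣ) ^ ℓ` fixed by `P` becomes everywhere regular after multiplication by an
element fixed by `P`. -/
theorem IsSepGen.exists_mul_mem_regularUnits [IsAlgClosed k] [Finite P] (h : IsSepGen k z)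
    (hz : ∀ p, ρ p z = z) (hfree : ∀ (y : intClosure k z →ₐ[k] k) p, InertAt y (ρ p) → p = 1)
    {ℓ : ℕ} (hℓ : (ℓ : k) ≠ 0) (β : Lˣ) (hβ : ∀ p, ∃ c, unitsAction ρ p β = β * c ^ ℓ) :
    ∃ N : Lˣ, (∀ p, unitsAction ρ p N = N) ∧ ∀ y : intClosure k z →ₐ[k] k,
      β * N ∈ regularUnits ℓ y := by
  classical
  have := Fintype.ofFinite P
  have hfin (β : Lˣ) : {y : intClosure k z →ₐ[k] k | β ∉ regularUnits ℓ y}.Finite :=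
    (h.finite_setOf_notMem_localUnits β).subset
      fun y hy hy' ↦ hy (localUnits_le_regularUnits _ _ hy')
  induction hn : {y : intClosure k z →ₐ[k] k | β ∉ regularUnits ℓ y}.ncard using
    Nat.strong_induction_on generalizing β with
  | _ n ih =>
  by_cases hbad : ∀ y : intClosure k z →ₐ[k] k, β ∈ regularUnits ℓ y
  · exact ⟨1, by simp, by simpa using hbad⟩
  push Not at hbad
  obtain ⟨y, hy⟩ := hbad
  obtain ⟨g, hg0, J, hg⟩ := h.exists_eq_ker_mul_pow hℓ y
  have hgL : (g : L) ≠ 0 := fun h0 ↦ hg0 (Subtype.ext h0)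
  set x : Lˣ := Units.mk0 (g : L) hgL with hx
  have hne (y' : intClosure k z →ₐ[k] k) (hyy : y ≠ y') : x ∈ regularUnits ℓ y' :=
    h.mem_regularUnits_of_ne hyy hg0 hg rfl
  obtain ⟨m, hm⟩ := h.exists_zpow_mul_mem_regularUnits hg0 hg (x := x) rfl β
  set N := ∏ p : P, unitsAction ρ p x with hN
  have hNfix (q : P) : unitsAction ρ q N = N := by
    rw [hN, map_prod]
    simp_rw [← MulAut.mul_apply, ← map_mul]
    exact Fintype.prod_equiv (Equiv.mulLeft q) _ _ fun _ ↦ rfl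
  have hNfix' (q : P) (n : ℤ) : unitsAction ρ q (N ^ n) = N ^ n := by rw [map_zpow, hNfix]
  have hact (p : P) (y' : intClosure k z →ₐ[k] k)
      (hyp : y ≠ y'.comp (intClosureHom (ρ p) (hz p))) :
      unitsAction ρ p x ∈ regularUnits ℓ y' :=
    unitsAction_mem_regularUnits hz p (hne _ hyp)
  set β' := β * N ^ m with hβ'
  have hβ'c : ∀ p, ∃ c, unitsAction ρ p β' = β' * c ^ ℓ := by
    intro p
    obtain ⟨c, hc⟩ := hβ p
    exact ⟨c, by rw [hβ', map_mul, hNfix', hc, mul_right_comm]⟩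
  have hyβ' : β' ∈ regularUnits ℓ y := by
    have h1 : N = x * ∏ p ∈ Finset.univ.erase 1, unitsAction ρ p x := by
      rw [hN, ← Finset.mul_prod_erase _ _ (Finset.mem_univ (1 : P)), map_one, MulAut.one_apply]
    rw [hβ', h1, mul_zpow, ← mul_assoc]
    refine mul_mem hm (zpow_mem (prod_mem fun p hp ↦ hact p y fun hyp ↦ ?_) m)
    exact (Finset.mem_erase.mp hp).1 (hfree y p ((inertAt_iff y _ (hz p)).mpr hyp.symm))
  have hsub : {y : intClosure k z →ₐ[k] k | β' ∉ regularUnits ℓ y} ⊂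
      {y | β ∉ regularUnits ℓ y} := by
    refine (Set.ssubset_iff_of_subset fun y' hy' ↦ ?_).mpr ⟨y, hy, not_not.mpr hyβ'⟩
    by_contra hgood
    rw [Set.mem_ofPred_eq, not_not] at hgood
    by_cases horb : ∃ p, y = y'.comp (intClosureHom (ρ p) (hz p))
    · obtain ⟨p, hp⟩ := horb
      have h1 : unitsAction ρ p β' ∈ regularUnits ℓ y' :=
        unitsAction_mem_regularUnits hz p (hp ▸ hyβ')
      obtain ⟨c, hc⟩ := hβ'c p
      rw [hc] at h1
      exact hy' ((mul_mem_cancel_right (pow_mem_regularUnits ℓ y' c)).mp h1)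
    · push Not at horb
      exact hy' (mul_mem hgood (zpow_mem (prod_mem fun p _ ↦ hact p y' (horb p)) m))
  obtain ⟨N', hN'1, hN'2⟩ := ih _ (hn ▸ Set.ncard_lt_ncard hsub (hfin β)) β' hβ'c rfl
  exact ⟨N ^ m * N', fun p ↦ by rw [map_mul, hNfix', hN'1], fun y ↦ by
    rw [← mul_assoc]; exact hN'2 y⟩

/-- A central extension of `P` with kernel of order `ℓ` is described by an everywhere unramified
Kummer cocycle. -/
theorem IsSepGen.exists_kummer_cocycle [IsAlgClosed k] [Finite P] (h : IsSepGen k z)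
    (hz : ∀ p, ρ p z = z) (hρ : Function.Injective ρ)
    (hfree : ∀ (y : intClosure k z →ₐ[k] k) p, InertAt y (ρ p) → p = 1)
    {ℓ : ℕ} (hℓ' : ℓ.Prime) (hℓ : (ℓ : k) ≠ 0) (hP : IsPGroup ℓ P) {E : Type*} [Group E]
    {π : E →* P} (hπ : Function.Surjective π) (hcen : π.ker ≤ Subgroup.center E)
    (hcard : Nat.card π.ker = ℓ) :
    ∃ (j : π.ker →* kˣ) (a : E → Lˣ) (β : Lˣ), Function.Injective j ∧
      (∀ w, j w ^ ℓ = 1) ∧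
      (∀ e e', a (e * e') = a e * unitsAction ρ (π e) (a e')) ∧
      (∀ w : π.ker, (a w : L) = algebraMap k L (j w)) ∧
      (∀ e, unitsAction ρ (π e) β = β * a e ^ ℓ) ∧
      ∀ y : intClosure k z →ₐ[k] k, β ∈ regularUnits ℓ y := by
  have : Fact ℓ.Prime := ⟨hℓ'⟩
  have : NeZero (ℓ : k) := ⟨hℓ⟩
  have hroots : Nat.card (rootsOfUnity ℓ k) = ℓ := HasEnoughRootsOfUnity.natCard_rootsOfUnity k ℓ
  let e₀ : π.ker ≃* rootsOfUnity ℓ k := mulEquivOfPrimeCardEq hcard hroots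
  let j : π.ker →* kˣ := (rootsOfUnity ℓ k).subtype.comp e₀.toMonoidHom
  have hj1 (w) : j w ^ ℓ = 1 := (e₀ w).2
  let jL : π.ker →* Lˣ := (Units.map (algebraMap k L : k →* L)).comp j
  obtain ⟨a, ha, haj⟩ := exists_crossed hP (hilbert90_unitsAction hρ)
    (normSurjective_unitsAction h hz hρ hℓ'.pos) hπ hcen jL (fun p w ↦ by
      ext
      exact (ρ p).commutes _)
  have hker (e : E) (w : π.ker) : a (e * w) ^ ℓ = a e ^ ℓ := by
    rw [ha, haj, mul_pow, ← map_pow, ← map_pow jL]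
    have : jL (w ^ ℓ) = 1 := by
      rw [map_pow]
      change Units.map _ (j w) ^ ℓ = 1
      rw [← map_pow, hj1, map_one]
    rw [this, map_one, mul_one]
  obtain ⟨s, hs⟩ := hπ.hasRightInverse
  have has (e : E) : a e ^ ℓ = a (s (π e)) ^ ℓ := by
    have := hker (s (π e)) ⟨(s (π e))⁻¹ * e, by simp [MonoidHom.mem_ker, hs (π e)]⟩
    rw [← this]
    simp
  obtain ⟨β, hβ⟩ := hilbert90_unitsAction hρ ⊤ (fun q ↦ a (s q) ^ ℓ) (fun q _ q' _ ↦ by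
    have h1 := has (s q * s q')
    rw [map_mul, hs, hs] at h1
    rw [← h1, ha, mul_pow, hs, map_pow])
  have hβ' (e : E) : unitsAction ρ (π e) β = β * a e ^ ℓ := by
    rw [has, hβ _ (Subgroup.mem_top _)]
    simp
  obtain ⟨N, hN1, hN2⟩ := h.exists_mul_mem_regularUnits hz hfree hℓ β (fun p ↦ by
    obtain ⟨e, rfl⟩ := hπ p
    exact ⟨a e, hβ' e⟩)
  refine ⟨j, a, β * N, Subtype.val_injective.comp e₀.injective, hj1, ha, fun w ↦ ?_, fun e ↦ ?_,
      hN2⟩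
  · rw [haj]
    rfl
  · rw [map_mul, hN1, hβ', mul_right_comm]

end Kummer

section ArtinSchreier

variable {k L P : Type*} [Field k] [Field L] [Algebra k L] {z : L} [Group P]
  {ρ : P →* (L ≃ₐ[k] L)}

theorem map_mem_intClosure (hz : ∀ p, ρ p z = z) (p : P) {x : L} (hx : x ∈ intClosure k z) :
    ρ p x ∈ intClosure k z := (intClosureHom (ρ p) (hz p) ⟨x, hx⟩).2

/-- An action that is free on places admits an integral element of trace one. -/
theorem IsSepGen.exists_trace_eq_one [IsAlgClosed k] [Fintype P] (h : IsSepGen k z)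
    (hz : ∀ p, ρ p z = z)
    (hfree : ∀ (y : intClosure k z →ₐ[k] k) p, InertAt y (ρ p) → p = 1) :
    ∃ θ ∈ intClosure k z, ∑ p, ρ p θ = 1 := by
  have hft := h.finiteType
  let A : Subalgebra k (intClosure k z) :=
    { carrier := {x | ∀ p, ρ p x = x}
      mul_mem' := fun {x y} hx hy p ↦ by
        push_cast
        rw [map_mul, hx p, hy p]
      add_mem' := fun {x y} hx hy p ↦ by
        push_cast
        rw [map_add, hx p, hy p]
      algebraMap_mem' := fun c p ↦ (ρ p).commutes c }
  have hInt : Algebra.IsIntegral A (intClosure k z) := by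
    constructor
    rintro ⟨x, hx⟩
    obtain ⟨Q, hQ, hQx⟩ := mem_intClosure_iff_exists.mp hx
    let zA : A := ⟨⟨z, self_mem_intClosure z⟩, hz⟩
    refine ⟨Q.map (Polynomial.aeval (R := k) zA).toRingHom, hQ.map _, ?_⟩
    apply Subtype.val_injective
    rw [Polynomial.eval₂_map]
    have hc : ((intClosure k z).val : intClosure k z →+* L).comp
        ((algebraMap A (intClosure k z)).comp
        (Polynomial.aeval (R := k) zA).toRingHom) = (Polynomial.aeval (R := k) z).toRingHom := by
      apply Polynomial.ringHom_ext
      · intro c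
        simp
      · simp
        rfl
    have := Polynomial.hom_eval₂ Q ((algebraMap A (intClosure k z)).comp
        (Polynomial.aeval (R := k) zA).toRingHom) ((intClosure k z).val : intClosure k z →+* L)
        ⟨x, hx⟩
    rw [hc] at this
    exact this.trans hQx
  let act (p : P) : intClosure k z →ₐ[k] intClosure k z := intClosureHom (ρ p) (hz p)
  let tr (x : intClosure k z) : intClosure k z := ∑ p, act p x
  have htr (x) : (tr x : L) = ∑ p, ρ p x := by
    change (intClosure k z).val (tr x) = _
    rw [map_sum]
    rfl
  have htrA (x) : tr x ∈ A := by
    intro q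
    rw [htr, map_sum]
    simp_rw [← AlgEquiv.mul_apply, ← map_mul]
    exact Fintype.sum_equiv (Equiv.mulLeft q) _ _ fun _ ↦ rfl
  let I : Ideal A :=
    { carrier := {x | ∃ b, tr b = x}
      zero_mem' := ⟨0, by simp [tr]⟩
      add_mem' := by
        rintro _ _ ⟨b, hb⟩ ⟨c, hc⟩
        exact ⟨b + c, by simp [tr, Finset.sum_add_distrib, ← hb, ← hc]⟩
      smul_mem' := by
        rintro r _ ⟨b, hb⟩
        refine ⟨r * b, ?_⟩
        rw [smul_eq_mul, Subalgebra.coe_mul, ← hb]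
        apply Subtype.ext
        push_cast
        rw [htr, htr, Finset.mul_sum]
        refine Finset.sum_congr rfl fun p _ ↦ ?_
        push_cast
        rw [map_mul, r.2 p] }
  by_cases hI : I = ⊤
  · have h1 : (1 : A) ∈ I := hI ▸ Submodule.mem_top
    obtain ⟨b, hb⟩ := h1
    refine ⟨b, b.2, ?_⟩
    rw [← htr, hb]
    rfl
  exfalso
  obtain ⟨M, hM, hIM⟩ := Ideal.exists_le_maximal I hI
  obtain ⟨Q, hQ, hQM⟩ := Ideal.exists_ideal_over_maximal_of_isIntegral
    (S := intClosure k z) M (fun x hx ↦ by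
      have : x = 0 := Subtype.val_injective hx
      rw [this]
      exact M.zero_mem)
  obtain ⟨y, hy⟩ := exists_algHom_ker_eq (k := k) Q
  have hzero (x : intClosure k z) : y (tr x) = 0 := by
    have : (⟨tr x, htrA x⟩ : A) ∈ M := hIM ⟨x, rfl⟩
    rw [← hQM, Ideal.mem_comap, ← hy] at this
    exact this
  have hinj : Function.Injective fun p : P ↦ (((y.comp (act p) : intClosure k z →ₐ[k] k) :
      intClosure k z →* k)) := by
    intro p q hpq
    have h1 : p⁻¹ * q = 1 := by
      refine hfree (y.comp (act p)) _ fun x x' hx ↦ ?_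
      have h2 : act q x = act p x' := by
        apply Subtype.ext
        simp only [act, coe_intClosureHom]
        rw [← hx, ← AlgEquiv.mul_apply, ← map_mul, mul_inv_cancel_left]
      rw [AlgHom.comp_apply, ← h2]
      exact (DFunLike.congr_fun hpq x).symm
    rwa [inv_mul_eq_one] at h1
  have hli := (linearIndependent_monoidHom (intClosure k z) k).comp _ hinj
  refine one_ne_zero (Fintype.linearIndependent_iff.mp hli (fun _ ↦ 1) ?_ 1)
  ext x
  rw [Finset.sum_apply]
  have := hzero x
  simp only [tr, map_sum] at this
  simpa using this

/-- A central extension of `P` with kernel of order `p` is described by an everywhere unramified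
Artin-Schreier cocycle. -/
theorem IsSepGen.exists_artinSchreier_cocycle [IsAlgClosed k] [Finite P] (h : IsSepGen k z)
    (hz : ∀ p, ρ p z = z)
    (hfree : ∀ (y : intClosure k z →ₐ[k] k) p, InertAt y (ρ p) → p = 1)
    {ℓ : ℕ} (hℓ : ℓ.Prime) [CharP k ℓ] {E : Type*} [Group E]
    {π : E →* P} (hπ : Function.Surjective π) (hcen : π.ker ≤ Subgroup.center E)
    (hcard : Nat.card π.ker = ℓ) :
    ∃ (j : π.ker → k) (a : E → L) (β : L), Function.Injective j ∧
      (∀ w w', j (w * w') = j w + j w') ∧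
      (∀ w, j w ^ ℓ = j w) ∧
      (∀ e e', a (e * e') = a e + ρ (π e) (a e')) ∧
      (∀ w : π.ker, a w = algebraMap k L (j w)) ∧
      (∀ e, a e ∈ intClosure k z) ∧ β ∈ intClosure k z ∧
      ∀ e, ρ (π e) β - β = a e ^ ℓ - a e := by
  have : Fact ℓ.Prime := ⟨hℓ⟩
  have := Fintype.ofFinite P
  have : CharP L ℓ := charP_of_injective_algebraMap (algebraMap k L).injective ℓ
  obtain ⟨θ, hθ, htr⟩ := h.exists_trace_eq_one hz hfree
  let e₀ : π.ker ≃* Multiplicative (ZMod ℓ) := mulEquivOfPrimeCardEq hcard (by simp)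
  let j (w : π.ker) : k := ZMod.castHom (dvd_refl ℓ) k (e₀ w).toAdd
  have hjinj : Function.Injective j := fun w w' hw ↦
    e₀.injective (Multiplicative.toAdd.injective ((ZMod.castHom (dvd_refl ℓ) k).injective hw))
  have hjmul (w w') : j (w * w') = j w + j w' := by simp [j]
  have hjpow (w) : j w ^ ℓ = j w := by
    simp only [j]
    rw [← map_pow, ZMod.pow_card]
  obtain ⟨s, hs⟩ := hπ.hasRightInverse
  have hH (e : E) (τ : P) : (s (π e * τ))⁻¹ * (e * s τ) ∈ π.ker := by
    rw [MonoidHom.mem_ker]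
    simp [hs _]
  let H (e : E) (τ : P) : π.ker := ⟨_, hH e τ⟩
  have hHe (e τ) : s (π e * τ) * (H e τ : E) = e * s τ := mul_inv_cancel_left _ _
  have hHmul (e e' τ) : H (e * e') τ = H e (π e' * τ) * H e' τ := by
    apply Subtype.ext
    apply mul_left_cancel (a := s (π (e * e') * τ))
    rw [hHe, Subgroup.coe_mul, map_mul, mul_assoc (π e), ← mul_assoc, hHe, mul_assoc e e',
      mul_assoc e (s _), hHe]
  let a (e : E) : L := ∑ τ, algebraMap k L (j (H e τ)) * ρ (π e * τ) θ
  have ha (e e') : a (e * e') = a e + ρ (π e) (a e') := by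
    simp only [a, hHmul, hjmul, map_add, add_mul, Finset.sum_add_distrib]
    congr 1
    · exact Fintype.sum_equiv (Equiv.mulLeft (π e')) _ _ fun τ ↦ by
        simp [mul_assoc]
    · rw [map_sum]
      refine Finset.sum_congr rfl fun τ _ ↦ ?_
      rw [map_mul (ρ (π e)), AlgEquiv.commutes, ← AlgEquiv.mul_apply, ← map_mul, map_mul π,
          mul_assoc]
  have haj (w : π.ker) : a w = algebraMap k L (j w) := by
    have hHw (τ) : H w τ = w := by
      apply Subtype.ext
      apply mul_left_cancel (a := s (π w * τ))
      rw [hHe, show π (w : E) = 1 from w.2, one_mul, Subgroup.mem_center_iff.mp (hcen w.2)]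
    simp only [a, hHw, show π (w : E) = 1 from w.2, one_mul]
    rw [← Finset.mul_sum, htr, mul_one]
  have hamem (e) : a e ∈ intClosure k z := by
    refine Subalgebra.sum_mem _ fun τ _ ↦ Subalgebra.mul_mem _ (Subalgebra.algebraMap_mem _ _) ?_
    exact map_mem_intClosure hz _ hθ
  have hsub (x y : L) : (x + y) ^ ℓ - (x + y) = (x ^ ℓ - x) + (y ^ ℓ - y) := by
    rw [add_pow_char]
    ring
  have has (e : E) : a e ^ ℓ - a e = a (s (π e)) ^ ℓ - a (s (π e)) := by
    let w : π.ker := ⟨(s (π e))⁻¹ * e, by simp [MonoidHom.mem_ker, hs (π e)]⟩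
    have h1 : a e = a (s (π e)) + algebraMap k L (j w) := by
      have := ha (s (π e)) w
      rwa [haj, AlgEquiv.commutes, show s (π e) * w = e from mul_inv_cancel_left _ _] at this
    rw [h1, hsub, ← map_pow, hjpow, sub_self, add_zero]
  let c (q : P) : L := a (s q) ^ ℓ - a (s q)
  have hc (q q' : P) : c (q * q') = c q + ρ q (c q') := by
    have h1 := has (s q * s q')
    rw [map_mul, hs, hs, ha, hsub, hs] at h1
    simp only [c]
    rw [← h1, map_sub, map_pow]
  have hcmem (q) : c q ∈ intClosure k z :=
    Subalgebra.sub_mem _ (Subalgebra.pow_mem _ (hamem _) _) (hamem _)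
  refine ⟨j, a, -∑ q, c q * ρ q θ, hjinj, hjmul, hjpow, ha, haj, hamem, ?_, fun e ↦ ?_⟩
  · exact Subalgebra.neg_mem _ (Subalgebra.sum_mem _ fun q _ ↦
      Subalgebra.mul_mem _ (hcmem q) (map_mem_intClosure hz _ hθ))
  · rw [has e]
    change _ = c (π e)
    have h1 : ∑ q, c q * ρ q θ = ρ (π e) (∑ q, c q * ρ q θ) + c (π e) * ∑ q, ρ q θ := by
      have e1 : ∑ q, c q * ρ q θ = ∑ q, c (π e * q) * ρ (π e * q) θ :=
        (Fintype.sum_equiv (Equiv.mulLeft (π e)) _ _ fun _ ↦ rfl).symm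
      have e2 : ∑ q, ρ q θ = ∑ q, ρ (π e * q) θ :=
        (Fintype.sum_equiv (Equiv.mulLeft (π e)) _ _ fun _ ↦ rfl).symm
      rw [e2]
      refine e1.trans ?_
      rw [map_sum, Finset.mul_sum, ← Finset.sum_add_distrib]
      refine Finset.sum_congr rfl fun q _ ↦ ?_
      rw [hc, map_mul (ρ (π e)), map_mul ρ, AlgEquiv.mul_apply]
      ring
    rw [htr, mul_one] at h1
    rw [map_neg]
    linear_combination h1

end ArtinSchreier

section Transitive

variable {k F Ω : Type*} [Field k] [Field F] [Field Ω] [Algebra k F] [Algebra F Ω] [Algebra k Ω]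
  [IsScalarTower k F Ω] [IsGalois F Ω] {z : Ω}

/-- The Galois group acts transitively on the places above a given place. -/
theorem exists_galois_conj (hz : ∀ n : Ω ≃ₐ[F] Ω, n z = z) (Y Y' : intClosure k z →ₐ[k] k)
    (hY : ∀ (x : intClosure k z) (a : F), algebraMap F Ω a = x → Y x = Y' x) :
    ∃ n : Ω ≃ₐ[F] Ω, ∀ x x' : intClosure k z, n x = x' → Y' x' = Y x := by
  let act (n : Ω ≃ₐ[F] Ω) : intClosure k z →ₐ[k] intClosure k z :=
    intClosureHom (n.restrictScalars k) (hz n)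
  have hact (n : Ω ≃ₐ[F] Ω) (x : intClosure k z) : (act n x : Ω) = n x := rfl
  let : MulSemiringAction (Ω ≃ₐ[F] Ω) (intClosure k z) :=
    { smul := fun n x ↦ act n x
      one_smul := fun x ↦ Subtype.ext rfl
      mul_smul := fun m n x ↦ Subtype.ext rfl
      smul_zero := fun n ↦ map_zero (act n)
      smul_add := fun n ↦ map_add (act n)
      smul_one := fun n ↦ map_one (act n)
      smul_mul := fun n ↦ map_mul (act n) }
  have hsmul (n : Ω ≃ₐ[F] Ω) (x : intClosure k z) : ((n • x : intClosure k z) : Ω) = n x := rfl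
  have : SMulCommClass (Ω ≃ₐ[F] Ω) k (intClosure k z) :=
    ⟨fun n c x ↦ (map_smul (act n) c x)⟩
  let : TopologicalSpace (intClosure k z) := ⊥
  have : DiscreteTopology (intClosure k z) := ⟨rfl⟩
  have : ContinuousSMul (Ω ≃ₐ[F] Ω) (intClosure k z) := by
    rw [continuousSMul_iff_stabilizer_isOpen]
    intro x
    have := stabilizer_isOpen_of_isIntegral (K := F) (x : Ω)
    convert this using 1
    ext n
    simp only [SetLike.mem_coe, MulAction.mem_stabilizer_iff, Subtype.ext_iff]
    rfl
  let A := FixedPoints.subalgebra k (intClosure k z) (Ω ≃ₐ[F] Ω)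
  have : Algebra.IsInvariant A (intClosure k z) (Ω ≃ₐ[F] Ω) := ⟨fun b hb ↦ ⟨⟨b, hb⟩, rfl⟩⟩
  have h1 := (ker_isMaximal Y).isPrime
  have h2 := (ker_isMaximal Y').isPrime
  have hu : (RingHom.ker Y).under A = (RingHom.ker Y').under A := by
    ext ⟨x, hx⟩
    obtain ⟨a, ha⟩ := (InfiniteGalois.mem_range_algebraMap_iff_fixed (k := F) (x : Ω)).mpr
      fun f ↦ congrArg Subtype.val (hx f)
    change Y x = 0 ↔ Y' x = 0
    rw [hY x a ha]
  obtain ⟨g, hg⟩ := Algebra.IsInvariant.exists_smul_of_under_eq_of_profinite (A := A)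
    (G := Ω ≃ₐ[F] Ω) (RingHom.ker Y) (RingHom.ker Y') hu
  refine ⟨g, ?_⟩
  have : Y = Y'.comp (act g) := by
    apply algHom_eq_of_ker_le
    intro x hx
    have : g • x ∈ RingHom.ker Y' := by
      rw [hg]
      exact Ideal.smul_mem_pointwise_smul _ _ _ hx
    exact this
  intro x x' hx
  rw [this]
  exact congrArg Y' (Subtype.ext hx.symm)

end Transitive

section Extension

variable {k L Ω : Type*} [Field k] [Field L] [Field Ω] [Algebra k L] [Algebra L Ω] [Algebra k Ω]
  [IsScalarTower k L Ω] {z : L}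

/-- Places extend along algebraic extensions. -/
theorem exists_place_extension [IsAlgClosed k] [Algebra.IsAlgebraic L Ω]
    (y : intClosure k z →ₐ[k] k) {z' : Ω} (hz' : algebraMap L Ω z = z') :
    ∃ Y : intClosure k z' →ₐ[k] k, ∀ (x : intClosure k z) (x' : intClosure k z'),
      algebraMap L Ω x = x' → Y x' = y x := by
  subst hz'
  let ι : intClosure k z →ₐ[k] intClosure k (algebraMap L Ω z) :=
    ((IsScalarTower.toAlgHom k L Ω).comp (intClosure k z).val).codRestrict _ fun x ↦
      (map_mem_intClosure_iff (z := z) (x := (x : L)) (IsScalarTower.toAlgHom k L Ω)).mpr x.2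
  have hι : Function.Injective ι := fun a b hab ↦ Subtype.ext
    ((algebraMap L Ω).injective (congrArg Subtype.val hab))
  let := ι.toRingHom.toAlgebra
  have hInt : Algebra.IsIntegral (intClosure k z) (intClosure k (algebraMap L Ω z)) := by
    constructor
    rintro ⟨x, hx⟩
    obtain ⟨Q, hQ, hQx⟩ := mem_intClosure_iff_exists.mp hx
    let zA : intClosure k z := ⟨z, self_mem_intClosure z⟩
    refine ⟨Q.map (Polynomial.aeval (R := k) zA).toRingHom, hQ.map _, ?_⟩
    apply Subtype.val_injective
    rw [Polynomial.eval₂_map]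
    have hc : ((intClosure k (algebraMap L Ω z)).val : _ →+* Ω).comp (ι.toRingHom.comp
        (Polynomial.aeval (R := k) zA).toRingHom)
        = (Polynomial.aeval (R := k) (algebraMap L Ω z)).toRingHom := by
      apply Polynomial.ringHom_ext
      · intro c
        simp
      · simp
        rfl
    have := Polynomial.hom_eval₂ Q (ι.toRingHom.comp (Polynomial.aeval (R := k) zA).toRingHom)
      ((intClosure k (algebraMap L Ω z)).val : _ →+* Ω) ⟨x, hx⟩
    rw [hc] at this
    exact this.trans hQx
  have := ker_isMaximal y
  obtain ⟨M, hM, hMy⟩ := Ideal.exists_ideal_over_maximal_of_isIntegral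
    (S := intClosure k (algebraMap L Ω z)) (RingHom.ker y) (by
      rw [(RingHom.injective_iff_ker_eq_bot _).mp
          (show Function.Injective (algebraMap (intClosure k z)
        (intClosure k (algebraMap L Ω z))) from hι)]
      exact bot_le)
  let := Ideal.Quotient.field M
  have hres : Algebra.IsIntegral k (intClosure k (algebraMap L Ω z) ⧸ M) := by
    constructor
    intro r
    obtain ⟨x, rfl⟩ := Ideal.Quotient.mk_surjective r
    obtain ⟨P, hP, hPx⟩ := hInt.isIntegral x
    refine ⟨P.map (y : intClosure k z →+* k), hP.map _, ?_⟩
    rw [Polynomial.eval₂_map]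
    have hc : (algebraMap k (intClosure k (algebraMap L Ω z) ⧸ M)).comp (y : intClosure k z →+* k)
        = (Ideal.Quotient.mk M).comp (algebraMap (intClosure k z) _) := by
      ext a
      have ha : a - algebraMap k _ (y a) ∈ RingHom.ker y := by simp [RingHom.mem_ker]
      rw [← hMy, Ideal.mem_comap, ← Ideal.Quotient.eq_zero_iff_mem, map_sub, map_sub,
        sub_eq_zero] at ha
      refine Eq.trans ?_ ha.symm
      change Ideal.Quotient.mk M (algebraMap k _ (y a)) = Ideal.Quotient.mk M
          (ι (algebraMap k _ (y a)))
      rw [ι.commutes]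
    rw [hc, ← Polynomial.hom_eval₂, hPx, map_zero]
  have hb := IsAlgClosed.algebraMap_bijective_of_isIntegral (k := k)
    (K := intClosure k (algebraMap L Ω z) ⧸ M)
  let e := AlgEquiv.ofBijective (Algebra.ofId k (intClosure k (algebraMap L Ω z) ⧸ M)) hb
  let Y : intClosure k (algebraMap L Ω z) →ₐ[k] k :=
    (e.symm : _ →ₐ[k] k).comp (Ideal.Quotient.mkₐ k M)
  have hY : Y.comp ι = y := by
    symm
    apply algHom_eq_of_ker_le
    intro a ha
    rw [← hMy, Ideal.mem_comap] at ha
    change e.symm (Ideal.Quotient.mk M (ι a)) = 0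
    rw [Ideal.Quotient.eq_zero_iff_mem.mpr (show ι a ∈ M from ha), map_zero]
  refine ⟨Y, fun x x' hx ↦ ?_⟩
  rw [← hY]
  exact congrArg Y (Subtype.ext hx.symm)

end Extension

section SepGen

variable {k K L : Type*} [Field k] [Field K] [Field L] [Algebra k K] [Algebra K L] [Algebra k L]
  [IsScalarTower k K L] {t : K}

theorem IsSepGen.of_finite (h : IsSepGen k t) [FiniteDimensional K L] [Algebra.IsSeparable K L] :
    IsSepGen k (algebraMap K L t) := by
  have := h.finite
  have := h.separable
  have h1 : Module.Finite k⟮t⟯ L := Module.Finite.trans K L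
  have h2 : Algebra.IsSeparable k⟮t⟯ L := Algebra.IsSeparable.trans k⟮t⟯ K L
  refine ⟨fun halg ↦ h.transcendental
    ((isAlgebraic_algebraMap_iff (algebraMap K L).injective).mp halg), ?_, ?_⟩
  · exact Module.Finite.of_equiv_equiv (adjoinSimpleEquiv (F := L) t).toRingEquiv
      (RingEquiv.refl L) (by ext x; rfl)
  · exact Algebra.IsSeparable.of_equiv_equiv (adjoinSimpleEquiv (F := L) t).toRingEquiv
      (RingEquiv.refl L) (by ext x; rfl)

end SepGen

section Good

variable {k K Ω : Type*} [Field k] [Field K] [Field Ω] [Algebra k K] [Algebra K Ω] [Algebra k Ω]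
  [IsScalarTower k K Ω] {t : K}

/-- A homomorphism from a subgroup of a Galois group is good if it has open kernel and
kills all inertia groups over the affine line with coordinate `t`. -/
structure IsGood (k : Type*) {K Ω : Type*} [Field k] [Field K] [Field Ω] [Algebra k K]
    [Algebra K Ω] [Algebra k Ω] [IsScalarTower k K Ω] (t : K) {Γ' : Subgroup (Ω ≃ₐ[K] Ω)}
    {G : Type*} [Group G] (f : Γ' →* G) : Prop where
  isOpen : IsOpen ((f.ker.map Γ'.subtype : Subgroup (Ω ≃ₐ[K] Ω)) : Set (Ω ≃ₐ[K] Ω))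
  inert : ∀ (σ : Γ') (Y : intClosure k (algebraMap K Ω t) →ₐ[k] k),
    InertAt Y ((σ : Ω ≃ₐ[K] Ω).restrictScalars k) → f σ = 1

variable {Γ' : Subgroup (Ω ≃ₐ[K] Ω)} {P : Type*} [Group P]

/-- A good surjection is realised by a finite extension with a free action on places. -/
theorem IsGood.exists_finite_level [IsAlgClosed k] [IsGalois K Ω] (ht : IsSepGen k t) {f : Γ' →* P}
    (hf : IsGood k t f) (hsurj : Function.Surjective f) :
    ∃ (L : IntermediateField K Ω) (ρ : P →* (L ≃ₐ[k] L)), FiniteDimensional K L ∧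
      IsSepGen k (algebraMap K L t) ∧
      (∀ (σ : Γ') (x : L), ((ρ (f σ) x : L) : Ω) = (σ : Ω ≃ₐ[K] Ω) x) ∧
      Function.Injective ρ ∧ (∀ p, ρ p (algebraMap K L t) = algebraMap K L t) ∧
      (∀ (y : intClosure k (algebraMap K L t) →ₐ[k] k) p, InertAt y (ρ p) → p = 1) ∧
      (∀ σ : Ω ≃ₐ[K] Ω, (∀ x : L, σ x = x) → ∃ h : σ ∈ Γ', f ⟨σ, h⟩ = 1) ∧
      (∀ x : Ω, (∀ σ : Γ', f σ = 1 → (σ : Ω ≃ₐ[K] Ω) x = x) → x ∈ L) := by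
  let N : Subgroup (Ω ≃ₐ[K] Ω) := f.ker.map Γ'.subtype
  let L : IntermediateField K Ω := IntermediateField.fixedField N
  have hN : L.fixingSubgroup = N := InfiniteGalois.fixingSubgroup_fixedField
    (⟨N, Subgroup.isClosed_of_isOpen N hf.isOpen⟩ : ClosedSubgroup (Ω ≃ₐ[K] Ω))
  have hfin : FiniteDimensional K L := (InfiniteGalois.isOpen_iff_finite L).mp (hN ▸ hf.isOpen)
  have hmemL (x : Ω) : x ∈ L ↔ ∀ σ : Γ', f σ = 1 → (σ : Ω ≃ₐ[K] Ω) x = x := by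
    rw [IntermediateField.mem_fixedField_iff]
    constructor
    · intro h σ hσ
      exact h σ ⟨σ, hσ, rfl⟩
    · rintro h _ ⟨σ, hσ, rfl⟩
      exact h σ hσ
  have hstab (σ : Γ') (x : L) : (σ : Ω ≃ₐ[K] Ω) x ∈ L := by
    rw [hmemL]
    intro τ hτ
    have h1 := (hmemL x).mp x.2 (σ⁻¹ * τ * σ) (by simp [hτ])
    have h2 := congrArg (σ : Ω ≃ₐ[K] Ω) h1
    simp only [Subgroup.coe_mul, Subgroup.coe_inv, AlgEquiv.mul_apply] at h2
    rwa [← AlgEquiv.mul_apply (σ : Ω ≃ₐ[K] Ω), mul_inv_cancel, AlgEquiv.one_apply] at h2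
  let r₀ : Γ' →* (L →ₐ[k] L) :=
    { toFun := fun σ ↦ ((((σ : Ω ≃ₐ[K] Ω) : Ω →ₐ[K] Ω).comp L.val).restrictScalars k).codRestrict
        (L.toSubalgebra.restrictScalars k) (hstab σ)
      map_one' := by ext; rfl
      map_mul' := fun σ τ ↦ by ext; rfl }
  let r : Γ' →* (L ≃ₐ[k] L) :=
    (AlgEquiv.algHomUnitsEquiv k L).toMonoidHom.comp r₀.toHomUnits
  have hr (σ : Γ') (x : L) : ((r σ x : L) : Ω) = (σ : Ω ≃ₐ[K] Ω) x := rfl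
  let ρ : P →* (L ≃ₐ[k] L) := f.liftOfSurjective hsurj ⟨r, by
    intro σ hσ
    ext x
    rw [hr]
    exact (hmemL x).mp x.2 σ hσ⟩
  have hρ (σ : Γ') : ρ (f σ) = r σ := f.liftOfRightInverse_comp_apply _ _ _ σ
  have hρ' (σ : Γ') (x : L) : ((ρ (f σ) x : L) : Ω) = (σ : Ω ≃ₐ[K] Ω) x := by rw [hρ, hr]
  have hfix (σ : Ω ≃ₐ[K] Ω) (hσ : ∀ x : L, σ x = x) : ∃ h : σ ∈ Γ', f ⟨σ, h⟩ = 1 := by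
    have : σ ∈ N := by
      rw [← hN, IntermediateField.mem_fixingSubgroup_iff]
      exact fun x hx ↦ hσ ⟨x, hx⟩
    obtain ⟨τ, hτ, rfl⟩ := this
    exact ⟨τ.2, hτ⟩
  have htow : IsScalarTower k L Ω := IsScalarTower.of_algebraMap_eq fun c ↦ by
    rw [IsScalarTower.algebraMap_apply k K L, IsScalarTower.algebraMap_apply k K Ω]
    rfl
  have htop : algebraMap L Ω (algebraMap K L t) = algebraMap K Ω t := rfl
  have hsep := ht.of_finite (L := L)
  refine ⟨L, ρ, hfin, hsep, hρ', ?_, ?_, ?_, hfix, fun x hx ↦ (hmemL x).mpr hx⟩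
  · rw [injective_iff_map_eq_one]
    intro p hp
    obtain ⟨σ, rfl⟩ := hsurj p
    obtain ⟨h, h'⟩ := hfix σ fun x ↦ by rw [← hρ', hp]; rfl
    exact h'
  · intro p
    obtain ⟨σ, rfl⟩ := hsurj p
    apply Subtype.ext
    rw [hρ']
    exact (σ : Ω ≃ₐ[K] Ω).commutes t
  · intro y p hy
    obtain ⟨σ, rfl⟩ := hsurj p
    obtain ⟨Y, hY⟩ := exists_place_extension y htop
    have hz : ((σ : Ω ≃ₐ[K] Ω).restrictScalars k) (algebraMap K Ω t)
      = algebraMap K Ω t := (σ : Ω ≃ₐ[K] Ω).commutes t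
    have hzn (n : Ω ≃ₐ[L] Ω) : n (algebraMap K Ω t)
      = algebraMap K Ω t := n.commutes (algebraMap K L t)
    have hmap {a : L} : algebraMap L Ω a ∈ intClosure k (algebraMap K Ω t) ↔
        a ∈ intClosure k (algebraMap K L t) := by
      rw [← map_mem_intClosure_iff (IsScalarTower.toAlgHom k L Ω), IsScalarTower.toAlgHom_apply,
        IsScalarTower.toAlgHom_apply, htop]
    have key : ∀ (x : intClosure k (algebraMap K Ω t)) (a : L),
        algebraMap L Ω a = x → Y x = Y.comp (intClosureHom _ hz) x := by
      rintro ⟨_, hx⟩ a rfl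
      have ha : a ∈ intClosure k (algebraMap K L t) :=
        hmap.mp hx
      have ha' : ρ (f σ) a ∈ intClosure k (algebraMap K L t) := by
        refine hmap.mp ?_
        have := (intClosureHom _ hz ⟨_, hx⟩).2
        rw [coe_intClosureHom] at this
        convert! this using 1
        exact hρ' σ a
      rw [hY ⟨a, ha⟩ _ rfl, ← hy ⟨a, ha⟩ ⟨_, ha'⟩ rfl, ← hY ⟨_, ha'⟩ ⟨ρ (f σ) a, hmap.mpr ha'⟩ rfl]
      change _ = Y _
      congr 1
      exact Subtype.ext (hρ' σ a)
    obtain ⟨n, hn⟩ := exists_galois_conj hzn _ _ key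
    obtain ⟨h1, h2⟩ := hfix (n.restrictScalars K) fun x ↦ n.commutes x
    have h3 := hf.inert (σ * ⟨_, h1⟩) Y fun x x' hx ↦ by
      have hzn' : (n.restrictScalars k) (algebraMap K Ω t)
        = algebraMap K Ω t := hzn n
      have := hn x (intClosureHom _ hzn' x) rfl
      rw [← this, AlgHom.comp_apply]
      congr 1
      exact Subtype.ext hx.symm
    rwa [map_mul, h2, mul_one] at h3

end Good

section Abstract

theorem exists_lift_of_cocycle {Γ E P X : Type*} [Group Γ] [Group E] [Group P] {π : E →* P}
    {f : Γ →* P} (s : Γ → X) (a : E → X) (op : Γ → X → X → X)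
    (ha : ∀ σ e e', π e = f σ → a (e * e') = op σ (a e) (a e'))
    (hs : ∀ σ τ, s (σ * τ) = op σ (s σ) (s τ))
    (hex : ∀ σ, ∃ e, π e = f σ ∧ a e = s σ)
    (hinj : ∀ e e', π e = π e' → a e = a e' → e = e') :
    ∃ F : Γ →* E, (∀ σ, π (F σ) = f σ) ∧ ∀ σ, a (F σ) = s σ := by
  choose F hF hF' using hex
  refine ⟨MonoidHom.mk' F fun σ τ ↦ hinj _ _ ?_ ?_, hF, hF'⟩
  · rw [hF, map_mul, map_mul, hF, hF]
  · rw [hF', hs, ha σ _ _ (hF σ), hF', hF']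

theorem exists_eq_of_isRoot {R ι : Type*} [CommRing R] [IsDomain R] [Finite ι] {q : R[X]}
    (hq : q ≠ 0) (hcard : q.natDegree ≤ Nat.card ι) {j : ι → R} (hj : Function.Injective j)
    (hroot : ∀ w, q.IsRoot (j w)) {x : R} (hx : q.IsRoot x) : ∃ w, j w = x := by
  classical
  have := Fintype.ofFinite ι
  have h1 : Finset.univ.image j ⊆ q.roots.toFinset := by
    intro r hr
    obtain ⟨w, -, rfl⟩ := Finset.mem_image.mp hr
    simpa [hq] using hroot w
  have h2 : q.roots.toFinset.card ≤ (Finset.univ.image j).card := by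
    rw [Finset.card_image_of_injective _ hj, Finset.card_univ, ← Nat.card_eq_fintype_card]
    exact (Multiset.toFinset_card_le _).trans ((Polynomial.card_roots' q).trans hcard)
  have h3 := Finset.eq_of_subset_of_card_le h1 h2
  have h4 : x ∈ Finset.univ.image j := by
    rw [h3]
    simpa [hq] using hx
  obtain ⟨w, -, h⟩ := Finset.mem_image.mp h4
  exact ⟨w, h⟩

end Abstract

section Central

variable {k K Ω : Type*} [Field k] [Field K] [Field Ω] [Algebra k K] [Algebra K Ω] [Algebra k Ω]
  [IsScalarTower k K Ω] {t : K} {Γ' : Subgroup (Ω ≃ₐ[K] Ω)} {P E : Type*} [Group P] [Group E]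

/-- The kernel of a homomorphism is open if it contains the automorphisms fixing a finite extension
and an algebraic element. -/
theorem isOpen_ker_of_adjoin [Algebra.IsAlgebraic K Ω] (f : Γ' →* E) (L : IntermediateField K Ω)
    [FiniteDimensional K L] (x : Ω)
    (h : ∀ σ : Ω ≃ₐ[K] Ω, (∀ y : L, σ y = y) → σ x = x → ∃ hσ : σ ∈ Γ', f ⟨σ, hσ⟩ = 1) :
    IsOpen ((f.ker.map Γ'.subtype : Subgroup (Ω ≃ₐ[K] Ω)) : Set (Ω ≃ₐ[K] Ω)) := by
  have : FiniteDimensional K K⟮x⟯ :=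
    IntermediateField.adjoin.finiteDimensional (Algebra.IsIntegral.isIntegral x)
  refine Subgroup.isOpen_mono (H₁ := (L ⊔ K⟮x⟯).fixingSubgroup) ?_
    (IntermediateField.fixingSubgroup_isOpen (L ⊔ K⟮x⟯))
  intro σ hσ
  rw [IntermediateField.mem_fixingSubgroup_iff] at hσ
  obtain ⟨h1, h2⟩ := h σ (fun y ↦ hσ y ((le_sup_left : L ≤ L ⊔ K⟮x⟯) y.2))
    (hσ x ((le_sup_right : K⟮x⟯ ≤ L ⊔ K⟮x⟯) (IntermediateField.mem_adjoin_simple_self K x)))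
  exact ⟨⟨σ, h1⟩, h2, rfl⟩

/-- The restriction of a place to a subfield. -/
noncomputable def restrictPlace {L : IntermediateField K Ω}
    (Y : intClosure k (algebraMap K Ω t) →ₐ[k] k) :
    intClosure k (algebraMap K L t) →ₐ[k] k :=
  Y.comp (((L.val.restrictScalars k).comp (intClosure k (algebraMap K L t)).val).codRestrict
    (intClosure k (algebraMap K Ω t)) fun x ↦ (map_mem_intClosure_iff (z := algebraMap K L t)
      (x := (x : L)) (L.val.restrictScalars k)).mpr x.2)

theorem restrictPlace_apply {L : IntermediateField K Ω}
    (Y : intClosure k (algebraMap K Ω t) →ₐ[k] k)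
    (x : intClosure k (algebraMap K L t)) (x' : intClosure k (algebraMap K Ω t))
    (h : ((x : L) : Ω) = x') : restrictPlace Y x = Y x' :=
  congrArg Y (Subtype.ext h)

theorem coe_mem_intClosure {L : IntermediateField K Ω} {x : L}
    (hx : x ∈ intClosure k (algebraMap K L t)) :
    (x : Ω) ∈ intClosure k (algebraMap K Ω t) :=
  (map_mem_intClosure_iff (z := algebraMap K L t) (L.val.restrictScalars k)).mpr hx

/-- The `ℓ`-th roots of an element of `regularUnits` are unramified. -/
theorem eq_one_of_inertAt_of_pow_eq {L : IntermediateField K Ω} {ℓ : ℕ} (hℓ : 0 < ℓ)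
    {Y : intClosure k (algebraMap K Ω t) →ₐ[k] k} {σ : Ω ≃ₐ[K] Ω}
    (hY : InertAt Y (σ.restrictScalars k)) (hσ : ∀ x : L, σ x = x) {β : Lˣ}
    (hβ : β ∈ regularUnits ℓ (restrictPlace Y)) {y : Ω} (hy : y ^ ℓ = ((β : L) : Ω)) {c : k}
    (hc : σ y = algebraMap k Ω c * y) : c = 1 := by
  obtain ⟨d, s₁, s₂, hs1, hs2, hs⟩ := mem_regularUnits.mp hβ
  let S₁ : intClosure k (algebraMap K Ω t) := ⟨_, coe_mem_intClosure s₁.2⟩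
  let S₂ : intClosure k (algebraMap K Ω t) := ⟨_, coe_mem_intClosure s₂.2⟩
  rw [restrictPlace_apply Y s₁ S₁ rfl] at hs1
  rw [restrictPlace_apply Y s₂ S₂ rfl] at hs2
  have hsΩ : ((β : L) : Ω) * ((d : L) : Ω) ^ ℓ * S₂ = S₁ := by
    have := congrArg (Subtype.val : L → Ω) hs
    simpa using this
  have hT : (y * (d : L) * S₂) ^ ℓ =
      ((S₁ * S₂ ^ (ℓ - 1) : intClosure k (algebraMap K Ω t)) : Ω) := by
    rw [mul_pow, mul_pow, hy]
    conv_lhs => rw [show ℓ = (ℓ - 1) + 1 by omega]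
    push_cast
    rw [← hsΩ]
    conv_rhs => rw [show ((d : L) : Ω) ^ ℓ = ((d : L) : Ω) ^ ((ℓ - 1) + 1) by
      congr 1; omega]
    ring
  have hTint : y * (d : L) * S₂ ∈ intClosure k (algebraMap K Ω t) := by
    rw [mem_intClosure]
    refine IsIntegral.of_pow hℓ ?_
    rw [hT, ← mem_intClosure]
    exact (S₁ * S₂ ^ (ℓ - 1)).2
  let T : intClosure k (algebraMap K Ω t) := ⟨_, hTint⟩
  have hTpow : T ^ ℓ = S₁ * S₂ ^ (ℓ - 1) := Subtype.ext hT
  have hYT : Y T ≠ 0 := by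
    intro h0
    have := congrArg Y hTpow
    rw [map_pow, h0, zero_pow hℓ.ne', map_mul, map_pow] at this
    exact mul_ne_zero hs1 (pow_ne_zero _ hs2) this.symm
  have h6 := hY T (c • T) (by
    change σ (y * (d : L) * (s₂ : L)) = c • (y * (d : L) * (s₂ : L))
    rw [map_mul, map_mul, hσ, hσ, hc, Algebra.smul_def]
    ring)
  rwa [map_smul, smul_eq_mul, mul_eq_right₀ hYT] at h6

theorem IsGood.exists_central_lift_of_ne [IsAlgClosed k] [IsGalois K Ω] [IsSepClosed Ω]
    (ht : IsSepGen k t) {ℓ : ℕ} (hℓ' : ℓ.Prime) (hℓ : (ℓ : k) ≠ 0) [Finite P] (hP : IsPGroup ℓ P)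
    {π : E →* P} (hπ : Function.Surjective π) (hcen : π.ker ≤ Subgroup.center E)
    (hcard : Nat.card π.ker = ℓ) {f : Γ' →* P} (hf : IsGood k t f) (hsurj : Function.Surjective f) :
    ∃ F : Γ' →* E, IsGood k t F ∧ π.comp F = f := by
  obtain ⟨L, ρ, hL, hsep, hρ, hinj, hz, hfree, hfix, -⟩ := hf.exists_finite_level ht hsurj
  obtain ⟨j, a, β, hj, hjℓ, hamul, haw, haβ, hβ⟩ :=
    hsep.exists_kummer_cocycle hz hinj hfree hℓ' hℓ hP hπ hcen hcard
  have hℓΩ : (ℓ : Ω) ≠ 0 := by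
    have := (map_ne_zero (algebraMap k Ω)).mpr hℓ
    rwa [map_natCast] at this
  have : NeZero (ℓ : Ω) := ⟨hℓΩ⟩
  have hℓ0 : ℓ ≠ 0 := hℓ'.ne_zero
  have hfin : Finite π.ker := Nat.finite_of_card_ne_zero (hcard ▸ hℓ0)
  obtain ⟨y, hy⟩ := IsSepClosed.exists_pow_nat_eq (((β : L)) : Ω) ℓ
  have hβ0 : ((β : L) : Ω) ≠ 0 := by simp
  have hy0 : y ≠ 0 := by
    rintro rfl
    rw [zero_pow hℓ0] at hy
    exact hβ0 hy.symm
  have hρ1 (σ : Γ') (hσ : f σ = 1) (x : L) : (σ : Ω ≃ₐ[K] Ω) x = x := by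
    rw [← hρ, hσ, map_one]; rfl
  have hamul' (e e') : ((a (e * e') : L) : Ω) = (a e : L) * ((ρ (π e) (a e' : L) : L) : Ω) := by
    rw [hamul, Units.val_mul]; rfl
  have haw' (w : π.ker) : ((a w : L) : Ω) = algebraMap k Ω (j w) := by
    rw [haw]; rfl
  have ha1 : ((a 1 : L) : Ω) = 1 := by simpa using haw' 1
  have hane (e) : ((a e : L) : Ω) ≠ 0 := by simp
  have hwe (w : π.ker) (e) : ((a (w * e) : L) : Ω) = algebraMap k Ω (j w) * (a e : L) := by
    rw [hamul', haw', (show π w = 1 from w.2), map_one]; rfl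
  obtain ⟨F, hF, hF'⟩ := exists_lift_of_cocycle (π := π) (f := f)
    (fun σ : Γ' ↦ (σ : Ω ≃ₐ[K] Ω) y / y) (fun e ↦ ((a e : L) : Ω))
    (fun σ u v ↦ u * (σ : Ω ≃ₐ[K] Ω) v)
    (fun σ e e' h ↦ by rw [hamul', h, hρ])
    (fun σ τ ↦ by
      have : (σ : Ω ≃ₐ[K] Ω) y ≠ 0 := by simpa using hy0
      rw [map_div₀, Subgroup.coe_mul, AlgEquiv.mul_apply]
      field_simp)
    (fun σ ↦ by
      obtain ⟨e, he⟩ := hπ (f σ)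
      have h1 : ((σ : Ω ≃ₐ[K] Ω) y / y / (a e : L)) ^ ℓ = 1 := by
        have h2 := congrArg (fun u : Lˣ ↦ (((u : L)) : Ω)) (haβ e)
        simp only [coe_unitsAction, he, hρ, Units.val_mul, Units.val_pow_eq_pow_val] at h2
        push_cast at h2
        rw [div_pow, div_pow, ← map_pow, hy, h2, mul_div_cancel_left₀ _ hβ0, div_self]
        exact pow_ne_zero _ (hane e)
      obtain ⟨w, hw⟩ := exists_eq_of_isRoot (q := (Polynomial.X ^ ℓ - 1 : Polynomial Ω))
          (ι := π.ker)
        (Polynomial.X_pow_sub_C_ne_zero hℓ'.pos 1)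
        (by rw [hcard]; exact (Polynomial.natDegree_X_pow_sub_C (r := (1 : Ω))).le)
        (j := fun w ↦ algebraMap k Ω (j w))
        (fun w w' h ↦ hj (Units.ext ((algebraMap k Ω).injective h)))
        (fun w ↦ by
          have := congrArg Units.val (hjℓ w)
          simp only [Units.val_pow_eq_pow_val, Units.val_one] at this
          simp [← map_pow, this])
        (x := (σ : Ω ≃ₐ[K] Ω) y / y / (a e : L)) (by simp [h1])
      refine ⟨w * e, by rw [map_mul, (show π w = 1 from w.2), one_mul, he], ?_⟩
      rw [hwe, hw, div_mul_cancel₀ _ (hane e)])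
    (fun e e' h h' ↦ by
      let w : π.ker := ⟨e * e'⁻¹, by rw [MonoidHom.mem_ker, map_mul, h, map_inv, mul_inv_cancel]⟩
      have h1 := hwe w e'
      rw [show (w : E) * e' = e by simp [w], h', eq_comm, mul_eq_right₀ (hane e')] at h1
      have h2 : w = 1 := hj (Units.ext ((algebraMap k Ω).injective (by rw [h1]; simp)))
      have := congrArg Subtype.val h2
      simpa [w, mul_inv_eq_one] using this)
  refine ⟨F, ⟨?_, ?_⟩, MonoidHom.ext hF⟩
  · refine isOpen_ker_of_adjoin F L y fun σ hσ hσy ↦ ?_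
    obtain ⟨h1, h2⟩ := hfix σ hσ
    refine ⟨h1, ?_⟩
    have h3 : π (F ⟨σ, h1⟩) = 1 := (hF _).trans h2
    have h4 := hF' ⟨σ, h1⟩
    simp only [hσy, div_self hy0] at h4
    have h5 : j ⟨_, h3⟩ = 1 := Units.ext ((algebraMap k Ω).injective (by
      rw [← haw' ⟨_, h3⟩, h4]; simp))
    rw [← map_one j] at h5
    exact congrArg Subtype.val (hj h5)
  · intro σ Y hY
    have h2 := hf.inert σ Y hY
    have h3 : π (F σ) = 1 := (hF _).trans h2
    have h4 := hF' σ
    set w : π.ker := ⟨_, h3⟩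
    have h5 : (σ : Ω ≃ₐ[K] Ω) y = algebraMap k Ω (j w) * y := by
      rw [← haw' w, ← div_eq_iff hy0]
      exact h4.symm
    have h6 := eq_one_of_inertAt_of_pow_eq hℓ'.pos hY (hρ1 σ h2) (hβ (restrictPlace Y)) hy h5
    have h7 : j w = 1 := Units.ext h6
    rw [← map_one j] at h7
    exact congrArg Subtype.val (hj h7)

end Central

section Central

variable {k K Ω : Type*} [Field k] [Field K] [Field Ω] [Algebra k K] [Algebra K Ω] [Algebra k Ω]
  [IsScalarTower k K Ω] {t : K} {Γ' : Subgroup (Ω ≃ₐ[K] Ω)} {P E : Type*} [Group P] [Group E]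

theorem exists_artinSchreier_root {F : Type*} [Field F] [IsSepClosed F] {ℓ : ℕ} (hℓ : ℓ.Prime)
    [CharP F ℓ] (b : F) : ∃ y : F, y ^ ℓ - y = b := by
  obtain ⟨y, hy⟩ := IsSepClosed.exists_root_C_mul_X_pow_add_C_mul_X_add_C' (k := F) ℓ ℓ 1 (-1) (-b)
    (by simp) hℓ.one_lt (by simp)
  refine ⟨y, ?_⟩
  linear_combination hy

theorem IsGood.exists_central_lift_of_charP [IsAlgClosed k] [IsGalois K Ω] [IsSepClosed Ω]
    (ht : IsSepGen k t) {ℓ : ℕ} (hℓ : ℓ.Prime) [CharP k ℓ] [Finite P]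
    {π : E →* P} (hπ : Function.Surjective π) (hcen : π.ker ≤ Subgroup.center E)
    (hcard : Nat.card π.ker = ℓ) {f : Γ' →* P} (hf : IsGood k t f) (hsurj : Function.Surjective f) :
    ∃ F : Γ' →* E, IsGood k t F ∧ π.comp F = f := by
  obtain ⟨L, ρ, hL, hsep, hρ, hinj, hz, hfree, hfix, -⟩ := hf.exists_finite_level ht hsurj
  obtain ⟨j, a, β, hj, hjadd, hjℓ, hamul, haw, haint, hβint, haβ⟩ :=
    hsep.exists_artinSchreier_cocycle hz hfree hℓ hπ hcen hcard
  have hℓ0 : ℓ ≠ 0 := hℓ.ne_zero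
  have : CharP Ω ℓ := charP_of_injective_algebraMap (algebraMap k Ω).injective ℓ
  have : Fact ℓ.Prime := ⟨hℓ⟩
  have hfin : Finite π.ker := Nat.finite_of_card_ne_zero (hcard ▸ hℓ0)
  obtain ⟨y, hy⟩ := exists_artinSchreier_root hℓ (β : Ω)
  have hρ1 (σ : Γ') (hσ : f σ = 1) (x : L) : (σ : Ω ≃ₐ[K] Ω) x = x := by
    rw [← hρ, hσ, map_one]; rfl
  have hamul' (e e') : ((a (e * e') : L) : Ω) = (a e : L) + ((ρ (π e) (a e' : L) : L) : Ω) := by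
    rw [hamul]; rfl
  have haw' (w : π.ker) : ((a w : L) : Ω) = algebraMap k Ω (j w) := by
    rw [haw]; rfl
  have hj1 : j 1 = 0 := by simpa using hjadd 1 1
  have hwe (w : π.ker) (e) : ((a (w * e) : L) : Ω) = algebraMap k Ω (j w) + (a e : L) := by
    rw [hamul', haw', (show π w = 1 from w.2), map_one]; rfl
  obtain ⟨F, hF, hF'⟩ := exists_lift_of_cocycle (π := π) (f := f)
    (fun σ : Γ' ↦ (σ : Ω ≃ₐ[K] Ω) y - y) (fun e ↦ ((a e : L) : Ω))
    (fun σ u v ↦ u + (σ : Ω ≃ₐ[K] Ω) v)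
    (fun σ e e' h ↦ by rw [hamul', h, hρ])
    (fun σ τ ↦ by
      rw [map_sub, Subgroup.coe_mul, AlgEquiv.mul_apply]
      ring)
    (fun σ ↦ by
      obtain ⟨e, he⟩ := hπ (f σ)
      have h2 := congrArg (Subtype.val : L → Ω) (haβ e)
      rw [he] at h2
      push_cast at h2
      rw [hρ, ← hy, map_sub, map_pow] at h2
      have h1 : ((σ : Ω ≃ₐ[K] Ω) y - y - (a e : L)) ^ ℓ = (σ : Ω ≃ₐ[K] Ω) y - y - (a e : L) := by
        rw [sub_pow_char, sub_pow_char]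
        linear_combination h2
      obtain ⟨w, hw⟩ := exists_eq_of_isRoot (q := (Polynomial.X ^ ℓ - Polynomial.X : Polynomial Ω))
        (ι := π.ker) (FiniteField.X_pow_card_sub_X_ne_zero Ω hℓ.one_lt)
        (by rw [hcard]; exact (FiniteField.X_pow_card_sub_X_natDegree_eq Ω hℓ.one_lt).le)
        (j := fun w ↦ algebraMap k Ω (j w))
        (fun w w' h ↦ hj ((algebraMap k Ω).injective h))
        (fun w ↦ by simp [← map_pow, hjℓ w])
        (x := (σ : Ω ≃ₐ[K] Ω) y - y - (a e : L)) (by simp [h1])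
      refine ⟨w * e, by rw [map_mul, (show π w = 1 from w.2), one_mul, he], ?_⟩
      rw [hwe, hw, sub_add_cancel])
    (fun e e' h h' ↦ by
      let w : π.ker := ⟨e * e'⁻¹, by rw [MonoidHom.mem_ker, map_mul, h, map_inv, mul_inv_cancel]⟩
      have h1 := hwe w e'
      rw [show (w : E) * e' = e by simp [w], h', eq_comm, add_eq_right] at h1
      have h2 : w = 1 := hj ((algebraMap k Ω).injective (by rw [h1, hj1, map_zero]))
      have := congrArg Subtype.val h2
      simpa [w, mul_inv_eq_one] using this)
  refine ⟨F, ⟨?_, ?_⟩, MonoidHom.ext hF⟩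
  · refine isOpen_ker_of_adjoin F L y fun σ hσ hσy ↦ ?_
    obtain ⟨h1, h2⟩ := hfix σ hσ
    refine ⟨h1, ?_⟩
    have h3 : π (F ⟨σ, h1⟩) = 1 := (hF _).trans h2
    have h4 := hF' ⟨σ, h1⟩
    simp only [hσy, sub_self] at h4
    have h5 : j ⟨_, h3⟩ = 0 := (algebraMap k Ω).injective (by
      rw [← haw' ⟨_, h3⟩, h4]; simp)
    rw [← hj1] at h5
    exact congrArg Subtype.val (hj h5)
  · intro σ Y hY
    have h2 := hf.inert σ Y hY
    have h3 : π (F σ) = 1 := (hF _).trans h2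
    have h4 := hF' σ
    set w : π.ker := ⟨_, h3⟩
    have h5 : (σ : Ω ≃ₐ[K] Ω) y = algebraMap k Ω (j w) + y := by
      rw [← haw' w, ← sub_eq_iff_eq_add]
      exact h4.symm
    have hyint : y ∈ intClosure k (algebraMap K Ω t) := by
      let R := integralClosure (Algebra.adjoin k {algebraMap K Ω t}) Ω
      let B : R := ⟨_, coe_mem_intClosure hβint⟩
      have hmon : (Polynomial.X ^ ℓ - (Polynomial.X + Polynomial.C B) : Polynomial R).Monic := by
        refine Polynomial.monic_X_pow_sub ?_
        rw [Polynomial.degree_X_add_C]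
        exact_mod_cast hℓ.one_lt
      have : IsIntegral R y := by
        refine ⟨_, hmon, ?_⟩
        rw [Polynomial.eval₂_sub, Polynomial.eval₂_add, Polynomial.eval₂_pow, Polynomial.eval₂_X,
          Polynomial.eval₂_C]
        change y ^ ℓ - (y + (β : Ω)) = 0
        rw [← hy]; ring
      exact isIntegral_trans (A := R) y this
    let Y' : intClosure k (algebraMap K Ω t) := ⟨y, hyint⟩
    have h6 := hY Y' (algebraMap k (intClosure k (algebraMap K Ω t)) (j w) + Y') h5
    rw [map_add, AlgHom.commutes, add_eq_right] at h6
    rw [show algebraMap k k (j w) = j w from rfl, ← hj1] at h6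
    exact congrArg Subtype.val (hj h6)

/-- **Central embedding problems** of prime order have good solutions. -/
theorem IsGood.exists_central_lift [IsAlgClosed k] [IsGalois K Ω] [IsSepClosed Ω]
    (ht : IsSepGen k t) {ℓ : ℕ} (hℓ : ℓ.Prime) [Finite P] (hP : IsPGroup ℓ P)
    {π : E →* P} (hπ : Function.Surjective π) (hcen : π.ker ≤ Subgroup.center E)
    (hcard : Nat.card π.ker = ℓ) {f : Γ' →* P} (hf : IsGood k t f) :
    ∃ F : Γ' →* E, IsGood k t F ∧ π.comp F = f := by
  let E' : Subgroup E := f.range.comap π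
  let π' : E' →* f.range := π.subgroupComap f.range
  have hπ' : Function.Surjective π' := by
    rintro ⟨p, hp⟩
    obtain ⟨e, rfl⟩ := hπ p
    exact ⟨⟨e, hp⟩, rfl⟩
  have hker (e : E') : e ∈ π'.ker ↔ (e : E) ∈ π.ker := by
    rw [MonoidHom.mem_ker, MonoidHom.mem_ker, Subtype.ext_iff]
    rfl
  have hcen' : π'.ker ≤ Subgroup.center E' := by
    intro e he
    rw [Subgroup.mem_center_iff]
    intro g
    exact Subtype.ext (Subgroup.mem_center_iff.mp (hcen ((hker e).mp he)) g)
  have hcard' : Nat.card π'.ker = ℓ := by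
    rw [← hcard]
    exact Nat.card_congr
      { toFun := fun e ↦ ⟨e, (hker e).mp e.2⟩
        invFun := fun e ↦ ⟨⟨e, by
          rw [Subgroup.mem_comap, show π e = 1 from e.2]; exact one_mem _⟩, (hker _).mpr e.2⟩
        left_inv := fun e ↦ rfl
        right_inv := fun e ↦ rfl }
  have hf' : IsGood k t f.rangeRestrict := by
    refine ⟨?_, fun σ Y hY ↦ Subtype.ext (hf.inert σ Y hY)⟩
    rw [MonoidHom.ker_rangeRestrict]
    exact hf.isOpen
  have hlift : ∃ F : Γ' →* E', IsGood k t F ∧ π'.comp F = f.rangeRestrict := by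
    by_cases hℓk : (ℓ : k) = 0
    · have : CharP k ℓ := (CharP.charP_iff_prime_eq_zero hℓ).mpr hℓk
      exact hf'.exists_central_lift_of_charP ht hℓ hπ' hcen' hcard' f.rangeRestrict_surjective
    · exact hf'.exists_central_lift_of_ne ht hℓ hℓk (hP.to_subgroup _) hπ' hcen' hcard'
        f.rangeRestrict_surjective
  obtain ⟨F, hF, hFf⟩ := hlift
  refine ⟨E'.subtype.comp F, ⟨?_, ?_⟩, ?_⟩
  · rw [show (E'.subtype.comp F).ker = F.ker by ext x; simp [MonoidHom.mem_ker]]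
    exact hF.isOpen
  · intro σ Y hY
    rw [MonoidHom.comp_apply, hF.inert σ Y hY, map_one]
  · ext σ
    exact congrArg Subtype.val (DFunLike.congr_fun hFf σ)

end Central

section PGroup

theorem exists_orderOf_eq_of_isPGroup {E : Type*} [Group E] [Finite E] {ℓ : ℕ} (hℓ : ℓ.Prime)
    (hE : IsPGroup ℓ E) {N : Subgroup E} [N.Normal] (hN : N ≠ ⊥) :
    ∃ c ∈ N ⊓ Subgroup.center E, orderOf c = ℓ := by
  have : Fact ℓ.Prime := ⟨hℓ⟩
  have : Nontrivial N := (Subgroup.nontrivial_iff_ne_bot N).mpr hN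
  have hE' : IsPGroup ℓ (ConjAct E) := hE.of_equiv ConjAct.toConjAct
  have hdvd : ℓ ∣ Nat.card N := by
    obtain ⟨n, hn, hcard⟩ := (hE.to_subgroup N).nontrivial_iff_card.mp this
    rw [hcard]
    exact dvd_pow_self ℓ hn.ne'
  obtain ⟨b, hb, hb1⟩ := hE'.exists_fixed_point_of_prime_dvd_card_of_fixed_point N hdvd
    (a := 1) (fun g ↦ smul_one g)
  have hbc : (b : E) ∈ Subgroup.center E := by
    rw [Subgroup.mem_center_iff]
    intro g
    have h := congrArg Subtype.val (hb (ConjAct.toConjAct g))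
    rw [ConjAct.Subgroup.val_conj_smul, ConjAct.toConjAct_smul] at h
    exact mul_inv_eq_iff_eq_mul.mp h
  have hnt : Nontrivial (N ⊓ Subgroup.center E : Subgroup E) :=
    ⟨⟨⟨b, b.2, hbc⟩, 1, fun h ↦ hb1 (Subtype.ext (congrArg Subtype.val h).symm)⟩⟩
  have hdvd' : ℓ ∣ Nat.card (N ⊓ Subgroup.center E : Subgroup E) := by
    obtain ⟨n, hn, hcard⟩ := (hE.to_subgroup _).nontrivial_iff_card.mp hnt
    rw [hcard]
    exact dvd_pow_self ℓ hn.ne'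
  obtain ⟨c, hc⟩ := exists_prime_orderOf_dvd_card' ℓ hdvd'
  exact ⟨c, c.2, by rw [← hc, Subgroup.orderOf_coe]⟩

variable {k K Ω : Type*} [Field k] [Field K] [Field Ω] [Algebra k K] [Algebra K Ω] [Algebra k Ω]
  [IsScalarTower k K Ω] {t : K} {Γ' : Subgroup (Ω ≃ₐ[K] Ω)}

theorem IsGood.comp {P Q : Type*} [Group P] [Group Q] {f : Γ' →* P} (hf : IsGood k t f)
    (g : P →* Q) : IsGood k t (g.comp f) := by
  refine ⟨Subgroup.isOpen_mono ?_ hf.isOpen, fun σ Y hY ↦ ?_⟩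
  · refine Subgroup.map_mono fun σ hσ ↦ ?_
    rw [MonoidHom.mem_ker, MonoidHom.comp_apply, MonoidHom.mem_ker.mp hσ, map_one]
  · rw [MonoidHom.comp_apply, hf.inert σ Y hY, map_one]

universe u

theorem IsGood.exists_lift_of_isPGroup [IsAlgClosed k] [IsGalois K Ω] [IsSepClosed Ω]
    (ht : IsSepGen k t) {ℓ : ℕ} (hℓ : ℓ.Prime) {P : Type*} [Group P]
    {f : Γ' →* P} (hf : IsGood k t f) {E : Type u} [Group E] [Finite E] (hE : IsPGroup ℓ E)
    {π : E →* P} (hπ : Function.Surjective π) :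
    ∃ F : Γ' →* E, IsGood k t F ∧ π.comp F = f := by
  induction hn : Nat.card E using Nat.strong_induction_on generalizing E with
  | _ n ih =>
  by_cases hker : π.ker = ⊥
  · let e : E ≃* P := MulEquiv.ofBijective π ⟨(MonoidHom.ker_eq_bot_iff π).mp hker, hπ⟩
    refine ⟨e.symm.toMonoidHom.comp f, hf.comp _, ?_⟩
    ext σ
    exact e.apply_symm_apply (f σ)
  · obtain ⟨c, ⟨hcN, hcZ⟩, hc⟩ := exists_orderOf_eq_of_isPGroup hℓ hE hker
    let Z : Subgroup E := Subgroup.zpowers c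
    have hZcen : Z ≤ Subgroup.center E := Subgroup.zpowers_le.mpr hcZ
    have hZker : Z ≤ π.ker := Subgroup.zpowers_le.mpr hcN
    have hZn : Z.Normal := ⟨fun z hz g ↦ by
      rwa [(Subgroup.mem_center_iff.mp (hZcen hz) g), mul_assoc, mul_inv_cancel,
        mul_one]⟩
    have hZcard : Nat.card Z = ℓ := by rw [Nat.card_zpowers, hc]
    have hlt : Nat.card (E ⧸ Z) < n := by
      have h := Subgroup.card_eq_card_quotient_mul_card_subgroup Z
      have h0 : 0 < Nat.card (E ⧸ Z) := Nat.card_pos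
      rw [hn, hZcard] at h
      rw [h]
      exact lt_mul_of_one_lt_right h0 hℓ.one_lt
    obtain ⟨F₁, hF₁, hF₁f⟩ := ih _ hlt (E := E ⧸ Z) (hE.to_quotient Z)
      (π := QuotientGroup.lift Z π hZker)
      (fun p ↦ by obtain ⟨e, rfl⟩ := hπ p; exact ⟨e, rfl⟩) rfl
    obtain ⟨F, hF, hFF⟩ := IsGood.exists_central_lift ht hℓ (hE.to_quotient Z)
      (π := QuotientGroup.mk' Z) (QuotientGroup.mk'_surjective Z)
      (by rwa [QuotientGroup.ker_mk']) (by rw [QuotientGroup.ker_mk', hZcard]) hF₁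
    refine ⟨F, hF, ?_⟩
    rw [← hF₁f, ← hFF]
    ext σ
    rfl

end PGroup

section Averaging

/-- Gaschütz-style averaging: a homomorphism lifting on a subgroup of index prime to `ℓ`
lifts everywhere, through a kernel that is abelian of exponent `ℓ`. -/
theorem exists_lift_of_coprime_index {Γ G : Type*} [Group Γ] [Group G] {N : Subgroup G} [N.Normal]
    (hNcomm : ∀ a ∈ N, ∀ b ∈ N, a * b = b * a) {ℓ : ℕ} (hℓ : 1 < ℓ) (hNℓ : ∀ a ∈ N, a ^ ℓ = 1)
    (φ : Γ →* G ⧸ N) (Γ' : Subgroup Γ) [Γ'.FiniteIndex] (hindex : Γ'.index.Coprime ℓ)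
    (s : Γ' →* G) (hs : ∀ σ : Γ', (s σ : G ⧸ N) = φ σ) :
    ∃ F : Γ →* G, (∀ σ, (F σ : G ⧸ N) = φ σ) ∧
      ∀ σ : Γ, (∀ r : Γ, ∃ h : r⁻¹ * σ * r ∈ Γ', s ⟨_, h⟩ = 1) → F σ = 1 := by
  let _ : CommGroup N := { (inferInstance : Group N) with
    mul_comm := fun a b ↦ Subtype.ext (hNcomm a a.2 b b.2) }
  let _ : Fintype (Γ ⧸ Γ') := Fintype.ofFinite _
  let r : Γ ⧸ Γ' → Γ := Quotient.out
  have hr (c : Γ ⧸ Γ') : (r c : Γ ⧸ Γ') = c := Quotient.out_eq' c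
  have hmem (c : Γ ⧸ Γ') (σ : Γ) : (r (σ • c))⁻¹ * (σ * r c) ∈ Γ' := by
    rw [← QuotientGroup.eq, hr]
    conv_lhs => rw [← hr c]
    rfl
  let h (c : Γ ⧸ Γ') (σ : Γ) : Γ' := ⟨_, hmem c σ⟩
  have hh (c : Γ ⧸ Γ') (σ τ : Γ) : h c (σ * τ) = h (τ • c) σ * h c τ := by
    apply Subtype.ext
    simp only [h, Subgroup.coe_mul, mul_smul]
    group
  let u : G ⧸ N → G := Quotient.out
  have hu (q : G ⧸ N) : (u q : G ⧸ N) = q := Quotient.out_eq' q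
  let g (c : Γ ⧸ Γ') : G := u (φ (r c))
  let x (c : Γ ⧸ Γ') (σ : Γ) : G := g (σ • c) * s (h c σ) * (g c)⁻¹
  have hxmul (c : Γ ⧸ Γ') (σ τ : Γ) : x c (σ * τ) = x (τ • c) σ * x c τ := by
    simp only [x, hh, map_mul, mul_smul]
    group
  have hx (c : Γ ⧸ Γ') (σ : Γ) : (x c σ : G ⧸ N) = φ σ := by
    simp only [x, g, QuotientGroup.mk_mul, QuotientGroup.mk_inv, hu, hs, h, map_mul, map_inv]
    group
  have hn (c : Γ ⧸ Γ') (σ : Γ) : x c σ * (u (φ σ))⁻¹ ∈ N := by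
    rw [← QuotientGroup.eq_one_iff, QuotientGroup.mk_mul, QuotientGroup.mk_inv, hu, hx,
      mul_inv_cancel]
  let n (c : Γ ⧸ Γ') (σ : Γ) : N := ⟨_, hn c σ⟩
  have hκ (σ τ : Γ) : u (φ σ) * u (φ τ) * (u (φ (σ * τ)))⁻¹ ∈ N := by
    rw [← QuotientGroup.eq_one_iff]
    simp only [QuotientGroup.mk_mul, QuotientGroup.mk_inv, hu, map_mul]
    group
  let κ (σ τ : Γ) : N := ⟨_, hκ σ τ⟩
  let cj (a : G) : N →* N := (MulAut.conjNormal a).toMonoidHom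
  have hcj (a : G) (b : N) : (cj a b : G) = a * b * a⁻¹ := MulAut.conjNormal_apply a b
  have hnmul (c : Γ ⧸ Γ') (σ τ : Γ) :
      n c (σ * τ) = n (τ • c) σ * cj (u (φ σ)) (n c τ) * κ σ τ := by
    apply Subtype.ext
    simp only [n, κ, Subgroup.coe_mul, hcj, hxmul]
    group
  have hm : ∃ m' : ℕ, (m' * Γ'.index) ≡ 1 [MOD ℓ] := by
    obtain ⟨a, ha⟩ := Nat.exists_mul_mod_eq_one_of_coprime hindex hℓ
    exact ⟨a, by rw [Nat.ModEq, mul_comm, ha.2, Nat.mod_eq_of_lt hℓ]⟩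
  obtain ⟨m', hm'⟩ := hm
  have hNpow (a : N) : a ^ (m' * Γ'.index) = a := by
    have h1 : a ^ ℓ = 1 := Subtype.ext (hNℓ a a.2)
    have := pow_eq_pow_of_modEq hm' h1
    rwa [pow_one] at this
  have hcard (a : N) : (∏ _c : Γ ⧸ Γ', a) ^ m' = a := by
    rw [Finset.prod_const, Finset.card_univ, ← Nat.card_eq_fintype_card, ← pow_mul, mul_comm]
    exact hNpow a
  let B (σ : Γ) : N := (∏ c, n c σ) ^ m'
  have hBmul (σ τ : Γ) : B (σ * τ) = B σ * cj (u (φ σ)) (B τ) * κ σ τ := by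
    have h1 : ∏ c, n (τ • c) σ = ∏ c, n c σ :=
      Fintype.prod_equiv (MulAction.toPerm τ) _ _ fun c ↦ rfl
    simp only [B, hnmul, Finset.prod_mul_distrib, mul_pow, hcard, map_pow, map_prod, h1]
  have hmul (σ τ : Γ) : (B (σ * τ) : G) * u (φ (σ * τ)) =
      B σ * u (φ σ) * (B τ * u (φ τ)) := by
    rw [hBmul]
    simp only [Subgroup.coe_mul, hcj, κ]
    group
  refine ⟨MonoidHom.mk' (fun σ ↦ B σ * u (φ σ)) hmul, ?_, ?_⟩
  · intro σ
    change (((B σ : G) * u (φ σ) : G) : G ⧸ N) = φ σ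
    rw [QuotientGroup.mk_mul, hu, (QuotientGroup.eq_one_iff _).mpr (B σ).2, one_mul]
  · intro σ hσ
    change (B σ : G) * u (φ σ) = 1
    have hx1 (c : Γ ⧸ Γ') : x c σ = 1 := by
      obtain ⟨hmem, hs1⟩ := hσ (r c)
      have hc : σ • c = c := by
        conv_lhs => rw [← hr c]
        conv_rhs => rw [← hr c]
        refine (QuotientGroup.eq.mpr ?_).symm
        change (r c)⁻¹ * (σ * r c) ∈ Γ'
        rwa [← mul_assoc]
      have h2 : h c σ = ⟨_, hmem⟩ := by
        apply Subtype.ext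
        simp only [h, hc, mul_assoc]
      simp only [x, h2, hs1, hc]
      group
    have hB : B σ = (n (1 : Γ) σ) := by
      have : ∀ c, n c σ = n (1 : Γ) σ := fun c ↦ Subtype.ext (by simp only [n, hx1])
      simp only [B, this]
      exact hcard _
    rw [hB]
    simp [n, hx1]

end Averaging

section GoodHom

variable {k K Ω : Type*} [Field k] [Field K] [Field Ω] [Algebra k K] [Algebra K Ω] [Algebra k Ω]
  [IsScalarTower k K Ω] {t : K}

/-- A homomorphism from a Galois group is good if it has open kernel and
kills all inertia groups over the affine line with coordinate `t`. -/
structure IsGoodHom (k : Type*) {K Ω : Type*} [Field k] [Field K] [Field Ω] [Algebra k K]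
    [Algebra K Ω] [Algebra k Ω] [IsScalarTower k K Ω] (t : K)
    {G : Type*} [Group G] (f : (Ω ≃ₐ[K] Ω) →* G) : Prop where
  isOpen : IsOpen (f.ker : Set (Ω ≃ₐ[K] Ω))
  inert : ∀ (σ : Ω ≃ₐ[K] Ω) (Y : intClosure k (algebraMap K Ω t) →ₐ[k] k),
    InertAt Y (σ.restrictScalars k) → f σ = 1

theorem IsGoodHom.isGood_subgroupComap {G : Type*} [Group G] {f : (Ω ≃ₐ[K] Ω) →* G}
    (hf : IsGoodHom k t f) (P : Subgroup G) : IsGood k t (f.subgroupComap P) := by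
  refine ⟨Subgroup.isOpen_mono ?_ hf.isOpen, fun σ Y hY ↦ Subtype.ext (hf.inert σ Y hY)⟩
  intro σ hσ
  have h1 : f σ = 1 := hσ
  exact ⟨⟨σ, by rw [Subgroup.mem_comap, h1]; exact one_mem _⟩, Subtype.ext h1, rfl⟩

theorem exists_inertAt_conj (r : Ω ≃ₐ[K] Ω) {σ : Ω ≃ₐ[K] Ω}
    {Y : intClosure k (algebraMap K Ω t) →ₐ[k] k} (hY : InertAt Y (σ.restrictScalars k)) :
    ∃ Y' : intClosure k (algebraMap K Ω t) →ₐ[k] k,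
      InertAt Y' ((r⁻¹ * σ * r).restrictScalars k) := by
  have hr : (r.restrictScalars k) (algebraMap K Ω t) = algebraMap K Ω t := r.commutes t
  refine ⟨Y.comp (intClosureHom (r.restrictScalars k) hr), fun x x' h ↦ hY _ _ ?_⟩
  change σ (r x) = r x'
  rw [← h]
  change σ (r x) = r (r.symm (σ (r x)))
  rw [AlgEquiv.apply_symm_apply]

/-- Good homomorphisms lift weakly through quotients by abelian normal subgroups of prime
exponent. -/
theorem IsGoodHom.exists_lift [IsAlgClosed k] [IsGalois K Ω] [IsSepClosed Ω]
    (ht : IsSepGen k t) {G : Type*} [Group G] [Finite G] {N : Subgroup G} [N.Normal]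
    (hNcomm : ∀ a ∈ N, ∀ b ∈ N, a * b = b * a) {ℓ : ℕ} (hℓ : ℓ.Prime) (hNℓ : ∀ a ∈ N, a ^ ℓ = 1)
    {φ : (Ω ≃ₐ[K] Ω) →* G ⧸ N} (hφ : IsGoodHom k t φ) (hφsurj : Function.Surjective φ) :
    ∃ F : (Ω ≃ₐ[K] Ω) →* G, IsGoodHom k t F ∧ ∀ σ, (F σ : G ⧸ N) = φ σ := by
  have : Fact ℓ.Prime := ⟨hℓ⟩
  obtain ⟨P⟩ : Nonempty (Sylow ℓ (G ⧸ N)) := inferInstance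
  let Γ' := (P : Subgroup (G ⧸ N)).comap φ
  have hidx : Γ'.index = (P : Subgroup (G ⧸ N)).index := Subgroup.index_comap_of_surjective _ hφsurj
  have : Γ'.FiniteIndex := ⟨by rw [hidx]; exact Subgroup.FiniteIndex.index_ne_zero⟩
  have hcop : Γ'.index.Coprime ℓ := by
    rw [hidx, Nat.coprime_comm, hℓ.coprime_iff_not_dvd]
    exact P.not_dvd_index
  have hNp : IsPGroup ℓ N := fun a ↦ ⟨1, Subtype.ext (by simpa using hNℓ a a.2)⟩
  have hE : IsPGroup ℓ ((P : Subgroup (G ⧸ N)).comap (QuotientGroup.mk' N)) :=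
    P.isPGroup'.comap_of_ker_isPGroup _ (by rwa [QuotientGroup.ker_mk'])
  obtain ⟨s, hs, hsφ⟩ := (hφ.isGood_subgroupComap P).exists_lift_of_isPGroup ht hℓ hE
    (π := (QuotientGroup.mk' N).subgroupComap P)
    ((QuotientGroup.mk' N).subgroupComap_surjective_of_surjective _
      (QuotientGroup.mk'_surjective N))
  obtain ⟨F, hFφ, hF⟩ := exists_lift_of_coprime_index hNcomm hℓ.one_lt hNℓ φ Γ' hcop
    ((Subgroup.subtype _).comp s) (fun σ ↦ congrArg Subtype.val (DFunLike.congr_fun hsφ σ))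
  refine ⟨F, ⟨?_, fun σ Y hY ↦ hF σ fun r ↦ ?_⟩, hFφ⟩
  · let M : Subgroup (Ω ≃ₐ[K] Ω) := s.ker.map Γ'.subtype
    have hM : IsOpen (M : Set (Ω ≃ₐ[K] Ω)) := hs.isOpen
    have hMq : Finite ((Ω ≃ₐ[K] Ω) ⧸ M) := M.quotient_finite_of_isOpen hM
    have hMf : M.FiniteIndex := Subgroup.finiteIndex_of_finite_quotient
    have hcore : IsOpen (M.normalCore : Set (Ω ≃ₐ[K] Ω)) :=
      Subgroup.isOpen_of_isClosed_of_finiteIndex _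
        (M.normalCore_isClosed (Subgroup.isClosed_of_isOpen M hM))
    refine Subgroup.isOpen_mono (fun σ hσ ↦ ?_) hcore
    refine hF σ fun r ↦ ?_
    obtain ⟨τ, hτ, hτr⟩ := hσ r⁻¹
    rw [inv_inv] at hτr
    have h1 : r⁻¹ * σ * r ∈ Γ' := hτr ▸ τ.2
    refine ⟨h1, ?_⟩
    have : τ = ⟨_, h1⟩ := Subtype.ext hτr
    rw [← this, MonoidHom.comp_apply, MonoidHom.mem_ker.mp hτ, map_one]
  · obtain ⟨Y', hY'⟩ := exists_inertAt_conj r hY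
    have h1 : φ (r⁻¹ * σ * r) = 1 := hφ.inert _ Y' hY'
    have h2 : r⁻¹ * σ * r ∈ Γ' := by
      rw [Subgroup.mem_comap, h1]
      exact one_mem _
    refine ⟨h2, ?_⟩
    rw [MonoidHom.comp_apply, hs.inert ⟨_, h2⟩ Y' hY', map_one]

end GoodHom

section Twist

theorem eq_top_of_inf_ne_bot {G : Type*} [Group G] {N : Subgroup G} [N.Normal]
    (hNcomm : ∀ a ∈ N, ∀ b ∈ N, a * b = b * a)
    (hmin : ∀ M : Subgroup G, M.Normal → M ≤ N → M = ⊥ ∨ M = N) {S : Subgroup G}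
    (hS : S ⊔ N = ⊤) (hSN : S ⊓ N ≠ ⊥) : S = ⊤ := by
  have hnorm : (S ⊓ N).Normal := by
    refine ⟨fun x hx g ↦ ?_⟩
    have hg : g ∈ S ⊔ N := hS ▸ Subgroup.mem_top g
    obtain ⟨s, hs, n, hn, rfl⟩ := Subgroup.mem_sup_of_normal_right.mp hg
    have h1 : s * n * x * (s * n)⁻¹ = s * x * s⁻¹ := by
      have h2 := hNcomm n hn x hx.2
      calc s * n * x * (s * n)⁻¹ = s * (n * x) * n⁻¹ * s⁻¹ := by group
        _ = s * x * s⁻¹ := by rw [h2]; group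
    rw [h1]
    exact ⟨S.mul_mem (S.mul_mem hs hx.1) (S.inv_mem hs), Subgroup.Normal.conj_mem ‹_› x hx.2 s⟩
  rcases hmin _ hnorm inf_le_right with h | h
  · exact absurd h hSN
  · rwa [sup_eq_left.mpr (inf_eq_right.mp h)] at hS

theorem exists_twisting_cocycle {S A : Type*} [Group S] [Fintype S] [CommGroup A] {ℓ : ℕ}
    (hℓ : ℓ.Prime) (hA : ∀ a : A, a ^ ℓ = 1) (act : S →* MulAut A) {h : A} (hh : h ≠ 1) :
    ∃ c : S → ZMod ℓ, c 1 ≠ 0 ∧ ∀ {Γ : Type*} [Group Γ] (F : Γ →* S) (b : S → Γ → ZMod ℓ),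
      (∀ q σ τ, b q (σ * τ) = b q σ + b ((F σ)⁻¹ * q) τ) →
      ∃ ψ : Γ → A, (∀ σ τ, ψ (σ * τ) = ψ σ * act (F σ) (ψ τ)) ∧
        (∀ σ, (∀ q, b q σ = 0) → ψ σ = 1) ∧ (∀ σ, ψ σ = 1 → ∑ q, c q * b q σ = 0) := by
  have : Fact ℓ.Prime := ⟨hℓ⟩
  let _ : Module (ZMod ℓ) (Additive A) := AddCommGroup.zmodModule (n := ℓ) fun a ↦
    Additive.toMul.injective (hA a.toMul)
  let cj (q : S) : Additive A →ₗ[ZMod ℓ] Additive A :=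
    AddMonoidHom.toZModLinearMap ℓ (MonoidHom.toAdditive (act q).toMonoidHom)
  have hcj (q : S) (a : Additive A) : (cj q a).toMul = act q a.toMul := rfl
  have hcjmul (q q' : S) (a : Additive A) : cj (q * q') a = cj q (cj q' a) := by
    apply Additive.toMul.injective
    rw [hcj, hcj, hcj, map_mul, MulAut.mul_apply]
  let a₀ : Additive A := Additive.ofMul h
  have hd : ∃ d : Module.Dual (ZMod ℓ) (Additive A), d a₀ ≠ 0 := by
    by_contra! hd
    exact hh (Additive.ofMul.injective
      ((Module.forall_dual_apply_eq_zero_iff (ZMod ℓ) a₀).mp hd))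
  obtain ⟨d, hd⟩ := hd
  have hcj1 : cj 1 a₀ = a₀ := by
    apply Additive.toMul.injective
    rw [hcj, map_one, MulAut.one_apply]
  refine ⟨fun q ↦ d (cj q a₀), (congrArg d hcj1).trans_ne hd, fun F b hb ↦ ?_⟩
  let ψ (σ) : Additive A := ∑ q, b q σ • cj q a₀
  have hψ (σ τ) : ψ (σ * τ) = ψ σ + cj (F σ) (ψ τ) := by
    simp only [ψ, hb, add_smul, Finset.sum_add_distrib, map_sum, map_smul, ← hcjmul]
    congr 1
    refine Fintype.sum_equiv (Equiv.mulLeft (F σ)⁻¹) _ _ fun q ↦ ?_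
    congr 2
    simp
  refine ⟨fun σ ↦ (ψ σ).toMul, fun σ τ ↦ ?_, fun σ hσ ↦ ?_, fun σ hσ ↦ ?_⟩
  · change (ψ (σ * τ)).toMul = _
    rw [hψ, toMul_add, hcj]
  · change (ψ σ).toMul = 1
    rw [show ψ σ = 0 from Finset.sum_eq_zero fun q _ ↦ by rw [hσ, zero_smul], toMul_zero]
  · have h2 : ψ σ = 0 := Additive.toMul.injective hσ
    have h3 := congrArg d h2
    rw [map_zero, map_sum] at h3
    rw [← h3]
    refine Finset.sum_congr rfl fun q _ ↦ ?_
    rw [map_smul, smul_eq_mul, mul_comm]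

/-- Twisting a homomorphism by a family of additive characters, with a criterion for
surjectivity of the twist. -/
theorem exists_twist {Γ G : Type*} [Group Γ] [Group G] {N : Subgroup G} [N.Normal]
    (hNcomm : ∀ a ∈ N, ∀ b ∈ N, a * b = b * a) {ℓ : ℕ} (hℓ : ℓ.Prime) (hNℓ : ∀ a ∈ N, a ^ ℓ = 1)
    (hmin : ∀ M : Subgroup G, M.Normal → M ≤ N → M = ⊥ ∨ M = N) (hN : N ≠ ⊥)
    (F : Γ →* G) [Fintype F.range] (hF : F.range ⊔ N = ⊤) :
    ∃ c : F.range → ZMod ℓ, c 1 ≠ 0 ∧ ∀ b : F.range → Γ → ZMod ℓ,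
      (∀ q σ τ, b q (σ * τ) = b q σ + b ((F.rangeRestrict σ)⁻¹ * q) τ) →
      ∃ F' : Γ →* G, (∀ σ, (F' σ : G ⧸ N) = F σ) ∧
        (∀ σ, F σ = 1 → (∀ q, b q σ = 0) → F' σ = 1) ∧
        (Function.Surjective F' ∨ ∀ σ, F σ = 1 → ∑ q, c q * b q σ = 0) := by
  let _ : CommGroup N := { N.toGroup with
    mul_comm := fun a b ↦ Subtype.ext (hNcomm a a.2 b b.2) }
  obtain ⟨a, ha⟩ := (Subgroup.ne_bot_iff_exists_ne_one).mp hN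
  have hA (a : N) : a ^ ℓ = 1 := Subtype.ext (hNℓ a a.2)
  obtain ⟨c, hc, H⟩ := exists_twisting_cocycle hℓ hA (MulAut.conjNormal.comp F.range.subtype) ha
  refine ⟨c, hc, fun b hb ↦ ?_⟩
  obtain ⟨ψ, hψ, hψ1, hψc⟩ := H F.rangeRestrict b hb
  have hcj (σ : Γ) (a : N) :
      (((MulAut.conjNormal.comp F.range.subtype) (F.rangeRestrict σ) a : N) : G) =
        F σ * a * (F σ)⁻¹ := MulAut.conjNormal_apply (F σ) a
  let F' : Γ →* G := MonoidHom.mk' (fun σ ↦ (ψ σ : G) * F σ) fun σ τ ↦ by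
    rw [hψ, Subgroup.coe_mul, hcj, map_mul]
    group
  have hF'N (σ : Γ) : (F' σ : G ⧸ N) = F σ := by
    change (((ψ σ : G) * F σ : G) : G ⧸ N) = F σ
    rw [QuotientGroup.mk_mul, (QuotientGroup.eq_one_iff _).mpr (ψ σ).2, one_mul]
  have hF'1 (σ : Γ) (hσ : F σ = 1) : F' σ = (ψ σ : G) := by
    change (ψ σ : G) * F σ = _
    rw [hσ, mul_one]
  have hsup : F'.range ⊔ N = ⊤ := by
    rw [← top_le_iff, ← hF, sup_le_iff]
    refine ⟨?_, le_sup_right⟩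
    rintro _ ⟨σ, rfl⟩
    have h1 : (F' σ)⁻¹ * F σ ∈ N := QuotientGroup.eq.mp (hF'N σ)
    have h2 := Subgroup.mul_mem_sup (show F' σ ∈ F'.range from ⟨σ, rfl⟩) h1
    rwa [mul_inv_cancel_left] at h2
  refine ⟨F', hF'N, fun σ hσ hbσ ↦ ?_, ?_⟩
  · rw [hF'1 σ hσ, hψ1 σ hbσ, OneMemClass.coe_one]
  · by_cases hbot : F'.range ⊓ N = ⊥
    · right
      intro σ hσ
      have h1 : F' σ ∈ F'.range ⊓ N := ⟨⟨σ, rfl⟩, hF'1 σ hσ ▸ (ψ σ).2⟩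
      rw [hbot, Subgroup.mem_bot, hF'1 σ hσ] at h1
      exact hψc σ (Subtype.ext h1)
    · left
      exact MonoidHom.range_eq_top.mp (eq_top_of_inf_ne_bot hNcomm hmin hsup hbot)

end Twist

section ArtinSchreierObstruction

variable {k L : Type*} [Field k] [Field L] [Algebra k L] {z : L}

theorem mem_range_of_isAlgebraic [IsAlgClosed k] {x : L} (hx : IsAlgebraic k x) :
    x ∈ (algebraMap k L).range :=
  minpoly.mem_range_of_degree_eq_one k x
    (IsAlgClosed.degree_eq_one_of_irreducible k (minpoly.irreducible hx.isIntegral))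

theorem mem_range_of_forall_pow_mem [IsAlgClosed k] (U : Submodule k L) [Module.Finite k U]
    {p : ℕ} (hp : 1 < p) {y : L} (hy : ∀ i ≤ Module.finrank k U, y ^ p ^ i ∈ U) :
    y ∈ (algebraMap k L).range := by
  apply mem_range_of_isAlgebraic
  by_contra hy'
  have htr : Transcendental k y := hy'
  let v (i : Fin (Module.finrank k U + 1)) : U := ⟨_, hy i (Nat.lt_succ_iff.mp i.2)⟩
  have hpow : LinearIndependent k fun i : ℕ ↦ y ^ i := by
    have h1 := (Polynomial.basisMonomials k).linearIndependent.map'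
      (Polynomial.aeval y).toLinearMap (LinearMap.ker_eq_bot.mpr
        (transcendental_iff_injective.mp htr))
    convert! h1 using 2 with i
    simp
  have hv : LinearIndependent k v := by
    apply LinearIndependent.of_comp U.subtype
    exact hpow.comp (fun i : Fin _ ↦ p ^ (i : ℕ))
      (fun i j h ↦ Fin.ext (Nat.pow_right_injective hp h))
  have := hv.fintype_card_le_finrank
  simp at this

theorem mem_range_of_artinSchreier_closed [IsAlgClosed k] {p : ℕ} [Fact p.Prime] [CharP L p]
    (U : Submodule k L) [Module.Finite k U] (hU : ∀ w ∈ U, ∃ y ∈ U, y ^ p - y = w) {w : L}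
    (hw : w ∈ U) : w ∈ (algebraMap k L).range := by
  have key (m : ℕ) : ∃ y ∈ U, w ∈ Algebra.adjoin k {y} ∧ ∀ i ≤ m, y ^ p ^ i ∈ U := by
    induction m with
    | zero => exact ⟨w, hw, Algebra.self_mem_adjoin_singleton k w, fun i hi ↦ by
        simpa [Nat.le_zero.mp hi] using hw⟩
    | succ m ih =>
      obtain ⟨y, hyU, hwy, hy⟩ := ih
      obtain ⟨x, hxU, hx⟩ := hU y hyU
      have hxp : x ^ p = y + x := by rw [← hx]; ring
      refine ⟨x, hxU, ?_, ?_⟩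
      · refine (Algebra.adjoin_le ?_ : Algebra.adjoin k {y} ≤ Algebra.adjoin k {x}) hwy
        rw [Set.singleton_subset_iff, SetLike.mem_coe, ← hx]
        exact sub_mem (pow_mem (Algebra.self_mem_adjoin_singleton k x) _)
          (Algebra.self_mem_adjoin_singleton k x)
      · intro i
        induction i with
        | zero => intro _; simpa using hxU
        | succ i ihi =>
          intro hi
          rw [pow_succ', pow_mul, hxp, add_pow_char_pow]
          exact add_mem (hy i (by lia)) (ihi (by lia))
  obtain ⟨y, -, hwy, hy⟩ := key (Module.finrank k U)
  obtain ⟨a, rfl⟩ := mem_range_of_forall_pow_mem U (Fact.out : p.Prime).one_lt hy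
  have : Algebra.adjoin k {algebraMap k L a} ≤ ⊥ := Algebra.adjoin_le (by
    rw [Set.singleton_subset_iff]
    exact ⟨a, rfl⟩)
  exact this hwy

theorem isIntegral_of_pow_eq {R A : Type*} [CommRing R] [CommRing A] [Algebra R A] {a b x : A}
    (ha : IsIntegral R a) (hb : IsIntegral R b) {n : ℕ} (hn : 1 < n) (h : x ^ n = a * x + b) :
    IsIntegral R x := by
  let S := integralClosure R A
  let q : Polynomial S := Polynomial.X ^ n -
    (Polynomial.C ⟨a, ha⟩ * Polynomial.X + Polynomial.C ⟨b, hb⟩)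
  have hq : q.Monic := by
    refine Polynomial.monic_X_pow_sub (lt_of_le_of_lt Polynomial.degree_linear_le ?_)
    exact_mod_cast hn
  have e1 : (algebraMap S A) ⟨a, ha⟩ = a := rfl
  have e2 : (algebraMap S A) ⟨b, hb⟩ = b := rfl
  have hroot : Polynomial.aeval x q = 0 := by
    simp only [q, map_sub, map_add, map_mul, map_pow, Polynomial.aeval_X, Polynomial.aeval_C,
      e1, e2, h, sub_self]
  exact isIntegral_trans (R := R) x (⟨q, hq, hroot⟩ : IsIntegral S x)

theorem mem_poleFilt_of_artinSchreier {p : ℕ} (hp : 1 < p) {y w : L}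
    (hy : y ∈ intClosure k z) (hyw : y ^ p - y = w) {N M : ℕ} (hw : w ∈ poleFilt k z N)
    (hNM : N ≤ p * M) : y ∈ poleFilt k z M := by
  have h1 := (mem_poleFilt.mp (poleFilt_mono hNM hw)).2
  refine mem_poleFilt.mpr ⟨hy, ?_⟩
  have hyw' : (z⁻¹ ^ M * y) ^ p = z⁻¹ ^ ((p - 1) * M) * (z⁻¹ ^ M * y) + z⁻¹ ^ (p * M) * w := by
    have h2 : z⁻¹ ^ (p * M) = z⁻¹ ^ ((p - 1) * M) * z⁻¹ ^ M := by
      rw [← pow_add]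
      congr 1
      obtain ⟨n, rfl⟩ : ∃ n, p = n + 1 := ⟨p - 1, by lia⟩
      rw [Nat.add_sub_cancel]
      ring
    rw [mul_pow, ← pow_mul, mul_comm M p, h2, ← hyw]
    ring
  exact isIntegral_of_pow_eq (pow_mem (self_mem_intClosure _) _) h1 hp hyw'

/-- For a nonconstant `w`, some constant multiple of `w` is not of the form `y ^ p - y`. -/
theorem IsSepGen.exists_artinSchreier_ne [IsAlgClosed k] (h : IsSepGen k z) {p : ℕ}
    [Fact p.Prime] [CharP k p] {w : L} (hw : w ∈ intClosure k z)
    (hwk : w ∉ (algebraMap k L).range) :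
    ∃ a : k, ∀ y ∈ intClosure k z, y ^ p - y ≠ a • w := by
  have hL : CharP L p := charP_of_injective_algebraMap (algebraMap k L).injective p
  by_contra! hcon
  let W : Submodule k L :=
    { carrier := {w | w ∈ intClosure k z ∧ ∀ a : k, ∃ y ∈ intClosure k z, y ^ p - y = a • w}
      zero_mem' := ⟨zero_mem _, fun a ↦ ⟨0, zero_mem _, by
        simp [(Fact.out : p.Prime).ne_zero]⟩⟩
      add_mem' := by
        rintro w₁ w₂ ⟨h₁, h₁'⟩ ⟨h₂, h₂'⟩
        refine ⟨add_mem h₁ h₂, fun a ↦ ?_⟩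
        obtain ⟨y₁, hy₁, e₁⟩ := h₁' a
        obtain ⟨y₂, hy₂, e₂⟩ := h₂' a
        exact ⟨y₁ + y₂, add_mem hy₁ hy₂, by rw [add_pow_char, smul_add, ← e₁, ← e₂]; ring⟩
      smul_mem' := by
        rintro c w ⟨h, h'⟩
        refine ⟨Subalgebra.smul_mem _ h c, fun a ↦ ?_⟩
        obtain ⟨y, hy, e⟩ := h' (a * c)
        exact ⟨y, hy, by rw [e, mul_smul]⟩ }
  have hWstep (w : L) (hw : w ∈ W) : ∃ y ∈ W, y ^ p - y = w := by
    obtain ⟨y, hy, e⟩ := hw.2 1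
    rw [one_smul] at e
    refine ⟨y, ⟨hy, fun a ↦ ?_⟩, e⟩
    obtain ⟨μ, hμ⟩ := exists_artinSchreier_root (F := k) (Fact.out : p.Prime) (-a)
    obtain ⟨v, hv, e'⟩ := hw.2 (μ ^ p)
    refine ⟨v - μ • y, sub_mem hv (Subalgebra.smul_mem _ hy μ), ?_⟩
    have ha : a = μ - μ ^ p := by rw [← neg_neg a, ← hμ]; ring
    rw [sub_pow_char, smul_pow, ha, sub_smul]
    rw [← e, smul_sub] at e'
    linear_combination e'
  have hbase (w : L) (hw : w ∈ W ⊓ poleFilt k z 1) : w ∈ (algebraMap k L).range := by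
    have := h.finite_poleFilt 1
    have : Module.Finite k (W ⊓ poleFilt k z 1 : Submodule k L) :=
      Submodule.finiteDimensional_of_le (inf_le_right : W ⊓ poleFilt k z 1 ≤ poleFilt k z 1)
    refine mem_range_of_artinSchreier_closed _ (fun w hw ↦ ?_) hw
    obtain ⟨y, hy, e⟩ := hWstep w hw.1
    exact ⟨y, ⟨hy, mem_poleFilt_of_artinSchreier (Fact.out : p.Prime).one_lt hy.1 e hw.2
      (by rw [mul_one]; exact (Fact.out : p.Prime).one_lt.le)⟩, e⟩
  have hall (N : ℕ) : ∀ w ∈ W, w ∈ poleFilt k z N → w ∈ (algebraMap k L).range := by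
    induction N using Nat.strong_induction_on with
    | _ N ih =>
    intro w hw hwN
    by_cases hN : N ≤ 1
    · exact hbase w ⟨hw, poleFilt_mono hN hwN⟩
    · obtain ⟨y, hy, e⟩ := hWstep w hw
      have hp2 : 2 ≤ p := (Fact.out : p.Prime).two_le
      have hle : N ≤ p * (N - 1) := by
        have : 2 * (N - 1) ≤ p * (N - 1) := Nat.mul_le_mul_right _ hp2
        lia
      have hyr := ih (N - 1) (by lia) y hy
        (mem_poleFilt_of_artinSchreier (Fact.out : p.Prime).one_lt hy.1 e hwN hle)
      rw [← e]
      exact sub_mem (pow_mem hyr p) hyr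
  obtain ⟨M, hM⟩ := exists_mem_poleFilt h.ne_zero hw
  exact hwk (hall M w ⟨hw, hcon⟩ (hM M le_rfl))

end ArtinSchreierObstruction

section Combination

variable {k L S : Type*} [Field k] [Field L] [Algebra k L] {z : L} [Group S]
  {ρ : S →* (L ≃ₐ[k] L)}

theorem IsSepGen.exists_combination_notMem_range [Fintype S] (h : IsSepGen k z)
    (hz : ∀ q, ρ q z = z) (hinj : Function.Injective ρ) {c : S → k} (hc : c 1 ≠ 0) :
    ∃ θ ∈ intClosure k z, ∑ q, c q • ρ q θ ∉ (algebraMap k L).range := by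
  have := h.isFractionRing
  obtain ⟨b, hb⟩ : ∃ b : intClosure k z, ∑ q, c q • ρ q (b : L) ≠ 0 := by
    by_contra! hcon
    have hinj' : Function.Injective fun q : S ↦
        (((ρ q : L →ₐ[k] L) : L →* L).comp ((intClosure k z).val : intClosure k z →* L)) := by
      intro q q' hq
      apply hinj
      ext x
      obtain ⟨a, b, -, rfl⟩ := IsFractionRing.div_surjective (A := intClosure k z) x
      have h1 (a : intClosure k z) : ρ q (a : L) = ρ q' (a : L) := DFunLike.congr_fun hq a
      have h2 := h1 a
      have h3 := h1 b
      rw [map_div₀, map_div₀]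
      exact congrArg₂ (· / ·) h2 h3
    have hli := (linearIndependent_monoidHom (intClosure k z) L).comp _ hinj'
    have h1 := Fintype.linearIndependent_iff.mp hli (fun q ↦ algebraMap k L (c q)) (by
      ext b
      rw [Finset.sum_apply, Pi.zero_apply, ← hcon b]
      exact Finset.sum_congr rfl fun q _ ↦ (Algebra.smul_def (c q) (ρ q (b : L))).symm) 1
    exact hc ((map_eq_zero _).mp h1)
  by_cases h1 : ∑ q, c q • ρ q (b : L) ∈ (algebraMap k L).range
  · refine ⟨z * b, mul_mem (self_mem_intClosure z) b.2, fun h2 ↦ h.transcendental ?_⟩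
    obtain ⟨a₁, e₁⟩ := h1
    obtain ⟨a₂, e₂⟩ := h2
    have h3 : ∑ q, c q • ρ q (z * (b : L)) = z * ∑ q, c q • ρ q (b : L) := by
      rw [Finset.mul_sum]
      refine Finset.sum_congr rfl fun q _ ↦ ?_
      rw [map_mul, hz, mul_smul_comm]
    rw [h3, ← e₁] at e₂
    rw [← e₁] at hb
    have : z = algebraMap k L (a₂ / a₁) := by
      rw [map_div₀, e₂, mul_div_cancel_right₀ _ hb]
    rw [this]
    exact isAlgebraic_algebraMap _
  · exact ⟨b, b.2, h1⟩

end Combination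

section GoodHom

variable {k K Ω : Type*} [Field k] [Field K] [Field Ω] [Algebra k K] [Algebra K Ω] [Algebra k Ω]
  [IsScalarTower k K Ω] {t : K}

theorem isOpen_ker_of_fixes [Algebra.IsAlgebraic K Ω] {G : Type*} [Group G]
    (f : (Ω ≃ₐ[K] Ω) →* G) (L : IntermediateField K Ω) [FiniteDimensional K L] {ι : Type*}
        [Finite ι]
    (x : ι → Ω) (h : ∀ σ : Ω ≃ₐ[K] Ω, (∀ y : L, σ y = y) → (∀ i, σ (x i) = x i) → f σ = 1) :
    IsOpen (f.ker : Set (Ω ≃ₐ[K] Ω)) := by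
  let M : IntermediateField K Ω := IntermediateField.adjoin K (Set.range x)
  have : FiniteDimensional K M := IntermediateField.finiteDimensional_adjoin
    (S := Set.range x) fun y _ ↦ Algebra.IsIntegral.isIntegral y
  refine Subgroup.isOpen_mono (H₁ := (L ⊔ M).fixingSubgroup) ?_
    (IntermediateField.fixingSubgroup_isOpen (L ⊔ M))
  intro σ hσ
  rw [IntermediateField.mem_fixingSubgroup_iff] at hσ
  exact h σ (fun y ↦ hσ y ((le_sup_left : L ≤ L ⊔ M) y.2)) fun i ↦
    hσ _ ((le_sup_right : M ≤ L ⊔ M) (IntermediateField.subset_adjoin K _ ⟨i, rfl⟩))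

theorem IsGoodHom.isGood_comp_subtype {G : Type*} [Group G] {f : (Ω ≃ₐ[K] Ω) →* G}
    (hf : IsGoodHom k t f) {Γ' : Subgroup (Ω ≃ₐ[K] Ω)} (hΓ' : IsOpen (Γ' : Set (Ω ≃ₐ[K] Ω))) :
    IsGood k t (f.comp Γ'.subtype) := by
  refine ⟨?_, fun σ Y hY ↦ hf.inert σ Y hY⟩
  refine Subgroup.isOpen_mono (H₁ := f.ker ⊓ Γ') ?_ (hf.isOpen.inter hΓ')
  rintro σ ⟨hσ, hσ'⟩
  exact ⟨⟨σ, hσ'⟩, hσ, rfl⟩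

theorem IsGoodHom.isGoodHom_rangeRestrict {G : Type*} [Group G] {f : (Ω ≃ₐ[K] Ω) →* G}
    (hf : IsGoodHom k t f) : IsGoodHom k t f.rangeRestrict := by
  refine ⟨?_, fun σ Y hY ↦ Subtype.ext (hf.inert σ Y hY)⟩
  rw [MonoidHom.ker_rangeRestrict]
  exact hf.isOpen

theorem IsGoodHom.exists_finite_level [IsAlgClosed k] [IsGalois K Ω] (ht : IsSepGen k t)
    {P : Type*} [Group P] {f : (Ω ≃ₐ[K] Ω) →* P}
    (hf : IsGoodHom k t f) (hsurj : Function.Surjective f) :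
    ∃ (L : IntermediateField K Ω) (ρ : P →* (L ≃ₐ[k] L)), FiniteDimensional K L ∧
      IsSepGen k (algebraMap K L t) ∧
      (∀ (σ : Ω ≃ₐ[K] Ω) (x : L), ((ρ (f σ) x : L) : Ω) = σ x) ∧
      Function.Injective ρ ∧ (∀ p, ρ p (algebraMap K L t) = algebraMap K L t) ∧
      (∀ (y : intClosure k (algebraMap K L t) →ₐ[k] k) p, InertAt y (ρ p) → p = 1) ∧
      (∀ σ : Ω ≃ₐ[K] Ω, (∀ x : L, σ x = x) → f σ = 1) ∧
      (∀ x : Ω, (∀ σ : Ω ≃ₐ[K] Ω, f σ = 1 → σ x = x) → x ∈ L) := by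
  obtain ⟨L, ρ, h1, h2, h3, h4, h5, h6, h7, h8⟩ :=
    (hf.isGood_comp_subtype (Γ' := ⊤) isOpen_univ).exists_finite_level ht
      (fun p ↦ by obtain ⟨σ, rfl⟩ := hsurj p; exact ⟨⟨σ, trivial⟩, rfl⟩)
  exact ⟨L, ρ, h1, h2, fun σ ↦ h3 ⟨σ, trivial⟩, h4, h5, h6,
    fun σ hσ ↦ (h7 σ hσ).2, fun x hx ↦ h8 x fun σ hσ ↦ hx σ hσ⟩

/-- In characteristic `p`, a weak lift through an elementary abelian `p`-group
can be modified to be surjective. -/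
theorem IsGoodHom.exists_surjective_of_charP [IsAlgClosed k] [IsGalois K Ω] [IsSepClosed Ω]
    (ht : IsSepGen k t) {G : Type*} [Group G] [Finite G] {N : Subgroup G} [N.Normal]
    (hNcomm : ∀ a ∈ N, ∀ b ∈ N, a * b = b * a) {p : ℕ} [Fact p.Prime] [CharP k p]
    (hNp : ∀ a ∈ N, a ^ p = 1) (hmin : ∀ M : Subgroup G, M.Normal → M ≤ N → M = ⊥ ∨ M = N)
    (hN : N ≠ ⊥) {F : (Ω ≃ₐ[K] Ω) →* G} (hF : IsGoodHom k t F) (hFN : F.range ⊔ N = ⊤) :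
    ∃ F' : (Ω ≃ₐ[K] Ω) →* G, IsGoodHom k t F' ∧ Function.Surjective F' := by
  have hp : p.Prime := Fact.out
  have : CharP Ω p := charP_of_injective_algebraMap (algebraMap k Ω).injective p
  let _ : Fintype F.range := Fintype.ofFinite _
  obtain ⟨c, hc, H⟩ := exists_twist hNcomm hp hNp hmin hN F hFN
  obtain ⟨L, ρ, hL, hsep, hρ, hinj, hz, -, hfix, hmemL⟩ :=
    hF.isGoodHom_rangeRestrict.exists_finite_level ht F.rangeRestrict_surjective
  have : CharP L p := charP_of_injective_algebraMap (algebraMap k L).injective p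
  let j : ZMod p →+* k := ZMod.castHom dvd_rfl k
  have hj : Function.Injective j := j.injective
  have hjp (a : ZMod p) : j a ^ p = j a := by rw [← map_pow, ZMod.pow_card]
  obtain ⟨θ, hθ, hθk⟩ := hsep.exists_combination_notMem_range hz hinj (c := fun q ↦ j (c q))
    fun h0 ↦ hc (hj (h0.trans (map_zero j).symm))
  have hρint (q) {x : L} (hx : x ∈ intClosure k (algebraMap K L t)) :
      ρ q x ∈ intClosure k (algebraMap K L t) := map_mem_intClosure hz q hx
  obtain ⟨a, ha⟩ := hsep.exists_artinSchreier_ne (p := p)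
    (sum_mem fun q _ ↦ Subalgebra.smul_mem _ (hρint q hθ) _) hθk
  choose y hy using fun q : F.range ↦ exists_artinSchreier_root hp ((ρ q (a • θ) : L) : Ω)
  have hyint (q) : y q ∈ intClosure k (algebraMap K Ω t) := by
    refine isIntegral_of_pow_eq (a := (1 : Ω)) isIntegral_one
      (coe_mem_intClosure (hρint q (Subalgebra.smul_mem _ hθ a))) hp.one_lt ?_
    rw [← hy q]
    ring
  have hb (q : F.range) (σ : Ω ≃ₐ[K] Ω) : ∃ b : ZMod p,
      algebraMap k Ω (j b) = σ (y ((F.rangeRestrict σ)⁻¹ * q)) - y q := by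
    have h2 := congrArg σ (hy ((F.rangeRestrict σ)⁻¹ * q))
    rw [← hρ, ← AlgEquiv.mul_apply, ← map_mul, mul_inv_cancel_left, ← hy q, map_sub, map_pow] at h2
    refine exists_eq_of_isRoot (q := (Polynomial.X ^ p - Polynomial.X : Polynomial Ω))
      (FiniteField.X_pow_card_sub_X_ne_zero Ω hp.one_lt)
      (by rw [Nat.card_zmod]; exact (FiniteField.X_pow_card_sub_X_natDegree_eq Ω hp.one_lt).le)
      (j := fun b : ZMod p ↦ algebraMap k Ω (j b)) ((algebraMap k Ω).injective.comp hj)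
      (fun b ↦ by simp [← map_pow]) ?_
    simp only [Polynomial.IsRoot.def, Polynomial.eval_sub, Polynomial.eval_pow,
      Polynomial.eval_X]
    rw [sub_pow_char]
    linear_combination h2
  choose b hb using hb
  have hbmul (q : F.range) (σ τ : Ω ≃ₐ[K] Ω) :
      b q (σ * τ) = b q σ + b ((F.rangeRestrict σ)⁻¹ * q) τ := by
    apply hj
    apply (algebraMap k Ω).injective
    have h1 := congrArg σ (hb ((F.rangeRestrict σ)⁻¹ * q) τ)
    rw [IsScalarTower.algebraMap_apply k K Ω, AlgEquiv.commutes,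
      ← IsScalarTower.algebraMap_apply k K Ω, map_sub] at h1
    rw [map_add, map_add, hb, hb, h1, map_mul, mul_inv_rev, mul_assoc, AlgEquiv.mul_apply]
    ring
  obtain ⟨F', -, hF'1, hF'⟩ := H b hbmul
  have hb1 (q : F.range) (σ : Ω ≃ₐ[K] Ω) (hσ : F σ = 1) :
      algebraMap k Ω (j (b q σ)) = σ (y q) - y q := by
    have h1 : F.rangeRestrict σ = 1 := Subtype.ext hσ
    rw [hb, h1, inv_one, one_mul]
  refine ⟨F', ⟨?_, fun σ Y hY ↦ ?_⟩, ?_⟩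
  · refine isOpen_ker_of_fixes F' L y fun σ hσ hσy ↦ ?_
    have h1 : F σ = 1 := congrArg Subtype.val (hfix σ hσ)
    refine hF'1 σ h1 fun q ↦ hj ((algebraMap k Ω).injective ?_)
    rw [hb1 q σ h1, hσy, sub_self, map_zero, map_zero]
  · have h1 := hF.inert σ Y hY
    refine hF'1 σ h1 fun q ↦ hj ?_
    have h3 : σ (y q) = algebraMap k Ω (j (b q σ)) + y q := sub_eq_iff_eq_add.mp (hb1 q σ h1).symm
    let T : intClosure k (algebraMap K Ω t) := ⟨y q, hyint q⟩
    have h4 : ((algebraMap k (intClosure k (algebraMap K Ω t)) (j (b q σ)) + T :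
        intClosure k (algebraMap K Ω t)) : Ω) = algebraMap k Ω (j (b q σ)) + y q := rfl
    have h2 := hY T (algebraMap k (intClosure k (algebraMap K Ω t)) (j (b q σ)) + T)
      (h3.trans h4.symm)
    rw [map_add, AlgHom.commutes, add_eq_right] at h2
    rw [map_zero]
    exact h2
  · refine hF'.resolve_right fun hcon ↦ ?_
    let x : Ω := ∑ q, j (c q) • y q
    have hxL : x ∈ L := by
      refine hmemL x fun σ hσ ↦ ?_
      have hσ1 : F σ = 1 := congrArg Subtype.val hσ
      have h1 := congrArg (fun a ↦ algebraMap k Ω (j a)) (hcon σ hσ1)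
      simp only [map_sum, map_mul, map_zero, hb1 _ σ hσ1, mul_sub, Finset.sum_sub_distrib] at h1
      rw [sub_eq_zero] at h1
      simp only [x, Algebra.smul_def, map_sum, map_mul]
      rw [← h1]
      refine Finset.sum_congr rfl fun q _ ↦ ?_
      rw [IsScalarTower.algebraMap_apply k K Ω, AlgEquiv.commutes]
    have hxint : x ∈ intClosure k (algebraMap K Ω t) :=
      sum_mem fun q _ ↦ Subalgebra.smul_mem _ (hyint q) _
    have hxint' : (⟨x, hxL⟩ : L) ∈ intClosure k (algebraMap K L t) :=
      (map_mem_intClosure_iff (z := algebraMap K L t) (L.val.restrictScalars k)).mp hxint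
    refine ha _ hxint' (Subtype.ext ?_)
    have h1 : x ^ p - x = ∑ q, j (c q) • ((ρ q (a • θ) : L) : Ω) := by
      have h2 : x ^ p = ∑ q, j (c q) • y q ^ p := by
        simp only [x]
        rw [sum_pow_char]
        simp only [smul_pow, hjp]
      rw [h2, ← Finset.sum_sub_distrib]
      refine Finset.sum_congr rfl fun q _ ↦ ?_
      rw [← smul_sub, hy]
    change x ^ p - x = _
    rw [h1]
    have h3 : a • ∑ q, j (c q) • ρ q θ = ∑ q, j (c q) • ρ q (a • θ) := by
      rw [Finset.smul_sum]
      refine Finset.sum_congr rfl fun q _ ↦ ?_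
      rw [map_smul, smul_comm]
    rw [h3]
    change _ = (L.val.restrictScalars k) _
    rw [map_sum]
    refine Finset.sum_congr rfl fun q _ ↦ ?_
    rw [map_smul]
    rfl

end GoodHom

section Kummer

variable {k L P : Type*} [Field k] [Field L] [Algebra k L] {z : L}

theorem IsSepGen.notMem_regularUnits (h : IsSepGen k z) {ℓ : ℕ} (hℓ : ℓ ≠ 1)
    {y : intClosure k z →ₐ[k] k} {J : Ideal (intClosure k z)}
    {g : intClosure k z} (hg0 : g ≠ 0) (hg : Ideal.span {g} = RingHom.ker y * J ^ ℓ)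
    {x : Lˣ} (hx : (x : L) = g) : x ∉ regularUnits ℓ y := by
  classical
  have := h.isDedekindDomain
  have := h.isFractionRing
  intro hmem
  obtain ⟨c, s₁, s₂, hs1, hs2, hs⟩ := mem_regularUnits.mp hmem
  obtain ⟨c₁, c₂, hc2, hc⟩ := IsFractionRing.div_surjective (A := intClosure k z) (c : L)
  have hc20 : c₂ ≠ 0 := nonZeroDivisors.ne_zero hc2
  have hc2L : (algebraMap (intClosure k z) L c₂) ≠ 0 := by simpa using hc20
  have hc10 : c₁ ≠ 0 := by
    rintro rfl
    rw [map_zero, zero_div] at hc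
    exact c.ne_zero hc.symm
  have hs10 : s₁ ≠ 0 := fun h0 ↦ hs1 (by rw [h0, map_zero])
  have hs20 : s₂ ≠ 0 := fun h0 ↦ hs2 (by rw [h0, map_zero])
  have key : g * c₁ ^ ℓ * s₂ = s₁ * c₂ ^ ℓ := by
    apply FaithfulSMul.algebraMap_injective (intClosure k z) L
    have h1 : (algebraMap (intClosure k z) L g) * (c : L) ^ ℓ * algebraMap (intClosure k z) L s₂ =
        algebraMap (intClosure k z) L s₁ := by
      have : ((x * c ^ ℓ : Lˣ) : L) = (g : L) * (c : L) ^ ℓ := by simp [hx]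
      rw [this] at hs
      exact hs
    rw [← hc, div_pow] at h1
    rw [map_mul, map_mul, map_mul, map_pow, map_pow, ← h1]
    field_simp
  have hP : Irreducible (RingHom.ker y) :=
    (Ideal.prime_of_isPrime (h.ker_ne_bot y) (ker_isMaximal y).isPrime).irreducible
  have hJ : J ^ ℓ ≠ 0 := by
    intro hJ
    rw [hJ, mul_zero] at hg
    exact hg0 (Ideal.span_singleton_eq_bot.mp hg)
  have hspan {s : intClosure k z} (hs : s ≠ 0) : Ideal.span {s} ≠ 0 := by
    simpa [Ideal.zero_eq_bot] using hs
  have hcount {s : intClosure k z} (hs0 : s ≠ 0) (hs : y s ≠ 0) :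
      (UniqueFactorizationMonoid.normalizedFactors (Ideal.span {s})).count (RingHom.ker y) = 0 := by
    rw [Multiset.count_eq_zero]
    intro hmem
    have := UniqueFactorizationMonoid.dvd_of_mem_normalizedFactors hmem
    exact hs (Ideal.dvd_span_singleton.mp this)
  have hid := congrArg (fun a ↦ (UniqueFactorizationMonoid.normalizedFactors
    (Ideal.span {a})).count (RingHom.ker y)) key
  simp only [← Ideal.span_singleton_mul_span_singleton, ← Ideal.span_singleton_pow, hg] at hid
  rw [UniqueFactorizationMonoid.normalizedFactors_mul
      (mul_ne_zero (mul_ne_zero hP.ne_zero hJ) (pow_ne_zero _ (hspan hc10))) (hspan hs20),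
    UniqueFactorizationMonoid.normalizedFactors_mul (mul_ne_zero hP.ne_zero hJ)
      (pow_ne_zero _ (hspan hc10)),
    UniqueFactorizationMonoid.normalizedFactors_mul hP.ne_zero hJ,
    UniqueFactorizationMonoid.normalizedFactors_mul (hspan hs10) (pow_ne_zero _ (hspan hc20)),
    UniqueFactorizationMonoid.normalizedFactors_pow,
    UniqueFactorizationMonoid.normalizedFactors_pow,
    UniqueFactorizationMonoid.normalizedFactors_pow,
    UniqueFactorizationMonoid.normalizedFactors_irreducible hP] at hid
  simp only [Multiset.count_add, Multiset.count_nsmul, hcount hs10 hs1, hcount hs20 hs2,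
    normalize_eq, Multiset.count_singleton_self, add_zero, zero_add] at hid
  have h1 : ℓ ∣ 1 := by
    rw [Nat.dvd_iff_mod_eq_zero]
    have := congrArg (· % ℓ) hid
    simpa [Nat.add_mod] using this
  exact hℓ (Nat.dvd_one.mp h1)

end Kummer

section Kummer

variable {k L P : Type*} [Field k] [Field L] [Algebra k L] {z : L} [Group P] {ρ : P →* (L ≃ₐ[k] L)}

theorem IsSepGen.exists_place [IsAlgClosed k] (h : IsSepGen k z) :
    Nonempty (intClosure k z →ₐ[k] k) := by
  have := h.finiteType
  obtain ⟨M, hM⟩ := Ideal.exists_maximal (intClosure k z)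
  obtain ⟨y, -⟩ := exists_algHom_ker_eq (k := k) M
  exact ⟨y⟩

theorem aeval_mem_localUnits (y : intClosure k z →ₐ[k] k) {q : k[X]}
    (hq : q.eval (y ⟨z, self_mem_intClosure z⟩) ≠ 0) {x : Lˣ}
        (hx : (x : L) = Polynomial.aeval z q) :
    x ∈ localUnits y := by
  refine mem_localUnits.mpr ⟨Polynomial.aeval ⟨z, self_mem_intClosure z⟩ q, 1, ?_, by simp, ?_⟩
  · rwa [← Polynomial.aeval_algHom_apply, Polynomial.coe_aeval_eq_eval]
  · rw [OneMemClass.coe_one, mul_one, hx]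
    exact Polynomial.aeval_algHom_apply (intClosure k z).val ⟨z, self_mem_intClosure z⟩ q

/-- At the points over `b₀`, a rational function of `z` is a power of `z - b₀` up to units. -/
theorem exists_zpow_mul_aeval_mem_localUnits {q : k[X]} (hq : q ≠ 0)
    (y : intClosure k z →ₐ[k] k) {u x : Lˣ}
    (hu : (u : L) = z - algebraMap k L (y ⟨z, self_mem_intClosure z⟩))
    (hx : (x : L) = Polynomial.aeval z q) : ∃ n : ℤ, x * u ^ n ∈ localUnits y := by
  obtain ⟨r, hr, hrd⟩ := q.exists_eq_pow_rootMultiplicity_mul_and_not_dvd hq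
    (y ⟨z, self_mem_intClosure z⟩)
  rw [Polynomial.dvd_iff_isRoot] at hrd
  refine ⟨-(q.rootMultiplicity (y ⟨z, self_mem_intClosure z⟩) : ℤ),
    aeval_mem_localUnits y hrd ?_⟩
  rw [zpow_neg, zpow_natCast, Units.val_mul, Units.val_inv_eq_inv_val,
    Units.val_pow_eq_pow_val, hx, ← div_eq_mul_inv, div_eq_iff (pow_ne_zero _ u.ne_zero)]
  conv_lhs => rw [hr]
  rw [map_mul, map_pow, map_sub, Polynomial.aeval_X, Polynomial.aeval_C, hu, mul_comm]

/-- There is a function whose `ℓ`-th roots ramify at a point `y₀`, but not at its conjugates, and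
become unramified after adjoining an `ℓ`-th root of `z - b₀`. -/
theorem IsSepGen.exists_ramified_generator [IsAlgClosed k] [Finite P] (h : IsSepGen k z)
    (hz : ∀ p, ρ p z = z) (hfree : ∀ (y : intClosure k z →ₐ[k] k) p, InertAt y (ρ p) → p = 1)
    (hfix : ∀ x, (∀ p, ρ p x = x) → x ∈ k⟮z⟯) {ℓ : ℕ} (hℓ : ℓ ≠ 1) (hℓk : (ℓ : k) ≠ 0) :
    ∃ (b₀ : k) (u β : Lˣ) (y₀ : intClosure k z →ₐ[k] k), (u : L) = z - algebraMap k L b₀ ∧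
      β ∉ regularUnits ℓ y₀ ∧ (∀ p, p ≠ 1 → unitsAction ρ p β ∈ regularUnits ℓ y₀) ∧
      ∀ (y : intClosure k z →ₐ[k] k) p, ∃ n : ℤ, unitsAction ρ p β * u ^ n ∈ regularUnits ℓ y := by
  classical
  have := Fintype.ofFinite P
  obtain ⟨y₀⟩ := h.exists_place
  obtain ⟨g, hg0, J, hg⟩ := h.exists_eq_ker_mul_pow hℓk y₀
  have hgL : (g : L) ≠ 0 := fun h0 ↦ hg0 (Subtype.ext h0)
  set b₀ := y₀ ⟨z, self_mem_intClosure z⟩ with hb₀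
  have hzb : z - algebraMap k L b₀ ≠ 0 := by
    intro h0
    exact h.transcendental (sub_eq_zero.mp h0 ▸ isAlgebraic_algebraMap b₀)
  let β : Lˣ := Units.mk0 g hgL
  let u : Lˣ := Units.mk0 _ hzb
  have hne (y : intClosure k z →ₐ[k] k) (p : P) (hp : y.comp (intClosureHom (ρ p) (hz p)) ≠ y₀) :
      unitsAction ρ p β ∈ regularUnits ℓ y :=
    unitsAction_mem_regularUnits hz p (h.mem_regularUnits_of_ne (Ne.symm hp) hg0 hg rfl)
  have hconj (y : intClosure k z →ₐ[k] k) (p p' : P)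
      (hp : y.comp (intClosureHom (ρ p) (hz p)) = y₀)
      (hp' : y.comp (intClosureHom (ρ p') (hz p')) = y₀) : p = p' := by
    rw [← inv_mul_eq_one]
    refine hfree y₀ _ fun x x' hx ↦ ?_
    rw [← DFunLike.congr_fun hp x', ← DFunLike.congr_fun hp' x]
    refine congrArg y (Subtype.ext ?_)
    change ρ p x' = ρ p' x
    rw [← hx, ← AlgEquiv.mul_apply, ← map_mul, mul_inv_cancel_left]
  refine ⟨b₀, u, β, y₀, rfl, h.notMem_regularUnits hℓ hg0 hg rfl, fun p hp ↦ ?_, fun y p ↦ ?_⟩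
  · refine hne y₀ p fun h0 ↦ hp (hconj y₀ p 1 h0 ?_)
    ext x
    exact congrArg y₀ (Subtype.ext (DFunLike.congr_fun (map_one ρ) (x : L)))
  by_cases hp : y.comp (intClosureHom (ρ p) (hz p)) = y₀
  swap
  · exact ⟨0, by simpa using hne y p hp⟩
  have hyz : y ⟨z, self_mem_intClosure z⟩ = b₀ := by
    rw [hb₀, ← hp]
    exact congrArg y (Subtype.ext (hz p).symm)
  let N : Lˣ := ∏ q, unitsAction ρ q β
  have hN (q : P) : ρ q N = N := by
    rw [← coe_unitsAction]
    congr 1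
    simp only [N, map_prod, ← MulAut.mul_apply, ← map_mul]
    exact Fintype.prod_equiv (Equiv.mulLeft q) _ _ fun _ ↦ rfl
  obtain ⟨r, s, hrs⟩ := (IntermediateField.mem_adjoin_simple_iff k _).mp (hfix N hN)
  have hr0 : Polynomial.aeval z r ≠ 0 := fun h0 ↦ N.ne_zero (by rw [hrs, h0, zero_div])
  have hs0 : Polynomial.aeval z s ≠ 0 := fun h0 ↦ N.ne_zero (by rw [hrs, h0, div_zero])
  obtain ⟨n, hn⟩ := exists_zpow_mul_aeval_mem_localUnits (q := r) (by rintro rfl; simp at hr0) y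
    (u := u) (x := Units.mk0 _ hr0) (by rw [hyz]; rfl) rfl
  obtain ⟨m, hm⟩ := exists_zpow_mul_aeval_mem_localUnits (q := s) (by rintro rfl; simp at hs0) y
    (u := u) (x := Units.mk0 _ hs0) (by rw [hyz]; rfl) rfl
  have hNu : N * u ^ (n - m) ∈ regularUnits ℓ y := by
    have h1 : N = Units.mk0 _ hr0 / Units.mk0 _ hs0 := Units.ext (by simpa using hrs)
    have h2 : N * u ^ (n - m) = (Units.mk0 _ hr0 * u ^ n) / (Units.mk0 _ hs0 * u ^ m) := by
      rw [h1, zpow_sub, mul_div_mul_comm, div_eq_mul_inv (u ^ n)]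
    rw [h2]
    exact localUnits_le_regularUnits ℓ y (div_mem hn hm)
  refine ⟨n - m, ?_⟩
  have h1 : N = unitsAction ρ p β * ∏ q ∈ Finset.univ.erase p, unitsAction ρ q β :=
    (Finset.mul_prod_erase _ _ (Finset.mem_univ p)).symm
  rw [h1, mul_right_comm] at hNu
  refine (mul_mem_cancel_right (prod_mem fun q hq ↦ hne y q fun h0 ↦ ?_)).mp hNu
  exact Finset.ne_of_mem_erase hq (hconj y q p h0 hp)

end Kummer

section GoodHom

variable {k K Ω : Type*} [Field k] [Field K] [Field Ω] [Algebra k K] [Algebra K Ω] [Algebra k Ω]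
  [IsScalarTower k K Ω] {t : K}

theorem exists_zmod_character [IsAlgClosed k] {ℓ : ℕ} (hℓ : ℓ.Prime) (hℓk : (ℓ : k) ≠ 0) :
    ∃ j : Multiplicative (ZMod ℓ) →* kˣ, Function.Injective j ∧ ∀ a, j a ^ ℓ = 1 := by
  have : NeZero (ℓ : k) := ⟨hℓk⟩
  have : NeZero ℓ := ⟨hℓ.ne_zero⟩
  obtain ⟨ζ, hζ⟩ := HasEnoughRootsOfUnity.exists_primitiveRoot k ℓ
  have hζ' := hζ.isUnit_unit hℓ.ne_zero
  let e := hζ'.zmodEquivZPowers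
  refine ⟨(Subgroup.zpowers _).subtype.comp (AddMonoidHom.toMultiplicativeLeft e.toAddMonoidHom),
    ?_, fun a ↦ ?_⟩
  · exact Subtype.val_injective.comp e.injective
  · have h1 : a ^ ℓ = 1 := Multiplicative.toAdd.injective (by simp)
    rw [← map_pow, h1, map_one]

theorem mem_adjoin_of_forall_apply_eq [IsGalois K Ω] (hK : ∀ x : K, x ∈ k⟮t⟯)
    {L : IntermediateField K Ω} {x : L} (hx : ∀ σ : Ω ≃ₐ[K] Ω, σ x = x) :
    x ∈ k⟮algebraMap K L t⟯ := by
  obtain ⟨a, ha⟩ := (InfiniteGalois.mem_range_algebraMap_iff_fixed (k := K) (x : Ω)).mpr hx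
  have ha' : algebraMap K L a = x := Subtype.ext ha
  obtain ⟨r, s, rfl⟩ := (IntermediateField.mem_adjoin_simple_iff k a).mp (hK a)
  rw [← ha', IntermediateField.mem_adjoin_simple_iff]
  refine ⟨r, s, ?_⟩
  rw [map_div₀, Polynomial.aeval_algebraMap_apply, Polynomial.aeval_algebraMap_apply]

/-- Away from the characteristic, a weak lift can be modified to be surjective at the cost of
introducing tame ramification over a single point. -/
theorem IsGoodHom.exists_surjective_of_ne [IsAlgClosed k] [IsGalois K Ω] [IsSepClosed Ω]
    (ht : IsSepGen k t) (hK : ∀ x : K, x ∈ k⟮t⟯) {G : Type*} [Group G] [Finite G]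
    {N : Subgroup G} [N.Normal] (hNcomm : ∀ a ∈ N, ∀ b ∈ N, a * b = b * a) {ℓ : ℕ} (hℓ : ℓ.Prime)
    (hℓk : (ℓ : k) ≠ 0) (hNℓ : ∀ a ∈ N, a ^ ℓ = 1)
    (hmin : ∀ M : Subgroup G, M.Normal → M ≤ N → M = ⊥ ∨ M = N) (hN : N ≠ ⊥)
    {F : (Ω ≃ₐ[K] Ω) →* G} (hF : IsGoodHom k t F) (hFN : F.range ⊔ N = ⊤) :
    ∃ (b₀ : k) (x : Ω), x ^ ℓ = algebraMap K Ω t - algebraMap k Ω b₀ ∧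
      ∃ F' : (Ω ≃ₐ[K] Ω) →* G, Function.Surjective F' ∧
        IsOpen (F'.ker : Set (Ω ≃ₐ[K] Ω)) ∧
        ∀ (σ : Ω ≃ₐ[K] Ω) (Y : intClosure k (algebraMap K Ω t) →ₐ[k] k),
          InertAt Y (σ.restrictScalars k) → σ x = x → F' σ = 1 := by
  classical
  let _ : Fintype F.range := Fintype.ofFinite _
  obtain ⟨c, hc, H⟩ := exists_twist hNcomm hℓ hNℓ hmin hN F hFN
  obtain ⟨L, ρ, hL, hsep, hρ, hinj, hz, hfree, hfix, hmemL⟩ :=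
    hF.isGoodHom_rangeRestrict.exists_finite_level ht F.rangeRestrict_surjective
  have hρfix (x : L) (hx : ∀ p, ρ p x = x) : x ∈ k⟮algebraMap K L t⟯ :=
    mem_adjoin_of_forall_apply_eq hK fun σ ↦ by rw [← hρ, hx]
  obtain ⟨b₀, u, β, y₀, hu, hβ₀, hβ, hreg⟩ :=
    hsep.exists_ramified_generator hz hfree hρfix hℓ.ne_one hℓk
  obtain ⟨j, hj, hjℓ⟩ := exists_zmod_character hℓ hℓk
  have : Fact ℓ.Prime := ⟨hℓ⟩
  have hℓ0 : ℓ ≠ 0 := hℓ.ne_zero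
  have hℓΩ : (ℓ : Ω) ≠ 0 := by
    have := (map_ne_zero (algebraMap k Ω)).mpr hℓk
    rwa [map_natCast] at this
  have : NeZero (ℓ : Ω) := ⟨hℓΩ⟩
  have huΩ : ((u : L) : Ω) = algebraMap K Ω t - algebraMap k Ω b₀ := congrArg Subtype.val hu
  obtain ⟨x, hx⟩ := IsSepClosed.exists_pow_nat_eq ((u : L) : Ω) ℓ
  have hx0 : x ≠ 0 := by
    rintro rfl
    rw [zero_pow hℓ0] at hx
    exact (show ((u : L) : Ω) ≠ 0 by simp) hx.symm
  choose y hy using fun q : F.range ↦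
    IsSepClosed.exists_pow_nat_eq ((unitsAction ρ q β : L) : Ω) ℓ
  have hy0 (q) : y q ≠ 0 := by
    intro h0
    have := hy q
    rw [h0, zero_pow hℓ0] at this
    exact (show ((unitsAction ρ q β : L) : Ω) ≠ 0 by simp) this.symm
  let χ (a : ZMod ℓ) : Ω := algebraMap k Ω (j (Multiplicative.ofAdd a))
  have hχadd (a b) : χ (a + b) = χ a * χ b := by simp [χ]
  have hχ0 (a) : χ a ≠ 0 := by simp [χ]
  have hχinj : Function.Injective χ := fun a b h ↦
    Multiplicative.ofAdd.injective (hj (Units.ext ((algebraMap k Ω).injective h)))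
  have hχzero : χ 0 = 1 := by simp [χ]
  have hχσ (a) (σ : Ω ≃ₐ[K] Ω) : σ (χ a) = χ a := by
    simp only [χ]
    rw [IsScalarTower.algebraMap_apply k K Ω, AlgEquiv.commutes]
  have hb (q : F.range) (σ : Ω ≃ₐ[K] Ω) : ∃ b : ZMod ℓ,
      χ b = σ (y ((F.rangeRestrict σ)⁻¹ * q)) / y q := by
    refine exists_eq_of_isRoot (q := (Polynomial.X ^ ℓ - 1 : Polynomial Ω))
      (Polynomial.X_pow_sub_C_ne_zero hℓ.pos 1)
      (by rw [Nat.card_zmod]; exact (Polynomial.natDegree_X_pow_sub_C (r := (1 : Ω))).le)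
      hχinj (fun w ↦ ?_) ?_
    · have := congrArg Units.val (hjℓ (Multiplicative.ofAdd w))
      simp only [Units.val_pow_eq_pow_val, Units.val_one] at this
      simp [χ, ← map_pow, this]
    · have h1 : ((unitsAction ρ q β : L) : Ω) ≠ 0 := by simp
      have h2 : σ ((unitsAction ρ ((F.rangeRestrict σ)⁻¹ * q) β : Lˣ) : L) =
          ((unitsAction ρ q β : L) : Ω) := by
        rw [← hρ, coe_unitsAction, coe_unitsAction, ← AlgEquiv.mul_apply, ← map_mul,
          mul_inv_cancel_left]
      rw [Polynomial.IsRoot.def, Polynomial.eval_sub, Polynomial.eval_pow, Polynomial.eval_X,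
        Polynomial.eval_one, div_pow, ← map_pow, hy, hy, h2, div_self h1, sub_self]
  choose b hb using hb
  have hbmul (q : F.range) (σ τ : Ω ≃ₐ[K] Ω) :
      b q (σ * τ) = b q σ + b ((F.rangeRestrict σ)⁻¹ * q) τ := by
    apply hχinj
    have h1 := congrArg σ (hb ((F.rangeRestrict σ)⁻¹ * q) τ)
    rw [hχσ, map_div₀] at h1
    have h3 : σ (y ((F.rangeRestrict σ)⁻¹ * q)) ≠ 0 := by simpa using hy0 _
    rw [hχadd, hb, hb, h1, map_mul, mul_inv_rev, mul_assoc, AlgEquiv.mul_apply, mul_comm,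
      div_mul_div_cancel₀ h3]
  obtain ⟨F', -, hF'1, hF'⟩ := H b hbmul
  have hb1 (q : F.range) (σ : Ω ≃ₐ[K] Ω) (hσ : F σ = 1) : σ (y q) = χ (b q σ) * y q := by
    have h1 : F.rangeRestrict σ = 1 := Subtype.ext hσ
    rw [hb, h1, inv_one, one_mul, div_mul_cancel₀ _ (hy0 q)]
  have hρ1 (σ : Ω ≃ₐ[K] Ω) (hσ : F σ = 1) (x : L) : σ x = x := by
    rw [← hρ, show F.rangeRestrict σ = 1 from Subtype.ext hσ, map_one]
    rfl
  refine ⟨b₀, x, hx.trans huΩ, F', hF'.resolve_right fun hcon ↦ ?_, ?_, fun σ Y hY hσx ↦ ?_⟩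
  · let X : Ω := ∏ q, y q ^ (c q).val
    have hXL : X ∈ L := by
      refine hmemL X fun σ hσ ↦ ?_
      have hσ1 : F σ = 1 := congrArg Subtype.val hσ
      have hχpow (a : ZMod ℓ) (n : ℕ) : χ a ^ n = χ (n * a) := by
        simp only [χ]
        rw [← nsmul_eq_mul, ofAdd_nsmul, map_pow, Units.val_pow_eq_pow_val, map_pow]
      have hχsum : ∏ q, χ (c q * b q σ) = χ (∑ q, c q * b q σ) := by
        simp [χ, ofAdd_sum]
      simp only [X, map_prod, map_pow, hb1 _ σ hσ1, mul_pow, Finset.prod_mul_distrib, hχpow,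
        ZMod.natCast_zmod_val]
      rw [hχsum, hcon σ hσ1, hχzero, one_mul]
    have hX0 : X ≠ 0 := Finset.prod_ne_zero_iff.mpr fun q _ ↦ pow_ne_zero _ (hy0 q)
    let XL : Lˣ := Units.mk0 ⟨X, hXL⟩ fun h0 ↦ hX0 (congrArg Subtype.val h0)
    have hXpow : ∏ q, unitsAction ρ q β ^ (c q).val = XL ^ ℓ := by
      refine Units.ext ((algebraMap L Ω).injective ?_)
      simp only [Units.coe_prod, Units.val_pow_eq_pow_val, map_prod, map_pow]
      change _ = X ^ ℓ
      rw [← Finset.prod_pow]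
      refine Finset.prod_congr rfl fun q _ ↦ ?_
      rw [pow_right_comm, hy]
      rfl
    have hmem := pow_mem_regularUnits ℓ y₀ XL
    rw [← hXpow, ← Finset.mul_prod_erase _ _ (Finset.mem_univ (1 : F.range))] at hmem
    have hmem' := (mul_mem_cancel_right (prod_mem fun q hq ↦
      pow_mem (hβ q (Finset.ne_of_mem_erase hq)) (c q).val)).mp hmem
    rw [map_one, MulAut.one_apply] at hmem'
    have h1 : (c 1).val * (c 1)⁻¹.val ≡ 1 [MOD ℓ] := by
      rw [← ZMod.natCast_eq_natCast_iff]
      simp [mul_inv_cancel₀ hc]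
    have h2 := pow_mem hmem' (c 1)⁻¹.val
    rw [← pow_mul, ← Nat.div_add_mod ((c 1).val * (c 1)⁻¹.val) ℓ,
      (show _ % ℓ = 1 from Eq.trans h1 (Nat.mod_eq_of_lt hℓ.one_lt)), pow_add, pow_mul,
          pow_one] at h2
    exact hβ₀ ((mul_mem_cancel_left (pow_mem (pow_mem_regularUnits ℓ y₀ β) _)).mp h2)
  · refine isOpen_ker_of_fixes F' L y fun σ hσ hσy ↦ ?_
    have h1 : F σ = 1 := congrArg Subtype.val (hfix σ hσ)
    refine hF'1 σ h1 fun q ↦ hχinj ?_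
    have h2 := hb1 q σ h1
    rw [hσy, eq_comm, mul_eq_right₀ (hy0 q)] at h2
    rw [h2, hχzero]
  · have h1 := hF.inert σ Y hY
    refine hF'1 σ h1 fun q ↦ ?_
    obtain ⟨n, hn⟩ := hreg (restrictPlace Y) q
    have h2 := eq_one_of_inertAt_of_pow_eq (y := y q * x ^ n)
      (c := j (Multiplicative.ofAdd (b q σ))) hℓ.pos hY (hρ1 σ h1) hn (by
        rw [mul_pow, hy, ← zpow_natCast, zpow_comm, zpow_natCast, hx, Units.val_mul,
          Units.val_zpow_eq_zpow_val]
        exact ((map_mul (algebraMap L Ω) _ _).trans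
          (congrArg _ (map_zpow₀ (algebraMap L Ω) _ _))).symm) (by
        rw [map_mul, map_zpow₀, hσx, hb1 q σ h1, mul_assoc])
    apply hχinj
    rw [hχzero]
    simp only [χ, h2, map_one]

end GoodHom

/-- The action `ρ` of `G` on `L` is a Galois cover of the affine line with coordinate `z` which is
unramified in the sense that all inertia groups are trivial. -/
structure IsAffineLineCover (k : Type*) {L G : Type*} [Field k] [Field L] [Algebra k L] [Group G]
    (z : L) (ρ : G →* (L ≃ₐ[k] L)) : Prop where
  isSepGen : IsSepGen k z
  injective : Function.Injective ρ
  map_eq : ∀ g, ρ g z = z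
  free : ∀ (y : intClosure k z →ₐ[k] k) g, InertAt y (ρ g) → g = 1
  fixed : ∀ x, (∀ g, ρ g x = x) → x ∈ k⟮z⟯

section Basic

variable {k L : Type*} [Field k] [Field L] [Algebra k L] {z x : L}

theorem IsSepGen.of_mem_adjoin (h : IsSepGen k z) (hz : z ∈ k⟮x⟯) : IsSepGen k x := by
  have hle : k⟮z⟯ ≤ k⟮x⟯ := by simpa [IntermediateField.adjoin_simple_le_iff] using hz
  let _ : Algebra k⟮z⟯ k⟮x⟯ := (IntermediateField.inclusion hle).toAlgebra
  have : IsScalarTower k⟮z⟯ k⟮x⟯ L := .of_algebraMap_eq fun _ ↦ rfl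
  have := h.finite
  have := h.separable
  refine ⟨fun hx ↦ h.transcendental ?_, .right k⟮z⟯ k⟮x⟯ L,
    Algebra.isSeparable_tower_top_of_isSeparable k⟮z⟯ k⟮x⟯ L⟩
  have := IntermediateField.isAlgebraic_adjoin_simple hx.isIntegral
  have h1 := Algebra.IsAlgebraic.isAlgebraic (R := k) (⟨z, hz⟩ : k⟮x⟯)
  exact h1.algebraMap (A := L)

theorem intClosure_le (hz : z ∈ Algebra.adjoin k {x}) : intClosure k z ≤ intClosure k x := by
  intro y hy
  have hle : Algebra.adjoin k {z} ≤ Algebra.adjoin k {x} := by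
    simpa [Algebra.adjoin_le_iff] using hz
  obtain ⟨q, hq, hqy⟩ := hy
  refine ⟨q.map (Subalgebra.inclusion hle), hq.map _, ?_⟩
  rw [Polynomial.eval₂_map]
  exact hqy

theorem aeval_mem_of_mem {E : IntermediateField k L} (hx : x ∈ E) (r : k[X]) :
    Polynomial.aeval x r ∈ E := by
  have h := Polynomial.aeval_algebraMap_apply L (⟨x, hx⟩ : E) r
  change Polynomial.aeval x r = _ at h
  rw [h]
  exact (Polynomial.aeval (⟨x, hx⟩ : E) r).2

theorem InertAt.comp_inclusion {y : intClosure k x →ₐ[k] k} {σ : L ≃ₐ[k] L} (hy : InertAt y σ)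
    (h : intClosure k z ≤ intClosure k x) : InertAt (y.comp (Subalgebra.inclusion h)) σ := by
  intro a a' ha
  rw [AlgHom.comp_apply, AlgHom.comp_apply]
  apply hy
  rw [Subalgebra.coe_inclusion, Subalgebra.coe_inclusion]
  exact ha

end Basic

section GoodHom

variable {k K Ω : Type*} [Field k] [Field K] [Field Ω] [Algebra k K] [Algebra K Ω] [Algebra k Ω]
  [IsScalarTower k K Ω] {t : K} {G : Type*} [Group G]

theorem IsGoodHom.exists_isAffineLineCover [IsAlgClosed k] [IsGalois K Ω] (ht : IsSepGen k t)
    (hK : ∀ x : K, x ∈ k⟮t⟯) {F : (Ω ≃ₐ[K] Ω) →* G} (hF : IsGoodHom k t F)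
    (hsurj : Function.Surjective F) :
    ∃ (L : IntermediateField K Ω) (z : L) (ρ : G →* (L ≃ₐ[k] L)), IsAffineLineCover k z ρ := by
  obtain ⟨L, ρ, hL, hsep, hρ, hinj, hz, hfree, -⟩ := hF.exists_finite_level ht hsurj
  exact ⟨L, _, ρ, hsep, hinj, hz, hfree,
    fun x hx ↦ mem_adjoin_of_forall_apply_eq hK fun σ ↦ by rw [← hρ, hx]⟩

theorem pow_apply_eq_of_pow_eq [IsAlgClosed k] {ℓ : ℕ} (hℓ : ℓ ≠ 0) {x : Ω} {a : K}
    (hx : x ^ ℓ = algebraMap K Ω a) (σ : Ω ≃ₐ[K] Ω) : (σ ^ ℓ) x = x := by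
  by_cases hx0 : x = 0
  · rw [hx0, map_zero]
  have h1 : (σ x / x) ^ ℓ = 1 := by
    rw [div_pow, ← map_pow, hx, AlgEquiv.commutes, ← hx, div_self (pow_ne_zero _ hx0)]
  obtain ⟨c, hc⟩ := mem_range_of_isAlgebraic (k := k) (x := σ x / x)
    ⟨Polynomial.X ^ ℓ - 1, Polynomial.X_pow_sub_C_ne_zero (Nat.pos_of_ne_zero hℓ) 1, by simp [h1]⟩
  have h2 : σ x = algebraMap k Ω c * x := by
    change algebraMap k Ω c = _ at hc
    rw [hc, div_mul_cancel₀ _ hx0]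
  have h3 (n : ℕ) : (σ ^ n) x = algebraMap k Ω c ^ n * x := by
    induction n with
    | zero => simp
    | succ n ih =>
      rw [pow_succ', AlgEquiv.mul_apply, ih, map_mul, map_pow, h2,
        IsScalarTower.algebraMap_apply k K Ω, AlgEquiv.commutes]
      ring
  change algebraMap k Ω c = _ at hc
  rw [h3, hc, h1, one_mul]

theorem mem_fixingSubgroup_adjoin_simple_iff {x : Ω} {σ : Ω ≃ₐ[K] Ω} :
    σ ∈ K⟮x⟯.fixingSubgroup ↔ σ x = x := by
  refine ⟨fun h ↦ h ⟨x, IntermediateField.mem_adjoin_simple_self K x⟩, fun h ↦ ?_⟩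
  have h1 : K⟮x⟯ ≤ IntermediateField.fixedField (Subgroup.zpowers σ) := by
    rw [IntermediateField.adjoin_simple_le_iff, IntermediateField.mem_fixedField_iff]
    intro τ hτ
    have h2 : Subgroup.zpowers σ ≤ MulAction.stabilizer (Ω ≃ₐ[K] Ω) x := by
      rw [Subgroup.zpowers_le]
      exact h
    exact h2 hτ
  exact (IntermediateField.le_iff_le _ _).mp h1 (Subgroup.mem_zpowers σ)

theorem surjective_comp_subtype_of_coprime {Γ : Type*} [Group Γ] {p ℓ : ℕ} (hp : p.Coprime ℓ)
    (hG : ∀ S : Subgroup G, (∀ g n, g ^ p ^ n = 1 → g ∈ S) → S = ⊤) {F : Γ →* G}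
    (hF : Function.Surjective F) {Γ' : Subgroup Γ} (hΓ' : ∀ σ, σ ^ ℓ ∈ Γ') :
    Function.Surjective (F.comp Γ'.subtype) := by
  rw [← MonoidHom.range_eq_top]
  refine hG _ fun g n hg ↦ ?_
  obtain ⟨σ, rfl⟩ := hF g
  obtain ⟨m, hm⟩ := exists_pow_eq_self_of_coprime
    ((Nat.Coprime.pow_left n hp).coprime_dvd_left (orderOf_dvd_of_pow_eq_one hg)).symm
  refine ⟨⟨(σ ^ m) ^ ℓ, hΓ' _⟩, ?_⟩
  change F ((σ ^ m) ^ ℓ) = F σ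
  rw [map_pow, map_pow, ← pow_mul, mul_comm, pow_mul, hm]

theorem mem_adjoin_of_mem_adjoin_tower (hK : ∀ x : K, x ∈ k⟮t⟯) {x w : Ω}
    (ht : algebraMap K Ω t ∈ k⟮x⟯) (hw : w ∈ K⟮x⟯) : w ∈ k⟮x⟯ := by
  have h2 (a : K) : algebraMap K Ω a ∈ k⟮x⟯ := by
    obtain ⟨r, s, rfl⟩ := (IntermediateField.mem_adjoin_simple_iff _ _).mp (hK a)
    rw [map_div₀, ← Polynomial.aeval_algebraMap_apply, ← Polynomial.aeval_algebraMap_apply]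
    exact div_mem (aeval_mem_of_mem ht r) (aeval_mem_of_mem ht s)
  have h3 : K⟮x⟯ ≤ k⟮x⟯.toSubfield.toIntermediateField h2 := by
    rw [IntermediateField.adjoin_simple_le_iff]
    exact IntermediateField.mem_adjoin_simple_self k x
  exact h3 hw

theorem mem_adjoin_of_coe_mem_adjoin {L : IntermediateField K Ω} {x w : L}
    (h : (w : Ω) ∈ k⟮(x : Ω)⟯) : w ∈ k⟮x⟯ := by
  have : IsScalarTower k L Ω := .of_algebraMap_eq fun _ ↦ rfl
  obtain ⟨r, s, hrs⟩ := (IntermediateField.mem_adjoin_simple_iff _ _).mp h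
  refine (IntermediateField.mem_adjoin_simple_iff _ _).mpr ⟨r, s, (algebraMap L Ω).injective ?_⟩
  rw [map_div₀, ← Polynomial.aeval_algebraMap_apply, ← Polynomial.aeval_algebraMap_apply]
  exact hrs

/-- Abhyankar's lemma: tame ramification over a single point of the affine line is removed by a
Kummer covering of the affine line by itself. -/
theorem exists_isAffineLineCover_of_kummer [IsAlgClosed k] [IsGalois K Ω] (ht : IsSepGen k t)
    (hK : ∀ x : K, x ∈ k⟮t⟯) {p ℓ : ℕ} (hp : p.Coprime ℓ) (hℓ : ℓ ≠ 0)
    (hG : ∀ S : Subgroup G, (∀ g n, g ^ p ^ n = 1 → g ∈ S) → S = ⊤) {b₀ : k} {x : Ω}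
    (hx : x ^ ℓ = algebraMap K Ω t - algebraMap k Ω b₀) {F : (Ω ≃ₐ[K] Ω) →* G}
    (hF : Function.Surjective F) (hopen : IsOpen (F.ker : Set (Ω ≃ₐ[K] Ω)))
    (hinert : ∀ (σ : Ω ≃ₐ[K] Ω) (Y : intClosure k (algebraMap K Ω t) →ₐ[k] k),
      InertAt Y (σ.restrictScalars k) → σ x = x → F σ = 1) :
    ∃ (L : IntermediateField K Ω) (z : L) (ρ : G →* (L ≃ₐ[k] L)), IsAffineLineCover k z ρ := by
  let Γ' := K⟮x⟯.fixingSubgroup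
  have hΓ' (σ : Ω ≃ₐ[K] Ω) : σ ∈ Γ' ↔ σ x = x := mem_fixingSubgroup_adjoin_simple_iff
  have hxt : x ^ ℓ = algebraMap K Ω (t - algebraMap k K b₀) := by
    rw [hx, map_sub, ← IsScalarTower.algebraMap_apply]
  have hfin : FiniteDimensional K K⟮x⟯ :=
    IntermediateField.adjoin.finiteDimensional (Algebra.IsIntegral.isIntegral x)
  have h3 : algebraMap K Ω t ∈ k⟮x⟯ := by
    rw [sub_eq_iff_eq_add.mp hx.symm]
    exact add_mem (pow_mem (IntermediateField.mem_adjoin_simple_self k x) _)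
      (IntermediateField.algebraMap_mem _ _)
  have hgood : IsGood k t (F.comp Γ'.subtype) := by
    refine ⟨?_, fun σ Y hY ↦ hinert σ Y hY ((hΓ' σ).mp σ.2)⟩
    refine Subgroup.isOpen_mono (H₁ := F.ker ⊓ Γ') ?_
      (hopen.inter (IntermediateField.fixingSubgroup_isOpen K⟮x⟯))
    rintro σ ⟨hσ, hσ'⟩
    exact ⟨⟨σ, hσ'⟩, hσ, rfl⟩
  have hsurj : Function.Surjective (F.comp Γ'.subtype) :=
    surjective_comp_subtype_of_coprime hp hG hF fun σ ↦
      (hΓ' _).mpr (pow_apply_eq_of_pow_eq (k := k) hℓ hxt _)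
  obtain ⟨L, ρ, hL, hsep, hρ, hinj, hz, hfree, hfix, hmem⟩ := hgood.exists_finite_level ht hsurj
  have hxL : x ∈ L := hmem x fun σ _ ↦ (hΓ' σ).mp σ.2
  have : IsScalarTower k L Ω := .of_algebraMap_eq fun _ ↦ rfl
  have hxL' : (⟨x, hxL⟩ : L) ^ ℓ = algebraMap K L t - algebraMap k L b₀ := by
    apply (algebraMap L Ω).injective
    rw [map_pow, map_sub, ← IsScalarTower.algebraMap_apply, ← IsScalarTower.algebraMap_apply k L Ω]
    exact hx
  have hzx : algebraMap K L t ∈ Algebra.adjoin k {(⟨x, hxL⟩ : L)} := by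
    rw [sub_eq_iff_eq_add.mp hxL'.symm]
    exact Subalgebra.add_mem _ (Subalgebra.pow_mem _ (Algebra.self_mem_adjoin_singleton k _) _)
      (Subalgebra.algebraMap_mem _ _)
  have hsep' : IsSepGen k (⟨x, hxL⟩ : L) :=
    hsep.of_mem_adjoin (IntermediateField.algebra_adjoin_le_adjoin _ _ hzx)
  refine ⟨L, ⟨x, hxL⟩, ρ, ⟨hsep', hinj, fun g ↦ ?_, fun y g hy ↦ ?_, fun w hw ↦ ?_⟩⟩
  · obtain ⟨σ, rfl⟩ := hsurj g
    apply Subtype.ext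
    rw [hρ]
    exact (hΓ' σ).mp σ.2
  · exact hfree _ g (hy.comp_inclusion (intClosure_le hzx))
  · have h1 : (w : Ω) ∈ K⟮x⟯ := by
      rw [← InfiniteGalois.fixedField_fixingSubgroup K⟮x⟯, IntermediateField.mem_fixedField_iff]
      intro σ hσ
      rw [← hρ ⟨σ, hσ⟩, hw]
    exact mem_adjoin_of_coe_mem_adjoin (mem_adjoin_of_mem_adjoin_tower hK h3 h1)

end GoodHom

section Restrict

variable {k K L Ω : Type*} [Field k] [Field K] [Field L] [Field Ω] [Algebra K L] [Algebra K Ω]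
  [Algebra L Ω] [Algebra k L] [Algebra k Ω] [IsScalarTower k L Ω] [IsScalarTower K L Ω] {t : K}

theorem algebraMap_mem_intClosure {x : L} (hx : x ∈ intClosure k (algebraMap K L t)) :
    algebraMap L Ω x ∈ intClosure k (algebraMap K Ω t) := by
  have h := (map_mem_intClosure_iff (IsScalarTower.toAlgHom k L Ω)).mpr hx
  rw [IsScalarTower.coe_toAlgHom', ← IsScalarTower.algebraMap_apply K L Ω] at h
  exact h

variable [Algebra k K] [IsScalarTower k K L] [IsScalarTower k K Ω]

theorem isGoodHom_restrictNormalHom [IsGalois K Ω] [FiniteDimensional K L] [IsGalois K L]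
    (hfree : ∀ (y : intClosure k (algebraMap K L t) →ₐ[k] k) (σ : L ≃ₐ[K] L),
      InertAt y (σ.restrictScalars k) → σ = 1) :
    IsGoodHom k t (AlgEquiv.restrictNormalHom (F := K) (K₁ := Ω) L) := by
  refine ⟨?_, fun σ Y hY ↦ ?_⟩
  · let f := IsScalarTower.toAlgHom K L Ω
    have : FiniteDimensional K f.fieldRange :=
      inferInstanceAs (FiniteDimensional K (LinearMap.range f.toLinearMap))
    refine Subgroup.isOpen_mono (H₁ := f.fieldRange.fixingSubgroup) (fun σ hσ ↦ ?_)
      (IntermediateField.fixingSubgroup_isOpen _)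
    rw [MonoidHom.mem_ker]
    ext x
    apply (algebraMap L Ω).injective
    refine (AlgEquiv.restrictNormal_commutes σ L x).trans ?_
    exact hσ ⟨f x, x, rfl⟩
  · let r : intClosure k (algebraMap K L t) →ₐ[k] intClosure k (algebraMap K Ω t) :=
      ((IsScalarTower.toAlgHom k L Ω).comp (intClosure k (algebraMap K L t)).val).codRestrict _
        fun x ↦ algebraMap_mem_intClosure x.2
    refine hfree (Y.comp r) _ fun x x' hx ↦ ?_
    rw [AlgHom.comp_apply, AlgHom.comp_apply]
    apply hY
    have h : σ (algebraMap L Ω x) = algebraMap L Ω x' := by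
      rw [← hx]
      exact (AlgEquiv.restrictNormal_commutes σ L x).symm
    exact h

theorem IsGoodHom.mulEquiv_comp {G Q : Type*} [Group G] [Group Q] {φ : (Ω ≃ₐ[K] Ω) →* G}
    (h : IsGoodHom k t φ) (e : G ≃* Q) : IsGoodHom k t (e.toMonoidHom.comp φ) := by
  refine ⟨?_, fun σ Y hY ↦ ?_⟩
  · have h1 : (e.toMonoidHom.comp φ).ker = φ.ker := MonoidHom.ker_mulEquiv_comp φ e
    rw [h1]
    exact h.isOpen
  · rw [MonoidHom.comp_apply, h.inert σ Y hY, map_one]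

/-- An embedding problem over the affine line with minimal abelian kernel and quasi-`p` group is
solvable, up to changing the coordinate on the affine line. -/
theorem exists_isAffineLineCover_of_galois [IsAlgClosed k] [IsGalois K Ω] [IsSepClosed Ω]
    [FiniteDimensional K L] [IsGalois K L] (ht : IsSepGen k t) (hK : ∀ x : K, x ∈ k⟮t⟯)
    (hfree : ∀ (y : intClosure k (algebraMap K L t) →ₐ[k] k) (σ : L ≃ₐ[K] L),
      InertAt y (σ.restrictScalars k) → σ = 1)
    {p : ℕ} [Fact p.Prime] [CharP k p] {G : Type*} [Group G] [Finite G] {N : Subgroup G} [N.Normal]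
    (hG : ∀ S : Subgroup G, (∀ g n, g ^ p ^ n = 1 → g ∈ S) → S = ⊤)
    (hNcomm : ∀ a ∈ N, ∀ b ∈ N, a * b = b * a) {ℓ : ℕ} (hℓ : ℓ.Prime) (hNℓ : ∀ a ∈ N, a ^ ℓ = 1)
    (hmin : ∀ M : Subgroup G, M.Normal → M ≤ N → M = ⊥ ∨ M = N) (hN : N ≠ ⊥)
    (e : (L ≃ₐ[K] L) ≃* G ⧸ N) :
    ∃ (L' : IntermediateField K Ω) (z : L') (ρ : G →* (L' ≃ₐ[k] L')),
      IsAffineLineCover k z ρ := by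
  let φ : (Ω ≃ₐ[K] Ω) →* G ⧸ N := e.toMonoidHom.comp (AlgEquiv.restrictNormalHom L)
  have hφ : IsGoodHom k t φ := (isGoodHom_restrictNormalHom hfree).mulEquiv_comp e
  have hφsurj : Function.Surjective φ :=
    e.surjective.comp (AlgEquiv.restrictNormalHom_surjective Ω)
  obtain ⟨F, hF, hFφ⟩ := hφ.exists_lift ht hNcomm hℓ hNℓ hφsurj
  have hFN : F.range ⊔ N = ⊤ := by
    refine eq_top_iff.mpr fun g _ ↦ ?_
    obtain ⟨σ, hσ⟩ := hφsurj g
    rw [← hFφ, QuotientGroup.eq] at hσ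
    exact (Subgroup.mem_sup_of_normal_right).mpr ⟨F σ, ⟨σ, rfl⟩, _, hσ, mul_inv_cancel_left _ _⟩
  by_cases hℓk : (ℓ : k) = 0
  · have hpℓ : p = ℓ :=
      (Nat.prime_dvd_prime_iff_eq Fact.out hℓ).mp ((CharP.cast_eq_zero_iff k p ℓ).mp hℓk)
    obtain ⟨F', hF', hsurj⟩ := hF.exists_surjective_of_charP ht hNcomm (p := p)
      (fun a ha ↦ hpℓ ▸ hNℓ a ha) hmin hN hFN
    exact hF'.exists_isAffineLineCover ht hK hsurj
  · obtain ⟨b₀, x, hx, F', hsurj, hopen, hinert⟩ :=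
      hF.exists_surjective_of_ne ht hK hNcomm hℓ hℓk hNℓ hmin hN hFN
    refine exists_isAffineLineCover_of_kummer ht hK (p := p) ?_ hℓ.ne_zero hG hx hsurj hopen hinert
    rw [Nat.coprime_primes Fact.out hℓ]
    rintro rfl
    exact hℓk (CharP.cast_eq_zero k p)

end Restrict

section Galois

variable {k L G : Type*} [Field k] [Field L] [Algebra k L] [Group G] {z : L}
  {ρ : G →* (L ≃ₐ[k] L)}

theorem apply_eq_of_mem_adjoin {σ : L ≃ₐ[k] L} (hσ : σ z = z) {x : L} (hx : x ∈ k⟮z⟯) :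
    σ x = x := by
  have h : k⟮z⟯ ≤ IntermediateField.fixedField (Subgroup.zpowers σ) := by
    rw [IntermediateField.adjoin_simple_le_iff, IntermediateField.mem_fixedField_iff]
    intro τ hτ
    have h2 : Subgroup.zpowers σ ≤ MulAction.stabilizer (L ≃ₐ[k] L) z := by
      rw [Subgroup.zpowers_le]
      exact hσ
    exact h2 hτ
  exact (IntermediateField.mem_fixedField_iff _ _).mp (h hx) σ (Subgroup.mem_zpowers σ)

/-- The automorphisms of the cover as automorphisms over the function field of the line. -/
def IsAffineLineCover.galoisHom (h : IsAffineLineCover k z ρ) : G →* (L ≃ₐ[k⟮z⟯] L) where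
  toFun g := AlgEquiv.ofRingEquiv (f := (ρ g).toRingEquiv)
    fun x ↦ apply_eq_of_mem_adjoin (h.map_eq g) x.2
  map_one' := by
    ext x
    change ρ 1 x = x
    rw [map_one, AlgEquiv.one_apply]
  map_mul' a b := by
    ext x
    change ρ (a * b) x = ρ a (ρ b x)
    rw [map_mul, AlgEquiv.mul_apply]

theorem IsAffineLineCover.galoisHom_apply (h : IsAffineLineCover k z ρ) (g : G) (x : L) :
    h.galoisHom g x = ρ g x := rfl

theorem IsAffineLineCover.galoisHom_injective (h : IsAffineLineCover k z ρ) :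
    Function.Injective h.galoisHom := fun a b hab ↦
  h.injective (AlgEquiv.ext fun x ↦ by
    rw [← h.galoisHom_apply, hab, h.galoisHom_apply])

theorem IsAffineLineCover.isGalois [Finite G] (h : IsAffineLineCover k z ρ) :
    IsGalois k⟮z⟯ L := by
  have := h.isSepGen.finite
  refine IsGalois.of_fixedField_eq_bot _ _ (eq_bot_iff.mpr fun x hx ↦ ?_)
  rw [IntermediateField.mem_fixedField_iff] at hx
  exact IntermediateField.mem_bot.mpr
    ⟨⟨x, h.fixed x fun g ↦ hx (h.galoisHom g) trivial⟩, rfl⟩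

theorem IsAffineLineCover.galoisHom_surjective [Finite G] (h : IsAffineLineCover k z ρ) :
    Function.Surjective h.galoisHom := by
  have := h.isSepGen.finite
  have := h.isGalois
  rw [← MonoidHom.range_eq_top, ← IntermediateField.fixingSubgroup_fixedField h.galoisHom.range,
    ← IntermediateField.fixingSubgroup_bot]
  congr 1
  refine eq_bot_iff.mpr fun x hx ↦ ?_
  rw [IntermediateField.mem_fixedField_iff] at hx
  exact IntermediateField.mem_bot.mpr ⟨⟨x, h.fixed x fun g ↦ hx (h.galoisHom g) ⟨g, rfl⟩⟩, rfl⟩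

theorem IsSepGen.coordinate (h : IsSepGen k z) :
    IsSepGen k (IntermediateField.AdjoinSimple.gen k z) :=
  IsSepGen.of_tower (F := L) h

theorem mem_adjoin_gen (x : k⟮z⟯) : x ∈ k⟮IntermediateField.AdjoinSimple.gen k z⟯ := by
  obtain ⟨r, s, hrs⟩ := (IntermediateField.mem_adjoin_simple_iff _ _).mp x.2
  refine (IntermediateField.mem_adjoin_simple_iff _ _).mpr ⟨r, s, (algebraMap k⟮z⟯ L).injective ?_⟩
  rw [map_div₀, ← Polynomial.aeval_algebraMap_apply, ← Polynomial.aeval_algebraMap_apply]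
  exact hrs

theorem IsAffineLineCover.exists_extension {k L G : Type} [Field k] [Field L] [Algebra k L]
    [IsAlgClosed k] {p : ℕ} [Fact p.Prime] [CharP k p] [Group G] [Finite G] {N : Subgroup G}
    [N.Normal] {z : L} {ρ : G ⧸ N →* (L ≃ₐ[k] L)} (h : IsAffineLineCover k z ρ)
    (hG : ∀ S : Subgroup G, (∀ g n, g ^ p ^ n = 1 → g ∈ S) → S = ⊤)
    (hNcomm : ∀ a ∈ N, ∀ b ∈ N, a * b = b * a) {ℓ : ℕ} (hℓ : ℓ.Prime) (hNℓ : ∀ a ∈ N, a ^ ℓ = 1)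
    (hmin : ∀ M : Subgroup G, M.Normal → M ≤ N → M = ⊥ ∨ M = N) (hN : N ≠ ⊥) :
    ∃ (L' : Type) (_ : Field L') (_ : Algebra k L') (z' : L') (ρ' : G →* (L' ≃ₐ[k] L')),
      IsAffineLineCover k z' ρ' := by
  obtain ⟨Ω, _, _, _, _⟩ : ∃ (Ω : Type) (_ : Field Ω) (_ : Algebra L Ω),
      IsSepClosed Ω ∧ Algebra.IsSeparable L Ω :=
    ⟨SeparableClosure L, inferInstance, inferInstance, inferInstance, inferInstance⟩
  let _ : Algebra k Ω := ((algebraMap L Ω).comp (algebraMap k L)).toAlgebra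
  have : IsScalarTower k L Ω := .of_algebraMap_eq fun _ ↦ rfl
  have : IsScalarTower k k⟮z⟯ Ω := .of_algebraMap_eq fun _ ↦ rfl
  have := h.isSepGen.finite
  have := h.isGalois
  have : Algebra.IsSeparable k⟮z⟯ Ω := Algebra.IsSeparable.trans k⟮z⟯ L Ω
  have : IsSepClosure k⟮z⟯ Ω := ⟨inferInstance, this⟩
  have : IsGalois k⟮z⟯ Ω := IsSepClosure.isGalois
  let e : G ⧸ N ≃* (L ≃ₐ[k⟮z⟯] L) :=
    MulEquiv.ofBijective h.galoisHom ⟨h.galoisHom_injective, h.galoisHom_surjective⟩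
  obtain ⟨L', z', ρ', h'⟩ := exists_isAffineLineCover_of_galois (Ω := Ω) (L := L)
    h.isSepGen.coordinate mem_adjoin_gen (fun y σ hy ↦ by
      obtain ⟨g, rfl⟩ := h.galoisHom_surjective σ
      rw [h.free y g hy, map_one]) hG hNcomm hℓ hNℓ hmin hN e.symm
  exact ⟨L', inferInstance, inferInstance, z', ρ', h'⟩

end Galois

section Group

/-- A minimal nontrivial normal subgroup contained in a solvable normal subgroup of a finite group
is commutative of prime exponent. -/
theorem exists_minimal_normal {G : Type*} [Group G] [Finite G] {H : Subgroup G} [H.Normal]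
    [Group.IsSolvable H] (hH : H ≠ ⊥) :
    ∃ N : Subgroup G, N.Normal ∧ N ≤ H ∧ N ≠ ⊥ ∧
      (∀ M : Subgroup G, M.Normal → M ≤ N → M = ⊥ ∨ M = N) ∧
      (∀ a ∈ N, ∀ b ∈ N, a * b = b * a) ∧ ∃ ℓ : ℕ, ℓ.Prime ∧ ∀ a ∈ N, a ^ ℓ = 1 := by
  obtain ⟨N, hN⟩ := (Set.toFinite {N : Subgroup G | N.Normal ∧ N ≤ H ∧ N ≠ ⊥}).exists_minimal
    ⟨H, inferInstance, le_rfl, hH⟩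
  obtain ⟨hNn, hNH, hNb⟩ := hN.prop
  have hmin (M : Subgroup G) (hM : M.Normal) (hMN : M ≤ N) : M = ⊥ ∨ M = N := by
    by_cases hMb : M = ⊥
    · exact .inl hMb
    · exact .inr (hMN.antisymm (hN.le_of_le ⟨hM, hMN.trans hNH, hMb⟩ hMN))
  have hcomm : ∀ a ∈ N, ∀ b ∈ N, a * b = b * a := by
    have hb : ⁅N, N⁆ = ⊥ := by
      refine (hmin ⁅N, N⁆ inferInstance (Subgroup.commutator_le_left N N)).resolve_right fun h ↦ ?_
      have h1 : N.subgroupOf H ≠ ⊥ := fun h2 ↦ hNb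
        (by rw [← Subgroup.map_subgroupOf_eq_of_le hNH, h2, Subgroup.map_bot])
      have h2 := Group.IsSolvable.commutator_lt_of_ne_bot h1
      refine h2.ne (Subgroup.map_injective H.subtype_injective ?_)
      rw [Subgroup.map_commutator, Subgroup.map_subgroupOf_eq_of_le hNH, h]
    rw [Subgroup.commutator_eq_bot_iff_le_centralizer] at hb
    exact fun a ha b hb' ↦ hb hb' a ha
  refine ⟨N, hNn, hNH, hNb, hmin, hcomm, ?_⟩
  have hcard : Nat.card N ≠ 1 := fun h ↦ hNb (Subgroup.card_eq_one.mp h)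
  obtain ⟨ℓ, hℓ, hdvd⟩ := Nat.exists_prime_and_dvd hcard
  refine ⟨ℓ, hℓ, ?_⟩
  let M : Subgroup G :=
    { carrier := {a | a ∈ N ∧ a ^ ℓ = 1}
      mul_mem' := fun {a b} ha hb ↦ ⟨N.mul_mem ha.1 hb.1, by
        rw [(show Commute a b from hcomm a ha.1 b hb.1).mul_pow, ha.2, hb.2, one_mul]⟩
      one_mem' := ⟨N.one_mem, one_pow _⟩
      inv_mem' := fun {a} ha ↦ ⟨N.inv_mem ha.1, by rw [inv_pow, ha.2, inv_one]⟩ }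
  have hM : M.Normal := ⟨fun a ha g ↦ ⟨hNn.conj_mem a ha.1 g, by rw [conj_pow, ha.2, mul_one,
    mul_inv_cancel]⟩⟩
  have : Fact ℓ.Prime := ⟨hℓ⟩
  obtain ⟨c, hc⟩ := exists_prime_orderOf_dvd_card' ℓ hdvd
  rcases hmin M hM fun a ha ↦ ha.1 with h | h
  · have h1 : (c : G) ∈ M := ⟨c.2, by rw [← Subgroup.coe_pow, ← hc, pow_orderOf_eq_one,
      Subgroup.coe_one]⟩
    rw [h, Subgroup.mem_bot] at h1
    have h2 : c = 1 := Subtype.ext h1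
    rw [h2, orderOf_one] at hc
    exact absurd hc hℓ.one_lt.ne
  · intro a ha
    rw [← h] at ha
    exact ha.2

theorem eq_top_of_pPart_eq_top {p : ℕ} {G : Type} [Group G] (hG : pPart p G = ⊤) (S : Subgroup G)
    (hS : ∀ g n, g ^ p ^ n = 1 → g ∈ S) : S = ⊤ := by
  rw [eq_top_iff, ← hG]
  refine iSup₂_le fun P hP g hg ↦ ?_
  obtain ⟨n, hn⟩ := hP ⟨g, hg⟩
  exact hS g n (congrArg Subtype.val hn)

end Group

section Embedding

variable {k : Type} [Field k]

/-- The group `G` acts on an unramified Galois cover of the affine line over `k`. -/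
def HasAffineLineCover (k : Type) [Field k] (G : Type) [Group G] : Prop :=
  ∃ (L : Type) (_ : Field L) (_ : Algebra k L) (z : L) (ρ : G →* (L ≃ₐ[k] L)),
    IsAffineLineCover k z ρ

theorem HasAffineLineCover.of_mulEquiv {G G' : Type} [Group G] [Group G']
    (h : HasAffineLineCover k G) (e : G' ≃* G) : HasAffineLineCover k G' := by
  obtain ⟨L, _, _, z, ρ, h⟩ := h
  refine ⟨L, _, _, z, ρ.comp e.toMonoidHom, h.isSepGen, h.injective.comp e.injective,
    fun g ↦ h.map_eq _, fun y g hg ↦ ?_, fun x hx ↦ h.fixed x fun g ↦ ?_⟩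
  · exact (map_eq_one_iff e e.injective).mp (h.free y (e g) hg)
  · have h1 := hx (e.symm g)
    change ρ (e (e.symm g)) x = x at h1
    rwa [e.apply_symm_apply] at h1

theorem HasAffineLineCover.of_isSolvable [IsAlgClosed k] {p : ℕ} [Fact p.Prime] [CharP k p]
    {G : Type} [Group G] [Finite G] (hG : ∀ S : Subgroup G, (∀ g n, g ^ p ^ n = 1 → g ∈ S) → S = ⊤)
    (H : Subgroup G) [H.Normal] [Group.IsSolvable H] (h : HasAffineLineCover k (G ⧸ H)) :
    HasAffineLineCover k G := by
  induction hn : Nat.card G using Nat.strong_induction_on generalizing G with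
  | _ n ih =>
  subst hn
  by_cases hH : H = ⊥
  · subst hH
    exact h.of_mulEquiv QuotientGroup.quotientBot.symm
  · obtain ⟨N, hN, hNH, hNb, hmin, hcomm, ℓ, hℓ, hNℓ⟩ := exists_minimal_normal hH
    have hsolv : Group.IsSolvable (H.map (QuotientGroup.mk' N)) :=
      Group.isSolvable_of_surjective (f := (QuotientGroup.mk' N).subgroupMap H)
        ((QuotientGroup.mk' N).subgroupMap_surjective H)
    have hcard : Nat.card (G ⧸ N) < Nat.card G := by
      rw [Subgroup.card_eq_card_quotient_mul_card_subgroup N]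
      refine lt_mul_of_one_lt_right Nat.card_pos ?_
      rwa [Subgroup.one_lt_card_iff_ne_bot]
    have h1 : HasAffineLineCover k (G ⧸ N) := by
      refine ih _ hcard (fun S hS ↦ ?_) (H.map (QuotientGroup.mk' N))
        (h.of_mulEquiv (QuotientGroup.quotientQuotientEquivQuotient N H hNH)) rfl
      have h2 := hG (S.comap (QuotientGroup.mk' N)) fun g n hg ↦ hS _ n (by
        rw [← map_pow, hg, map_one])
      rw [← Subgroup.map_comap_eq_self_of_surjective (QuotientGroup.mk'_surjective N) S, h2]
      exact Subgroup.map_top_of_surjective _ (QuotientGroup.mk'_surjective N)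
    obtain ⟨L, _, _, z, ρ, hρ⟩ := h1
    exact hρ.exists_extension hG hcomm hℓ hNℓ hmin hNb

end Embedding

section GaloisExtension

open scoped TensorProduct

variable {A B G : Type*} [CommRing A] [CommRing B] [Algebra A B] [Group G]

/-- A finite group acting freely on an algebra makes it unramified over a ring containing all
traces. -/
theorem formallyUnramified_of_free [Algebra.EssFiniteType A B] [Fintype G]
    (φ : G →* (B ≃ₐ[A] B)) (htr : ∀ b, ∃ a, algebraMap A B a = ∑ g, φ g b)
    (hfree : ∀ g, g ≠ 1 → Ideal.span (Set.range fun x ↦ x - φ g x) = ⊤) :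
    Algebra.FormallyUnramified A B := by
  classical
  let ψ (g : G) : B ⊗[A] B →ₐ[A] B :=
    Algebra.TensorProduct.productMap (AlgHom.id A B) (φ g).toAlgHom
  have hψ (g : G) (a b : B) : ψ g (a ⊗ₜ b) = a * φ g b :=
    Algebra.TensorProduct.productMap_apply_tmul _ _ _ _
  have hsurj : Function.Surjective (ψ 1) := fun b ↦ ⟨b ⊗ₜ 1, by rw [hψ, map_one, mul_one]⟩
  have hu (g : G) (hg : g ≠ 1) : ∃ u, ψ g u = 0 ∧ ψ 1 u = 1 := by
    have h1 : Ideal.span (Set.range fun x ↦ x - φ g x) ≤ (RingHom.ker (ψ g)).map (ψ 1) := by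
      refine Ideal.span_le.mpr ?_
      rintro - ⟨x, rfl⟩
      refine (Ideal.mem_map_iff_of_surjective _ hsurj).mpr
        ⟨(1 : B) ⊗ₜ x - φ g x ⊗ₜ (1 : B), ?_, ?_⟩
      · rw [RingHom.mem_ker, map_sub, hψ, hψ, map_one, one_mul, mul_one, sub_self]
      · rw [map_sub, hψ, hψ, map_one, one_mul, AlgEquiv.one_apply, AlgEquiv.one_apply, mul_one]
    rw [hfree g hg] at h1
    exact (Ideal.mem_map_iff_of_surjective _ hsurj).mp (h1 (Submodule.mem_top (x := (1 : B))))
  choose! u hu0 hu1 using hu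
  obtain ⟨t, ht1, ht0⟩ : ∃ t, ψ 1 t = 1 ∧ ∀ g, g ≠ 1 → ψ g t = 0 := by
    refine ⟨∏ g ∈ Finset.univ.erase 1, u g, ?_, fun g hg ↦ ?_⟩
    · rw [map_prod]
      exact Finset.prod_eq_one fun g hg ↦ hu1 g (Finset.ne_of_mem_erase hg)
    · rw [map_prod]
      exact Finset.prod_eq_zero (Finset.mem_erase.mpr ⟨hg, Finset.mem_univ g⟩) (hu0 g hg)
  obtain ⟨S, rfl⟩ := TensorProduct.exists_finset t
  choose tr htr using htr
  have hdual (s : B) : ∑ i ∈ S, i.1 * algebraMap A B (tr (i.2 * s)) = s := by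
    have h (g : G) : ∑ i ∈ S, i.1 * φ g (i.2 * s) = ψ g (∑ i ∈ S, i.1 ⊗ₜ i.2) * φ g s := by
      rw [map_sum, Finset.sum_mul]
      exact Finset.sum_congr rfl fun i _ ↦ by rw [hψ, map_mul, mul_assoc]
    simp only [htr, Finset.mul_sum]
    rw [Finset.sum_comm]
    simp only [h]
    rw [Finset.sum_eq_single 1 (fun g _ hg ↦ by rw [ht0 g hg, zero_mul])
      (fun h ↦ absurd (Finset.mem_univ 1) h), ht1, one_mul, map_one, AlgEquiv.one_apply]
  have hswap (s : B) : ∑ i ∈ S, i.1 ⊗ₜ[A] (s * i.2) = ∑ j ∈ S, (s * j.2) ⊗ₜ[A] j.1 := by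
    calc ∑ i ∈ S, i.1 ⊗ₜ[A] (s * i.2)
        = ∑ i ∈ S, ∑ j ∈ S, i.1 ⊗ₜ[A] (j.1 * algebraMap A B (tr (j.2 * (s * i.2)))) :=
          Finset.sum_congr rfl fun i _ ↦ by rw [← TensorProduct.tmul_sum, hdual]
      _ = ∑ i ∈ S, ∑ j ∈ S, (i.1 * algebraMap A B (tr (i.2 * (s * j.2)))) ⊗ₜ[A] j.1 := by
          refine Finset.sum_congr rfl fun i _ ↦ Finset.sum_congr rfl fun j _ ↦ ?_
          rw [mul_comm j.1, mul_comm i.1, ← Algebra.smul_def, ← Algebra.smul_def,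
            TensorProduct.tmul_smul, TensorProduct.smul_tmul',
            show j.2 * (s * i.2) = i.2 * (s * j.2) by ring]
      _ = ∑ j ∈ S, (s * j.2) ⊗ₜ[A] j.1 := by
          rw [Finset.sum_comm]
          exact Finset.sum_congr rfl fun i _ ↦ by rw [← TensorProduct.sum_tmul, hdual]
  refine Algebra.FormallyUnramified.iff_exists_tensorProduct.mpr
    ⟨∑ i ∈ S, i.1 ⊗ₜ i.2, fun s ↦ ?_, ?_⟩
  · have h1 : ∑ i ∈ S, i.1 ⊗ₜ[A] i.2 = ∑ j ∈ S, j.2 ⊗ₜ[A] j.1 := by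
      simpa only [one_mul] using hswap 1
    have h2 : ((1 : B) ⊗ₜ[A] s) * ∑ i ∈ S, i.1 ⊗ₜ[A] i.2 = ∑ i ∈ S, i.1 ⊗ₜ[A] (s * i.2) := by
      simp only [Finset.mul_sum, Algebra.TensorProduct.tmul_mul_tmul, one_mul]
    have h3 : (s ⊗ₜ[A] (1 : B)) * ∑ j ∈ S, j.2 ⊗ₜ[A] j.1 = ∑ j ∈ S, (s * j.2) ⊗ₜ[A] j.1 := by
      simp only [Finset.mul_sum, Algebra.TensorProduct.tmul_mul_tmul, one_mul]
    rw [sub_mul, h2, hswap, h1, h3, sub_self]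
  · refine Eq.trans ?_ ht1
    simp only [map_sum, hψ, Algebra.TensorProduct.lmul'_apply_tmul, map_one, AlgEquiv.one_apply]

end GaloisExtension

section OfOccurs

variable {k L : Type} [Field k] [Field L] [Algebra k[X] L]

/-- Unramified automorphisms have trivial inertia groups. -/
theorem eq_one_of_inertAt_of_formallyUnramified {B : Subalgebra k[X] L} [IsNoetherianRing B]
    [Algebra.FormallyUnramified k[X] B] (hB : ∀ x : L, ∃ a b : B, x = a / b)
    {y : B →+* k} {σ : L ≃ₐ[k[X]] L} (hσB : ∀ x ∈ B, σ x ∈ B)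
    (hσ : ∀ x x' : B, σ x = x' → y x' = y x) : σ = 1 := by
  let τ : B →ₐ[k[X]] B := (σ.toAlgHom.comp B.val).codRestrict B fun x ↦ hσB x x.2
  have h1 : τ = AlgHom.id k[X] B := by
    refine Algebra.FormallyUnramified.ext_of_iInf (RingHom.ker y)
      (Ideal.iInf_pow_eq_bot_of_isDomain _ (RingHom.ker_ne_top y)) fun x ↦ ?_
    rw [Ideal.Quotient.eq, RingHom.mem_ker, map_sub, sub_eq_zero]
    exact hσ x (τ x) rfl
  have h2 (x : B) : σ x = x := congrArg Subtype.val (DFunLike.congr_fun h1 x)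
  ext x
  obtain ⟨a, b, rfl⟩ := hB x
  rw [map_div₀, h2, h2, AlgEquiv.one_apply]
variable [Algebra k L] [IsScalarTower k k[X] L]

theorem mem_integralClosure_iff_mem_intClosure {x : L} :
    x ∈ integralClosure k[X] L ↔ x ∈ intClosure k (algebraMap k[X] L Polynomial.X) := by
  rw [mem_intClosure_iff_exists, mem_integralClosure_iff]
  have h : algebraMap k[X] L
      = (Polynomial.aeval (R := k) (algebraMap k[X] L Polynomial.X)).toRingHom := by
    refine RingHom.ext fun q ↦ ?_
    change _ = Polynomial.aeval (algebraMap k[X] L Polynomial.X) q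
    rw [Polynomial.aeval_algebraMap_apply, Polynomial.aeval_X_left_apply]
  rw [← h]
  rfl

end OfOccurs

theorem isSepGen_ratFunc_X (k : Type) [Field k] : IsSepGen k (RatFunc.X : RatFunc k) := by
  have h : Function.Surjective (algebraMap k⟮(RatFunc.X : RatFunc k)⟯ (RatFunc k)) := fun x ↦
    ⟨⟨x, RatFunc.adjoin_X (K := k) ▸ IntermediateField.mem_top⟩, rfl⟩
  refine ⟨RatFunc.transcendental_X, ?_, ?_⟩
  · exact Module.Finite.of_surjective (Algebra.linearMap _ _) h
  · exact ⟨fun x ↦ by obtain ⟨y, rfl⟩ := h x; exact isSeparable_algebraMap y⟩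

end AffineLineCover

open AffineLineCover in
theorem OccursAsGaloisGroupOfUnramifiedCover.hasAffineLineCover {k G : Type} [Field k] [Group G]
    (h : OccursAsGaloisGroupOfUnramifiedCover k k[X] G) : HasAffineLineCover k G := by
  obtain ⟨L, _, _, _, _, _, _, ⟨e⟩, _⟩ := h
  let _ : Algebra k L := ((algebraMap (RatFunc k) L).comp (algebraMap k (RatFunc k))).toAlgebra
  have : IsScalarTower k (RatFunc k) L := .of_algebraMap_eq fun _ ↦ rfl
  have : IsScalarTower k k[X] L := .of_algebraMap_eq fun a ↦ by
    rw [IsScalarTower.algebraMap_apply k (RatFunc k) L,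
      IsScalarTower.algebraMap_apply k k[X] (RatFunc k), ← IsScalarTower.algebraMap_apply]
  let z : L := algebraMap k[X] L Polynomial.X
  have hz : z = algebraMap (RatFunc k) L RatFunc.X := by
    rw [← RatFunc.algebraMap_X, ← IsScalarTower.algebraMap_apply]
  refine ⟨L, inferInstance, inferInstance, z,
    (AlgEquiv.restrictScalarsHom k).comp e.toMonoidHom, ?_, ?_, ?_, ?_, ?_⟩
  · rw [hz]
    exact (isSepGen_ratFunc_X k).of_finite
  · exact (AlgEquiv.restrictScalarsHom_injective k).comp e.injective
  · intro g
    rw [hz]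
    exact (e g).commutes _
  · intro y g hy
    let B := integralClosure k[X] L
    have : IsDedekindDomain B := integralClosure.isDedekindDomain k[X] (RatFunc k) L
    have : IsFractionRing B L :=
      integralClosure.isFractionRing_of_finite_extension (RatFunc k) L
    let r : B →+* intClosure k z := B.val.toRingHom.codRestrict (intClosure k z)
      fun x ↦ mem_integralClosure_iff_mem_intClosure.mp x.2
    have h1 : (e g).restrictScalars k[X] = 1 := by
      refine eq_one_of_inertAt_of_formallyUnramified (B := B) (fun x ↦ ?_)
        (y := y.toRingHom.comp r) (fun x hx ↦ ?_) fun x x' hx ↦ ?_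
      · obtain ⟨a, b, -, rfl⟩ := IsFractionRing.div_surjective (A := B) x
        exact ⟨a, b, rfl⟩
      · exact IsIntegral.map ((e g).restrictScalars k[X]) hx
      · exact hy (r x) (r x') hx
    refine (map_eq_one_iff e e.injective).mp (AlgEquiv.ext fun x ↦ ?_)
    exact DFunLike.congr_fun h1 x
  · intro x hx
    obtain ⟨a, rfl⟩ := (IsGalois.mem_range_algebraMap_iff_fixed (F := RatFunc k) x).mpr fun f ↦ by
      obtain ⟨g, rfl⟩ := e.surjective f
      exact hx g
    have ha : a ∈ k⟮(RatFunc.X : RatFunc k)⟯ := RatFunc.adjoin_X (K := k) ▸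
        IntermediateField.mem_top
    obtain ⟨r, s, rfl⟩ := (IntermediateField.mem_adjoin_simple_iff _ _).mp ha
    rw [map_div₀, ← Polynomial.aeval_algebraMap_apply, ← Polynomial.aeval_algebraMap_apply, ← hz]
    exact (IntermediateField.mem_adjoin_simple_iff _ _).mpr ⟨r, s, rfl⟩

namespace AffineLineCover

section Etale

/-- The integral closure of a principal ideal domain in a finite Galois extension is étale if all
inertia groups are trivial. -/
theorem etale_integralClosure {A K L : Type*} [CommRing A] [IsDomain A] [IsPrincipalIdealRing A]
    [Field K] [Algebra A K] [IsFractionRing A K] [Field L] [Algebra K L] [Algebra A L]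
    [IsScalarTower A K L] [FiniteDimensional K L] [IsGalois K L]
    (hfree : ∀ σ : L ≃ₐ[K] L, σ ≠ 1 → ∀ M : Ideal (integralClosure A L), M.IsMaximal →
      ∃ x x' : integralClosure A L, σ x = x' ∧ x - x' ∉ M) :
    Algebra.Etale A (integralClosure A L) := by
  have : Module.IsTorsionFree A L := Module.IsTorsionFree.trans_faithfulSMul A K L
  have : Module.Finite A (integralClosure A L) := IsIntegralClosure.finite A K L _
  have : Module.Free A (integralClosure A L) := IsIntegralClosure.module_free A K L _
  have : Algebra.FinitePresentation A (integralClosure A L) :=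
    Algebra.FinitePresentation.of_finiteType.mp inferInstance
  have hφ (σ : L ≃ₐ[K] L) (x : integralClosure A L) :
      ((galRestrict A K L (integralClosure A L) σ x : integralClosure A L) : L) = σ x :=
    algebraMap_galRestrict_apply A σ x
  have : Algebra.FormallyUnramified A (integralClosure A L) := by
    refine formallyUnramified_of_free
      (galRestrict A K L (integralClosure A L)).toMonoidHom (fun b ↦ ?_) fun σ hσ ↦ ?_
    · obtain ⟨a, ha⟩ := IsIntegrallyClosed.isIntegral_iff.mp
        (Algebra.isIntegral_trace (L := K) (F := L) b.2)
      refine ⟨a, Subtype.ext ?_⟩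
      have h1 := trace_eq_sum_automorphisms (K := K) (b : L)
      rw [← ha, ← IsScalarTower.algebraMap_apply] at h1
      refine h1.trans ?_
      rw [AddSubmonoidClass.coe_finsetSum]
      exact Finset.sum_congr rfl fun σ _ ↦ (hφ σ b).symm
    · by_contra hne
      obtain ⟨M, hM, hle⟩ := Ideal.exists_le_maximal _ hne
      obtain ⟨x, x', hx, hxM⟩ := hfree σ hσ M hM
      refine hxM (hle (Ideal.subset_span ⟨x, ?_⟩))
      have h1 : galRestrict A K L (integralClosure A L) σ x = x' := Subtype.ext ((hφ σ x).trans hx)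
      exact congrArg (x - ·) h1
  exact Algebra.Etale.of_formallyUnramified_of_flat

end Etale

section Occurs

variable {k L G : Type} [Field k] [Field L] [Algebra k L] [Group G] {z : L}
  {ρ : G →* (L ≃ₐ[k] L)}

theorem IsAffineLineCover.occurs [IsAlgClosed k] [Finite G] (h : IsAffineLineCover k z ρ) :
    OccursAsGaloisGroupOfUnramifiedCover k k[X] G := by
  let e₀ : RatFunc k ≃ₐ[k] k⟮z⟯ := RatFunc.algEquivOfTranscendental z h.isSepGen.transcendental
  let _ : Algebra (RatFunc k) L := ((algebraMap k⟮z⟯ L).comp e₀.toRingHom).toAlgebra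
  let _ : Algebra k[X] L := ((algebraMap (RatFunc k) L).comp
      (algebraMap k[X] (RatFunc k))).toAlgebra
  have he₀ (r : RatFunc k) : algebraMap (RatFunc k) L r = e₀ r := rfl
  have : IsScalarTower k[X] (RatFunc k) L := .of_algebraMap_eq fun _ ↦ rfl
  have htower : IsScalarTower k k[X] L := .of_algebraMap_eq fun a ↦ by
    change algebraMap k L a =
      ((e₀ (algebraMap k[X] (RatFunc k) (algebraMap k k[X] a)) : k⟮z⟯) : L)
    rw [← IsScalarTower.algebraMap_apply k k[X] (RatFunc k), e₀.commutes]
    rfl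
  have hz : algebraMap k[X] L Polynomial.X = z := by
    rw [IsScalarTower.algebraMap_apply k[X] (RatFunc k) L, RatFunc.algebraMap_X, he₀]
    exact RatFunc.algEquivOfTranscendental_X z h.isSepGen.transcendental
  have hfin := h.isSepGen.finite
  have hgal := h.isGalois
  have hcomp : (algebraMap (RatFunc k) L).comp (e₀.symm.toRingEquiv : k⟮z⟯ →+* RatFunc k) =
      (RingEquiv.refl L : L →+* L).comp (algebraMap k⟮z⟯ L) := by
    ext x
    change ((e₀ (e₀.symm x) : k⟮z⟯) : L) = x
    rw [e₀.apply_symm_apply]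
  have : FiniteDimensional (RatFunc k) L :=
    Module.Finite.of_equiv_equiv e₀.symm.toRingEquiv (RingEquiv.refl L) hcomp
  have : IsGalois (RatFunc k) L := IsGalois.of_equiv_equiv hcomp
  let j (τ : L ≃ₐ[k⟮z⟯] L) : L ≃ₐ[RatFunc k] L :=
    AlgEquiv.ofRingEquiv (f := τ.toRingEquiv) fun r ↦ τ.commutes (e₀ r)
  let f : G →* (L ≃ₐ[RatFunc k] L) :=
    { toFun := fun g ↦ j (h.galoisHom g)
      map_one' := by rw [map_one]; rfl
      map_mul' := fun a b ↦ by rw [map_mul]; rfl }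
  have hf (g : G) (x : L) : f g x = ρ g x := rfl
  have hinj : Function.Injective f := fun a b hab ↦ h.injective (AlgEquiv.ext fun x ↦ by
    rw [← hf, hab, hf])
  have hsurj : Function.Surjective f := fun τ ↦ by
    let τ' : L ≃ₐ[k⟮z⟯] L := AlgEquiv.ofRingEquiv (f := τ.toRingEquiv) fun r ↦ by
      have h1 := τ.commutes (e₀.symm r)
      rw [he₀, e₀.apply_symm_apply] at h1
      exact h1
    obtain ⟨g, hg⟩ := h.galoisHom_surjective τ'
    exact ⟨g, AlgEquiv.ext fun x ↦ DFunLike.congr_fun hg x⟩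
  refine ⟨L, inferInstance, inferInstance, inferInstance, inferInstance, inferInstance,
    inferInstance, ⟨MulEquiv.ofBijective f ⟨hinj, hsurj⟩⟩, ?_⟩
  refine etale_integralClosure (K := RatFunc k) fun σ hσ M hM ↦ ?_
  obtain ⟨g, rfl⟩ := hsurj σ
  have hmem (x : L) : x ∈ integralClosure k[X] L ↔ x ∈ intClosure k z := by
    rw [mem_integralClosure_iff_mem_intClosure, hz]
  let r : intClosure k z →+* integralClosure k[X] L :=
    (intClosure k z).val.toRingHom.codRestrict (integralClosure k[X] L) fun x ↦ (hmem x).mpr x.2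
  have hr : Function.Surjective r := fun x ↦ ⟨⟨x, (hmem x).mp x.2⟩, rfl⟩
  have := h.isSepGen.finiteType
  have : (M.comap r).IsMaximal := Ideal.comap_isMaximal_of_surjective r hr
  obtain ⟨y, hy⟩ := exists_algHom_ker_eq (k := k) (M.comap r)
  have hg : ¬ InertAt y (ρ g) := fun hg ↦ hσ (by rw [h.free y g hg, map_one])
  unfold InertAt at hg
  push Not at hg
  obtain ⟨x, x', hx, hne⟩ := hg
  refine ⟨r x, r x', hx, fun hM ↦ hne ?_⟩
  rw [← map_sub, ← Ideal.mem_comap, ← hy, RingHom.mem_ker, map_sub, sub_eq_zero] at hM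
  exact hM.symm

end Occurs

end AffineLineCover

/-- **Serre's theorem on solvable embedding problems over the affine line**:
let `k` be an algebraically closed field of characteristic `p > 0`, let `G` be a
finite quasi-`p` group and `H` a solvable normal subgroup of `G`.  If `G/H`
occurs as the Galois group of an unramified cover of the affine line `Spec k[X]`,
then so does `G`. -/
theorem serre_solvable_embedding_affine_line (k : Type) [Field k] [IsAlgClosed k]
    (p : ℕ) (hp : p.Prime) [CharP k p]
    (G : Type) [Group G] [Finite G] (hG : pPart p G = ⊤)
    (H : Subgroup G) [H.Normal] (hH : IsSolvable H)
    (hquot : OccursAsGaloisGroupOfUnramifiedCover k (Polynomial k) (G ⧸ H)) :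
    OccursAsGaloisGroupOfUnramifiedCover k (Polynomial k) G := by
  have : Fact p.Prime := ⟨hp⟩
  have : Group.IsSolvable H := hH
  obtain ⟨L, _, _, z, ρ, h⟩ := hquot.hasAffineLineCover.of_isSolvable
    (AffineLineCover.eq_top_of_pPart_eq_top hG) H
  exact h.occurs
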